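/- For every integer n ≥ 0, writing N_i = N(i,11,11n+5) and M_i = M(i,11,11n+5), the following hold: 3N_0 + N_2 + N_5 + 2M_2 ≥ 2N_1 + 3N_3 + 2M_0; 7N_1 + N_4 + 3M_2 ≥ 3N_0 + 2N_2 + N_3 + 2N_5 + 3M_0; 2N_0 + N_2 + 3N_3 + N_5 + 4M_0 ≥ 3N_1 + 4N_4 + 4M_2; 4N_2 + 7N_3 + 2N_4 ≥ 4N_0 + 2N_1 + 7N_5; and 4N_1 + N_2 + 2N_4 + N_5 + 5M_2 ≥ 2N_0 + 6N_3 + 5M_0. -/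

import Mathlib

/-- `p n`: the number of partitions of `n`. -/
def partitionCount (n : ℕ) : ℕ := Fintype.card (Nat.Partition n)

/-- The rank of a partition: its largest part minus its number of parts
(the empty partition has rank 0). -/
def partitionRank {n : ℕ} (π : Nat.Partition n) : ℤ :=
  (π.parts.sup : ℤ) - (Multiset.card π.parts : ℤ)

/-- The crank of a partition `π`: if `π` has no parts equal to 1, it is the largest part;
otherwise it is (number of parts larger than the number of ones) − (number of ones). -/
def partitionCrank {n : ℕ} (π : Nat.Partition n) : ℤ :=
  if π.parts.count 1 = 0 then (π.parts.sup : ℤ)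
  else ((π.parts.filter fun x => π.parts.count 1 < x).card : ℤ) - (π.parts.count 1 : ℤ)

/-- `rankCount a r n` = `N(a,r,n)`: the number of partitions of `n` whose rank is
congruent to `a` modulo `r`. -/
def rankCount (a r : ℤ) (n : ℕ) : ℕ :=
  (Finset.univ.filter fun π : Nat.Partition n => partitionRank π % r = a % r).card

/-- `crankCount a n` = `M(a,11,n)`: for `n ≠ 1`, the number of partitions of `n` whose crank
is congruent to `a` modulo 11; at `n = 1` the standard convention `M(0,11,1) = −1`,
`M(1,11,1) = M(10,11,1) = 1`, and `M(a,11,1) = 0` otherwise. -/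
def crankCount (a : ℤ) (n : ℕ) : ℤ :=
  if n = 1 then
    if a % 11 = 0 then -1
    else if a % 11 = 1 ∨ a % 11 = 10 then 1
    else 0
  else ((Finset.univ.filter fun π : Nat.Partition n => partitionCrank π % 11 = a % 11).card : ℤ)

open Filter Topology

/-- Nonzero `t₁, …, t₅` together with six monomials that satisfy the relations of the
functions `x, x - 1, Y, Y + 1, Y + 1 - x, Y + x` on the curve `Y² + Y = x³ - x²`. -/
structure ThetaUnits (t₁ t₂ t₃ t₄ t₅ x x₁ Y Y₁ U V : ℂ) : Prop where
  h₁ : t₁ ≠ 0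
  h₂ : t₂ ≠ 0
  h₃ : t₃ ≠ 0
  h₄ : t₄ ≠ 0
  h₅ : t₅ ≠ 0
  hx : x = t₃ * t₄ * t₅ / (t₁ ^ 2 * t₂)
  hx₁ : x₁ = t₄ * t₅ ^ 2 / (t₁ ^ 2 * t₃)
  hY : Y = t₃ * t₅ ^ 3 / (t₁ ^ 3 * t₂)
  hY₁ : Y₁ = t₄ ^ 3 * t₅ / (t₁ ^ 3 * t₂)
  hU : U = t₄ ^ 2 * t₅ ^ 3 / (t₁ ^ 2 * t₂ ^ 2 * t₃)
  hV : V = t₂ * t₄ * t₅ ^ 2 / t₁ ^ 4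
  rx₁ : x₁ = x - 1
  rY₁ : Y₁ = Y + 1
  rU : U = Y + 1 - x
  rV : V = Y + x
  hc : Y ^ 2 + Y - x ^ 3 + x ^ 2 = 0

section
variable {t₁ t₂ t₃ t₄ t₅ x x₁ Y Y₁ U V : ℂ}

theorem rank_dissection_class_0 (h : ThetaUnits t₁ t₂ t₃ t₄ t₅ x x₁ Y Y₁ U V) :
    (t₁ / (t₂ ^ 3 * t₃ ^ 2 * t₄ ^ 5 * t₅ ^ 4) * (22 + 11 * Y - 22 * x + 11 * x ^ 2)) -
        t₂ / t₁ * (t₁ ^ 3 / (t₂ ^ 2 * t₃ ^ 2 * t₄ ^ 5 * t₅ ^ 7) * (5 + 21 * Y - 12 * x -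
        37 * x * Y + 19 * x ^ 2 + 11 * x ^ 2 * Y - 17 * x ^ 3)) +
        (t₄ / t₂) * (t₁ ^ 2 / (t₂ ^ 2 * t₃ ^ 2 * t₄ ^ 5 * t₅ ^ 6) * (-8 - 16 * Y + 17 * x +
        13 * x * Y - 15 * x ^ 2 + 3 * x ^ 3)) - t₅ / t₃ * (t₁ ^ 3 / (t₂ ^ 2 * t₃ ^ 2 * t₄ ^ 6 *
        t₅ ^ 6) * (-9 - 7 * Y + 15 * x + 16 * x * Y - 10 * x ^ 2 + 13 * x ^ 3)) +
        (t₃ / t₄) * (t₁ ^ 3 / (t₂ ^ 3 * t₃ ^ 2 * t₄ ^ 5 * t₅ ^ 6) * (4 - 14 * Y - 14 * x +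
        21 * x * Y + 13 * x ^ 2 + 4 * x ^ 3)) - t₁ / t₅ * (t₁ ^ 3 / (t₂ ^ 2 * t₃ ^ 3 * t₄ ^ 5 *
        t₅ ^ 6) * (1 - 9 * Y - 9 * x + 8 * x * Y - 5 * x ^ 2 + 12 * x ^ 3))
      = t₁ ^ 3 / (t₂ ^ 2 * t₃ ^ 2 * t₄ ^ 5 * t₅ ^ 6) * (1 + 2 * Y + 2 * x - 3 * x * Y - 5 * x ^ 2 +
          x ^ 3) * ((-3) * (t₃ ^ 2 / (t₁ ^ 2 * t₄)) - 3 * (t₂ * t₄ ^ 2 / (t₁ ^ 2 * t₃ * t₅)) -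
          3 * (t₂ * t₅ / (t₁ ^ 2 * t₄)) + (t₂ ^ 3 / (t₁ ^ 3 * t₃)) +
          4 * (t₁ * t₄ / (t₂ ^ 2 * t₃))) := by
  obtain ⟨h₁, h₂, h₃, h₄, h₅, hx, hx₁, hY, hY₁, hU, hV, rx₁, rY₁, rU, rV, hc⟩ := h
  obtain ⟨X, hX⟩ : ∃ X, X = x := ⟨_, rfl⟩
  obtain ⟨Z, hZ⟩ : ∃ Z, Z = Y := ⟨_, rfl⟩
  have key : (22 + 11 * Y - 22 * x + 11 * x ^ 2) * X * x₁ ^ 2 * Z * Y₁ + (-5 - 21 * Y + 12 * x +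
      37 * x * Y - 19 * x ^ 2 - 11 * x ^ 2 * Y + 17 * x ^ 3) * X * x₁ * Y₁ * V + (-8 - 16 * Y +
      17 * x + 13 * x * Y - 15 * x ^ 2 + 3 * x ^ 3) * X * Y₁ * U * V + (9 + 7 * Y - 15 * x -
      16 * x * Y + 10 * x ^ 2 - 13 * x ^ 3) * X * x₁ * U * V + (4 - 14 * Y - 14 * x + 21 * x * Y +
      13 * x ^ 2 + 4 * x ^ 3) * X * x₁ * Z * Y₁ + (-1 + 9 * Y + 9 * x - 8 * x * Y + 5 * x ^ 2 -
      12 * x ^ 3) * X * x₁ ^ 2 * Y₁ + (3 + 6 * Y + 6 * x - 9 * x * Y - 15 * x ^ 2 +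
      3 * x ^ 3) * X * Z * Y₁ * V + (3 + 6 * Y + 6 * x - 9 * x * Y - 15 * x ^ 2 +
      3 * x ^ 3) * x₁ * Y₁ ^ 2 * V + (3 + 6 * Y + 6 * x - 9 * x * Y - 15 * x ^ 2 +
      3 * x ^ 3) * x₁ * Z * Y₁ * V + (-1 - 2 * Y - 2 * x + 3 * x * Y + 5 * x ^ 2 -
      x ^ 3) * x₁ * Y₁ * V ^ 2 + (-4 - 8 * Y - 8 * x + 12 * x * Y + 20 * x ^ 2 -
      4 * x ^ 3) * X * x₁ * Y₁ * U = 0 := by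
    rw [hX, rx₁, hZ, rY₁, rU, rV]
    linear_combination (-3 - 11 * Y - 10 * Y ^ 2 + 14 * x + 28 * x * Y + 15 * x * Y ^ 2 -
        22 * x ^ 2 - 24 * x ^ 2 * Y - 11 * x ^ 2 * Y ^ 2 + 18 * x ^ 3 - 5 * x ^ 3 * Y -
        13 * x ^ 4) * hc
  rw [hX.trans hx, hx₁, hZ.trans hY, hY₁, hU, hV] at key
  linear_combination (norm := (field_simp; ring)) (t₁ ^ 13 / (t₃ ^ 2 * t₄ ^ 11 * t₅ ^ 13)) * key

theorem rank_dissection_class_1 (h : ThetaUnits t₁ t₂ t₃ t₄ t₅ x x₁ Y Y₁ U V) :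
    (t₁ ^ 3 / (t₂ ^ 2 * t₃ ^ 3 * t₄ ^ 5 * t₅ ^ 6) * (1 - 9 * Y - 9 * x + 8 * x * Y - 5 * x ^ 2 +
        12 * x ^ 3)) - t₂ / t₁ * (t₁ ^ 2 / (t₂ ^ 2 * t₃ ^ 2 * t₄ ^ 5 * t₅ ^ 6) * (-8 - 16 * Y +
        17 * x + 13 * x * Y - 15 * x ^ 2 + 3 * x ^ 3)) + (t₄ / t₂) * (t₁ ^ 3 / (t₂ ^ 3 * t₃ ^ 3 *
        t₄ ^ 5 * t₅ ^ 5) * (3 + 6 * Y - 5 * x + 13 * x * Y + 18 * x ^ 2 + 3 * x ^ 3)) -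
        t₅ / t₃ * (t₁ ^ 3 / (t₂ ^ 2 * t₃ ^ 2 * t₄ ^ 5 * t₅ ^ 7) * (5 + 21 * Y - 12 * x -
        37 * x * Y + 19 * x ^ 2 + 11 * x ^ 2 * Y - 17 * x ^ 3)) +
        (t₃ / t₄) * (t₁ ^ 3 / (t₂ * t₃ ^ 2 * t₄ ^ 5 * t₅ ^ 8) * (1 - 10 * Y - 9 * x + x * Y +
        15 * x ^ 2 + 10 * x ^ 2 * Y - 7 * x ^ 3)) - t₁ / t₅ * (t₁ ^ 4 / (t₂ ^ 2 * t₃ ^ 2 * t₄ ^ 6 *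
        t₅ ^ 7) * (7 + 3 * Y - 8 * x - 10 * x * Y - 13 * x ^ 2 + 11 * x ^ 2 * Y + 18 * x ^ 3))
      = t₁ ^ 3 / (t₂ ^ 2 * t₃ ^ 2 * t₄ ^ 5 * t₅ ^ 6) * (1 + 2 * Y + 2 * x - 3 * x * Y - 5 * x ^ 2 +
          x ^ 3) * ((-11) * (t₃ * t₅ / (t₁ * t₂ * t₄))) := by
  obtain ⟨h₁, h₂, h₃, h₄, h₅, hx, hx₁, hY, hY₁, hU, hV, rx₁, rY₁, rU, rV, hc⟩ := h
  obtain ⟨Z, hZ⟩ : ∃ Z, Z = Y := ⟨_, rfl⟩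
  have key : (1 - 9 * Y - 9 * x + 8 * x * Y - 5 * x ^ 2 + 12 * x ^ 3) * x₁ ^ 2 + (8 + 16 * Y -
      17 * x - 13 * x * Y + 15 * x ^ 2 - 3 * x ^ 3) * x₁ * V + (3 + 6 * Y - 5 * x + 13 * x * Y +
      18 * x ^ 2 + 3 * x ^ 3) * x₁ * U + (-5 - 21 * Y + 12 * x + 37 * x * Y - 19 * x ^ 2 -
      11 * x ^ 2 * Y + 17 * x ^ 3) * x₁ ^ 2 + (1 - 10 * Y - 9 * x + x * Y + 15 * x ^ 2 +
      10 * x ^ 2 * Y - 7 * x ^ 3) * V + (-7 - 3 * Y + 8 * x + 10 * x * Y + 13 * x ^ 2 -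
      11 * x ^ 2 * Y - 18 * x ^ 3) * x₁ + (11 + 22 * Y + 22 * x - 33 * x * Y - 55 * x ^ 2 +
      11 * x ^ 3) * x₁ * Z = 0 := by
    rw [rx₁, hZ, rU, rV]
    linear_combination (-54 + 78 * x - 23 * x ^ 2) * hc
  rw [hx₁, hZ.trans hY, hU, hV] at key
  linear_combination (norm := (field_simp; ring)) (t₁ ^ 7 / (t₂ ^ 2 * t₃ * t₄ ^ 7 * t₅ ^ 10)) * key

theorem rank_dissection_class_2 (h : ThetaUnits t₁ t₂ t₃ t₄ t₅ x x₁ Y Y₁ U V) :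
    (t₁ ^ 4 / (t₂ ^ 2 * t₃ ^ 2 * t₄ ^ 6 * t₅ ^ 7) * (7 + 3 * Y - 8 * x - 10 * x * Y - 13 * x ^ 2 +
        11 * x ^ 2 * Y + 18 * x ^ 3)) - t₂ / t₁ * (t₁ ^ 3 / (t₂ ^ 3 * t₃ ^ 3 * t₄ ^ 5 * t₅ ^ 5) *
        (3 + 6 * Y - 5 * x + 13 * x * Y + 18 * x ^ 2 + 3 * x ^ 3)) +
        (t₄ / t₂) * (t₁ ^ 3 / (t₂ * t₃ ^ 3 * t₄ ^ 5 * t₅ ^ 7) * (6 * Y - 11 * x - 13 * x * Y +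
        12 * x ^ 2 + 6 * x ^ 2 * Y + 4 * x ^ 3)) - t₅ / t₃ * (t₁ ^ 2 / (t₂ ^ 2 * t₃ ^ 2 * t₄ ^ 5 *
        t₅ ^ 6) * (-8 - 16 * Y + 17 * x + 13 * x * Y - 15 * x ^ 2 + 3 * x ^ 3)) +
        (t₃ / t₄) * (t₁ / (t₂ ^ 3 * t₃ ^ 2 * t₄ ^ 5 * t₅ ^ 4) * (22 + 11 * Y - 22 * x +
        11 * x ^ 2)) - t₁ / t₅ * (t₁ ^ 3 / (t₂ ^ 2 * t₃ ^ 2 * t₄ ^ 6 * t₅ ^ 6) * (-9 - 7 * Y +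
        15 * x + 16 * x * Y - 10 * x ^ 2 + 13 * x ^ 3))
      = 0 := by
  obtain ⟨h₁, h₂, h₃, h₄, h₅, hx, hx₁, hY, hY₁, hU, hV, rx₁, rY₁, rU, rV, hc⟩ := h
  obtain ⟨X, hX⟩ : ∃ X, X = x := ⟨_, rfl⟩
  obtain ⟨Z, hZ⟩ : ∃ Z, Z = Y := ⟨_, rfl⟩
  have key : (7 + 3 * Y - 8 * x - 10 * x * Y - 13 * x ^ 2 + 11 * x ^ 2 * Y + 18 * x ^ 3) * X + (-3 -
      6 * Y + 5 * x - 13 * x * Y - 18 * x ^ 2 - 3 * x ^ 3) * X * x₁ + (6 * Y - 11 * x - 13 * x * Y +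
      12 * x ^ 2 + 6 * x ^ 2 * Y + 4 * x ^ 3) * Y₁ + (8 + 16 * Y - 17 * x - 13 * x * Y +
      15 * x ^ 2 - 3 * x ^ 3) * X * x₁ + (22 + 11 * Y - 22 * x + 11 * x ^ 2) * X * Z + (9 + 7 * Y -
      15 * x - 16 * x * Y + 10 * x ^ 2 - 13 * x ^ 3) * X = 0 := by
    rw [hX, rx₁, hZ, rY₁]
    linear_combination (6 - 2 * x + 6 * x ^ 2) * hc
  rw [hX.trans hx, hx₁, hZ.trans hY, hY₁] at key
  linear_combination (norm := (field_simp; ring)) (t₁ ^ 6 / (t₂ * t₃ ^ 3 * t₄ ^ 7 * t₅ ^ 8)) * key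

theorem rank_dissection_class_3 (h : ThetaUnits t₁ t₂ t₃ t₄ t₅ x x₁ Y Y₁ U V) :
    (t₁ ^ 3 / (t₂ ^ 2 * t₃ ^ 2 * t₄ ^ 6 * t₅ ^ 6) * (-9 - 7 * Y + 15 * x + 16 * x * Y - 10 * x ^ 2 +
        13 * x ^ 3)) - t₂ / t₁ * (t₁ ^ 3 / (t₂ * t₃ ^ 3 * t₄ ^ 5 * t₅ ^ 7) * (6 * Y - 11 * x -
        13 * x * Y + 12 * x ^ 2 + 6 * x ^ 2 * Y + 4 * x ^ 3)) +
        (t₄ / t₂) * (t₁ ^ 2 / (t₂ * t₃ ^ 3 * t₄ ^ 5 * t₅ ^ 6) * (-2 - 4 * Y + 7 * x - 5 * x * Y -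
        12 * x ^ 2 + 9 * x ^ 3)) - t₅ / t₃ * (t₁ ^ 3 / (t₂ ^ 3 * t₃ ^ 3 * t₄ ^ 5 * t₅ ^ 5) * (3 +
        6 * Y - 5 * x + 13 * x * Y + 18 * x ^ 2 + 3 * x ^ 3)) +
        (t₃ / t₄) * (t₁ ^ 3 / (t₂ ^ 2 * t₃ ^ 3 * t₄ ^ 5 * t₅ ^ 6) * (1 - 9 * Y - 9 * x + 8 * x * Y -
        5 * x ^ 2 + 12 * x ^ 3)) - t₁ / t₅ * (t₁ ^ 3 / (t₂ ^ 2 * t₃ ^ 2 * t₄ ^ 5 * t₅ ^ 7) * (5 +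
        21 * Y - 12 * x - 37 * x * Y + 19 * x ^ 2 + 11 * x ^ 2 * Y - 17 * x ^ 3))
      = t₁ ^ 3 / (t₂ ^ 2 * t₃ ^ 2 * t₄ ^ 5 * t₅ ^ 6) * (1 + 2 * Y + 2 * x - 3 * x * Y - 5 * x ^ 2 +
          x ^ 3) * ((-11) * (1 / t₄)) := by
  obtain ⟨h₁, h₂, h₃, h₄, h₅, hx, hx₁, hY, hY₁, hU, hV, rx₁, rY₁, rU, rV, hc⟩ := h
  obtain ⟨X, hX⟩ : ∃ X, X = x := ⟨_, rfl⟩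
  obtain ⟨Z, hZ⟩ : ∃ Z, Z = Y := ⟨_, rfl⟩
  have key : (-9 - 7 * Y + 15 * x + 16 * x * Y - 10 * x ^ 2 + 13 * x ^ 3) * X * Z + (-6 * Y +
      11 * x + 13 * x * Y - 12 * x ^ 2 - 6 * x ^ 2 * Y - 4 * x ^ 3) * X * V + (-2 - 4 * Y + 7 * x -
      5 * x * Y - 12 * x ^ 2 + 9 * x ^ 3) * Z * Y₁ + (-3 - 6 * Y + 5 * x - 13 * x * Y - 18 * x ^ 2 -
      3 * x ^ 3) * Z * U + (1 - 9 * Y - 9 * x + 8 * x * Y - 5 * x ^ 2 + 12 * x ^ 3) * X * Z + (-5 -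
      21 * Y + 12 * x + 37 * x * Y - 19 * x ^ 2 - 11 * x ^ 2 * Y + 17 * x ^ 3) * X ^ 2 + (11 +
      22 * Y + 22 * x - 33 * x * Y - 55 * x ^ 2 + 11 * x ^ 3) * X * Z = 0 := by
    rw [hX, hZ, rY₁, rU, rV]
    linear_combination (-5 - 10 * Y + 18 * x - 18 * x * Y - 13 * x ^ 2) * hc
  rw [hX.trans hx, hZ.trans hY, hY₁, hU, hV] at key
  linear_combination (norm := (field_simp; ring)) (t₁ ^ 8 / (t₃ ^ 4 * t₄ ^ 7 * t₅ ^ 10)) * key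

theorem rank_dissection_class_4 (h : ThetaUnits t₁ t₂ t₃ t₄ t₅ x x₁ Y Y₁ U V) :
    (t₁ ^ 3 / (t₂ ^ 2 * t₃ ^ 2 * t₄ ^ 5 * t₅ ^ 7) * (5 + 21 * Y - 12 * x - 37 * x * Y + 19 * x ^ 2 +
        11 * x ^ 2 * Y - 17 * x ^ 3)) - t₂ / t₁ * (t₁ ^ 2 / (t₂ * t₃ ^ 3 * t₄ ^ 5 * t₅ ^ 6) * (-2 -
        4 * Y + 7 * x - 5 * x * Y - 12 * x ^ 2 + 9 * x ^ 3)) +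
        (t₄ / t₂) * (t₁ ^ 3 / (t₂ ^ 3 * t₃ ^ 2 * t₄ ^ 5 * t₅ ^ 6) * (4 - 14 * Y - 14 * x +
        21 * x * Y + 13 * x ^ 2 + 4 * x ^ 3)) - t₅ / t₃ * (t₁ ^ 3 / (t₂ * t₃ ^ 3 * t₄ ^ 5 *
        t₅ ^ 7) * (6 * Y - 11 * x - 13 * x * Y + 12 * x ^ 2 + 6 * x ^ 2 * Y + 4 * x ^ 3)) +
        (t₃ / t₄) * (t₁ ^ 4 / (t₂ ^ 2 * t₃ ^ 2 * t₄ ^ 6 * t₅ ^ 7) * (7 + 3 * Y - 8 * x -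
        10 * x * Y - 13 * x ^ 2 + 11 * x ^ 2 * Y + 18 * x ^ 3)) -
        t₁ / t₅ * (t₁ ^ 2 / (t₂ ^ 2 * t₃ ^ 2 * t₄ ^ 5 * t₅ ^ 6) * (-8 - 16 * Y + 17 * x +
        13 * x * Y - 15 * x ^ 2 + 3 * x ^ 3))
      = 0 := by
  obtain ⟨h₁, h₂, h₃, h₄, h₅, hx, hx₁, hY, hY₁, hU, hV, rx₁, rY₁, rU, rV, hc⟩ := h
  obtain ⟨X, hX⟩ : ∃ X, X = x := ⟨_, rfl⟩
  have key : (5 + 21 * Y - 12 * x - 37 * x * Y + 19 * x ^ 2 + 11 * x ^ 2 * Y -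
      17 * x ^ 3) * X * x₁ * Y₁ + (2 + 4 * Y - 7 * x + 5 * x * Y + 12 * x ^ 2 -
      9 * x ^ 3) * x₁ * Y₁ * V + (4 - 14 * Y - 14 * x + 21 * x * Y + 13 * x ^ 2 +
      4 * x ^ 3) * X * Y₁ * U + (-6 * Y + 11 * x + 13 * x * Y - 12 * x ^ 2 - 6 * x ^ 2 * Y -
      4 * x ^ 3) * x₁ ^ 2 * Y₁ + (7 + 3 * Y - 8 * x - 10 * x * Y - 13 * x ^ 2 + 11 * x ^ 2 * Y +
      18 * x ^ 3) * X ^ 2 * x₁ + (8 + 16 * Y - 17 * x - 13 * x * Y + 15 * x ^ 2 -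
      3 * x ^ 3) * X * x₁ * Y₁ = 0 := by
    rw [hX, rx₁, rY₁, rU, rV]
    linear_combination (-8 - 4 * Y - 17 * x - 15 * x * Y + 50 * x ^ 2 + 26 * x ^ 2 * Y -
        18 * x ^ 3) * hc
  rw [hX.trans hx, hx₁, hY₁, hU, hV] at key
  linear_combination (norm := (field_simp; ring)) (t₁ ^ 10 / (t₃ ^ 2 * t₄ ^ 10 * t₅ ^ 11)) * key

theorem rank_dissection_class_5 (h : ThetaUnits t₁ t₂ t₃ t₄ t₅ x x₁ Y Y₁ U V) :
    (t₁ ^ 2 / (t₂ ^ 2 * t₃ ^ 2 * t₄ ^ 5 * t₅ ^ 6) * (-8 - 16 * Y + 17 * x + 13 * x * Y -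
        15 * x ^ 2 + 3 * x ^ 3)) - t₂ / t₁ * (t₁ ^ 3 / (t₂ ^ 3 * t₃ ^ 2 * t₄ ^ 5 * t₅ ^ 6) * (4 -
        14 * Y - 14 * x + 21 * x * Y + 13 * x ^ 2 + 4 * x ^ 3)) +
        (t₄ / t₂) * (t₁ ^ 3 / (t₂ * t₃ ^ 2 * t₄ ^ 5 * t₅ ^ 8) * (1 - 10 * Y - 9 * x + x * Y +
        15 * x ^ 2 + 10 * x ^ 2 * Y - 7 * x ^ 3)) - t₅ / t₃ * (t₁ ^ 2 / (t₂ * t₃ ^ 3 * t₄ ^ 5 *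
        t₅ ^ 6) * (-2 - 4 * Y + 7 * x - 5 * x * Y - 12 * x ^ 2 + 9 * x ^ 3)) +
        (t₃ / t₄) * (t₁ ^ 3 / (t₂ ^ 2 * t₃ ^ 2 * t₄ ^ 6 * t₅ ^ 6) * (-9 - 7 * Y + 15 * x +
        16 * x * Y - 10 * x ^ 2 + 13 * x ^ 3)) - t₁ / t₅ * (t₁ ^ 3 / (t₂ ^ 3 * t₃ ^ 3 * t₄ ^ 5 *
        t₅ ^ 5) * (3 + 6 * Y - 5 * x + 13 * x * Y + 18 * x ^ 2 + 3 * x ^ 3))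
      = 0 := by
  obtain ⟨h₁, h₂, h₃, h₄, h₅, hx, hx₁, hY, hY₁, hU, hV, rx₁, rY₁, rU, rV, hc⟩ := h
  obtain ⟨X, hX⟩ : ∃ X, X = x := ⟨_, rfl⟩
  obtain ⟨Z, hZ⟩ : ∃ Z, Z = Y := ⟨_, rfl⟩
  have key : (-8 - 16 * Y + 17 * x + 13 * x * Y - 15 * x ^ 2 + 3 * x ^ 3) * X * Z * Y₁ * V + (-4 +
      14 * Y + 14 * x - 21 * x * Y - 13 * x ^ 2 - 4 * x ^ 3) * X * Z * Y₁ * V + (1 - 10 * Y -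
      9 * x + x * Y + 15 * x ^ 2 + 10 * x ^ 2 * Y - 7 * x ^ 3) * X ^ 2 * Y₁ * V + (2 + 4 * Y -
      7 * x + 5 * x * Y + 12 * x ^ 2 - 9 * x ^ 3) * x₁ * Z * Y₁ * V + (-9 - 7 * Y + 15 * x +
      16 * x * Y - 10 * x ^ 2 + 13 * x ^ 3) * X ^ 2 * Z * V + (-3 - 6 * Y + 5 * x - 13 * x * Y -
      18 * x ^ 2 - 3 * x ^ 3) * X * x₁ * Z * Y₁ = 0 := by
    rw [hX, rx₁, hZ, rY₁, rV]
    linear_combination (-2 * Y - 4 * Y ^ 2 + x - x * Y - 3 * x * Y ^ 2 - 8 * x ^ 2 - x ^ 2 * Y -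
        3 * x ^ 2 * Y ^ 2 + 7 * x ^ 3 - 6 * x ^ 3 * Y) * hc
  rw [hX.trans hx, hx₁, hZ.trans hY, hY₁, hV] at key
  linear_combination (norm := (field_simp; ring)) (t₁ ^ 14 / (t₃ ^ 4 * t₄ ^ 10 * t₅ ^ 13)) * key

theorem rank_dissection_class_6 (h : ThetaUnits t₁ t₂ t₃ t₄ t₅ x x₁ Y Y₁ U V) :
    (t₁ ^ 3 / (t₂ ^ 3 * t₃ ^ 3 * t₄ ^ 5 * t₅ ^ 5) * (3 + 6 * Y - 5 * x + 13 * x * Y + 18 * x ^ 2 +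
        3 * x ^ 3)) - t₂ / t₁ * (t₁ ^ 3 / (t₂ * t₃ ^ 2 * t₄ ^ 5 * t₅ ^ 8) * (1 - 10 * Y - 9 * x +
        x * Y + 15 * x ^ 2 + 10 * x ^ 2 * Y - 7 * x ^ 3)) + (t₄ / t₂) * (t₁ / (t₂ ^ 3 * t₃ ^ 2 *
        t₄ ^ 5 * t₅ ^ 4) * (22 + 11 * Y - 22 * x + 11 * x ^ 2)) -
        t₅ / t₃ * (t₁ ^ 3 / (t₂ ^ 3 * t₃ ^ 2 * t₄ ^ 5 * t₅ ^ 6) * (4 - 14 * Y - 14 * x +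
        21 * x * Y + 13 * x ^ 2 + 4 * x ^ 3)) + (t₃ / t₄) * (t₁ ^ 3 / (t₂ ^ 2 * t₃ ^ 2 * t₄ ^ 5 *
        t₅ ^ 7) * (5 + 21 * Y - 12 * x - 37 * x * Y + 19 * x ^ 2 + 11 * x ^ 2 * Y - 17 * x ^ 3)) -
        t₁ / t₅ * (t₁ ^ 3 / (t₂ * t₃ ^ 3 * t₄ ^ 5 * t₅ ^ 7) * (6 * Y - 11 * x - 13 * x * Y +
        12 * x ^ 2 + 6 * x ^ 2 * Y + 4 * x ^ 3))
      = t₁ ^ 3 / (t₂ ^ 2 * t₃ ^ 2 * t₄ ^ 5 * t₅ ^ 6) * (1 + 2 * Y + 2 * x - 3 * x * Y - 5 * x ^ 2 +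
          x ^ 3) * (11 * (t₄ / (t₁ * t₅))) := by
  obtain ⟨h₁, h₂, h₃, h₄, h₅, hx, hx₁, hY, hY₁, hU, hV, rx₁, rY₁, rU, rV, hc⟩ := h
  obtain ⟨X, hX⟩ : ∃ X, X = x := ⟨_, rfl⟩
  obtain ⟨Z, hZ⟩ : ∃ Z, Z = Y := ⟨_, rfl⟩
  have key : (3 + 6 * Y - 5 * x + 13 * x * Y + 18 * x ^ 2 + 3 * x ^ 3) * Z * U + (-1 + 10 * Y +
      9 * x - x * Y - 15 * x ^ 2 - 10 * x ^ 2 * Y + 7 * x ^ 3) * X * V + (22 + 11 * Y - 22 * x +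
      11 * x ^ 2) * X * Z * U + (-4 + 14 * Y + 14 * x - 21 * x * Y - 13 * x ^ 2 -
      4 * x ^ 3) * Z * U + (5 + 21 * Y - 12 * x - 37 * x * Y + 19 * x ^ 2 + 11 * x ^ 2 * Y -
      17 * x ^ 3) * X * Z + (-6 * Y + 11 * x + 13 * x * Y - 12 * x ^ 2 - 6 * x ^ 2 * Y -
      4 * x ^ 3) * X * x₁ + (-11 - 22 * Y - 22 * x + 33 * x * Y + 55 * x ^ 2 -
      11 * x ^ 3) * Z * Y₁ = 0 := by
    rw [hX, rx₁, hZ, rY₁, rU, rV]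
    linear_combination (-12 - 2 * Y + 20 * x + 36 * x * Y - 3 * x ^ 2) * hc
  rw [hX.trans hx, hx₁, hZ.trans hY, hY₁, hU, hV] at key
  linear_combination (norm := (field_simp; ring)) (t₁ ^ 8 / (t₃ ^ 3 * t₄ ^ 7 * t₅ ^ 11)) * key

theorem rank_dissection_class_7 (h : ThetaUnits t₁ t₂ t₃ t₄ t₅ x x₁ Y Y₁ U V) :
    (t₁ ^ 3 / (t₂ * t₃ ^ 3 * t₄ ^ 5 * t₅ ^ 7) * (6 * Y - 11 * x - 13 * x * Y + 12 * x ^ 2 +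
        6 * x ^ 2 * Y + 4 * x ^ 3)) - t₂ / t₁ * (t₁ / (t₂ ^ 3 * t₃ ^ 2 * t₄ ^ 5 * t₅ ^ 4) * (22 +
        11 * Y - 22 * x + 11 * x ^ 2)) + (t₄ / t₂) * (t₁ ^ 3 / (t₂ ^ 2 * t₃ ^ 3 * t₄ ^ 5 * t₅ ^ 6) *
        (1 - 9 * Y - 9 * x + 8 * x * Y - 5 * x ^ 2 + 12 * x ^ 3)) -
        t₅ / t₃ * (t₁ ^ 3 / (t₂ * t₃ ^ 2 * t₄ ^ 5 * t₅ ^ 8) * (1 - 10 * Y - 9 * x + x * Y +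
        15 * x ^ 2 + 10 * x ^ 2 * Y - 7 * x ^ 3)) + (t₃ / t₄) * (t₁ ^ 2 / (t₂ ^ 2 * t₃ ^ 2 *
        t₄ ^ 5 * t₅ ^ 6) * (-8 - 16 * Y + 17 * x + 13 * x * Y - 15 * x ^ 2 + 3 * x ^ 3)) -
        t₁ / t₅ * (t₁ ^ 2 / (t₂ * t₃ ^ 3 * t₄ ^ 5 * t₅ ^ 6) * (-2 - 4 * Y + 7 * x - 5 * x * Y -
        12 * x ^ 2 + 9 * x ^ 3))
      = 0 := by
  obtain ⟨h₁, h₂, h₃, h₄, h₅, hx, hx₁, hY, hY₁, hU, hV, rx₁, rY₁, rU, rV, hc⟩ := h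
  obtain ⟨Z, hZ⟩ : ∃ Z, Z = Y := ⟨_, rfl⟩
  have key : (6 * Y - 11 * x - 13 * x * Y + 12 * x ^ 2 + 6 * x ^ 2 * Y + 4 * x ^ 3) * x₁ + (-22 -
      11 * Y + 22 * x - 11 * x ^ 2) * x₁ * Z + (1 - 9 * Y - 9 * x + 8 * x * Y - 5 * x ^ 2 +
      12 * x ^ 3) * U + (-1 + 10 * Y + 9 * x - x * Y - 15 * x ^ 2 - 10 * x ^ 2 * Y +
      7 * x ^ 3) * x₁ + (-8 - 16 * Y + 17 * x + 13 * x * Y - 15 * x ^ 2 + 3 * x ^ 3) * Z + (2 +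
      4 * Y - 7 * x + 5 * x * Y + 12 * x ^ 2 - 9 * x ^ 3) * x₁ = 0 := by
    rw [rx₁, hZ, rU]
    linear_combination (-14 + 10 * x) * hc
  rw [hx₁, hZ.trans hY, hU] at key
  linear_combination (norm := (field_simp; ring)) (t₁ ^ 5 / (t₂ * t₃ ^ 2 * t₄ ^ 6 * t₅ ^ 9)) * key

theorem rank_dissection_class_8 (h : ThetaUnits t₁ t₂ t₃ t₄ t₅ x x₁ Y Y₁ U V) :
    (t₁ ^ 2 / (t₂ * t₃ ^ 3 * t₄ ^ 5 * t₅ ^ 6) * (-2 - 4 * Y + 7 * x - 5 * x * Y - 12 * x ^ 2 +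
        9 * x ^ 3)) - t₂ / t₁ * (t₁ ^ 3 / (t₂ ^ 2 * t₃ ^ 3 * t₄ ^ 5 * t₅ ^ 6) * (1 - 9 * Y - 9 * x +
        8 * x * Y - 5 * x ^ 2 + 12 * x ^ 3)) + (t₄ / t₂) * (t₁ ^ 4 / (t₂ ^ 2 * t₃ ^ 2 * t₄ ^ 6 *
        t₅ ^ 7) * (7 + 3 * Y - 8 * x - 10 * x * Y - 13 * x ^ 2 + 11 * x ^ 2 * Y + 18 * x ^ 3)) -
        t₅ / t₃ * (t₁ / (t₂ ^ 3 * t₃ ^ 2 * t₄ ^ 5 * t₅ ^ 4) * (22 + 11 * Y - 22 * x + 11 * x ^ 2)) +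
        (t₃ / t₄) * (t₁ ^ 3 / (t₂ ^ 3 * t₃ ^ 3 * t₄ ^ 5 * t₅ ^ 5) * (3 + 6 * Y - 5 * x +
        13 * x * Y + 18 * x ^ 2 + 3 * x ^ 3)) - t₁ / t₅ * (t₁ ^ 3 / (t₂ ^ 3 * t₃ ^ 2 * t₄ ^ 5 *
        t₅ ^ 6) * (4 - 14 * Y - 14 * x + 21 * x * Y + 13 * x ^ 2 + 4 * x ^ 3))
      = 0 := by
  obtain ⟨h₁, h₂, h₃, h₄, h₅, hx, hx₁, hY, hY₁, hU, hV, rx₁, rY₁, rU, rV, hc⟩ := h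
  obtain ⟨X, hX⟩ : ∃ X, X = x := ⟨_, rfl⟩
  obtain ⟨Z, hZ⟩ : ∃ Z, Z = Y := ⟨_, rfl⟩
  have key : (-2 - 4 * Y + 7 * x - 5 * x * Y - 12 * x ^ 2 + 9 * x ^ 3) * V + (-1 + 9 * Y + 9 * x -
      8 * x * Y + 5 * x ^ 2 - 12 * x ^ 3) * V + (7 + 3 * Y - 8 * x - 10 * x * Y - 13 * x ^ 2 +
      11 * x ^ 2 * Y + 18 * x ^ 3) * X + (-22 - 11 * Y + 22 * x - 11 * x ^ 2) * x₁ * Z + (3 +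
      6 * Y - 5 * x + 13 * x * Y + 18 * x ^ 2 + 3 * x ^ 3) * Z + (-4 + 14 * Y + 14 * x -
      21 * x * Y - 13 * x ^ 2 - 4 * x ^ 3) * X = 0 := by
    rw [hX, rx₁, hZ, rV]
    linear_combination (22 - 11 * x) * hc
  rw [hX.trans hx, hx₁, hZ.trans hY, hV] at key
  linear_combination (norm := (field_simp; ring)) (t₁ ^ 6 / (t₂ ^ 2 * t₃ ^ 3 * t₄ ^ 6 * t₅ ^ 8)) *
      key

theorem rank_dissection_class_9 (h : ThetaUnits t₁ t₂ t₃ t₄ t₅ x x₁ Y Y₁ U V) :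
    (t₁ ^ 3 / (t₂ ^ 3 * t₃ ^ 2 * t₄ ^ 5 * t₅ ^ 6) * (4 - 14 * Y - 14 * x + 21 * x * Y + 13 * x ^ 2 +
        4 * x ^ 3)) - t₂ / t₁ * (t₁ ^ 4 / (t₂ ^ 2 * t₃ ^ 2 * t₄ ^ 6 * t₅ ^ 7) * (7 + 3 * Y - 8 * x -
        10 * x * Y - 13 * x ^ 2 + 11 * x ^ 2 * Y + 18 * x ^ 3)) +
        (t₄ / t₂) * (t₁ ^ 3 / (t₂ ^ 2 * t₃ ^ 2 * t₄ ^ 6 * t₅ ^ 6) * (-9 - 7 * Y + 15 * x +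
        16 * x * Y - 10 * x ^ 2 + 13 * x ^ 3)) - t₅ / t₃ * (t₁ ^ 3 / (t₂ ^ 2 * t₃ ^ 3 * t₄ ^ 5 *
        t₅ ^ 6) * (1 - 9 * Y - 9 * x + 8 * x * Y - 5 * x ^ 2 + 12 * x ^ 3)) +
        (t₃ / t₄) * (t₁ ^ 3 / (t₂ * t₃ ^ 3 * t₄ ^ 5 * t₅ ^ 7) * (6 * Y - 11 * x - 13 * x * Y +
        12 * x ^ 2 + 6 * x ^ 2 * Y + 4 * x ^ 3)) - t₁ / t₅ * (t₁ ^ 3 / (t₂ * t₃ ^ 2 * t₄ ^ 5 *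
        t₅ ^ 8) * (1 - 10 * Y - 9 * x + x * Y + 15 * x ^ 2 + 10 * x ^ 2 * Y - 7 * x ^ 3))
      = 0 := by
  obtain ⟨h₁, h₂, h₃, h₄, h₅, hx, hx₁, hY, hY₁, hU, hV, rx₁, rY₁, rU, rV, hc⟩ := h
  obtain ⟨X, hX⟩ : ∃ X, X = x := ⟨_, rfl⟩
  obtain ⟨Z, hZ⟩ : ∃ Z, Z = Y := ⟨_, rfl⟩
  have key : (4 - 14 * Y - 14 * x + 21 * x * Y + 13 * x ^ 2 + 4 * x ^ 3) * X * Z * U + (-7 - 3 * Y +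
      8 * x + 10 * x * Y + 13 * x ^ 2 - 11 * x ^ 2 * Y - 18 * x ^ 3) * X * x₁ * Z + (-9 - 7 * Y +
      15 * x + 16 * x * Y - 10 * x ^ 2 + 13 * x ^ 3) * X * Z * U + (-1 + 9 * Y + 9 * x - 8 * x * Y +
      5 * x ^ 2 - 12 * x ^ 3) * x₁ * Z * U + (6 * Y - 11 * x - 13 * x * Y + 12 * x ^ 2 +
      6 * x ^ 2 * Y + 4 * x ^ 3) * X * x₁ * Z + (-1 + 10 * Y + 9 * x - x * Y - 15 * x ^ 2 -
      10 * x ^ 2 * Y + 7 * x ^ 3) * X ^ 2 * x₁ = 0 := by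
    rw [hX, rx₁, hZ, rU]
    linear_combination (1 - 9 * Y - 9 * x - 4 * x * Y + 15 * x ^ 2 + 29 * x ^ 2 * Y -
        7 * x ^ 3) * hc
  rw [hX.trans hx, hx₁, hZ.trans hY, hU] at key
  linear_combination (norm := (field_simp; ring)) (t₁ ^ 10 * t₂ / (t₃ ^ 3 * t₄ ^ 8 * t₅ ^ 13)) * key

theorem rank_dissection_class_10 (h : ThetaUnits t₁ t₂ t₃ t₄ t₅ x x₁ Y Y₁ U V) :
    (t₁ ^ 3 / (t₂ * t₃ ^ 2 * t₄ ^ 5 * t₅ ^ 8) * (1 - 10 * Y - 9 * x + x * Y + 15 * x ^ 2 +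
        10 * x ^ 2 * Y - 7 * x ^ 3)) - t₂ / t₁ * (t₁ ^ 3 / (t₂ ^ 2 * t₃ ^ 2 * t₄ ^ 6 * t₅ ^ 6) *
        (-9 - 7 * Y + 15 * x + 16 * x * Y - 10 * x ^ 2 + 13 * x ^ 3)) +
        (t₄ / t₂) * (t₁ ^ 3 / (t₂ ^ 2 * t₃ ^ 2 * t₄ ^ 5 * t₅ ^ 7) * (5 + 21 * Y - 12 * x -
        37 * x * Y + 19 * x ^ 2 + 11 * x ^ 2 * Y - 17 * x ^ 3)) -
        t₅ / t₃ * (t₁ ^ 4 / (t₂ ^ 2 * t₃ ^ 2 * t₄ ^ 6 * t₅ ^ 7) * (7 + 3 * Y - 8 * x - 10 * x * Y -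
        13 * x ^ 2 + 11 * x ^ 2 * Y + 18 * x ^ 3)) + (t₃ / t₄) * (t₁ ^ 2 / (t₂ * t₃ ^ 3 * t₄ ^ 5 *
        t₅ ^ 6) * (-2 - 4 * Y + 7 * x - 5 * x * Y - 12 * x ^ 2 + 9 * x ^ 3)) -
        t₁ / t₅ * (t₁ / (t₂ ^ 3 * t₃ ^ 2 * t₄ ^ 5 * t₅ ^ 4) * (22 + 11 * Y - 22 * x + 11 * x ^ 2))
      = t₁ ^ 3 / (t₂ ^ 2 * t₃ ^ 2 * t₄ ^ 5 * t₅ ^ 6) * (1 + 2 * Y + 2 * x - 3 * x * Y - 5 * x ^ 2 +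
          x ^ 3) * (11 * (t₂ * t₄ / (t₁ ^ 2 * t₃))) := by
  obtain ⟨h₁, h₂, h₃, h₄, h₅, hx, hx₁, hY, hY₁, hU, hV, rx₁, rY₁, rU, rV, hc⟩ := h
  obtain ⟨X, hX⟩ : ∃ X, X = x := ⟨_, rfl⟩
  obtain ⟨Z, hZ⟩ : ∃ Z, Z = Y := ⟨_, rfl⟩
  have key : (1 - 10 * Y - 9 * x + x * Y + 15 * x ^ 2 + 10 * x ^ 2 * Y -
      7 * x ^ 3) * X ^ 2 * x₁ * V + (9 + 7 * Y - 15 * x - 16 * x * Y + 10 * x ^ 2 -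
      13 * x ^ 3) * X * x₁ * Z * V + (5 + 21 * Y - 12 * x - 37 * x * Y + 19 * x ^ 2 +
      11 * x ^ 2 * Y - 17 * x ^ 3) * X * x₁ * Z * Y₁ + (-7 - 3 * Y + 8 * x + 10 * x * Y +
      13 * x ^ 2 - 11 * x ^ 2 * Y - 18 * x ^ 3) * X * x₁ ^ 2 * Z + (-2 - 4 * Y + 7 * x - 5 * x * Y -
      12 * x ^ 2 + 9 * x ^ 3) * X * x₁ * Z * V + (-22 - 11 * Y + 22 * x -
      11 * x ^ 2) * X * Z * U * V + (-11 - 22 * Y - 22 * x + 33 * x * Y + 55 * x ^ 2 -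
      11 * x ^ 3) * x₁ * Z * Y₁ * V = 0 := by
    rw [hX, rx₁, hZ, rY₁, rU, rV]
    linear_combination (11 * Y + 22 * Y ^ 2 - x - 13 * x * Y - 66 * x * Y ^ 2 + 9 * x ^ 2 -
        28 * x ^ 2 * Y + 33 * x ^ 2 * Y ^ 2 - 15 * x ^ 3 + 19 * x ^ 3 * Y + 7 * x ^ 4) * hc
  rw [hX.trans hx, hx₁, hZ.trans hY, hY₁, hU, hV] at key
  linear_combination (norm := (field_simp; ring)) (t₁ ^ 13 / (t₃ ^ 3 * t₄ ^ 9 * t₅ ^ 14)) * key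

theorem crank_dissection_class_0 (h : ThetaUnits t₁ t₂ t₃ t₄ t₅ x x₁ Y Y₁ U V) :
    (-(t₂ / t₁)) * (1 / t₅ * (-2)) + (t₄ / t₂) * (1 / t₁ * (1)) - t₅ / t₃ * (1 / t₄ * (-3)) +
        (t₃ / t₄) * (1 / t₂ * (5)) - t₁ / t₅ * (1 / t₃ * (4))
      = (-1) * (t₃ ^ 2 / (t₁ ^ 2 * t₄)) - (t₂ * t₄ ^ 2 / (t₁ ^ 2 * t₃ * t₅)) -
          (t₂ * t₅ / (t₁ ^ 2 * t₄)) + 4 * (t₂ ^ 3 / (t₁ ^ 3 * t₃)) +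
          5 * (t₁ * t₄ / (t₂ ^ 2 * t₃)) := by
  obtain ⟨h₁, h₂, h₃, h₄, h₅, hx, hx₁, hY, hY₁, hU, hV, rx₁, rY₁, rU, rV, hc⟩ := h
  obtain ⟨X, hX⟩ : ∃ X, X = x := ⟨_, rfl⟩
  obtain ⟨Z, hZ⟩ : ∃ Z, Z = Y := ⟨_, rfl⟩
  have key : 2 * X * x₁ * Y₁ * V + 1 * X * Y₁ * U * V + 3 * X * x₁ * U * V + 5 * X * x₁ * Z * Y₁ +
      (-4) * X * x₁ ^ 2 * Y₁ + 1 * X * Z * Y₁ * V + 1 * x₁ * Y₁ ^ 2 * V + 1 * x₁ * Z * Y₁ * V +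
      (-4) * x₁ * Y₁ * V ^ 2 + (-5) * X * x₁ * Y₁ * U = 0 := by
    rw [hX, rx₁, hZ, rY₁, rU, rV]
    linear_combination (-1 + 2 * Y + 3 * x) * hc
  rw [hX.trans hx, hx₁, hZ.trans hY, hY₁, hU, hV] at key
  linear_combination (norm := (field_simp; ring)) (t₁ ^ 10 * t₂ ^ 2 / (t₄ ^ 6 * t₅ ^ 7)) * key

theorem crank_dissection_class_1 (h : ThetaUnits t₁ t₂ t₃ t₄ t₅ x x₁ Y Y₁ U V) :
    1 * (1 / t₃ * (4)) - t₂ / t₁ * (1 / t₁ * (1)) + (t₄ / t₂) * (t₅ / (t₂ * t₃) * (1)) -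
        t₅ / t₃ * (1 / t₅ * (-2)) + (t₃ / t₄) * (t₄ / (t₂ * t₅) * (-4)) -
        t₁ / t₅ * (t₁ / (t₄ * t₅) * (6))
      = (-11) * (t₁ ^ 2 / (t₄ * t₅ ^ 2)) := by
  obtain ⟨h₁, h₂, h₃, h₄, h₅, hx, hx₁, hY, hY₁, hU, hV, rx₁, rY₁, rU, rV, hc⟩ := h
  obtain ⟨X, hX⟩ : ∃ X, X = x := ⟨_, rfl⟩
  have key : 4 * x₁ + (-1) * V + 1 * U + 2 * x₁ + (-4) * X + (-6) + 11 = 0 := by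
    rw [hX, rx₁, rU, rV]
    linear_combination
  rw [hX.trans hx, hx₁, hU, hV] at key
  linear_combination (norm := (field_simp; ring)) (t₁ ^ 2 / (t₄ * t₅ ^ 2)) * key

theorem crank_dissection_class_2 (h : ThetaUnits t₁ t₂ t₃ t₄ t₅ x x₁ Y Y₁ U V) :
    (t₁ / (t₄ * t₅) * (6)) - t₂ / t₁ * (t₅ / (t₂ * t₃) * (1)) + (t₄ / t₂) * (t₃ / (t₁ * t₄) * (2)) -
        t₅ / t₃ * (1 / t₁ * (1)) - t₁ / t₅ * (1 / t₄ * (-3))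
      = 11 * (t₁ / (t₄ * t₅)) := by
  obtain ⟨h₁, h₂, h₃, h₄, h₅, hx, hx₁, hY, hY₁, hU, hV, rx₁, rY₁, rU, rV, hc⟩ := h
  obtain ⟨X, hX⟩ : ∃ X, X = x := ⟨_, rfl⟩
  have key : 6 + (-1) * x₁ + 2 * X + (-1) * x₁ + 3 + (-11) = 0 := by
    rw [hX, rx₁]
    linear_combination
  rw [hX.trans hx, hx₁] at key
  linear_combination (norm := (field_simp; ring)) (t₁ / (t₄ * t₅)) * key

theorem crank_dissection_class_3 (h : ThetaUnits t₁ t₂ t₃ t₄ t₅ x x₁ Y Y₁ U V) :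
    1 * (1 / t₄ * (-3)) - t₂ / t₁ * (t₃ / (t₁ * t₄) * (2)) + (t₄ / t₂) * (t₂ / (t₁ * t₃) * (3)) -
        t₅ / t₃ * (t₅ / (t₂ * t₃) * (1)) + (t₃ / t₄) * (1 / t₃ * (4)) - t₁ / t₅ * (1 / t₅ * (-2))
      = 0 := by
  obtain ⟨h₁, h₂, h₃, h₄, h₅, hx, hx₁, hY, hY₁, hU, hV, rx₁, rY₁, rU, rV, hc⟩ := h
  obtain ⟨X, hX⟩ : ∃ X, X = x := ⟨_, rfl⟩
  obtain ⟨Z, hZ⟩ : ∃ Z, Z = Y := ⟨_, rfl⟩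
  have key : (-3) * X * x₁ * Z + (-2) * X * Z * V + 3 * x₁ * Z * Y₁ + (-1) * x₁ * Z * U +
      4 * X * x₁ * Z + 2 * X ^ 2 * x₁ = 0 := by
    rw [hX, rx₁, hZ, rY₁, rU, rV]
    linear_combination (-2) * hc
  rw [hX.trans hx, hx₁, hZ.trans hY, hY₁, hU, hV] at key
  linear_combination (norm := (field_simp; ring)) (t₁ ^ 7 * t₂ ^ 2 / (t₃ * t₄ ^ 3 * t₅ ^ 6)) * key

theorem crank_dissection_class_4 (h : ThetaUnits t₁ t₂ t₃ t₄ t₅ x x₁ Y Y₁ U V) :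
    1 * (1 / t₅ * (-2)) - t₂ / t₁ * (t₂ / (t₁ * t₃) * (3)) + (t₄ / t₂) * (1 / t₂ * (5)) -
        t₅ / t₃ * (t₃ / (t₁ * t₄) * (2)) + (t₃ / t₄) * (t₁ / (t₄ * t₅) * (6)) -
        t₁ / t₅ * (1 / t₁ * (1))
      = (-11) * (t₁ * t₅ / (t₂ * t₃ * t₄)) := by
  obtain ⟨h₁, h₂, h₃, h₄, h₅, hx, hx₁, hY, hY₁, hU, hV, rx₁, rY₁, rU, rV, hc⟩ := h
  obtain ⟨X, hX⟩ : ∃ X, X = x := ⟨_, rfl⟩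
  obtain ⟨Z, hZ⟩ : ∃ Z, Z = Y := ⟨_, rfl⟩
  have key : (-2) * X * x₁ * Y₁ + (-3) * x₁ * Y₁ * V + 5 * X * Y₁ * U + (-2) * x₁ * Z * Y₁ +
      6 * X ^ 2 * x₁ + (-1) * X * x₁ * Y₁ + 11 * X * x₁ * U = 0 := by
    rw [hX, rx₁, hZ, rY₁, rU, rV]
    linear_combination 5 * hc
  rw [hX.trans hx, hx₁, hZ.trans hY, hY₁, hU, hV] at key
  linear_combination (norm := (field_simp; ring)) (t₁ ^ 7 * t₂ ^ 2 / (t₄ ^ 5 * t₅ ^ 5)) * key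

theorem crank_dissection_class_5 (h : ThetaUnits t₁ t₂ t₃ t₄ t₅ x x₁ Y Y₁ U V) :
    1 * (1 / t₁ * (1)) - t₂ / t₁ * (1 / t₂ * (5)) + (t₄ / t₂) * (t₄ / (t₂ * t₅) * (-4)) -
        t₅ / t₃ * (t₂ / (t₁ * t₃) * (3)) + (t₃ / t₄) * (1 / t₄ * (-3)) -
        t₁ / t₅ * (t₅ / (t₂ * t₃) * (1))
      = (-11) * (1 / t₁) := by
  obtain ⟨h₁, h₂, h₃, h₄, h₅, hx, hx₁, hY, hY₁, hU, hV, rx₁, rY₁, rU, rV, hc⟩ := h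
  obtain ⟨X, hX⟩ : ∃ X, X = x := ⟨_, rfl⟩
  have key : 1 * X * Y₁ * V + (-5) * X * Y₁ * V + (-4) * X * Y₁ ^ 2 + (-3) * x₁ * Y₁ * V +
      (-3) * X ^ 2 * V + (-1) * X * x₁ * Y₁ + 11 * X * Y₁ * V = 0 := by
    rw [hX, rx₁, rY₁, rV]
    linear_combination 3 * hc
  rw [hX.trans hx, hx₁, hY₁, hV] at key
  linear_combination (norm := (field_simp; ring)) (t₁ ^ 8 * t₂ / (t₃ * t₄ ^ 5 * t₅ ^ 4)) * key

theorem crank_dissection_class_6 (h : ThetaUnits t₁ t₂ t₃ t₄ t₅ x x₁ Y Y₁ U V) :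
    (t₅ / (t₂ * t₃) * (1)) - t₂ / t₁ * (t₄ / (t₂ * t₅) * (-4)) - t₅ / t₃ * (1 / t₂ * (5)) +
        (t₃ / t₄) * (1 / t₅ * (-2)) - t₁ / t₅ * (t₃ / (t₁ * t₄) * (2))
      = 0 := by
  obtain ⟨h₁, h₂, h₃, h₄, h₅, hx, hx₁, hY, hY₁, hU, hV, rx₁, rY₁, rU, rV, hc⟩ := h
  obtain ⟨X, hX⟩ : ∃ X, X = x := ⟨_, rfl⟩
  have key : 1 * U + 4 * Y₁ + (-5) * U + (-2) * X + (-2) * X = 0 := by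
    rw [hX, rY₁, rU]
    linear_combination
  rw [hX.trans hx, hY₁, hU] at key
  linear_combination (norm := (field_simp; ring)) (t₁ ^ 2 * t₂ / (t₄ ^ 2 * t₅ ^ 2)) * key

theorem crank_dissection_class_7 (h : ThetaUnits t₁ t₂ t₃ t₄ t₅ x x₁ Y Y₁ U V) :
    (t₃ / (t₁ * t₄) * (2)) + (t₄ / t₂) * (1 / t₃ * (4)) - t₅ / t₃ * (t₄ / (t₂ * t₅) * (-4)) +
        (t₃ / t₄) * (1 / t₁ * (1)) - t₁ / t₅ * (t₂ / (t₁ * t₃) * (3))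
      = 11 * (t₄ / (t₂ * t₃)) := by
  obtain ⟨h₁, h₂, h₃, h₄, h₅, hx, hx₁, hY, hY₁, hU, hV, rx₁, rY₁, rU, rV, hc⟩ := h
  obtain ⟨Z, hZ⟩ : ∃ Z, Z = Y := ⟨_, rfl⟩
  have key : 2 * Z + 4 * U + 4 * U + 1 * Z + (-3) * x₁ + (-11) * U = 0 := by
    rw [rx₁, hZ, rU]
    linear_combination
  rw [hx₁, hZ.trans hY, hU] at key
  linear_combination (norm := (field_simp; ring)) (t₁ ^ 2 * t₂ / (t₄ * t₅ ^ 3)) * key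

theorem crank_dissection_class_8 (h : ThetaUnits t₁ t₂ t₃ t₄ t₅ x x₁ Y Y₁ U V) :
    (t₂ / (t₁ * t₃) * (3)) - t₂ / t₁ * (1 / t₃ * (4)) + (t₄ / t₂) * (t₁ / (t₄ * t₅) * (6)) +
        (t₃ / t₄) * (t₅ / (t₂ * t₃) * (1)) - t₁ / t₅ * (1 / t₂ * (5))
      = 0 := by
  obtain ⟨h₁, h₂, h₃, h₄, h₅, hx, hx₁, hY, hY₁, hU, hV, rx₁, rY₁, rU, rV, hc⟩ := h
  obtain ⟨X, hX⟩ : ∃ X, X = x := ⟨_, rfl⟩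
  obtain ⟨Z, hZ⟩ : ∃ Z, Z = Y := ⟨_, rfl⟩
  have key : 3 * V + (-4) * V + 6 * X + 1 * Z + (-5) * X = 0 := by
    rw [hX, hZ, rV]
    linear_combination
  rw [hX.trans hx, hZ.trans hY, hV] at key
  linear_combination (norm := (field_simp; ring)) (t₁ ^ 3 / (t₃ * t₄ * t₅ ^ 2)) * key

theorem crank_dissection_class_9 (h : ThetaUnits t₁ t₂ t₃ t₄ t₅ x x₁ Y Y₁ U V) :
    1 * (1 / t₂ * (5)) - t₂ / t₁ * (t₁ / (t₄ * t₅) * (6)) + (t₄ / t₂) * (1 / t₄ * (-3)) -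
        t₅ / t₃ * (1 / t₃ * (4)) + (t₃ / t₄) * (t₃ / (t₁ * t₄) * (2)) -
        t₁ / t₅ * (t₄ / (t₂ * t₅) * (-4))
      = 0 := by
  obtain ⟨h₁, h₂, h₃, h₄, h₅, hx, hx₁, hY, hY₁, hU, hV, rx₁, rY₁, rU, rV, hc⟩ := h
  obtain ⟨X, hX⟩ : ∃ X, X = x := ⟨_, rfl⟩
  obtain ⟨Z, hZ⟩ : ∃ Z, Z = Y := ⟨_, rfl⟩
  have key : 5 * X * Z * U + (-6) * X * x₁ * Z + (-3) * X * Z * U + (-4) * x₁ * Z * U +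
      2 * X * Z ^ 2 + 4 * X ^ 2 * U = 0 := by
    rw [hX, rx₁, hZ, rU]
    linear_combination 4 * hc
  rw [hX.trans hx, hx₁, hZ.trans hY, hU] at key
  linear_combination (norm := (field_simp; ring)) (t₁ ^ 7 * t₂ ^ 3 / (t₃ * t₄ ^ 3 * t₅ ^ 7)) * key

theorem crank_dissection_class_10 (h : ThetaUnits t₁ t₂ t₃ t₄ t₅ x x₁ Y Y₁ U V) :
    (t₄ / (t₂ * t₅) * (-4)) - t₂ / t₁ * (1 / t₄ * (-3)) + (t₄ / t₂) * (1 / t₅ * (-2)) -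
        t₅ / t₃ * (t₁ / (t₄ * t₅) * (6)) + (t₃ / t₄) * (t₂ / (t₁ * t₃) * (3))
      = 0 := by
  obtain ⟨h₁, h₂, h₃, h₄, h₅, hx, hx₁, hY, hY₁, hU, hV, rx₁, rY₁, rU, rV, hc⟩ := h
  have key : (-4) * Y₁ + 3 * V + (-2) * Y₁ + (-6) * x₁ + 3 * V = 0 := by
    rw [rx₁, rY₁, rV]
    linear_combination
  rw [hx₁, hY₁, hV] at key
  linear_combination (norm := (field_simp; ring)) (t₁ ^ 3 / (t₄ ^ 2 * t₅ ^ 2)) * key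

theorem rank_dissection (h : ThetaUnits t₁ t₂ t₃ t₄ t₅ x x₁ Y Y₁ U V) :
    (1 + (-(t₂ / t₁)) + (t₄ / t₂) + (-(t₅ / t₃)) + (t₃ / t₄) + (-(t₁ / t₅))) *
      (t₁ ^ 3 / (t₂ ^ 2 * t₃ ^ 2 * t₄ ^ 5 * t₅ ^ 7) * (5 + 21 * Y - 12 * x - 37 * x * Y +
          19 * x ^ 2 + 11 * x ^ 2 * Y - 17 * x ^ 3) + t₁ ^ 2 / (t₂ ^ 2 * t₃ ^ 2 * t₄ ^ 5 * t₅ ^ 6) *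
          (-8 - 16 * Y + 17 * x + 13 * x * Y - 15 * x ^ 2 + 3 * x ^ 3) +
          t₁ ^ 3 / (t₂ ^ 3 * t₃ ^ 3 * t₄ ^ 5 * t₅ ^ 5) * (3 + 6 * Y - 5 * x + 13 * x * Y +
          18 * x ^ 2 + 3 * x ^ 3) + t₁ ^ 3 / (t₂ * t₃ ^ 3 * t₄ ^ 5 * t₅ ^ 7) * (6 * Y - 11 * x -
          13 * x * Y + 12 * x ^ 2 + 6 * x ^ 2 * Y + 4 * x ^ 3) +
          t₁ ^ 2 / (t₂ * t₃ ^ 3 * t₄ ^ 5 * t₅ ^ 6) * (-2 - 4 * Y + 7 * x - 5 * x * Y - 12 * x ^ 2 +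
          9 * x ^ 3) + t₁ ^ 3 / (t₂ ^ 3 * t₃ ^ 2 * t₄ ^ 5 * t₅ ^ 6) * (4 - 14 * Y - 14 * x +
          21 * x * Y + 13 * x ^ 2 + 4 * x ^ 3) + t₁ ^ 3 / (t₂ * t₃ ^ 2 * t₄ ^ 5 * t₅ ^ 8) * (1 -
          10 * Y - 9 * x + x * Y + 15 * x ^ 2 + 10 * x ^ 2 * Y - 7 * x ^ 3) +
          t₁ / (t₂ ^ 3 * t₃ ^ 2 * t₄ ^ 5 * t₅ ^ 4) * (22 + 11 * Y - 22 * x + 11 * x ^ 2) +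
          t₁ ^ 3 / (t₂ ^ 2 * t₃ ^ 3 * t₄ ^ 5 * t₅ ^ 6) * (1 - 9 * Y - 9 * x + 8 * x * Y -
          5 * x ^ 2 + 12 * x ^ 3) + t₁ ^ 4 / (t₂ ^ 2 * t₃ ^ 2 * t₄ ^ 6 * t₅ ^ 7) * (7 + 3 * Y -
          8 * x - 10 * x * Y - 13 * x ^ 2 + 11 * x ^ 2 * Y + 18 * x ^ 3) +
          t₁ ^ 3 / (t₂ ^ 2 * t₃ ^ 2 * t₄ ^ 6 * t₅ ^ 6) * (-9 - 7 * Y + 15 * x + 16 * x * Y -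
          10 * x ^ 2 + 13 * x ^ 3))
      = t₁ ^ 3 / (t₂ ^ 2 * t₃ ^ 2 * t₄ ^ 5 * t₅ ^ 6) * (1 + 2 * Y + 2 * x - 3 * x * Y - 5 * x ^ 2 +
          x ^ 3) * (11 * (t₂ * t₄ / (t₁ ^ 2 * t₃)) - 11 * (t₃ * t₅ / (t₁ * t₂ * t₄)) +
          11 * (t₄ / (t₁ * t₅)) - 11 * (1 / t₄) - 3 * (t₃ ^ 2 / (t₁ ^ 2 * t₄)) -
          3 * (t₂ * t₄ ^ 2 / (t₁ ^ 2 * t₃ * t₅)) - 3 * (t₂ * t₅ / (t₁ ^ 2 * t₄)) +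
          (t₂ ^ 3 / (t₁ ^ 3 * t₃)) + 4 * (t₁ * t₄ / (t₂ ^ 2 * t₃))) := by
  linear_combination rank_dissection_class_0 h + rank_dissection_class_1 h +
      rank_dissection_class_2 h + rank_dissection_class_3 h + rank_dissection_class_4 h +
      rank_dissection_class_5 h + rank_dissection_class_6 h + rank_dissection_class_7 h +
      rank_dissection_class_8 h + rank_dissection_class_9 h + rank_dissection_class_10 h

theorem crank_dissection (h : ThetaUnits t₁ t₂ t₃ t₄ t₅ x x₁ Y Y₁ U V) :
    (1 + (-(t₂ / t₁)) + (t₄ / t₂) + (-(t₅ / t₃)) + (t₃ / t₄) + (-(t₁ / t₅))) *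
      (1 / t₁ * (1) + t₅ / (t₂ * t₃) * (1) + t₃ / (t₁ * t₄) * (2) + t₂ / (t₁ * t₃) * (3) +
          1 / t₂ * (5) + t₄ / (t₂ * t₅) * (-4) + 1 / t₃ * (4) + t₁ / (t₄ * t₅) * (6) +
          1 / t₄ * (-3) + 1 / t₅ * (-2))
      = 11 * (t₄ / (t₂ * t₃)) - 11 * (t₁ * t₅ / (t₂ * t₃ * t₄)) + 11 * (t₁ / (t₄ * t₅)) -
          11 * (t₁ ^ 2 / (t₄ * t₅ ^ 2)) - 11 * (1 / t₁) - (t₃ ^ 2 / (t₁ ^ 2 * t₄)) -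
          (t₂ * t₄ ^ 2 / (t₁ ^ 2 * t₃ * t₅)) - (t₂ * t₅ / (t₁ ^ 2 * t₄)) +
          4 * (t₂ ^ 3 / (t₁ ^ 3 * t₃)) + 5 * (t₁ * t₄ / (t₂ ^ 2 * t₃)) := by
  linear_combination crank_dissection_class_0 h + crank_dissection_class_1 h +
      crank_dissection_class_2 h + crank_dissection_class_3 h + crank_dissection_class_4 h +
      crank_dissection_class_5 h + crank_dissection_class_6 h + crank_dissection_class_7 h +
      crank_dissection_class_8 h + crank_dissection_class_9 h + crank_dissection_class_10 h

end

section
variable {t₁ t₂ t₃ t₄ t₅ x x₁ Y Y₁ U V : ℂ}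

theorem rank_piece_one (h : ThetaUnits t₁ t₂ t₃ t₄ t₅ x x₁ Y Y₁ U V) :
    t₁ ^ 3 / (t₂ * t₃ ^ 2 * t₄ ^ 5 * t₅ ^ 8) * (1 - 10 * Y - 9 * x + x * Y + 15 * x ^ 2 +
        10 * x ^ 2 * Y - 7 * x ^ 3) =
      t₁ ^ 3 / (t₂ ^ 3 * t₃ ^ 2 * t₄ ^ 4 * t₅ ^ 7) * ((-11) * Y / x - 1 + 9 * Y - 2 * x +
          3 * Y * x - 6 * x ^ 2 + 10 * x ^ 3) := by
  obtain ⟨h₁, h₂, h₃, h₄, h₅, hx, hx₁, hY, hY₁, hU, hV, rx₁, rY₁, rU, rV, hc⟩ := h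
  have e₀ : t₁ ^ 3 / (t₂ * t₃ ^ 2 * t₄ ^ 5 * t₅ ^ 8) = t₁ ^ 3 / (t₂ ^ 3 * t₃ ^ 2 * t₄ ^ 4 *
      t₅ ^ 7) * (x₁ / U) := by
    rw [hx₁, hU]; field_simp
  rw [e₀, mul_assoc]
  congr 1
  have hU0 : U ≠ 0 := by rw [hU]; positivity
  have hx0 : x ≠ 0 := by rw [hx]; positivity
  refine mul_left_cancel₀ (by positivity : x * U ≠ 0) ?_
  calc
    _ = (x * x₁) - 10 * (x * x₁ * Y) - 9 * (x ^ 2 * x₁) + (x ^ 2 * x₁ * Y) + 15 * (x ^ 3 * x₁) +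
        10 * (x ^ 3 * x₁ * Y) - 7 * (x ^ 4 * x₁) := by field_simp
    _ = -11 * (U) * Y - 1 * (x * U) + 9 * (x * U) * Y - 2 * (x ^ 2 * U) + 3 * (x ^ 2 * U) * Y -
        6 * (x ^ 3 * U) + 10 * (x ^ 4 * U) := by
      simp only [rx₁, rU]
      linear_combination (11 - 9 * x - 3 * x ^ 2) * hc
    _ = _ := by field_simp

theorem rank_piece_two (h : ThetaUnits t₁ t₂ t₃ t₄ t₅ x x₁ Y Y₁ U V) {X Z : ℂ}
    (hX : X = t₅ * (-t₃) * t₁ / (t₂ ^ 2 * (-t₄)))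
    (hZ : Z = t₅ * t₁ ^ 3 / (t₂ ^ 3 * (-t₄))) :
    t₂ ^ 2 / ((-t₄) * t₅ ^ 3 * (-t₃) ^ 5 * t₁ ^ 6) * (-2 - 4 * Z + 7 * X - 5 * X * Z - 12 * X ^ 2 +
        9 * X ^ 3) =
      t₁ ^ 3 / (t₂ ^ 3 * t₃ ^ 2 * t₄ ^ 4 * t₅ ^ 7) * ((11) * Y / x + 2 - 18 * Y - 7 * x +
          5 * Y * x + x ^ 2 + 2 * x ^ 3) := by
  obtain ⟨h₁, h₂, h₃, h₄, h₅, hx, hx₁, hY, hY₁, hU, hV, rx₁, rY₁, rU, rV, hc⟩ := h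
  have e₀ : t₂ ^ 2 / ((-t₄) * t₅ ^ 3 * (-t₃) ^ 5 * t₁ ^ 6) =
      t₁ ^ 3 / (t₂ ^ 3 * t₃ ^ 2 * t₄ ^ 4 * t₅ ^ 7) * ((x₁ * V ^ 3 / (x * Y))) := by
    rw [hx, hx₁, hY, hV]; field_simp
  have eX : X = (Y / V) := by
    rw [hX, hY, hV]; field_simp
  have eZ : Z = -(x₁ * Y / V ^ 2) := by
    rw [hZ, hx₁, hY, hV]; field_simp
  rw [e₀, mul_assoc]
  congr 1
  have hV0 : V ≠ 0 := by rw [hV]; positivity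
  have hY0 : Y ≠ 0 := by rw [hY]; positivity
  have hx0 : x ≠ 0 := by rw [hx]; positivity
  refine mul_left_cancel₀ (by positivity : x * Y ≠ 0) ?_
  calc
    _ = -2 * (x₁ * V ^ 3) + 4 * (x₁ ^ 2 * Y * V) + 7 * (x₁ * Y * V ^ 2) + 5 * (x₁ ^ 2 * Y ^ 2) - 12 * (x₁ * Y ^ 2 * V) + 9 * (x₁ * Y ^ 3) := by rw [eX, eZ]; field_simp; ring
    _ = 11 * (Y) * Y + 2 * (x * Y) - 18 * (x * Y) * Y - 7 * (x ^ 2 * Y) + 5 * (x ^ 2 * Y) * Y +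
        (x ^ 3 * Y) + 2 * (x ^ 4 * Y) := by
      simp only [rx₁, rV]
      linear_combination (-2 * Y + 2 * x + 2 * x * Y) * hc
    _ = _ := by field_simp

theorem rank_piece_three (h : ThetaUnits t₁ t₂ t₃ t₄ t₅ x x₁ Y Y₁ U V) {X Z : ℂ}
    (hX : X = t₂ * (-t₁) * (-t₄) / (t₃ ^ 2 * t₅))
    (hZ : Z = t₂ * (-t₄) ^ 3 / (t₃ ^ 3 * t₅)) :
    t₃ ^ 3 / (t₅ ^ 3 * t₂ ^ 3 * (-t₁) ^ 5 * (-t₄) ^ 5) * (3 + 6 * Z - 5 * X + 13 * X * Z +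
        18 * X ^ 2 + 3 * X ^ 3) =
      t₁ ^ 3 / (t₂ ^ 3 * t₃ ^ 2 * t₄ ^ 4 * t₅ ^ 7) * ((-3) + 16 * Y + 16 * x - 24 * Y * x -
          18 * x ^ 2 - 3 * x ^ 3) := by
  obtain ⟨h₁, h₂, h₃, h₄, h₅, hx, hx₁, hY, hY₁, hU, hV, rx₁, rY₁, rU, rV, hc⟩ := h
  have e₀ : t₃ ^ 3 / (t₅ ^ 3 * t₂ ^ 3 * (-t₁) ^ 5 * (-t₄) ^ 5) =
      t₁ ^ 3 / (t₂ ^ 3 * t₃ ^ 2 * t₄ ^ 4 * t₅ ^ 7) * (Y ^ 3 * Y₁ / U ^ 2) := by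
    rw [hY, hY₁, hU]; field_simp
  have eX : X = (x₁ / Y) := by
    rw [hX, hx₁, hY]; field_simp
  have eZ : Z = -(x₁ * Y₁ / (x * Y)) := by
    rw [hZ, hx, hx₁, hY, hY₁]; field_simp
  rw [e₀, mul_assoc]
  congr 1
  have hU0 : U ≠ 0 := by rw [hU]; positivity
  have hY0 : Y ≠ 0 := by rw [hY]; positivity
  have hx0 : x ≠ 0 := by rw [hx]; positivity
  refine mul_left_cancel₀ (by positivity : x * U ^ 2 ≠ 0) ?_
  calc
    _ = 3 * (x * Y ^ 3 * Y₁) - 6 * (x₁ * Y ^ 2 * Y₁ ^ 2) - 5 * (x * x₁ * Y ^ 2 * Y₁) - 13 * (x₁ ^ 2 * Y * Y₁ ^ 2) + 18 * (x * x₁ ^ 2 * Y * Y₁) + 3 * (x * x₁ ^ 3 * Y₁) := by rw [eX, eZ]; field_simp; ring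
    _ = -3 * (x * U ^ 2) + 16 * (x * U ^ 2) * Y + 16 * (x ^ 2 * U ^ 2) - 24 * (x ^ 2 * U ^ 2) * Y -
        18 * (x ^ 3 * U ^ 2) - 3 * (x ^ 4 * U ^ 2) := by
      simp only [rx₁, rY₁, rU]
      linear_combination (-13 - 7 * Y + 6 * Y ^ 2 + 31 * x + 9 * x * Y - 3 * x * Y ^ 2 -
          15 * x ^ 2 + 6 * x ^ 2 * Y - 3 * x ^ 3) * hc
    _ = _ := by field_simp

theorem rank_piece_four (h : ThetaUnits t₁ t₂ t₃ t₄ t₅ x x₁ Y Y₁ U V) {X Z : ℂ}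
    (hX : X = (-t₁) * t₅ * (-t₂) / (t₄ ^ 2 * (-t₃)))
    (hZ : Z = (-t₁) * (-t₂) ^ 3 / (t₄ ^ 3 * (-t₃))) :
    t₄ ^ 4 / ((-t₃) ^ 2 * (-t₁) ^ 2 * t₅ ^ 6 * (-t₂) ^ 7) * (7 + 3 * Z - 8 * X - 10 * X * Z -
        13 * X ^ 2 + 11 * X ^ 2 * Z + 18 * X ^ 3) =
      t₁ ^ 3 / (t₂ ^ 3 * t₃ ^ 2 * t₄ ^ 4 * t₅ ^ 7) * ((-11) * Y / x + 4 + 8 * Y - 25 * x -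
          1 * Y * x + 24 * x ^ 2 - 7 * x ^ 3) := by
  obtain ⟨h₁, h₂, h₃, h₄, h₅, hx, hx₁, hY, hY₁, hU, hV, rx₁, rY₁, rU, rV, hc⟩ := h
  have e₀ : t₄ ^ 4 / ((-t₃) ^ 2 * (-t₁) ^ 2 * t₅ ^ 6 * (-t₂) ^ 7) =
      t₁ ^ 3 / (t₂ ^ 3 * t₃ ^ 2 * t₄ ^ 4 * t₅ ^ 7) * (-(Y₁ ^ 3 / V)) := by
    rw [hY₁, hV]; field_simp
  have eX : X = -(x₁ / Y₁) := by
    rw [hX, hx₁, hY₁]; field_simp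
  have eZ : Z = -(V / (x * Y₁)) := by
    rw [hZ, hx, hY₁, hV]; field_simp
  rw [e₀, mul_assoc]
  congr 1
  have hV0 : V ≠ 0 := by rw [hV]; positivity
  have hY10 : Y₁ ≠ 0 := by rw [hY₁]; positivity
  have hx0 : x ≠ 0 := by rw [hx]; positivity
  refine mul_left_cancel₀ (by positivity : x * V ≠ 0) ?_
  calc
    _ = -7 * (x * Y₁ ^ 3) + 3 * (Y₁ ^ 2 * V) - 8 * (x * x₁ * Y₁ ^ 2) + 10 * (x₁ * Y₁ * V) + 13 * (x * x₁ ^ 2 * Y₁) + 11 * (x₁ ^ 2 * V) + 18 * (x * x₁ ^ 3) := by rw [eX, eZ]; field_simp; ring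
    _ = -11 * (V) * Y + 4 * (x * V) + 8 * (x * V) * Y - 25 * (x ^ 2 * V) - 1 * (x ^ 2 * V) * Y +
        24 * (x ^ 3 * V) - 7 * (x ^ 4 * V) := by
      simp only [rx₁, rY₁, rV]
      linear_combination (4 + 3 * Y - x - 7 * x * Y - 7 * x ^ 2) * hc
    _ = _ := by field_simp

theorem rank_piece_five (h : ThetaUnits t₁ t₂ t₃ t₄ t₅ x x₁ Y Y₁ U V) {X Z : ℂ}
    (hX : X = (-t₄) * (-t₂) * t₃ / (t₅ ^ 2 * t₁))
    (hZ : Z = (-t₄) * t₃ ^ 3 / (t₅ ^ 3 * t₁)) :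
    t₅ ^ 3 / (t₁ * (-t₄) ^ 3 * (-t₂) ^ 5 * t₃ ^ 7) * (6 * Z - 11 * X - 13 * X * Z + 12 * X ^ 2 +
        6 * X ^ 2 * Z + 4 * X ^ 3) =
      t₁ ^ 3 / (t₂ ^ 3 * t₃ ^ 2 * t₄ ^ 4 * t₅ ^ 7) * ((11) * Y / x - 5 - 32 * Y + 12 * x +
          15 * Y * x - 19 * x ^ 2 + 6 * x ^ 3) := by
  obtain ⟨h₁, h₂, h₃, h₄, h₅, hx, hx₁, hY, hY₁, hU, hV, rx₁, rY₁, rU, rV, hc⟩ := h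
  have e₀ : t₅ ^ 3 / (t₁ * (-t₄) ^ 3 * (-t₂) ^ 5 * t₃ ^ 7) =
      t₁ ^ 3 / (t₂ ^ 3 * t₃ ^ 2 * t₄ ^ 4 * t₅ ^ 7) * (x₁ ^ 3 * U ^ 2 / Y₁ ^ 2) := by
    rw [hx₁, hY₁, hU]; field_simp
  have eX : X = (Y₁ / U) := by
    rw [hX, hY₁, hU]; field_simp
  have eZ : Z = -(x * Y₁ / (x₁ * U)) := by
    rw [hZ, hx, hx₁, hY₁, hU]; field_simp
  rw [e₀, mul_assoc]
  congr 1
  have hU0 : U ≠ 0 := by rw [hU]; positivity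
  have hY10 : Y₁ ≠ 0 := by rw [hY₁]; positivity
  have hx0 : x ≠ 0 := by rw [hx]; positivity
  have hx10 : x₁ ≠ 0 := by rw [hx₁]; positivity
  refine mul_left_cancel₀ (by positivity : x * Y₁ * U ≠ 0) ?_
  calc
    _ = -6 * (x ^ 2 * x₁ ^ 2 * U ^ 2) - 11 * (x * x₁ ^ 3 * U ^ 2) + 13 * (x ^ 2 * x₁ ^ 2 * Y₁ * U) + 12 * (x * x₁ ^ 3 * Y₁ * U) - 6 * (x ^ 2 * x₁ ^ 2 * Y₁ ^ 2) + 4 * (x * x₁ ^ 3 * Y₁ ^ 2) := by rw [eX, eZ]; field_simp; ring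
    _ = 11 * (Y₁ * U) * Y - 5 * (x * Y₁ * U) - 32 * (x * Y₁ * U) * Y + 12 * (x ^ 2 * Y₁ * U) +
        15 * (x ^ 2 * Y₁ * U) * Y - 19 * (x ^ 3 * Y₁ * U) + 6 * (x ^ 4 * Y₁ * U) := by
      simp only [rx₁, rY₁, rU]
      linear_combination (-11 - 11 * Y + 43 * x + 32 * x * Y - 43 * x ^ 2 - 15 * x ^ 2 * Y +
          17 * x ^ 3) * hc
    _ = _ := by field_simp

end

/-- The finite `q`-Pochhammer symbol `(x; Q)_N`. -/
noncomputable def qPoch (Q x : ℂ) (N : ℕ) : ℂ := ∏ i ∈ Finset.range N, (1 - x * Q ^ i)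

/-- The infinite `q`-Pochhammer symbol `(x; Q)_∞`. -/
noncomputable def qPochInf (Q x : ℂ) : ℂ := ∏' i : ℕ, (1 - x * Q ^ i)

/-- The theta product `(x; Q)_∞ (Q / x; Q)_∞`. -/
noncomputable def thetaProd (Q x : ℂ) : ℂ := qPochInf Q x * qPochInf Q (Q / x)

section qPoch

variable {Q : ℂ}

theorem summable_norm_mul_pow (hQ : ‖Q‖ < 1) (x : ℂ) : Summable fun i : ℕ => ‖-(x * Q ^ i)‖ := by
  simp only [norm_neg, norm_mul, norm_pow]
  exact (summable_geometric_of_lt_one (norm_nonneg _) hQ).mul_left _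

theorem multipliable_one_sub_mul_pow (hQ : ‖Q‖ < 1) (x : ℂ) :
    Multipliable fun i : ℕ => 1 - x * Q ^ i := by
  simpa [sub_eq_add_neg] using multipliable_one_add_of_summable (summable_norm_mul_pow hQ x)

theorem tendsto_qPoch (hQ : ‖Q‖ < 1) (x : ℂ) :
    Tendsto (qPoch Q x) atTop (𝓝 (qPochInf Q x)) :=
  (multipliable_one_sub_mul_pow hQ x).hasProd.tendsto_prod_nat

theorem qPochInf_ne_zero (hQ : ‖Q‖ < 1) {x : ℂ} (hx : ∀ i : ℕ, 1 - x * Q ^ i ≠ 0) :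
    qPochInf Q x ≠ 0 := by
  have := tprod_one_add_ne_zero_of_summable (f := fun i : ℕ => -(x * Q ^ i))
    (fun i => by simpa [sub_eq_add_neg] using hx i) (summable_norm_mul_pow hQ x)
  simpa [qPochInf, sub_eq_add_neg] using this

theorem qPoch_succ' (x : ℂ) (N : ℕ) : qPoch Q x (N + 1) = (1 - x) * qPoch Q (x * Q) N := by
  simp only [qPoch, Finset.prod_range_succ', pow_zero, mul_one]
  rw [mul_comm]
  congr 1
  exact Finset.prod_congr rfl fun i _ => by ring

theorem qPoch_succ (x : ℂ) (N : ℕ) : qPoch Q x (N + 1) = qPoch Q x N * (1 - x * Q ^ N) :=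
  Finset.prod_range_succ _ _

theorem qPochInf_eq (hQ : ‖Q‖ < 1) (x : ℂ) : qPochInf Q x = (1 - x) * qPochInf Q (x * Q) := by
  refine tendsto_nhds_unique ((tendsto_add_atTop_iff_nat 1).2 (tendsto_qPoch hQ x)) ?_
  simp only [qPoch_succ']
  exact (tendsto_qPoch hQ _).const_mul _

theorem exists_bound_qPoch (hQ : ‖Q‖ < 1) (x : ℂ) : ∃ C > 0, ∀ N, ‖qPoch Q x N‖ ≤ C := by
  obtain ⟨C, hC⟩ := (tendsto_qPoch hQ x).norm.bddAbove_range
  exact ⟨max C 1, by positivity, fun N => le_max_of_le_left (hC ⟨N, rfl⟩)⟩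

theorem exists_bound_inv_qPoch (hQ : ‖Q‖ < 1) {x : ℂ} (hx : ∀ i : ℕ, 1 - x * Q ^ i ≠ 0) :
    ∃ C > 0, ∀ N, ‖(qPoch Q x N)⁻¹‖ ≤ C := by
  obtain ⟨C, hC⟩ := ((tendsto_qPoch hQ x).inv₀ (qPochInf_ne_zero hQ hx)).norm.bddAbove_range
  exact ⟨max C 1, by positivity, fun N => le_max_of_le_left (hC ⟨N, rfl⟩)⟩

theorem qPoch_ne_zero {x : ℂ} (hx : ∀ i : ℕ, 1 - x * Q ^ i ≠ 0) (N : ℕ) : qPoch Q x N ≠ 0 :=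
  Finset.prod_ne_zero_iff.2 fun i _ => hx i

end qPoch

/-- The integer `n (n + 1) / 2`. -/
def triInt (n : ℤ) : ℤ := n * (n + 1) / 2

theorem two_mul_triInt (n : ℤ) : 2 * triInt n = n * (n + 1) :=
  Int.mul_ediv_cancel' (Int.even_mul_succ_self n).two_dvd

theorem triInt_succ (n : ℤ) : triInt (n + 1) = triInt n + (n + 1) := by
  have h1 := two_mul_triInt n
  have h2 := two_mul_triInt (n + 1)
  linarith

theorem triInt_neg (n : ℤ) : triInt (-n) = triInt n - n := by
  have h1 := two_mul_triInt n
  have h2 := two_mul_triInt (-n)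
  linarith

/-- Gaussian decay beats geometric growth. -/
theorem summable_zpow_mul_triInt {a Q : ℂ} (ha : a ≠ 0) (hQ0 : Q ≠ 0) (hQ : ‖Q‖ < 1) :
    Summable fun n : ℤ => ‖a ^ n * Q ^ triInt n‖ := by
  have key : ∀ b : ℂ, b ≠ 0 → Summable fun n : ℕ => ‖b ^ (n : ℤ) * Q ^ triInt n‖ := by
    intro b hb
    refine summable_of_ratio_test_tendsto_lt_one (l := 0) one_pos
      (Eventually.of_forall fun n => ?_) ?_
    · exact norm_ne_zero_iff.2 (mul_ne_zero (zpow_ne_zero _ hb) (zpow_ne_zero _ hQ0))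
    · have h : Tendsto (fun n : ℕ => ‖b‖ * ‖Q‖ ^ (n + 1)) atTop (𝓝 0) := by
        simpa using ((tendsto_add_atTop_iff_nat 1).2
          (tendsto_pow_atTop_nhds_zero_of_lt_one (norm_nonneg Q) hQ)).const_mul ‖b‖
      refine h.congr fun n => ?_
      have hne : ‖b ^ (n : ℤ) * Q ^ triInt n‖ ≠ 0 :=
        norm_ne_zero_iff.2 (mul_ne_zero (zpow_ne_zero _ hb) (zpow_ne_zero _ hQ0))
      rw [norm_norm, norm_norm, eq_div_iff hne, ← norm_pow, ← norm_mul, ← norm_mul]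
      congr 1
      push_cast
      rw [triInt_succ, zpow_add₀ hQ0, zpow_add₀ hb, zpow_one, ← zpow_natCast Q]
      push_cast
      ring
  refine Summable.of_nat_of_neg (key a ha) ?_
  refine (key (Q⁻¹ * a⁻¹) (by simp [ha, hQ0])).congr fun n => ?_
  rw [triInt_neg, zpow_sub₀ hQ0, mul_zpow, inv_zpow, inv_zpow, zpow_neg]
  congr 1
  ring

/-- Shifting the argument of a truncated theta product. -/
theorem qPoch_mul_qPoch_shift {Q x : ℂ} (hQ0 : Q ≠ 0) (hx : x ≠ 0) {M N M' N' : ℕ}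
    (h : M + N = M' + N') :
    qPoch Q (x * Q ^ (-((M : ℤ) - M'))) M * qPoch Q (Q / (x * Q ^ (-((M : ℤ) - M')))) N =
      (-x) ^ ((M : ℤ) - M') * Q ^ (-triInt ((M : ℤ) - M')) * (qPoch Q x M' * qPoch Q (Q / x) N') :=
          by
  have step : ∀ (w : ℂ) (A B : ℕ), w ≠ 0 →
      qPoch Q (w / Q) (A + 1) * qPoch Q (Q / (w / Q)) B =
        (-w) * Q⁻¹ * (qPoch Q w A * qPoch Q (Q / w) (B + 1)) := by
    intro w A B hw
    rw [qPoch_succ', qPoch_succ']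
    have e1 : w / Q * Q = w := by field_simp
    have e2 : Q / w * Q = Q / (w / Q) := by field_simp
    rw [e1, e2]
    field_simp
    ring
  have up : ∀ (k A B : ℕ) (w : ℂ), w ≠ 0 →
      qPoch Q (w * Q ^ (-(k : ℤ))) (A + k) * qPoch Q (Q / (w * Q ^ (-(k : ℤ)))) B =
        (-w) ^ (k : ℤ) * Q ^ (-triInt k) * (qPoch Q w A * qPoch Q (Q / w) (B + k)) := by
    intro k
    induction k with
    | zero => intro A B w hw; simp [triInt]
    | succ k ih =>
      intro A B w hw
      have hw' : w * Q ^ (-(k : ℤ)) ≠ 0 := mul_ne_zero hw (zpow_ne_zero _ hQ0)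
      have e : w * Q ^ (-((k + 1 : ℕ) : ℤ)) = w * Q ^ (-(k : ℤ)) / Q := by
        push_cast
        rw [neg_add, zpow_add₀ hQ0, zpow_neg_one]
        ring
      rw [e, ← add_assoc, step _ _ _ hw', ih A (B + 1) w hw]
      push_cast
      rw [triInt_succ, neg_add, neg_add, zpow_add₀ hQ0, zpow_add₀ hQ0, zpow_add₀ (neg_ne_zero.2 hw),
        zpow_neg_one, zpow_one, show B + 1 + k = B + (k + 1) by ring]
      ring
  rcases le_total M' M with hle | hle
  · obtain ⟨k, rfl⟩ := Nat.exists_eq_add_of_le hle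
    obtain rfl : N' = N + k := by omega
    have := up k M' N x hx
    simpa using this
  · obtain ⟨k, rfl⟩ := Nat.exists_eq_add_of_le hle
    obtain rfl : N = N' + k := by omega
    have hx' : x * Q ^ (k : ℤ) ≠ 0 := mul_ne_zero hx (zpow_ne_zero _ hQ0)
    have h1 := up k M N' (x * Q ^ (k : ℤ)) hx'
    have e : x * Q ^ (k : ℤ) * Q ^ (-(k : ℤ)) = x := by
      rw [mul_assoc, ← zpow_add₀ hQ0]; simp
    rw [e] at h1
    have e2 : -((M : ℤ) - (M + k : ℕ)) = k := by push_cast; ring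
    have e3 : ((M : ℤ) - (M + k : ℕ)) = -k := by push_cast; ring
    rw [e2, e3, h1, triInt_neg]
    have e4 : (-(x * Q ^ (k : ℤ))) ^ (k : ℤ) = (-x) ^ (k : ℤ) * Q ^ ((k : ℤ) * k) := by
      rw [neg_mul_eq_neg_mul, mul_zpow, zpow_mul]
    have e5 : ((k : ℤ) * k) = 2 * triInt k - k := by rw [two_mul_triInt]; ring
    rw [e4, e5, zpow_neg, zpow_neg, zpow_neg, zpow_sub₀ hQ0, zpow_sub₀ hQ0, two_mul, zpow_add₀ hQ0]
    have h3 : Q ^ triInt k ≠ 0 := zpow_ne_zero _ hQ0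
    have h4 : Q ^ (k : ℤ) ≠ 0 := zpow_ne_zero _ hQ0
    have h5 : (-x) ^ (k : ℤ) ≠ 0 := zpow_ne_zero _ (neg_ne_zero.2 hx)
    field_simp

/-- Partial fractions in the form of Lagrange interpolation at nonzero nodes. -/
theorem eval_eq_sum_prod_one_sub_div {α : Type*} [DecidableEq α] (s : Finset α) (v : α → ℂ)
    (hv : Set.InjOn v s) (hv0 : ∀ i ∈ s, v i ≠ 0) (p : Polynomial ℂ) (hp : p.degree < s.card)
    (z : ℂ) :
    p.eval z = ∑ i ∈ s, p.eval (v i) * ∏ j ∈ s.erase i, (1 - z / v j) / (1 - v i / v j) := by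
  conv_lhs => rw [Lagrange.eq_interpolate hv hp]
  simp only [Lagrange.interpolate_apply, Polynomial.eval_finsetSum, Polynomial.eval_mul,
    Polynomial.eval_C]
  refine Finset.sum_congr rfl fun i hi => ?_
  congr 1
  simp only [Lagrange.basis, Polynomial.eval_prod, Lagrange.basisDivisor, Polynomial.eval_mul,
    Polynomial.eval_C, Polynomial.eval_sub, Polynomial.eval_X]
  refine Finset.prod_congr rfl fun j hj => ?_
  have hj' := Finset.mem_erase.1 hj
  have h0 := hv0 j hj'.2
  have h1 : v i - v j ≠ 0 := sub_ne_zero.2 fun h => hj'.1 (hv hi hj'.2 h).symm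
  have h2 : 1 - v i / v j ≠ 0 := by
    rw [one_sub_div h0]; exact div_ne_zero (by rw [← neg_sub]; exact neg_ne_zero.2 h1) h0
  have h3 : v j - v i ≠ 0 := by rw [← neg_sub]; exact neg_ne_zero.2 h1
  rw [one_sub_div h0, one_sub_div h0]
  field_simp
  ring

/-- The product `∏ (1 - x Q ^ n)` over `-N ≤ n < N`. -/
theorem qPoch_symm {Q x : ℂ} (hQ0 : Q ≠ 0) (hx : x ≠ 0) {N m n : ℕ} (h : m + n = 2 * N) :
    qPoch Q (x * Q ^ (-(m : ℤ))) (2 * N) =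
      (-x) ^ m * Q ^ (-triInt m) * (qPoch Q x n * qPoch Q (Q / x) m) := by
  have := qPoch_mul_qPoch_shift (M := 2 * N) (N := 0) (M' := n) (N' := m) hQ0 hx (by omega)
  have e : ((2 * N : ℕ) : ℤ) - n = m := by omega
  rw [e] at this
  simpa [qPoch] using this

theorem prod_erase_one_sub {Q : ℂ} (hQ0 : Q ≠ 0) {M m : ℕ} (hm : m < M) :
    ∏ j ∈ (Finset.range M).erase m, (1 - Q ^ (-(m : ℤ)) * Q ^ j) =
      (-1) ^ m * Q ^ (-triInt m) * (qPoch Q Q m * qPoch Q Q (M - 1 - m)) := by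
  have h1 : (Finset.range M).erase m =
      (Finset.range m).disjUnion ((Finset.range (M - 1 - m)).map (addLeftEmbedding (m + 1)))
        (by
          rw [Finset.disjoint_left]
          intro a ha hb
          simp only [Finset.mem_map, Finset.mem_range, addLeftEmbedding_apply] at ha hb
          omega) := by
    ext a
    simp only [Finset.mem_erase, Finset.mem_range, Finset.mem_disjUnion, Finset.mem_map,
      addLeftEmbedding_apply]
    constructor
    · rintro ⟨h1, h2⟩
      rcases lt_or_gt_of_ne h1 with h | h
      · exact Or.inl h
      · exact Or.inr ⟨a - (m + 1), by omega, by omega⟩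
    · rintro (h | ⟨b, hb, rfl⟩) <;> omega
  rw [h1, Finset.prod_disjUnion, Finset.prod_map]
  have h2 : ∏ x ∈ Finset.range (M - 1 - m),
      (1 - Q ^ (-(m : ℤ)) * Q ^ (addLeftEmbedding (m + 1)) x) = qPoch Q Q (M - 1 - m) := by
    refine Finset.prod_congr rfl fun j _ => ?_
    rw [addLeftEmbedding_apply, pow_add, pow_succ, zpow_neg, zpow_natCast]
    have := pow_ne_zero m hQ0
    field_simp
  have h3 : ∏ j ∈ Finset.range m, (1 - Q ^ (-(m : ℤ)) * Q ^ j) =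
      (-1) ^ m * Q ^ (-triInt m) * qPoch Q Q m := by
    clear h1 h2 hm
    induction m with
    | zero => simp [qPoch, triInt]
    | succ m ih =>
      rw [Finset.prod_range_succ', qPoch_succ]
      have e : ∏ k ∈ Finset.range m, (1 - Q ^ (-((m + 1 : ℕ) : ℤ)) * Q ^ (k + 1)) =
          ∏ k ∈ Finset.range m, (1 - Q ^ (-(m : ℤ)) * Q ^ k) := by
        refine Finset.prod_congr rfl fun k _ => ?_
        rw [pow_succ, zpow_neg, zpow_neg, zpow_natCast, zpow_natCast, pow_succ]
        have := pow_ne_zero m hQ0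
        field_simp
      rw [e, ih]
      have e2 : Q ^ (-((m : ℤ) + 1)) = (Q ^ m * Q)⁻¹ := by
        rw [zpow_neg, zpow_add₀ hQ0, zpow_natCast, zpow_one]
      push_cast
      rw [triInt_succ, neg_add (triInt _), zpow_add₀ hQ0, e2, pow_zero, pow_succ]
      have := pow_ne_zero m hQ0
      field_simp
      ring
  rw [h2, h3, mul_assoc]

theorem triInt_add (m n : ℤ) : triInt (m + n) = triInt m + triInt n + m * n := by
  have h1 := two_mul_triInt m
  have h2 := two_mul_triInt n
  have h3 := two_mul_triInt (m + n)
  linarith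

section PartialFractions

variable {ι κ : Type*} [Fintype ι] [DecidableEq ι] [Fintype κ]

/-- Truncated theta product with `n` factors in `x` and `m` factors in `Q / x`. -/
noncomputable def thetaTrunc (Q x : ℂ) (m n : ℕ) : ℂ := qPoch Q x n * qPoch Q (Q / x) m

theorem prod_qPoch_symm {Q : ℂ} (hQ0 : Q ≠ 0) {α : Type*} (s : Finset α) (b : α → ℂ) (x : ℂ)
    (hx : x ≠ 0) (hb : ∀ k, b k ≠ 0) {N m n : ℕ} (h : m + n = 2 * N) :
    ∏ k ∈ s, qPoch Q (x / b k * Q ^ (-(m : ℤ))) (2 * N) =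
      ((-x) ^ s.card / ∏ k ∈ s, b k) ^ m * (Q ^ (-triInt m)) ^ s.card *
        ∏ k ∈ s, thetaTrunc Q (x / b k) m n := by
  rw [Finset.prod_congr rfl fun k _ => qPoch_symm hQ0 (div_ne_zero hx (hb k)) h]
  simp only [thetaTrunc, Finset.prod_mul_distrib, Finset.prod_const, Finset.prod_pow, ← neg_div,
    Finset.prod_div_distrib]

theorem prod_thetaTrunc_div_eq {Q : ℂ} (hQ0 : Q ≠ 0) (ζ : ι → ℂ) (a : κ → ℂ) (e : ℕ)
    (he : 1 ≤ e) (hcard : Fintype.card ι = Fintype.card κ + e) (hζ : ∀ i, ζ i ≠ 0)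
    (ha : ∀ k, a k ≠ 0) (hQ1 : ∀ n : ℤ, n ≠ 0 → Q ^ n ≠ 1)
    (hζζ : ∀ i k, i ≠ k → ∀ n : ℤ, ζ i / ζ k * Q ^ n ≠ 1) {z : ℂ} (hz0 : z ≠ 0)
    (hz : ∀ i (n : ℤ), 1 - z / ζ i * Q ^ n ≠ 0) (N : ℕ) (hN : 1 ≤ N) :
    (∏ k, thetaTrunc Q (z / a k) N N) / ∏ i, thetaTrunc Q (z / ζ i) N N =
      ∑ i, ∑ m ∈ Finset.range (2 * N),
        ((-1) ^ e * ((∏ i, ζ i) / ∏ k, a k) / ζ i ^ e) ^ ((m : ℤ) - N) *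
          (Q ^ triInt ((m : ℤ) - N)) ^ e *
        ((∏ k, thetaTrunc Q (ζ i / a k) m (2 * N - m)) /
          ((∏ k ∈ Finset.univ.erase i, thetaTrunc Q (ζ i / ζ k) m (2 * N - m)) *
            (qPoch Q Q m * qPoch Q Q (2 * N - 1 - m)))) / (1 - z / ζ i * Q ^ ((m : ℤ) - N)) := by
  classical
  set v : ι × ℕ → ℂ := fun j => ζ j.1 * Q ^ ((N : ℤ) - j.2) with hvdef
  set s : Finset (ι × ℕ) := Finset.univ ×ˢ Finset.range (2 * N) with hs
  have hv0 : ∀ j, v j ≠ 0 := fun j => mul_ne_zero (hζ _) (zpow_ne_zero _ hQ0)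
  have hvinj : Set.InjOn v s := by
    rintro ⟨i, m⟩ - ⟨k, n⟩ - h
    simp only [hvdef] at h
    have h' : ζ i / ζ k * Q ^ ((n : ℤ) - m) = 1 := by
      have e1 : (n : ℤ) - m = (N - m) - (N - n) := by ring
      rw [e1, zpow_sub₀ hQ0, div_mul_div_comm, h, div_self]
      exact mul_ne_zero (hζ _) (zpow_ne_zero _ hQ0)
    by_cases hik : i = k
    · subst hik
      rw [div_self (hζ _), one_mul] at h'
      by_cases hmn : (n : ℤ) - m = 0
      · have : m = n := by omega
        rw [this]
      · exact absurd h' (hQ1 _ hmn)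
    · exact absurd h' (hζζ i k hik _)
  set p : Polynomial ℂ := Polynomial.X ^ (e * N) * ∏ k, ∏ m ∈ Finset.range (2 * N),
    (1 - Polynomial.C ((a k)⁻¹ * Q ^ (-(N : ℤ)) * Q ^ m) * Polynomial.X) with hp
  have hpeval : ∀ w, p.eval w =
      w ^ (e * N) * ∏ k, qPoch Q (w / a k * Q ^ (-(N : ℤ))) (2 * N) := by
    intro w
    simp only [hp, qPoch, Polynomial.eval_mul, Polynomial.eval_pow, Polynomial.eval_X,
      Polynomial.eval_prod, Polynomial.eval_sub, Polynomial.eval_one, Polynomial.eval_C]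
    congr 1
    refine Finset.prod_congr rfl fun k _ => Finset.prod_congr rfl fun m _ => ?_
    ring
  have hpdeg : p.degree < s.card := by
    have h1 : p.natDegree ≤ e * N + ∑ k : κ, ∑ m ∈ Finset.range (2 * N), 1 := by
      refine Polynomial.natDegree_mul_le.trans (add_le_add (Polynomial.natDegree_X_pow_le _) ?_)
      refine (Polynomial.natDegree_prod_le _ _).trans (Finset.sum_le_sum fun k _ => ?_)
      refine (Polynomial.natDegree_prod_le _ _).trans (Finset.sum_le_sum fun m _ => ?_)
      refine (Polynomial.natDegree_sub_le _ _).trans ?_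
      exact max_le (by rw [Polynomial.natDegree_one]; exact zero_le_one)
        ((Polynomial.natDegree_C_mul_le _ _).trans Polynomial.natDegree_X_le)
    refine Polynomial.degree_le_natDegree.trans_lt ?_
    have h2 : s.card = (Fintype.card κ + e) * (2 * N) := by
      simp [hs, Finset.card_product, hcard]
    have h3 : p.natDegree < s.card := by
      simp only [Finset.sum_const, Finset.card_range, smul_eq_mul, Finset.card_univ, mul_one] at h1
      rw [h2]
      have : 0 < e * N := Nat.mul_pos he hN
      nlinarith
    exact_mod_cast h3
  have key := eval_eq_sum_prod_one_sub_div s v hvinj (fun j _ => hv0 j) p hpdeg z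
  have hfac : ∀ (w : ℂ) (j : ι × ℕ), w / v j = w / ζ j.1 * Q ^ (-(N : ℤ)) * Q ^ j.2 := by
    intro w j
    simp only [hvdef]
    rw [zpow_sub₀ hQ0, zpow_neg, zpow_natCast, zpow_natCast]
    have := pow_ne_zero N hQ0
    have := pow_ne_zero j.2 hQ0
    have := hζ j.1
    field_simp
  have hfac' : ∀ (w : ℂ) (j : ι × ℕ), w / v j = w / ζ j.1 * Q ^ ((j.2 : ℤ) - N) := by
    intro w j
    rw [hfac, zpow_sub₀ hQ0, zpow_neg, zpow_natCast, zpow_natCast]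
    ring
  have hzv : ∀ j, 1 - z / v j ≠ 0 := fun j => by rw [hfac']; exact hz _ _
  have hall : ∏ j ∈ s, (1 - z / v j) = ∏ i, qPoch Q (z / ζ i * Q ^ (-(N : ℤ))) (2 * N) := by
    rw [hs, Finset.prod_product]
    refine Finset.prod_congr rfl fun i _ => Finset.prod_congr rfl fun m _ => ?_
    rw [hfac]
  have hall0 : ∏ j ∈ s, (1 - z / v j) ≠ 0 := Finset.prod_ne_zero_iff.2 fun j _ => hzv j
  have herase : ∀ i, ∀ m ∈ Finset.range (2 * N), ∏ j ∈ s.erase (i, m), (1 - v (i, m) / v j) =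
      (∏ k ∈ Finset.univ.erase i, qPoch Q (ζ i / ζ k * Q ^ (-(m : ℤ))) (2 * N)) *
        ((-1) ^ m * Q ^ (-triInt m) * (qPoch Q Q m * qPoch Q Q (2 * N - 1 - m))) := by
    intro i m hm
    have h1 : s.erase (i, m) = ((Finset.univ.erase i) ×ˢ Finset.range (2 * N)).disjUnion
        (({i} : Finset ι) ×ˢ (Finset.range (2 * N)).erase m) (by
          rw [Finset.disjoint_left]
          rintro ⟨k, n⟩ h1 h2
          simp only [Finset.mem_product, Finset.mem_erase, Finset.mem_singleton] at h1 h2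
          exact h1.1.1 h2.1) := by
      ext ⟨k, n⟩
      simp only [hs, Finset.mem_erase, Finset.mem_product, Finset.mem_univ, true_and,
        Finset.mem_disjUnion, Finset.mem_singleton, ne_eq, Prod.mk.injEq, and_true]
      tauto
    have hvv : ∀ k (n : ℕ), v (i, m) / v (k, n) = ζ i / ζ k * Q ^ (-(m : ℤ)) * Q ^ n := by
      intro k n
      rw [hfac]
      simp only [hvdef]
      rw [zpow_sub₀ hQ0, zpow_neg, zpow_natCast, zpow_natCast, zpow_neg, zpow_natCast]
      have := pow_ne_zero N hQ0
      have := pow_ne_zero m hQ0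
      have := hζ k
      field_simp
    rw [h1, Finset.prod_disjUnion, Finset.prod_product, Finset.prod_product, Finset.prod_singleton,
      ← prod_erase_one_sub hQ0 (Finset.mem_range.1 hm)]
    congr 1
    · exact Finset.prod_congr rfl fun k _ => Finset.prod_congr rfl fun n _ => by rw [hvv]
    · exact Finset.prod_congr rfl fun n _ => by rw [hvv, div_self (hζ i), one_mul]
  have hprod : ∏ i, ζ i ≠ 0 := Finset.prod_ne_zero_iff.2 fun i _ => hζ i
  have hproda : ∏ k, a k ≠ 0 := Finset.prod_ne_zero_iff.2 fun i _ => ha i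
  have hsq : ∀ j : ℕ, ((-1 : ℂ) ^ j) * (-1) ^ j = 1 := fun j => by
    rw [← mul_pow]; simp
  set C : ℂ := ((∏ i, ζ i) / ∏ k, a k) ^ N * (-1) ^ (e * N) / (Q ^ (-triInt N)) ^ e with hC
  have hq : ∀ j : ℤ, Q ^ j ≠ 0 := fun j => zpow_ne_zero _ hQ0
  have hC0 : C ≠ 0 := div_ne_zero (mul_ne_zero (pow_ne_zero _ (div_ne_zero hprod hproda))
    (pow_ne_zero _ (by norm_num))) (pow_ne_zero _ (hq _))
  have hL : p.eval z / ∏ j ∈ s, (1 - z / v j) =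
      C * ((∏ k, thetaTrunc Q (z / a k) N N) / ∏ i, thetaTrunc Q (z / ζ i) N N) := by
    have h2 : (∏ i, thetaTrunc Q (z / ζ i) N N) ≠ 0 := by
      have h3 := hall0
      rw [hall, prod_qPoch_symm hQ0 _ ζ z hz0 hζ (two_mul N).symm] at h3
      exact right_ne_zero_of_mul h3
    rw [hall, hpeval, prod_qPoch_symm hQ0 _ ζ z hz0 hζ (two_mul N).symm,
      prod_qPoch_symm hQ0 _ a z hz0 ha (two_mul N).symm, Finset.card_univ, Finset.card_univ,
      hcard, hC]
    have h4 := hq (-triInt N)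
    generalize Q ^ (-triInt (N : ℤ)) = q at *
    have h5 : (-z) ^ (Fintype.card κ + e) = (-z) ^ Fintype.card κ * ((-1) ^ e * z ^ e) := by
      rw [pow_add, neg_pow z e]
    have h6 : (-z) ^ Fintype.card κ ≠ 0 := pow_ne_zero _ (neg_ne_zero.2 hz0)
    rw [h5]
    generalize (-z) ^ Fintype.card κ = zk at *
    have h7 : z ^ e ≠ 0 := pow_ne_zero _ hz0
    rw [pow_mul, pow_mul]
    have h8 : ((-1 : ℂ)) ^ e ≠ 0 := pow_ne_zero _ (by norm_num)
    have h9 := hsq e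
    generalize z ^ e = ze at *
    generalize (-1 : ℂ) ^ e = se at *
    have h10 : (se ^ N) ^ 2 = 1 := by rw [← pow_mul, mul_comm N 2, pow_mul, pow_two, h9, one_pow]
    have h11 : se ^ N ≠ 0 := pow_ne_zero _ h8
    rw [pow_add]
    simp only [div_pow, mul_pow]
    generalize se ^ N = sN at *
    field_simp
    rw [h10]
    ring
  have hprodi : ∀ i, ∏ k ∈ Finset.univ.erase i, ζ k = (∏ k, ζ k) / ζ i := fun i => by
    rw [← Finset.mul_prod_erase Finset.univ ζ (Finset.mem_univ i), mul_div_cancel_left₀ _ (hζ i)]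
  have hR : ∀ i, ∀ m ∈ Finset.range (2 * N),
      p.eval (v (i, m)) / ∏ j ∈ s.erase (i, m), (1 - v (i, m) / v j) =
      C * (((-1) ^ e * ((∏ i, ζ i) / ∏ k, a k) / ζ i ^ e) ^ ((m : ℤ) - N) *
          (Q ^ triInt ((m : ℤ) - N)) ^ e *
        ((∏ k, thetaTrunc Q (ζ i / a k) m (2 * N - m)) /
          ((∏ k ∈ Finset.univ.erase i, thetaTrunc Q (ζ i / ζ k) m (2 * N - m)) *
            (qPoch Q Q m * qPoch Q Q (2 * N - 1 - m))))) := by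
    intro i m hm
    have hmN : m + (2 * N - m) = 2 * N := by have := Finset.mem_range.1 hm; omega
    have h1 : ∀ k, v (i, m) / a k * Q ^ (-(N : ℤ)) = ζ i / a k * Q ^ (-(m : ℤ)) := by
      intro k
      simp only [hvdef]
      rw [zpow_sub₀ hQ0, zpow_neg, zpow_natCast, zpow_natCast, zpow_neg, zpow_natCast]
      have := pow_ne_zero N hQ0
      have := ha k
      field_simp
    have hcard' : (Finset.univ.erase i).card + 1 = Fintype.card κ + e := by
      rw [Finset.card_erase_add_one (Finset.mem_univ i), Finset.card_univ, hcard]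
    rw [herase i m hm, hpeval]
    simp only [h1]
    rw [prod_qPoch_symm hQ0 _ ζ (ζ i) (hζ i) hζ hmN, prod_qPoch_symm hQ0 _ a (ζ i) (hζ i) ha hmN,
      hprodi, Finset.card_univ]
    generalize ∏ k ∈ Finset.univ.erase i, thetaTrunc Q (ζ i / ζ k) m (2 * N - m) = T1
    generalize ∏ k, thetaTrunc Q (ζ i / a k) m (2 * N - m) = T2
    generalize qPoch Q Q m * qPoch Q Q (2 * N - 1 - m) = T3
    generalize hc : (Finset.univ.erase i).card = c at hcard'
    have e1 : triInt (m : ℤ) = triInt N + triInt ((m : ℤ) - N) + N * ((m : ℤ) - N) := by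
      rw [← triInt_add]; congr 1; ring
    have e2 : v (i, m) ^ (e * N) = ((ζ i) ^ e) ^ N * (Q ^ (-((N : ℤ) * ((m : ℤ) - N)))) ^ e := by
      simp only [hvdef]
      rw [mul_pow, pow_mul, pow_mul', ← zpow_natCast (Q ^ ((N : ℤ) - m)) N, ← zpow_mul]
      congr 3
      ring
    have e3 : (Q ^ (-((N : ℤ) * ((m : ℤ) - N)))) ^ e =
        (Q ^ (-triInt (m : ℤ))) ^ e * (Q ^ triInt ((m : ℤ) - N)) ^ e / (Q ^ (-triInt N)) ^ e := by
      rw [← mul_pow, ← div_pow, ← zpow_add₀ hQ0, ← zpow_sub₀ hQ0, e1]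
      congr 2
      ring
    rw [e2, e3, hC]
    have hqm := hq (-triInt m)
    have hqN := hq (-triInt N)
    generalize Q ^ (-triInt (m : ℤ)) = qm at *
    generalize Q ^ (-triInt (N : ℤ)) = qN at *
    generalize Q ^ (triInt ((m : ℤ) - N)) = qmN at *
    have hzi := hζ i
    have h5 : (-ζ i) ^ c * (-ζ i) = (-ζ i) ^ Fintype.card κ * ((-1) ^ e * ζ i ^ e) := by
      rw [← pow_succ, hcard', pow_add, neg_pow (ζ i) e]
    have h5' : (-ζ i) ^ c = - (-ζ i) ^ Fintype.card κ * ((-1) ^ e * ζ i ^ e) / ζ i := by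
      field_simp
      linear_combination -h5
    have h6 : (-ζ i) ^ Fintype.card κ ≠ 0 := pow_ne_zero _ (neg_ne_zero.2 hzi)
    have h7 : qm ^ c = qm ^ Fintype.card κ * qm ^ e / qm := by
      rw [← pow_add, ← hcard', pow_succ, mul_div_cancel_right₀ _ hqm]
    have h8 : ((-1 : ℂ)) ^ e ≠ 0 := pow_ne_zero _ (by norm_num)
    have h9 := hsq e
    have h10 := pow_ne_zero e hzi
    rw [h5', h7, zpow_sub₀ (by positivity), zpow_natCast, zpow_natCast, pow_mul]
    generalize (-ζ i) ^ Fintype.card κ = zk at *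
    generalize ζ i ^ e = ze at *
    generalize (-1 : ℂ) ^ e = se at *
    have h11 : se ^ m * se ^ m = 1 := by rw [← mul_pow, h9, one_pow]
    have h12 : se ^ m ≠ 0 := pow_ne_zero _ h8
    have h13 : se ^ N ≠ 0 := pow_ne_zero _ h8
    have h14 : (-1 : ℂ) ^ m * (-1) ^ m = 1 := hsq m
    have h15 : (-1 : ℂ) ^ m ≠ 0 := pow_ne_zero _ (by norm_num)
    have h16 : (-zk * (se * ze) / ζ i / ((∏ k, ζ k) / ζ i)) ^ m =
        (-1) ^ m * (zk ^ m * (se ^ m * ze ^ m) / (∏ k, ζ k) ^ m) := by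
      rw [div_div_div_cancel_right₀ hzi, neg_mul, neg_div, neg_pow, div_pow, mul_pow, mul_pow]
    rw [h16]
    simp only [div_pow, mul_pow]
    generalize se ^ m = sm at *
    generalize se ^ N = sN at *
    generalize (-1 : ℂ) ^ m = tm at *
    have h17 := pow_ne_zero m h6
    field_simp
    rw [show tm ^ 2 = 1 by rw [pow_two, h14], show sm ^ 2 = 1 by rw [pow_two, h11]]
    ring
  calc _ = C⁻¹ * (p.eval z / ∏ j ∈ s, (1 - z / v j)) := by rw [hL]; field_simp
    _ = _ := by
      rw [key, Finset.sum_div, Finset.mul_sum, hs, Finset.sum_product]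
      refine Finset.sum_congr rfl fun i _ => Finset.sum_congr rfl fun m hm => ?_
      have h1 := hR i m hm
      have hmem : (i, m) ∈ s := by rw [hs]; exact Finset.mem_product.2 ⟨Finset.mem_univ _, hm⟩
      rw [← hs, Finset.prod_div_distrib, ← Finset.mul_prod_erase s _ hmem]
      have h2 : ∏ j ∈ s.erase (i, m), (1 - z / v j) ≠ 0 :=
        Finset.prod_ne_zero_iff.2 fun j _ => hzv j
      have h3 := hzv (i, m)
      rw [hfac'] at h3 ⊢
      simp only at h3 ⊢
      rw [← mul_right_inj' hC0, ← mul_div_assoc C, ← h1]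
      field_simp

theorem tendsto_sum_range_int {g : ℤ → ℂ} {r : ℕ → ℕ → ℂ} {C : ℝ} {R : ℂ}
    (hg : Summable fun n => ‖g n‖) (hr : ∀ m k, ‖r m k‖ ≤ C)
    (hR : Tendsto (fun p : ℕ × ℕ => r p.1 p.2) (atTop ×ˢ atTop) (𝓝 R)) :
    Tendsto (fun N : ℕ => ∑ m ∈ Finset.range (2 * N), g ((m : ℤ) - N) * r m (2 * N - m)) atTop
      (𝓝 ((∑' n, g n) * R)) := by
  set f : ℕ → ℤ → ℂ := fun N n =>
    if -(N : ℤ) ≤ n ∧ n < N then g n * r (n + N).toNat (N - n).toNat else 0 with hf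
  have h1 : ∀ N : ℕ, ∑' n, f N n = ∑ m ∈ Finset.range (2 * N), g ((m : ℤ) - N) * r m (2 * N -
      m) := by
    intro N
    rw [tsum_eq_sum (s := (Finset.range (2 * N)).image fun m : ℕ => (m : ℤ) - N)]
    · rw [Finset.sum_image (fun a _ b _ h => by simpa using h)]
      refine Finset.sum_congr rfl fun m hm => ?_
      have hm' := Finset.mem_range.1 hm
      simp only [hf]
      rw [if_pos (by omega)]
      congr 2 <;> omega
    · intro n hn
      simp only [hf]
      rw [if_neg]
      rintro ⟨h2, h3⟩
      exact hn (Finset.mem_image.2 ⟨(n + N).toNat, Finset.mem_range.2 (by omega), by omega⟩)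
  simp only [← h1, ← tsum_mul_right]
  refine tendsto_tsum_of_dominated_convergence (bound := fun n => ‖g n‖ * C) (hg.mul_right C) ?_ ?_
  · intro n
    have h2 : Tendsto (fun N : ℕ => ((n + N).toNat, ((N : ℤ) -
        n).toNat)) atTop (atTop ×ˢ atTop) := by
      refine Tendsto.prodMk ?_ ?_
      · refine tendsto_atTop.2 fun b => eventually_atTop.2 ⟨b + n.natAbs, fun N hN => ?_⟩
        show b ≤ (n + (N : ℤ)).toNat
        omega
      · refine tendsto_atTop.2 fun b => eventually_atTop.2 ⟨b + n.natAbs, fun N hN => ?_⟩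
        show b ≤ ((N : ℤ) - n).toNat
        omega
    refine ((hR.comp h2).const_mul (g n)).congr' ?_
    refine eventually_atTop.2 ⟨n.natAbs + 1, fun N hN => ?_⟩
    simp only [hf, Function.comp]
    rw [if_pos (by omega)]
  · refine Eventually.of_forall fun N n => ?_
    simp only [hf]
    split_ifs with h
    · rw [norm_mul]
      gcongr
      exact hr _ _
    · rw [norm_zero]
      exact mul_nonneg (norm_nonneg _) ((norm_nonneg _).trans (hr 0 0))

theorem exists_bound_inv_one_sub_mul_zpow {Q c : ℂ} (hQ0 : Q ≠ 0) (hQ : ‖Q‖ < 1) (hc0 : c ≠ 0) :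
    ∃ C > 0, ∀ n : ℤ, ‖(1 - c * Q ^ n)⁻¹‖ ≤ C := by
  have hQt : Tendsto (fun n : ℕ => Q ^ n) atTop (𝓝 0) :=
    tendsto_pow_atTop_nhds_zero_of_norm_lt_one hQ
  have h1 : Tendsto (fun n : ℕ => (1 - c * Q ^ n)⁻¹) atTop (𝓝 (1 - c * 0)⁻¹) :=
    ((hQt.const_mul c).const_sub 1).inv₀ (by simp)
  have h2 : Tendsto (fun n : ℕ => Q ^ n * (Q ^ n - c)⁻¹) atTop (𝓝 (0 * (0 - c)⁻¹)) :=
    hQt.mul ((hQt.sub_const c).inv₀ (by simpa using hc0))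
  obtain ⟨C₁, hC₁⟩ := h1.norm.bddAbove_range
  obtain ⟨C₂, hC₂⟩ := h2.norm.bddAbove_range
  refine ⟨max (max C₁ C₂) 1, by positivity, fun n => le_max_of_le_left ?_⟩
  obtain ⟨k, rfl | rfl⟩ := n.eq_nat_or_neg
  · exact le_max_of_le_left (by simpa using hC₁ ⟨k, rfl⟩)
  · refine le_max_of_le_right ?_
    have h3 : (1 - c * Q ^ (-(k : ℤ)))⁻¹ = Q ^ k * (Q ^ k - c)⁻¹ := by
      have hk := pow_ne_zero k hQ0
      rw [zpow_neg, zpow_natCast, ← inv_inj, inv_inv, mul_inv, inv_inv]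
      field_simp
    rw [h3]
    exact hC₂ ⟨k, rfl⟩

theorem one_sub_mul_pow_ne_zero {Q : ℂ} (hQ : ‖Q‖ < 1) (i : ℕ) : 1 - Q * Q ^ i ≠ 0 := by
  intro h
  have h1 : Q ^ (i + 1) = 1 := by rw [pow_succ']; linear_combination -h
  have h2 : ‖Q‖ ^ (i + 1) = 1 := by rw [← norm_pow, h1, norm_one]
  have h3 := pow_lt_one₀ (norm_nonneg Q) hQ (Nat.succ_ne_zero i)
  rw [Nat.succ_eq_add_one] at h3
  linarith

theorem zpow_ne_one_of_norm_lt_one {Q : ℂ} (hQ : ‖Q‖ < 1) (n : ℤ) (hn : n ≠ 0) :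
    Q ^ n ≠ 1 := by
  have key : ∀ k : ℕ, k ≠ 0 → Q ^ k ≠ 1 := by
    intro k hk h
    have h2 : ‖Q‖ ^ k = 1 := by rw [← norm_pow, h, norm_one]
    have h3 := pow_lt_one₀ (norm_nonneg Q) hQ hk
    linarith
  intro h
  obtain ⟨k, rfl | rfl⟩ := n.eq_nat_or_neg
  · exact key k (by omega) (by simpa using h)
  · exact key k (by omega) (by simpa using h)

theorem tendsto_thetaTrunc {Q : ℂ} (hQ : ‖Q‖ < 1) (x : ℂ) :
    Tendsto (fun p : ℕ × ℕ => thetaTrunc Q x p.1 p.2) (atTop ×ˢ atTop) (𝓝 (thetaProd Q x)) :=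
  ((tendsto_qPoch hQ x).comp tendsto_snd).mul ((tendsto_qPoch hQ (Q / x)).comp tendsto_fst)

theorem tendsto_thetaTrunc_self {Q : ℂ} (hQ : ‖Q‖ < 1) (x : ℂ) :
    Tendsto (fun N : ℕ => thetaTrunc Q x N N) atTop (𝓝 (thetaProd Q x)) :=
  (tendsto_qPoch hQ x).mul (tendsto_qPoch hQ (Q / x))

theorem exists_bound_thetaTrunc {Q : ℂ} (hQ : ‖Q‖ < 1) (x : ℂ) :
    ∃ C > 0, ∀ m n, ‖thetaTrunc Q x m n‖ ≤ C := by
  obtain ⟨C, hC0, hC⟩ := exists_bound_qPoch hQ x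
  obtain ⟨D, hD0, hD⟩ := exists_bound_qPoch hQ (Q / x)
  refine ⟨C * D, by positivity, fun m n => ?_⟩
  rw [thetaTrunc, norm_mul]
  exact mul_le_mul (hC n) (hD m) (norm_nonneg _) hC0.le

theorem one_sub_ne_zero_of_zpow {Q x : ℂ} (hQ0 : Q ≠ 0) (hx : ∀ n : ℤ, x * Q ^ n ≠ 1) :
    (∀ i : ℕ, 1 - x * Q ^ i ≠ 0) ∧ ∀ i : ℕ, 1 - Q / x * Q ^ i ≠ 0 := by
  refine ⟨fun i h => hx i ?_, fun i h => hx (-(i + 1 : ℤ)) ?_⟩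
  · rw [zpow_natCast]
    linear_combination -h
  · have hx0 : x ≠ 0 := by
      rintro rfl
      simp at h
    rw [zpow_neg, zpow_add₀ hQ0, zpow_natCast, zpow_one]
    have := pow_ne_zero i hQ0
    field_simp at h ⊢
    linear_combination h

theorem thetaProd_ne_zero {Q x : ℂ} (hQ0 : Q ≠ 0) (hQ : ‖Q‖ < 1) (hx : ∀ n : ℤ, x * Q ^ n ≠ 1) :
    thetaProd Q x ≠ 0 :=
  mul_ne_zero (qPochInf_ne_zero hQ (one_sub_ne_zero_of_zpow hQ0 hx).1)
    (qPochInf_ne_zero hQ (one_sub_ne_zero_of_zpow hQ0 hx).2)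

theorem exists_bound_inv_thetaTrunc {Q x : ℂ} (hQ0 : Q ≠ 0) (hQ : ‖Q‖ < 1)
    (hx : ∀ n : ℤ, x * Q ^ n ≠ 1) : ∃ C > 0, ∀ m n, ‖(thetaTrunc Q x m n)⁻¹‖ ≤ C := by
  obtain ⟨C, hC0, hC⟩ := exists_bound_inv_qPoch hQ (one_sub_ne_zero_of_zpow hQ0 hx).1
  obtain ⟨D, hD0, hD⟩ := exists_bound_inv_qPoch hQ (one_sub_ne_zero_of_zpow hQ0 hx).2
  refine ⟨C * D, by positivity, fun m n => ?_⟩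
  rw [thetaTrunc, mul_inv, norm_mul]
  exact mul_le_mul (hC n) (hD m) (norm_nonneg _) hC0.le

theorem exists_bound_prod {α β γ : Type*} (s : Finset α) {f : α → β → γ → ℂ}
    (h : ∀ a ∈ s, ∃ C > 0, ∀ m n, ‖f a m n‖ ≤ C) : ∃ C > 0, ∀ m n, ‖∏ a ∈ s, f a m n‖ ≤ C := by
  classical
  induction s using Finset.induction_on with
  | empty => exact ⟨1, one_pos, fun m n => by simp⟩
  | insert a s ha ih =>
    obtain ⟨C, hC0, hC⟩ := h a (Finset.mem_insert_self _ _)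
    obtain ⟨D, hD0, hD⟩ := ih fun b hb => h b (Finset.mem_insert_of_mem hb)
    refine ⟨C * D, by positivity, fun m n => ?_⟩
    rw [Finset.prod_insert ha, norm_mul]
    exact mul_le_mul (hC m n) (hD m n) (norm_nonneg _) hC0.le

theorem summable_theta_div {Q A c : ℂ} (hQ0 : Q ≠ 0) (hQ : ‖Q‖ < 1) (hA : A ≠ 0) (hc : c ≠ 0) {e : ℕ}
    (he : 1 ≤ e) : Summable fun n : ℤ => ‖A ^ n * (Q ^ triInt n) ^ e / (1 - c * Q ^ n)‖ := by
  obtain ⟨C, hC0, hC⟩ := exists_bound_inv_one_sub_mul_zpow hQ0 hQ hc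
  have h1 := summable_zpow_mul_triInt (a := A) (Q := Q ^ e) hA (pow_ne_zero _ hQ0)
    (by rw [norm_pow]; exact pow_lt_one₀ (norm_nonneg _) hQ (by omega))
  refine (h1.mul_right C).of_nonneg_of_le (fun n => norm_nonneg _) fun n => ?_
  rw [div_eq_mul_inv, norm_mul]
  have h2 : (Q ^ e) ^ triInt n = (Q ^ triInt n) ^ e := by
    rw [← zpow_natCast, ← zpow_natCast, ← zpow_mul, ← zpow_mul, mul_comm]
  rw [h2]
  gcongr
  exact hC n

theorem exists_bound_residue {ι κ : Type*} [Fintype κ] {Q : ℂ} (hQ0 : Q ≠ 0) (hQ : ‖Q‖ < 1)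
    (s : Finset ι) (b : κ → ℂ) (c : ι → ℂ) (hc : ∀ k ∈ s, ∀ n : ℤ, c k * Q ^ n ≠ 1) :
    ∃ C, ∀ m n, ‖(∏ k, thetaTrunc Q (b k) m n) / ((∏ k ∈ s, thetaTrunc Q (c k) m n) *
      (qPoch Q Q m * qPoch Q Q (n - 1)))‖ ≤ C := by
  obtain ⟨C₁, hC₁0, hC₁⟩ := exists_bound_prod Finset.univ
    fun k _ => exists_bound_thetaTrunc hQ (b k)
  obtain ⟨C₂, hC₂0, hC₂⟩ := exists_bound_prod s
    fun k hk => exists_bound_inv_thetaTrunc hQ0 hQ (hc k hk)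
  obtain ⟨C₃, hC₃0, hC₃⟩ := exists_bound_inv_qPoch hQ (one_sub_mul_pow_ne_zero hQ)
  refine ⟨C₁ * (C₂ * (C₃ * C₃)), fun m n => ?_⟩
  have h2 := hC₂ m n
  rw [Finset.prod_inv_distrib] at h2
  rw [div_eq_mul_inv, mul_inv, mul_inv, norm_mul, norm_mul, norm_mul]
  refine mul_le_mul (hC₁ m n) (mul_le_mul h2 (mul_le_mul (hC₃ m) (hC₃ _) (norm_nonneg _) hC₃0.le)
    (mul_nonneg (norm_nonneg _) (norm_nonneg _)) hC₂0.le) ?_ hC₁0.le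
  exact mul_nonneg (norm_nonneg _) (mul_nonneg (norm_nonneg _) (norm_nonneg _))

theorem tendsto_residue {ι κ : Type*} [Fintype κ] {Q : ℂ} (hQ0 : Q ≠ 0) (hQ : ‖Q‖ < 1)
    (s : Finset ι) (b : κ → ℂ) (c : ι → ℂ) (hc : ∀ k ∈ s, ∀ n : ℤ, c k * Q ^ n ≠ 1) :
    Tendsto (fun p : ℕ × ℕ => (∏ k, thetaTrunc Q (b k) p.1 p.2) /
      ((∏ k ∈ s, thetaTrunc Q (c k) p.1 p.2) * (qPoch Q Q p.1 * qPoch Q Q (p.2 - 1))))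
      (atTop ×ˢ atTop) (𝓝 ((∏ k, thetaProd Q (b k)) / ((∏ k ∈ s, thetaProd Q (c k)) *
        qPochInf Q Q ^ 2))) := by
  have hQQ := qPochInf_ne_zero hQ (one_sub_mul_pow_ne_zero hQ)
  refine Tendsto.div (tendsto_finsetProd _ fun k _ => tendsto_thetaTrunc hQ _)
    (Tendsto.mul (tendsto_finsetProd _ fun k _ => tendsto_thetaTrunc hQ _) ?_)
    (mul_ne_zero (Finset.prod_ne_zero_iff.2 fun k hk => thetaProd_ne_zero hQ0 hQ (hc k hk))
      (pow_ne_zero _ hQQ))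
  rw [pow_two]
  exact ((tendsto_qPoch hQ Q).comp tendsto_fst).mul
    (((tendsto_qPoch hQ Q).comp (tendsto_sub_atTop_nat 1)).comp tendsto_snd)

/-- Partial fractions for a quotient of theta products. -/
theorem prod_thetaProd_div_eq {ι κ : Type*} [Fintype ι] [Fintype κ] [DecidableEq ι] {Q : ℂ} (hQ0 : Q ≠ 0)
    (hQ : ‖Q‖ < 1) (ζ : ι → ℂ) (a : κ → ℂ) (e : ℕ) (he : 1 ≤ e)
    (hcard : Fintype.card ι = Fintype.card κ + e) (hζ : ∀ i, ζ i ≠ 0) (ha : ∀ k, a k ≠ 0)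
    (hζζ : ∀ i k, i ≠ k → ∀ n : ℤ, ζ i / ζ k * Q ^ n ≠ 1) {z : ℂ} (hz0 : z ≠ 0)
    (hz : ∀ i (n : ℤ), z / ζ i * Q ^ n ≠ 1) :
    (∏ k, thetaProd Q (z / a k)) / ∏ i, thetaProd Q (z / ζ i) =
      ∑ i, (∑' n : ℤ, ((-1) ^ e * ((∏ i, ζ i) / ∏ k, a k) / ζ i ^ e) ^ n * (Q ^ triInt n) ^ e /
          (1 - z / ζ i * Q ^ n)) *
        ((∏ k, thetaProd Q (ζ i / a k)) /
          ((∏ k ∈ Finset.univ.erase i, thetaProd Q (ζ i / ζ k)) * qPochInf Q Q ^ 2)) := by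
  have hL : Tendsto (fun N : ℕ => (∏ k, thetaTrunc Q (z / a k) N N) /
      ∏ i, thetaTrunc Q (z / ζ i) N N) atTop
      (𝓝 ((∏ k, thetaProd Q (z / a k)) / ∏ i, thetaProd Q (z / ζ i))) := by
    refine Tendsto.div (tendsto_finsetProd _ fun k _ => ?_) (tendsto_finsetProd _ fun i _ => ?_)
      (Finset.prod_ne_zero_iff.2 fun i _ => thetaProd_ne_zero hQ0 hQ (hz i))
    · exact tendsto_thetaTrunc_self hQ _
    · exact tendsto_thetaTrunc_self hQ _
  refine tendsto_nhds_unique hL ?_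
  have hR : Tendsto (fun N : ℕ => ∑ i, ∑ m ∈ Finset.range (2 * N),
      (((-1) ^ e * ((∏ i, ζ i) / ∏ k, a k) / ζ i ^ e) ^ ((m : ℤ) - N) *
          (Q ^ triInt ((m : ℤ) - N)) ^ e / (1 - z / ζ i * Q ^ ((m : ℤ) - N))) *
        ((∏ k, thetaTrunc Q (ζ i / a k) m (2 * N - m)) /
          ((∏ k ∈ Finset.univ.erase i, thetaTrunc Q (ζ i / ζ k) m (2 * N - m)) *
            (qPoch Q Q m * qPoch Q Q (2 * N - m - 1))))) atTop
      (𝓝 (∑ i, (∑' n : ℤ, ((-1) ^ e * ((∏ i, ζ i) / ∏ k, a k) / ζ i ^ e) ^ n * (Q ^ triInt n) ^ e /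
          (1 - z / ζ i * Q ^ n)) *
        ((∏ k, thetaProd Q (ζ i / a k)) /
          ((∏ k ∈ Finset.univ.erase i, thetaProd Q (ζ i / ζ k)) * qPochInf Q Q ^ 2)))) := by
    refine tendsto_finsetSum _ fun i _ => ?_
    have hA : ((-1) ^ e * ((∏ i, ζ i) / ∏ k, a k) / ζ i ^ e) ≠ 0 := by
      have h1 := Finset.prod_ne_zero_iff.2 fun i (_ : i ∈ Finset.univ) => hζ i
      have h2 := Finset.prod_ne_zero_iff.2 fun i (_ : i ∈ Finset.univ) => ha i
      exact div_ne_zero (mul_ne_zero (pow_ne_zero _ (by norm_num)) (div_ne_zero h1 h2))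
        (pow_ne_zero _ (hζ i))
    obtain ⟨C, hC⟩ := exists_bound_residue hQ0 hQ (Finset.univ.erase i) (fun k => ζ i / a k)
      (fun k => ζ i / ζ k) (fun k hk => hζζ i k (Finset.ne_of_mem_erase hk).symm)
    exact tendsto_sum_range_int
      (g := fun n => ((-1) ^ e * ((∏ i, ζ i) / ∏ k, a k) / ζ i ^ e) ^ n * (Q ^ triInt n) ^ e /
        (1 - z / ζ i * Q ^ n))
      (r := fun m n => (∏ k, thetaTrunc Q (ζ i / a k) m n) /
        ((∏ k ∈ Finset.univ.erase i, thetaTrunc Q (ζ i / ζ k) m n) *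
          (qPoch Q Q m * qPoch Q Q (n - 1))))
      (summable_theta_div hQ0 hQ hA (div_ne_zero hz0 (hζ i)) he) hC
      (tendsto_residue hQ0 hQ (Finset.univ.erase i) (fun k => ζ i / a k)
      (fun k => ζ i / ζ k) (fun k hk => hζζ i k (Finset.ne_of_mem_erase hk).symm))
  refine hR.congr' (eventually_atTop.2 ⟨1, fun N hN => ?_⟩)
  beta_reduce
  rw [prod_thetaTrunc_div_eq hQ0 ζ a e he hcard hζ ha (zpow_ne_one_of_norm_lt_one hQ) hζζ hz0
    (fun i n => sub_ne_zero.2 (hz i n).symm) N hN]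
  refine Finset.sum_congr rfl fun i _ => Finset.sum_congr rfl fun m hm => ?_
  rw [div_mul_eq_mul_div, Nat.sub_right_comm]

/-- Gaussian binomial coefficients, by their Pascal recursion. -/
def gaussBinom (Q : ℂ) : ℕ → ℕ → ℂ
  | _, 0 => 1
  | 0, _ + 1 => 0
  | n + 1, k + 1 => gaussBinom Q n k + Q ^ (k + 1) * gaussBinom Q n (k + 1)

theorem gaussBinom_eq_zero (Q : ℂ) : ∀ {n k : ℕ}, n < k → gaussBinom Q n k = 0
  | _, 0, h => absurd h (Nat.not_lt_zero _)
  | 0, _ + 1, _ => rfl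
  | n + 1, k + 1, h => by
    rw [gaussBinom, gaussBinom_eq_zero Q (by omega), gaussBinom_eq_zero Q (by omega)]
    ring

theorem gaussBinom_zero_right (Q : ℂ) (n : ℕ) : gaussBinom Q n 0 = 1 := by
  cases n <;> rfl

theorem gaussBinom_mul_qPoch (Q : ℂ) : ∀ n k m : ℕ, m + k = n →
    gaussBinom Q n k * (qPoch Q Q k * qPoch Q Q m) = qPoch Q Q n
  | n, 0, m, h => by
    obtain rfl : m = n := by omega
    simp [gaussBinom_zero_right, qPoch]
  | 0, k + 1, m, h => by omega
  | n + 1, k + 1, 0, h => by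
    obtain rfl : k = n := by omega
    have h1 := gaussBinom_mul_qPoch Q k k 0 (by omega)
    rw [gaussBinom, gaussBinom_eq_zero Q (Nat.lt_succ_self k), qPoch_succ]
    linear_combination (1 - Q * Q ^ k) * h1
  | n + 1, k + 1, m + 1, h => by
    have h1 := gaussBinom_mul_qPoch Q n k (m + 1) (by omega)
    have h2 := gaussBinom_mul_qPoch Q n (k + 1) m (by omega)
    obtain rfl : n = m + k + 1 := by omega
    rw [gaussBinom, qPoch_succ _ (m + k + 1)]
    rw [qPoch_succ _ k] at h2 ⊢
    rw [qPoch_succ _ m] at h1 ⊢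
    rw [pow_succ, pow_succ, pow_add]
    linear_combination (1 - Q * Q ^ k) * h1 + Q ^ k * Q * (1 - Q * Q ^ m) * h2

theorem qPoch_eq_sum_gaussBinom (Q : ℂ) (n : ℕ) : ∀ x : ℂ,
    qPoch Q x n = ∑ k ∈ Finset.range (n + 1), gaussBinom Q n k * ((-x) ^ k * Q ^ k.choose 2) := by
  induction n with
  | zero => intro x; simp [qPoch, gaussBinom]
  | succ n ih =>
    intro x
    have h0 : ∀ x : ℂ, qPoch Q x n =
        ∑ k ∈ Finset.range (n + 1), gaussBinom Q n (k + 1) * ((-x) ^ (k + 1) * Q ^ (k + 1).choose 2)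
          + 1 := by
      intro x
      rw [Finset.sum_range_succ, gaussBinom_eq_zero Q (Nat.lt_succ_self n), ih x,
        Finset.sum_range_succ', gaussBinom_zero_right]
      simp
    rw [qPoch_succ', sub_mul, one_mul, Finset.sum_range_succ', gaussBinom_zero_right]
    nth_rewrite 1 [h0 (x * Q)]
    rw [ih (x * Q), Finset.mul_sum, add_sub_right_comm, ← Finset.sum_sub_distrib]
    congr 1
    · refine Finset.sum_congr rfl fun k _ => ?_
      rw [gaussBinom, Nat.choose_succ_succ' k 1, Nat.choose_one_right]
      simp only [neg_mul_eq_neg_mul, mul_pow, pow_add, pow_succ]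
      ring
    · simp

/-- The Jacobi triple product. -/
theorem qPochInf_mul_thetaProd {Q x : ℂ} (hQ0 : Q ≠ 0) (hQ : ‖Q‖ < 1) (hx : x ≠ 0) :
    qPochInf Q Q * thetaProd Q x = ∑' n : ℤ, (-x / Q) ^ n * Q ^ triInt n := by
  have hQn := qPoch_ne_zero (Q := Q) (x := Q) (one_sub_mul_pow_ne_zero hQ)
  have hQQ := qPochInf_ne_zero hQ (one_sub_mul_pow_ne_zero hQ)
  set r : ℕ → ℕ → ℂ := fun m k => qPoch Q Q (m + k - 1) / (qPoch Q Q m * qPoch Q Q (k - 1)) with hr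
  have hfin : ∀ N : ℕ, 1 ≤ N → qPoch Q x (N - 1) * qPoch Q (Q / x) N =
      ∑ m ∈ Finset.range (2 * N), ((-x / Q) ^ ((m : ℤ) - N) * Q ^ triInt ((m : ℤ) - N)) *
        r m (2 * N - m) := by
    intro N hN
    have h1 := qPoch_mul_qPoch_shift (M := 2 * N - 1) (N := 0) (M' := N - 1) (N' := N) hQ0 hx
      (by omega)
    have h2 : ((2 * N - 1 : ℕ) : ℤ) - (N - 1 : ℕ) = N := by omega
    rw [h2] at h1
    have h3 : qPoch Q (x * Q ^ (-(N : ℤ))) (2 * N - 1) = (-x) ^ (N : ℤ) * Q ^ (-triInt N) *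
        (qPoch Q x (N - 1) * qPoch Q (Q / x) N) := by
      simpa [qPoch] using h1
    have hp : (-x) ^ (N : ℤ) * Q ^ (-triInt N) ≠ 0 :=
      mul_ne_zero (zpow_ne_zero _ (neg_ne_zero.2 hx)) (zpow_ne_zero _ hQ0)
    rw [qPoch_eq_sum_gaussBinom, show 2 * N - 1 + 1 = 2 * N by omega] at h3
    rw [← mul_right_inj' hp, ← h3, Finset.mul_sum]
    refine Finset.sum_congr rfl fun k hk => ?_
    have hk' := Finset.mem_range.1 hk
    have h4 := gaussBinom_mul_qPoch Q (2 * N - 1) k (2 * N - 1 - k) (by omega)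
    have h5 : r k (2 * N - k) = gaussBinom Q (2 * N - 1) k := by
      simp only [hr]
      rw [show k + (2 * N - k) - 1 = 2 * N - 1 by omega, Nat.sub_right_comm (2 * N) k 1, ← h4]
      exact mul_div_cancel_right₀ _ (mul_ne_zero (hQn _) (hQn _))
    have h6 : (k.choose 2 : ℤ) = triInt k - k := by
      have e1 := two_mul_triInt k
      have e2 : (k.choose 2 : ℤ) * 2 = k * (k - 1) := by
        have := Nat.triangle_succ k
        have e3 := Nat.choose_two_right k
        have e4 : k * (k - 1) / 2 * 2 = k * (k - 1) :=
          Nat.div_mul_cancel (Nat.even_mul_pred_self k).two_dvd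
        rw [← e3] at e4
        rcases k with _ | k
        · simp
        · have := congrArg (Nat.cast : ℕ → ℤ) e4
          push_cast at this ⊢
          simpa using this
      linarith
    have h7 : triInt ((k : ℤ) - N) = triInt k + triInt N - N - k * N := by
      rw [sub_eq_add_neg, triInt_add, triInt_neg]
      ring
    rw [h5, ← zpow_natCast Q, h6, h7, mul_comm (gaussBinom _ _ _), ← mul_assoc]
    congr 1
    have hxn := neg_ne_zero.2 hx
    rw [div_zpow, zpow_sub₀ hxn, zpow_natCast (-x) k, neg_mul_eq_neg_mul, mul_pow,
      ← zpow_natCast (Q ^ _), ← zpow_mul]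
    have hN0 := zpow_ne_zero (N : ℤ) hxn
    have e1 : Q ^ (-(N : ℤ) * k) * Q ^ (triInt k - k) = Q ^ (-triInt N) *
        (Q ^ (triInt k + triInt N - N - k * N) / Q ^ ((k : ℤ) - N)) := by
      rw [← zpow_add₀ hQ0, ← zpow_sub₀ hQ0, ← zpow_add₀ hQ0]
      congr 1
      ring
    rw [mul_assoc, e1]
    field_simp
  have hl : Tendsto (fun N => qPoch Q x (N - 1) * qPoch Q (Q / x) N) atTop (𝓝 (thetaProd Q x)) :=
    ((tendsto_qPoch hQ x).comp (tendsto_sub_atTop_nat 1)).mul (tendsto_qPoch hQ _)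
  obtain ⟨C₁, hC₁0, hC₁⟩ := exists_bound_qPoch hQ Q
  obtain ⟨C₂, hC₂0, hC₂⟩ := exists_bound_inv_qPoch hQ (one_sub_mul_pow_ne_zero hQ)
  have hrb : ∀ m k, ‖r m k‖ ≤ C₁ * (C₂ * C₂) := by
    intro m k
    simp only [hr]
    rw [div_eq_mul_inv, mul_inv, norm_mul, norm_mul]
    exact mul_le_mul (hC₁ _) (mul_le_mul (hC₂ _) (hC₂ _) (norm_nonneg _) hC₂0.le)
      (by positivity) hC₁0.le
  have hrt : Tendsto (fun p : ℕ × ℕ => r p.1 p.2) (atTop ×ˢ atTop)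
      (𝓝 (qPochInf Q Q / (qPochInf Q Q * qPochInf Q Q))) := by
    refine Tendsto.div ((tendsto_qPoch hQ Q).comp ?_) (((tendsto_qPoch hQ Q).comp tendsto_fst).mul
      (((tendsto_qPoch hQ Q).comp (tendsto_sub_atTop_nat 1)).comp tendsto_snd))
      (mul_ne_zero hQQ hQQ)
    exact (tendsto_sub_atTop_nat 1).comp (tendsto_atTop_mono (fun p : ℕ × ℕ => Nat.le_add_right p.1 p.2) tendsto_fst)
  have hs := summable_zpow_mul_triInt (a := -x / Q) (div_ne_zero (neg_ne_zero.2 hx) hQ0) hQ0 hQ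
  have hlim := tendsto_sum_range_int hs hrb hrt
  have := tendsto_nhds_unique hl (hlim.congr' (eventually_atTop.2 ⟨1,
      fun N hN => (hfin N hN).symm⟩))
  rw [this]
  field_simp

theorem thetaProd_inv {Q x : ℂ} (hQ : ‖Q‖ < 1) (hx : x ≠ 0) :
    thetaProd Q x⁻¹ = -x⁻¹ * thetaProd Q x := by
  rw [thetaProd, thetaProd, qPochInf_eq hQ x⁻¹, qPochInf_eq hQ x, div_inv_eq_mul, mul_comm Q x,
    inv_mul_eq_div]
  field_simp
  ring

theorem thetaProd_mul_self {Q x : ℂ} (hQ0 : Q ≠ 0) (hQ : ‖Q‖ < 1) (hx : x ≠ 0) :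
    thetaProd Q (x * Q) = -x⁻¹ * thetaProd Q x := by
  have h : Q / (x * Q) = x⁻¹ := by field_simp
  rw [thetaProd, thetaProd, h, qPochInf_eq hQ x⁻¹, qPochInf_eq hQ x, inv_mul_eq_div]
  field_simp
  ring

/-- The even part of the double series behind the product of two theta functions. -/
theorem thetaProd_mul_thetaProd {Q x y : ℂ} (hQ0 : Q ≠ 0) (hQ : ‖Q‖ < 1) (hx : x ≠ 0)
    (hy : y ≠ 0) :
    qPochInf Q Q ^ 2 * (thetaProd Q (x * y) * thetaProd Q (x / y)) / x =
      ((∑' k : ℤ, (x / Q) ^ (2 * k) * Q ^ (k * k + k)) / x) * (∑' k : ℤ,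
          y ^ (2 * k) * Q ^ (k * k)) -
      (∑' k : ℤ, x ^ (2 * k) * Q ^ (k * k)) *
        ((∑' k : ℤ, (y / Q) ^ (2 * k) * Q ^ (k * k + k)) / y) := by
  have hQ2 : ‖Q ^ 2‖ < 1 := by
    rw [norm_pow]; exact pow_lt_one₀ (norm_nonneg _) hQ two_ne_zero
  have hQ20 : Q ^ 2 ≠ 0 := pow_ne_zero 2 hQ0
  have hA : ∀ u : ℂ, u ≠ 0 → Summable fun k : ℤ => ‖(u / Q) ^ (2 * k) * Q ^ (k * k + k)‖ := by
    intro u hu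
    refine (summable_zpow_mul_triInt (a := (u / Q) ^ 2)
      (pow_ne_zero 2 (div_ne_zero hu hQ0)) hQ20 hQ2).congr fun k => ?_
    rw [← zpow_natCast, ← zpow_natCast, ← zpow_mul, ← zpow_mul]
    push_cast
    rw [two_mul_triInt, mul_add, mul_one]
  have hB : ∀ u : ℂ, u ≠ 0 → Summable fun k : ℤ => ‖u ^ (2 * k) * Q ^ (k * k)‖ := by
    intro u hu
    refine (summable_zpow_mul_triInt (a := u ^ 2 / Q)
      (div_ne_zero (pow_ne_zero 2 hu) hQ0) hQ20 hQ2).congr fun k => ?_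
    rw [← zpow_natCast, ← zpow_natCast, div_zpow, ← zpow_mul, ← zpow_mul]
    push_cast
    rw [two_mul_triInt, div_mul_eq_mul_div, mul_div_assoc, ← zpow_sub₀ hQ0, mul_add, mul_one,
      add_sub_cancel_right]
  set f : ℤ × ℤ → ℂ := fun p => ((-(x * y) / Q) ^ p.1 * Q ^ triInt p.1) *
    ((-(x / y) / Q) ^ p.2 * Q ^ triInt p.2) with hf
  have hx1 : -(x * y) / Q ≠ 0 := div_ne_zero (neg_ne_zero.2 (mul_ne_zero hx hy)) hQ0
  have hx2 : -(x / y) / Q ≠ 0 := div_ne_zero (neg_ne_zero.2 (div_ne_zero hx hy)) hQ0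
  have hs1 := summable_zpow_mul_triInt hx1 hQ0 hQ
  have hs2 := summable_zpow_mul_triInt hx2 hQ0 hQ
  have hsum : HasSum f (qPochInf Q Q * thetaProd Q (x * y) *
      (qPochInf Q Q * thetaProd Q (x / y))) := by
    rw [qPochInf_mul_thetaProd hQ0 hQ (mul_ne_zero hx hy),
      qPochInf_mul_thetaProd hQ0 hQ (div_ne_zero hx hy), tsum_mul_tsum_of_summable_norm hs1 hs2]
    exact (summable_mul_of_summable_norm hs1 hs2).hasSum
  have hconv : ∀ m n : ℤ, f (m, n) = (-1) ^ (m + n) * ((x / Q) ^ (m + n) * y ^ (m - n) *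
      Q ^ (triInt m + triInt n)) := by
    intro m n
    simp only [hf]
    rw [zpow_add₀ (by norm_num), zpow_add₀ (div_ne_zero hx hQ0), zpow_add₀ hQ0, zpow_sub₀ hy,
      show -(x * y) / Q = -1 * ((x / Q) * y) by ring,
      show -(x / y) / Q = -1 * ((x / Q) * y⁻¹) by ring, mul_zpow, mul_zpow, mul_zpow, mul_zpow,
      inv_zpow]
    ring
  set e₁ : ℤ × ℤ → ℤ × ℤ := fun p => (p.1 + p.2, p.1 - p.2) with he₁
  set e₂ : ℤ × ℤ → ℤ × ℤ := fun p => (p.1 + p.2 + 1, p.1 - p.2) with he₂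
  have hi₁ : Function.Injective e₁ := by
    rintro ⟨a, b⟩ ⟨c, d⟩ h
    simp only [he₁, Prod.mk.injEq] at h ⊢
    omega
  have hi₂ : Function.Injective e₂ := by
    rintro ⟨a, b⟩ ⟨c, d⟩ h
    simp only [he₂, Prod.mk.injEq] at h ⊢
    omega
  have hcompl : IsCompl (Set.range e₁) (Set.range e₂) := by
    constructor
    · rw [Set.disjoint_iff]
      rintro _ ⟨⟨⟨a, b⟩, rfl⟩, ⟨⟨c, d⟩, h⟩⟩
      simp only [he₁, he₂, Prod.mk.injEq] at h
      omega
    · rw [codisjoint_iff_le_sup]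
      rintro ⟨m, n⟩ -
      rcases Int.even_or_odd' (m + n) with ⟨k, hk | hk⟩
      · exact Or.inl ⟨(k, m - k), by simp only [he₁, Prod.mk.injEq]; omega⟩
      · exact Or.inr ⟨(k, m - k - 1), by simp only [he₂, Prod.mk.injEq]; omega⟩
  have h₁ : HasSum (f ∘ e₁) ((∑' k : ℤ, (x / Q) ^ (2 * k) * Q ^ (k * k + k)) *
      ∑' k : ℤ, y ^ (2 * k) * Q ^ (k * k)) := by
    rw [tsum_mul_tsum_of_summable_norm (hA x hx) (hB y hy)]
    refine (summable_mul_of_summable_norm (hA x hx) (hB y hy)).hasSum.congr_fun ?_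
    rintro ⟨k, l⟩
    simp only [Function.comp, he₁]
    rw [hconv, show k + l + (k - l) = 2 * k by ring, show k + l - (k - l) = 2 * l by ring,
      show triInt (k + l) + triInt (k - l) = (k * k + k) + l * l by
        have := two_mul_triInt (k + l); have := two_mul_triInt (k - l); linarith,
      zpow_add₀ hQ0 _ (l * l), (even_two_mul k).neg_one_zpow]
    ring
  have hsh : (∑' k : ℤ, (y / Q) ^ (2 * k) * Q ^ (k * k + k)) / y =
      ∑' k : ℤ, y * (y ^ (2 * k) * Q ^ (k * k + k)) := by
    rw [← (Equiv.addRight (1 : ℤ)).tsum_eq, ← tsum_div_const]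
    refine tsum_congr fun k => ?_
    simp only [Equiv.coe_addRight]
    rw [div_zpow, show (k + 1) * (k + 1) + (k + 1) = (k * k + k) + 2 * (k + 1) by ring,
      zpow_add₀ hQ0 _ (2 * (k + 1)), mul_add 2 k, zpow_add₀ hy]
    have := zpow_ne_zero (2 * k + 2 * 1) hQ0
    have h2 : y ^ (2 * 1 : ℤ) = y * y := by rw [mul_one, zpow_two]
    rw [h2]
    field_simp
  have hC : Summable fun k : ℤ => ‖y * (y ^ (2 * k) * Q ^ (k * k + k))‖ := by
    refine ((hA (y * Q) (mul_ne_zero hy hQ0)).mul_left ‖y‖).congr fun k => ?_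
    rw [mul_div_cancel_right₀ _ hQ0, norm_mul, norm_mul, norm_mul]
  have h₂ : HasSum (f ∘ e₂) (-((x / Q) * ((∑' k : ℤ, x ^ (2 * k) * Q ^ (k * k)) *
      ∑' k : ℤ, y * (y ^ (2 * k) * Q ^ (k * k + k)))) * Q) := by
    rw [tsum_mul_tsum_of_summable_norm (hB x hx) hC]
    refine (((summable_mul_of_summable_norm (hB x hx) hC).hasSum.mul_left (x / Q)).neg.mul_right
      Q).congr_fun ?_
    rintro ⟨k, l⟩
    simp only [Function.comp, he₂]
    rw [hconv, show k + l + 1 + (k - l) = 2 * k + 1 by ring,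
      show k + l + 1 - (k - l) = 2 * l + 1 by ring,
      show triInt (k + l + 1) + triInt (k - l) = k * k + (l * l + l) + 2 * k + 1 by
        have := two_mul_triInt (k + l + 1); have := two_mul_triInt (k - l); linarith,
      (odd_two_mul_add_one k).neg_one_zpow, zpow_add_one₀ (div_ne_zero hx hQ0), zpow_add_one₀ hy,
      zpow_add_one₀ hQ0, zpow_add₀ hQ0 _ (2 * k), zpow_add₀ hQ0 (k * k), div_zpow]
    have := zpow_ne_zero (2 * k) hQ0
    field_simp
  have htot := HasSum.add_isCompl (f := f) hcompl (hi₁.hasSum_range_iff.2 h₁)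
    (hi₂.hasSum_range_iff.2 h₂)
  have := hsum.unique htot
  rw [hsh]
  rw [show qPochInf Q Q ^ 2 * (thetaProd Q (x * y) * thetaProd Q (x / y)) =
    qPochInf Q Q * thetaProd Q (x * y) * (qPochInf Q Q * thetaProd Q (x / y)) by ring, this]
  field_simp
  ring

/-- The Weierstrass three-term relation. -/
theorem thetaProd_three_term {Q x y z w : ℂ} (hQ0 : Q ≠ 0) (hQ : ‖Q‖ < 1) (hx : x ≠ 0)
    (hy : y ≠ 0) (hz : z ≠ 0) (hw : w ≠ 0) :
    thetaProd Q (x * y) * thetaProd Q (x / y) / x * (thetaProd Q (z * w) * thetaProd Q (z / w) /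
        z) -
    thetaProd Q (x * z) * thetaProd Q (x / z) / x * (thetaProd Q (y * w) * thetaProd Q (y / w) /
        y) +
    thetaProd Q (x * w) * thetaProd Q (x / w) / x * (thetaProd Q (y * z) * thetaProd Q (y / z) / y)
      = 0 := by
  have hQQ := pow_ne_zero 4 (qPochInf_ne_zero hQ (one_sub_mul_pow_ne_zero hQ))
  refine (mul_eq_zero.1 ?_).resolve_left hQQ
  have h1 := thetaProd_mul_thetaProd hQ0 hQ hx hy
  have h2 := thetaProd_mul_thetaProd hQ0 hQ hz hw
  have h3 := thetaProd_mul_thetaProd hQ0 hQ hx hz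
  have h4 := thetaProd_mul_thetaProd hQ0 hQ hy hw
  have h5 := thetaProd_mul_thetaProd hQ0 hQ hx hw
  have h6 := thetaProd_mul_thetaProd hQ0 hQ hy hz
  calc _ = (qPochInf Q Q ^ 2 * (thetaProd Q (x * y) * thetaProd Q (x / y)) / x) *
        (qPochInf Q Q ^ 2 * (thetaProd Q (z * w) * thetaProd Q (z / w)) / z) -
      (qPochInf Q Q ^ 2 * (thetaProd Q (x * z) * thetaProd Q (x / z)) / x) *
        (qPochInf Q Q ^ 2 * (thetaProd Q (y * w) * thetaProd Q (y / w)) / y) +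
      (qPochInf Q Q ^ 2 * (thetaProd Q (x * w) * thetaProd Q (x / w)) / x) *
        (qPochInf Q Q ^ 2 * (thetaProd Q (y * z) * thetaProd Q (y / z)) / y) := by ring
    _ = 0 := by rw [h1, h2, h3, h4, h5, h6]; ring

/-- Theta values at the points of order eleven, normalised to be odd and antiperiodic. -/
noncomputable def thetaVal (q : ℂ) (k : ℤ) : ℂ :=
  q ^ (triInt k - 6 * k) * thetaProd (q ^ 121) ((q ^ 11) ^ k)

/-- The algebraic properties of the sequence of theta values at points of order eleven. -/
structure IsThetaSeq (t : ℤ → ℂ) : Prop where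
  neg : ∀ k, t (-k) = -t k
  add_eleven : ∀ k, t (k + 11) = -t k
  ne_zero : ∀ k, ¬ 11 ∣ k → t k ≠ 0
  three_term : ∀ i j k l, t (i + j) * t (i - j) * (t (k + l) * t (k - l)) -
    t (i + k) * t (i - k) * (t (j + l) * t (j - l)) +
    t (i + l) * t (i - l) * (t (j + k) * t (j - k)) = 0

theorem pow_zpow_ne_one {q : ℂ} (hq0 : q ≠ 0) (hq : ‖q‖ < 1) {k : ℤ} (hk : ¬ 11 ∣ k) (n : ℤ) :
    (q ^ 11) ^ k * (q ^ 121) ^ n ≠ 1 := by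
  have h := zpow_ne_one_of_norm_lt_one hq (11 * k + 121 * n) (by
    intro h; exact hk ⟨-n, by linarith⟩)
  rwa [zpow_add₀ hq0, zpow_mul, zpow_mul] at h

theorem isThetaSeq_thetaVal {q : ℂ} (hq0 : q ≠ 0) (hq : ‖q‖ < 1) : IsThetaSeq (thetaVal q) := by
  have hQ0 : q ^ 121 ≠ 0 := pow_ne_zero _ hq0
  have hQ : ‖q ^ 121‖ < 1 := by
    rw [norm_pow]; exact pow_lt_one₀ (norm_nonneg _) hq (by norm_num)
  have hy0 : q ^ 11 ≠ 0 := pow_ne_zero _ hq0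
  have hyk : ∀ k : ℤ, (q ^ 11) ^ k ≠ 0 := fun k => zpow_ne_zero k hy0
  have hyq : ∀ k : ℤ, (q ^ 11) ^ k = q ^ (11 * k) := fun k => by rw [zpow_mul]; rfl
  have hinv : ∀ k : ℤ, ((q ^ 11) ^ k)⁻¹ = q ^ (-(11 * k)) := fun k => by rw [hyq, zpow_neg]
  refine ⟨fun k => ?_, fun k => ?_, fun k hk => ?_, fun i j k l => ?_⟩
  · rw [thetaVal, zpow_neg, thetaProd_inv hQ (hyk k), hinv, triInt_neg, thetaVal]
    have : q ^ (triInt k - 6 * k) = q ^ (triInt k - k - 6 * -k) * q ^ (-(11 * k)) := by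
      rw [← zpow_add₀ hq0]; ring_nf
    rw [this]; ring
  · have h1 : (q ^ 11) ^ (k + 11) = (q ^ 11) ^ k * q ^ 121 := by
      rw [zpow_add₀ hy0]; norm_cast; ring
    rw [thetaVal, h1, thetaProd_mul_self hQ0 hQ (hyk k), hinv, thetaVal]
    have : q ^ (triInt k - 6 * k) = q ^ (triInt (k + 11) - 6 * (k + 11)) * q ^ (-(11 * k)) := by
      rw [← zpow_add₀ hq0]
      congr 1
      have := two_mul_triInt k; have := two_mul_triInt (k + 11); linarith
    rw [this]; ring
  · exact mul_ne_zero (zpow_ne_zero _ hq0) (thetaProd_ne_zero hQ0 hQ (pow_zpow_ne_one hq0 hq hk))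
  · have h := thetaProd_three_term hQ0 hQ (hyk i) (hyk j) (hyk k) (hyk l)
    simp only [← zpow_add₀ hy0, ← zpow_sub₀ hy0] at h
    have hp : ∀ a b : ℤ, thetaVal q (a + b) * thetaVal q (a - b) = q ^ (a * a + b * b) *
        (thetaProd (q ^ 121) ((q ^ 11) ^ (a + b)) * thetaProd (q ^ 121) ((q ^ 11) ^ (a - b)) /
          (q ^ 11) ^ a) := by
      intro a b
      have e : q ^ (triInt (a + b) - 6 * (a + b)) * q ^ (triInt (a - b) - 6 * (a - b)) =
          q ^ (a * a + b * b) / (q ^ 11) ^ a := by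
        rw [hyq, ← zpow_add₀ hq0, ← zpow_sub₀ hq0]
        congr 1
        have := two_mul_triInt (a + b); have := two_mul_triInt (a - b); linarith
      rw [thetaVal, thetaVal, mul_mul_mul_comm, e]; ring
    rw [hp, hp, hp, hp, hp, hp]
    have e1 : q ^ (i * i + k * k) * q ^ (j * j + l * l) =
      q ^ (i * i + j * j) * q ^ (k * k + l * l) := by
      rw [← zpow_add₀ hq0, ← zpow_add₀ hq0]; ring_nf
    have e2 : q ^ (i * i + l * l) * q ^ (j * j + k * k) =
      q ^ (i * i + j * j) * q ^ (k * k + l * l) := by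
      rw [← zpow_add₀ hq0, ← zpow_add₀ hq0]; ring_nf
    rw [mul_mul_mul_comm, mul_mul_mul_comm (q ^ (i * i + k * k)),
      mul_mul_mul_comm (q ^ (i * i + l * l)), e1, e2, ← mul_sub, ← mul_add, h, mul_zero]

namespace IsThetaSeq

variable {t : ℤ → ℂ}

theorem comp_mul (h : IsThetaSeq t) {s : ℤ} (hs : Odd s) (hs' : ¬ 11 ∣ s) :
    IsThetaSeq fun k => t (s * k) := by
  have hper : ∀ (m : ℕ) (k : ℤ), t (k + 11 * m) = (-1) ^ m * t k := by
    intro m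
    induction m with
    | zero => intro k; simp
    | succ m ih =>
      intro k
      rw [pow_succ, mul_assoc, neg_one_mul, ← h.add_eleven, ← ih]
      push_cast; ring_nf
  have h2 : ∀ (m : ℕ) (k : ℤ), Odd m → t (k + 11 * m) = - t k := fun m k hm => by
    rw [hper, hm.neg_one_pow, neg_one_mul]
  refine ⟨fun k => ?_, fun k => ?_, fun k hk => ?_, fun i j k l => ?_⟩
  · rw [mul_neg, h.neg]
  · rw [mul_add, mul_comm s 11]
    rcases Int.eq_nat_or_neg s with ⟨m, hm | hm⟩
    · have hm' : Odd m := by rw [hm] at hs; exact_mod_cast hs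
      rw [hm, h2 _ _ hm']
    · have hm' : Odd m := by rw [hm] at hs; exact_mod_cast (odd_neg.1 hs)
      have := h2 m (s * k + 11 * s) hm'
      rw [hm] at this ⊢
      rw [← neg_eq_iff_eq_neg, ← this]
      ring_nf
  · exact h.ne_zero _ fun hd => ((Int.prime_iff_natAbs_prime.2 (by norm_num)).dvd_or_dvd hd).elim hs' hk
  · have := h.three_term (s * i) (s * j) (s * k) (s * l)
    simpa only [← mul_add, ← mul_sub] using this

end IsThetaSeq

theorem differentiable_qPochInf {Q : ℂ} (hQ : ‖Q‖ < 1) : Differentiable ℂ (qPochInf Q) := by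
  intro x
  have hs : Summable fun i : ℕ => (‖x‖ + 1) * ‖Q‖ ^ i :=
    (summable_geometric_of_lt_one (norm_nonneg _) hQ).mul_left _
  have hU : IsOpen (Metric.ball (0 : ℂ) (‖x‖ + 1)) := Metric.isOpen_ball
  have h : HasProdLocallyUniformlyOn (fun (i : ℕ) (z : ℂ) => 1 + -(z * Q ^ i))
      (fun z => ∏' i : ℕ, (1 + -(z * Q ^ i))) (Metric.ball (0 : ℂ) (‖x‖ + 1)) := by
    refine Summable.hasProdLocallyUniformlyOn_nat_one_add hU hs
      (Eventually.of_forall fun n z hz => ?_) fun n => by fun_prop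
    rw [norm_neg, norm_mul, norm_pow]
    rw [Metric.mem_ball, dist_zero_right] at hz
    gcongr
  have hd := h.differentiableOn (.of_forall fun s => by
    simpa [Finset.prod_fn] using DifferentiableOn.finsetProd (fun _ _ => by fun_prop)) hU
  have hx := hd.differentiableAt (x := x) (hU.mem_nhds (by simp))
  refine hx.congr_of_eventuallyEq (Eventually.of_forall fun z => ?_)
  simp [qPochInf, sub_eq_add_neg]

/-- The function `thetaProd Q x / (1 - x)`, continued to `x = 1`. -/
noncomputable def thetaCore (Q x : ℂ) : ℂ := qPochInf Q (x * Q) * qPochInf Q (Q / x)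

/-- The Euler operator `x d/dx` applied to the logarithm of `thetaProd Q x`. -/
noncomputable def thetaLog (Q x : ℂ) : ℂ := x * logDeriv (thetaProd Q) x

section thetaLog

variable {Q : ℂ}

theorem thetaProd_eq_thetaCore (hQ : ‖Q‖ < 1) (x : ℂ) :
    thetaProd Q x = (1 - x) * thetaCore Q x := by
  rw [thetaProd, thetaCore, qPochInf_eq hQ x, mul_assoc]

theorem thetaCore_one : thetaCore Q 1 = qPochInf Q Q ^ 2 := by
  rw [thetaCore, one_mul, div_one, sq]

theorem hasDerivAt_thetaCore_one (hQ : ‖Q‖ < 1) : HasDerivAt (thetaCore Q) 0 1 := by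
  have hd := (differentiable_qPochInf hQ Q).hasDerivAt
  have h1 : HasDerivAt (fun x : ℂ => qPochInf Q (x * Q)) (deriv (qPochInf Q) Q * Q) 1 := by
    have hd' : HasDerivAt (qPochInf Q) (deriv (qPochInf Q) Q) (1 * Q) := by rwa [one_mul]
    simpa [Function.comp_def] using hd'.comp 1 ((hasDerivAt_id (1 : ℂ)).mul_const Q)
  have h2 : HasDerivAt (fun x : ℂ => qPochInf Q (Q / x)) (deriv (qPochInf Q) Q * -Q) 1 := by
    have hd' : HasDerivAt (qPochInf Q) (deriv (qPochInf Q) Q) (Q * (1 : ℂ)⁻¹) := by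
      rwa [inv_one, mul_one]
    have := hd'.comp 1 ((hasDerivAt_inv (one_ne_zero (α := ℂ))).const_mul Q)
    simpa [Function.comp_def, div_eq_mul_inv] using this
  refine (h1.mul h2).congr_deriv ?_
  rw [one_mul, div_one]
  ring

theorem differentiableAt_thetaProd (hQ : ‖Q‖ < 1) {x : ℂ} (hx : x ≠ 0) :
    DifferentiableAt ℂ (thetaProd Q) x := by
  unfold thetaProd
  refine (differentiable_qPochInf hQ x).mul ((differentiable_qPochInf hQ (Q / x)).comp x ?_)
  exact (differentiableAt_const Q).div differentiableAt_id hx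

theorem hasDerivAt_thetaProd_one (hQ : ‖Q‖ < 1) :
    HasDerivAt (thetaProd Q) (-qPochInf Q Q ^ 2) 1 := by
  have h := ((hasDerivAt_id (1 : ℂ)).const_sub 1).mul (hasDerivAt_thetaCore_one hQ)
  rw [thetaCore_one] at h
  have he : thetaProd Q = (fun x => 1 - id x) * thetaCore Q := by
    ext x; simpa using thetaProd_eq_thetaCore hQ x
  rw [he]
  exact h.congr_deriv (by simp)

theorem hasDerivAt_thetaProd_mul (hQ : ‖Q‖ < 1) {k : ℂ} (hk : k ≠ 0) (hθ : thetaProd Q k ≠ 0) :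
    HasDerivAt (fun u => thetaProd Q (k * u)) (thetaLog Q k * thetaProd Q k) 1 := by
  have hd : HasDerivAt (thetaProd Q) (deriv (thetaProd Q) k) (k * 1) := by
    rw [mul_one]; exact (differentiableAt_thetaProd hQ hk).hasDerivAt
  refine (hd.comp 1 ((hasDerivAt_id (1 : ℂ)).const_mul k)).congr_deriv ?_
  rw [thetaLog, logDeriv_apply]
  field_simp

theorem hasDerivAt_thetaProd_div (hQ : ‖Q‖ < 1) {k : ℂ} (hk : k ≠ 0) (hθ : thetaProd Q k ≠ 0) :
    HasDerivAt (fun u => thetaProd Q (k / u)) (-(thetaLog Q k * thetaProd Q k)) 1 := by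
  have hd : HasDerivAt (fun u => thetaProd Q (k * u)) (thetaLog Q k * thetaProd Q k) (1 : ℂ)⁻¹ := by
    rw [inv_one]; exact hasDerivAt_thetaProd_mul hQ hk hθ
  have := hd.comp 1 (hasDerivAt_inv (one_ne_zero (α := ℂ)))
  simpa [Function.comp_def, div_eq_mul_inv] using this

theorem thetaLog_inv (hQ : ‖Q‖ < 1) {x : ℂ} (hx : x ≠ 0) (hθ : thetaProd Q x ≠ 0) :
    thetaLog Q x⁻¹ = 1 - thetaLog Q x := by
  have hθ' : thetaProd Q x⁻¹ ≠ 0 := by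
    rw [thetaProd_inv hQ hx]; exact mul_ne_zero (neg_ne_zero.2 (inv_ne_zero hx)) hθ
  have h1 := hasDerivAt_thetaProd_mul hQ (inv_ne_zero hx) hθ'
  have h2 := ((hasDerivAt_id (1 : ℂ)).const_mul (-x⁻¹)).mul (hasDerivAt_thetaProd_div hQ hx hθ)
  have he : (fun u => thetaProd Q (x⁻¹ * u)) =ᶠ[𝓝 1]
      (fun u => -x⁻¹ * id u) * fun u => thetaProd Q (x / u) := by
    filter_upwards [isOpen_ne.mem_nhds (one_ne_zero (α := ℂ))] with u hu
    have := thetaProd_inv hQ (div_ne_zero hx hu)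
    rw [inv_div] at this
    rw [inv_mul_eq_div, this]
    simp [div_eq_mul_inv, mul_comm]
  have := h1.unique (h2.congr_of_eventuallyEq he)
  rw [thetaProd_inv hQ hx] at this
  simp only [id, mul_one, div_one] at this
  generalize thetaLog Q x⁻¹ = L1 at *
  have hc : -x⁻¹ * thetaProd Q x ≠ 0 := mul_ne_zero (neg_ne_zero.2 (inv_ne_zero hx)) hθ
  refine mul_right_cancel₀ hc ?_
  linear_combination this

theorem thetaLog_mul_self (hQ0 : Q ≠ 0) (hQ : ‖Q‖ < 1) {x : ℂ} (hx : x ≠ 0)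
    (hθ : thetaProd Q x ≠ 0) : thetaLog Q (x * Q) = thetaLog Q x - 1 := by
  have hθ' : thetaProd Q (x * Q) ≠ 0 := by
    rw [thetaProd_mul_self hQ0 hQ hx]; exact mul_ne_zero (neg_ne_zero.2 (inv_ne_zero hx)) hθ
  have h1 := hasDerivAt_thetaProd_mul hQ (mul_ne_zero hx hQ0) hθ'
  have h2 := ((hasDerivAt_inv (one_ne_zero (α := ℂ))).const_mul (-x⁻¹)).mul
    (hasDerivAt_thetaProd_mul hQ hx hθ)
  have he : (fun u => thetaProd Q (x * Q * u)) =ᶠ[𝓝 1]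
      (fun u => -x⁻¹ * u⁻¹) * fun u => thetaProd Q (x * u) := by
    filter_upwards [isOpen_ne.mem_nhds (one_ne_zero (α := ℂ))] with u hu
    rw [mul_right_comm, thetaProd_mul_self hQ0 hQ (mul_ne_zero hx hu)]
    simp [mul_comm]
  have := h1.unique (h2.congr_of_eventuallyEq he)
  rw [thetaProd_mul_self hQ0 hQ hx] at this
  simp only [mul_one, inv_one, one_pow] at this
  have hc : -x⁻¹ * thetaProd Q x ≠ 0 := mul_ne_zero (neg_ne_zero.2 (inv_ne_zero hx)) hθ
  refine mul_right_cancel₀ hc ?_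
  linear_combination this

/-- The addition formula for the logarithmic derivative of theta. -/
theorem thetaLog_add (hQ0 : Q ≠ 0) (hQ : ‖Q‖ < 1) {b c : ℂ} (hb : b ≠ 0) (hc : c ≠ 0)
    (hθc : thetaProd Q c ≠ 0) (hθm : thetaProd Q (c * b) ≠ 0) (hθd : thetaProd Q (c / b) ≠ 0) :
    thetaLog Q (c * b) + thetaLog Q (c / b) - 2 * thetaLog Q c =
      -(qPochInf Q Q ^ 2 * (c / b * thetaProd Q (c ^ 2) * thetaProd Q b ^ 2 /
        (thetaProd Q c ^ 2 * thetaProd Q (c * b) * thetaProd Q (c / b)))) := by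
  have hcb : c / b ≠ 0 := div_ne_zero hc hb
  have hθc' : thetaProd Q c⁻¹ ≠ 0 := by
    rw [thetaProd_inv hQ hc]; exact mul_ne_zero (neg_ne_zero.2 (inv_ne_zero hc)) hθc
  have hinvd := thetaProd_inv hQ hcb
  rw [inv_div] at hinvd
  have hlogd := thetaLog_inv hQ hcb hθd
  rw [inv_div] at hlogd
  have hθd' : thetaProd Q (b / c) ≠ 0 := by
    rw [hinvd]; exact mul_ne_zero (neg_ne_zero.2 (div_ne_zero hb hc)) hθd
  have d1 : HasDerivAt (fun u : ℂ => thetaProd Q (1 / u)) (qPochInf Q Q ^ 2) 1 := by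
    have hd : HasDerivAt (thetaProd Q) (-qPochInf Q Q ^ 2) (1 : ℂ)⁻¹ := by
      rw [inv_one]; exact hasDerivAt_thetaProd_one hQ
    simpa [Function.comp_def, div_eq_mul_inv] using hd.comp 1 (hasDerivAt_inv (one_ne_zero (α :=
        ℂ)))
  have d2 : HasDerivAt (fun u : ℂ => thetaProd Q (c ^ 2 * u)) (deriv (thetaProd Q) (c ^ 2) * c ^ 2)
      1 := by
    have hd : HasDerivAt (thetaProd Q) (deriv (thetaProd Q) (c ^ 2)) (c ^ 2 * 1) := by
      rw [mul_one]; exact (differentiableAt_thetaProd hQ (pow_ne_zero 2 hc)).hasDerivAt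
    simpa [Function.comp_def] using hd.comp 1 ((hasDerivAt_id (1 : ℂ)).const_mul (c ^ 2))
  have h := (((d2.mul d1).const_mul (thetaProd Q b * thetaProd Q b⁻¹ / c)).sub
    (((hasDerivAt_thetaProd_mul hQ (mul_ne_zero hc hb) hθm).mul
      (hasDerivAt_thetaProd_div hQ (div_ne_zero hb hc) hθd')).const_mul
        (thetaProd Q c * thetaProd Q c⁻¹ / b))).add
    (((hasDerivAt_thetaProd_mul hQ hc hθc).mul
      (hasDerivAt_thetaProd_div hQ (inv_ne_zero hc) hθc')).const_mul
        (thetaProd Q (c * b) * thetaProd Q (b / c) / b))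
  have h0 := h.congr_of_eventuallyEq (f₁ := fun _ => (0 : ℂ)) (by
    filter_upwards [isOpen_ne.mem_nhds (one_ne_zero (α := ℂ))] with u hu
    have := thetaProd_three_term hQ0 hQ one_ne_zero hb hc (mul_ne_zero hc hu)
    have e1 : c * (c * u) = c ^ 2 * u := by ring
    have e2 : c / (c * u) = 1 / u := by field_simp
    have e3 : b * (c * u) = c * b * u := by ring
    have e4 : b / (c * u) = b / c / u := by field_simp
    have e5 : 1 / (c * u) = c⁻¹ / u := by field_simp
    have e6 : b * c = c * b := mul_comm _ _
    rw [e1, e2, e3, e4, e5, e6] at this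
    simp only [one_mul, div_one, one_div] at this ⊢
    simp only [Pi.mul_apply, Pi.add_apply, Pi.sub_apply]
    rw [← this]
    ring)
  have h1 := (hasDerivAt_const (1 : ℂ) (0 : ℂ)).unique h0
  have hone : thetaProd Q 1 = 0 := by rw [thetaProd_eq_thetaCore hQ]; simp
  simp only [mul_one, div_one, hone, mul_zero, zero_add] at h1
  rw [hinvd, hlogd, thetaLog_inv hQ hc hθc, thetaProd_inv hQ hb, thetaProd_inv hQ hc] at h1
  clear h h0 hinvd hlogd
  generalize thetaLog Q (c * b) = L1 at *
  generalize thetaProd Q (c * b) = T1 at *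
  field_simp at h1 ⊢
  linear_combination h1

end thetaLog

/-- The level-`e` Appell sum, for odd `e`. -/
noncomputable def appell (e : ℕ) (Q z w : ℂ) : ℂ :=
  ∑' n : ℤ, (-w ^ e) ^ n * (Q ^ triInt n) ^ e / (1 - z * w * Q ^ n)

section appell

variable {Q : ℂ}

theorem continuousAt_tsum_div (hQ0 : Q ≠ 0) (hQ : ‖Q‖ < 1) {g : ℤ → ℂ}
    (hg : Summable fun n => ‖g n‖) {c z₀ : ℂ} (hc : c ≠ 0) (hz₀ : z₀ ≠ 0)
    (h : ∀ n, g n = 0 ∨ z₀ * c * Q ^ n ≠ 1) :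
    ContinuousAt (fun z => ∑' n, g n / (1 - z * c * Q ^ n)) z₀ := by
  obtain ⟨C, hC0, hC⟩ := exists_bound_inv_one_sub_mul_zpow hQ0 hQ (mul_ne_zero hz₀ hc)
  have hr : 0 < ‖z₀‖ / (2 * (C + 1)) := by positivity
  refine tendsto_tsum_of_dominated_convergence (bound := fun n => 2 * C * ‖g n‖)
    (hg.mul_left _) (fun n => ?_) ?_
  · rcases h n with h0 | h0
    · simp [h0]
    · have : ContinuousAt (fun z => g n / (1 - z * c * Q ^ n)) z₀ := by
        refine continuousAt_const.div (by fun_prop) ?_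
        rw [Ne, sub_eq_zero]; exact fun hh => h0 hh.symm
      exact this
  · filter_upwards [Metric.ball_mem_nhds z₀ hr] with z hz n
    rcases h n with h0 | h0
    · simp [h0]
    have hd : 1 - z₀ * c * Q ^ n ≠ 0 := by rw [Ne, sub_eq_zero]; exact fun hh => h0 hh.symm
    rw [Metric.mem_ball, dist_eq_norm] at hz
    have key : c * Q ^ n * (1 - z₀ * c * Q ^ n)⁻¹ = ((1 - z₀ * c * Q ^ n)⁻¹ - 1) / z₀ := by
      rw [eq_div_iff hz₀]
      linear_combination -mul_inv_cancel₀ hd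
    have hK : ‖c * Q ^ n * (1 - z₀ * c * Q ^ n)⁻¹‖ ≤ (C + 1) / ‖z₀‖ := by
      rw [key, norm_div]
      gcongr
      exact (norm_sub_le _ _).trans (by rw [norm_one]; gcongr; exact hC n)
    have hsmall : ‖(z - z₀) * (c * Q ^ n * (1 - z₀ * c * Q ^ n)⁻¹)‖ ≤ 1 / 2 := by
      rw [norm_mul]
      calc _ ≤ ‖z₀‖ / (2 * (C + 1)) * ((C + 1) / ‖z₀‖) := by gcongr
        _ = 1 / 2 := by
          have : ‖z₀‖ ≠ 0 := norm_ne_zero_iff.2 hz₀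
          field_simp
    have hfac : 1 - z * c * Q ^ n =
        (1 - z₀ * c * Q ^ n) * (1 - (z - z₀) * (c * Q ^ n * (1 - z₀ * c * Q ^ n)⁻¹)) := by
      linear_combination (z - z₀) * (c * Q ^ n) * mul_inv_cancel₀ hd
    have hlow : 1 / 2 ≤ ‖1 - (z - z₀) * (c * Q ^ n * (1 - z₀ * c * Q ^ n)⁻¹)‖ := by
      have := norm_sub_norm_le 1 ((z - z₀) * (c * Q ^ n * (1 - z₀ * c * Q ^ n)⁻¹))
      rw [norm_one] at this
      linarith
    have hinv : ‖(1 - (z - z₀) * (c * Q ^ n * (1 - z₀ * c * Q ^ n)⁻¹))⁻¹‖ ≤ 2 := by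
      rw [norm_inv]
      exact inv_le_of_inv_le₀ (by norm_num) (by linarith)
    rw [hfac, div_eq_mul_inv, mul_inv, norm_mul, norm_mul]
    calc _ ≤ ‖g n‖ * (C * 2) := by gcongr; exact hC n
      _ = 2 * C * ‖g n‖ := by ring

theorem pow_triInt (e : ℕ) (n : ℤ) : (Q ^ e) ^ triInt n = (Q ^ triInt n) ^ e := by
  rw [← zpow_natCast, ← zpow_natCast, ← zpow_mul, ← zpow_mul, mul_comm]

theorem summable_appell_num (hQ0 : Q ≠ 0) (hQ : ‖Q‖ < 1) {e : ℕ} (he : 1 ≤ e) {w : ℂ} (hw : w ≠ 0) :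
    Summable fun n : ℤ => ‖(-w ^ e) ^ n * (Q ^ triInt n) ^ e‖ :=
  (summable_zpow_mul_triInt (neg_ne_zero.2 (pow_ne_zero e hw)) (pow_ne_zero e hQ0)
    (by rw [norm_pow]; exact pow_lt_one₀ (norm_nonneg _) hQ (by omega))).congr fun n => by
      rw [pow_triInt]

theorem summable_appell (hQ0 : Q ≠ 0) (hQ : ‖Q‖ < 1) {e : ℕ} (he : 1 ≤ e) {z w : ℂ} (hz : z ≠ 0)
    (hw : w ≠ 0) : Summable fun n : ℤ => (-w ^ e) ^ n * (Q ^ triInt n) ^ e / (1 - z * w * Q ^ n) :=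
  (summable_theta_div hQ0 hQ (neg_ne_zero.2 (pow_ne_zero e hw)) (mul_ne_zero hz hw) he).of_norm

theorem continuousAt_appell (hQ0 : Q ≠ 0) (hQ : ‖Q‖ < 1) {e : ℕ} (he : 1 ≤ e) {z₀ w : ℂ}
    (hw : w ≠ 0) (hz₀ : z₀ ≠ 0) (h : ∀ n : ℤ, z₀ * w * Q ^ n ≠ 1) :
    ContinuousAt (fun z => appell e Q z w) z₀ :=
  continuousAt_tsum_div hQ0 hQ (summable_appell_num hQ0 hQ he hw) hw hz₀ fun n => Or.inr (h n)

theorem tendsto_appell_sub_pole (hQ0 : Q ≠ 0) (hQ : ‖Q‖ < 1) {e : ℕ} (he : 1 ≤ e) {z₀ : ℂ}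
    (hz₀ : z₀ ≠ 0) :
    Tendsto (fun z => appell e Q z z₀⁻¹ - 1 / (1 - z * z₀⁻¹)) (𝓝[≠] z₀)
      (𝓝 (appell e Q z₀ z₀⁻¹)) := by
  have hw := inv_ne_zero hz₀
  set g : ℤ → ℂ := fun n => if n = 0 then 0 else (-z₀⁻¹ ^ e) ^ n * (Q ^ triInt n) ^ e with hg
  have hgs : Summable fun n => ‖g n‖ := by
    refine (summable_appell_num hQ0 hQ he hw).of_nonneg_of_le (fun n => norm_nonneg _) fun n => ?_
    simp only [hg]
    split_ifs
    · rw [norm_zero]; exact norm_nonneg _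
    · exact le_rfl
  have hc : ContinuousAt (fun z => ∑' n, g n / (1 - z * z₀⁻¹ * Q ^ n)) z₀ := by
    refine continuousAt_tsum_div hQ0 hQ hgs hw hz₀ fun n => ?_
    by_cases hn : n = 0
    · exact Or.inl (by simp [hg, hn])
    · right
      rw [mul_inv_cancel₀ hz₀, one_mul]
      exact zpow_ne_one_of_norm_lt_one hQ n hn
  have hval : ∑' n, g n / (1 - z₀ * z₀⁻¹ * Q ^ n) = appell e Q z₀ z₀⁻¹ := by
    refine tsum_congr fun n => ?_
    by_cases hn : n = 0
    · simp [hg, hn, hz₀]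
    · simp [hg, hn]
  rw [ContinuousAt, hval] at hc
  refine (hc.mono_left nhdsWithin_le_nhds).congr' ?_
  filter_upwards [mem_nhdsWithin_of_mem_nhds (isOpen_ne.mem_nhds hz₀)] with z hz
  rw [appell, (summable_appell hQ0 hQ he hz hw).tsum_eq_add_tsum_ite 0]
  have : triInt 0 = 0 := rfl
  simp only [zpow_zero, this, one_pow, mul_one, add_sub_cancel_left]
  refine tsum_congr fun n => ?_
  simp only [hg]
  split_ifs <;> simp

theorem appell_one_one (hQ0 : Q ≠ 0) (hQ : ‖Q‖ < 1) {z : ℂ} (hz0 : z ≠ 0)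
    (hz : ∀ n : ℤ, z * Q ^ n ≠ 1) : appell 1 Q z 1 = qPochInf Q Q ^ 2 / thetaProd Q z := by
  have hQQ := qPochInf_ne_zero hQ (one_sub_mul_pow_ne_zero hQ)
  have h := prod_thetaProd_div_eq (ι := Fin 1) (κ := Fin 0) hQ0 hQ (fun _ => 1) (fun _ => 1) 1
    le_rfl (by simp) (by simp) (by simp) (fun i k hik => absurd (Subsingleton.elim i k) hik) hz0
    (fun _ n => by simpa using hz n)
  simp only [Fin.prod_univ_zero, Fin.prod_univ_one, Fin.sum_univ_one, div_one, pow_one,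
      mul_one] at h
  simp [appell] at h ⊢
  have hθ := thetaProd_ne_zero hQ0 hQ hz
  field_simp at h ⊢
  linear_combination -h

theorem appell_one_relation (hQ0 : Q ≠ 0) (hQ : ‖Q‖ < 1) {z w : ℂ} (hz0 : z ≠ 0) (hw0 : w ≠ 0)
    (hw : ∀ n : ℤ, w * Q ^ n ≠ 1) (hw2 : ∀ n : ℤ, w ^ 2 * Q ^ n ≠ 1)
    (h1 : ∀ n : ℤ, z * w * Q ^ n ≠ 1) (h2 : ∀ n : ℤ, z / w * Q ^ n ≠ 1) :
    w * appell 1 Q z w + appell 1 Q z w⁻¹ = qPochInf Q Q ^ 2 * thetaProd Q z * thetaProd Q (w ^ 2) /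
      (thetaProd Q w * thetaProd Q (z * w) * thetaProd Q (z / w)) := by
  have hQQ := qPochInf_ne_zero hQ (one_sub_mul_pow_ne_zero hQ)
  have hw2' : ∀ n : ℤ, w⁻¹ ^ 2 * Q ^ n ≠ 1 := fun n hn => hw2 (-n) (by
    rw [← inv_inj, mul_inv, zpow_neg, inv_inv, inv_one, ← inv_pow, hn])
  have h := prod_thetaProd_div_eq (ι := Fin 2) (κ := Fin 1) hQ0 hQ ![w⁻¹, w] (fun _ => 1) 1
    le_rfl (by simp) (by simp [Fin.forall_fin_two, hw0]) (by simp)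
    (by
      have e1 : w⁻¹ / w = w⁻¹ ^ 2 := by ring
      have e2 : w / w⁻¹ = w ^ 2 := by field_simp
      simp only [Fin.forall_fin_two, Matrix.cons_val_zero, Matrix.cons_val_one, e1, e2]
      exact ⟨⟨fun h => absurd rfl h, fun _ => hw2'⟩, fun _ => hw2, fun h => absurd rfl h⟩) hz0
    (by
      simp only [Fin.forall_fin_two]
      exact ⟨fun n => by simpa [div_inv_eq_mul] using h1 n, fun n => by simpa using h2 n⟩)
  have e1 : (Finset.univ : Finset (Fin 2)).erase 0 = {1} := by decide
  have e2 : (Finset.univ : Finset (Fin 2)).erase 1 = {0} := by decide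
  simp only [Fin.prod_univ_two, Fin.prod_univ_one, Fin.sum_univ_two, e1, e2, Finset.prod_singleton,
    Matrix.cons_val_zero, Matrix.cons_val_one, inv_mul_cancel₀ hw0, div_one, pow_one, mul_one,
    div_inv_eq_mul] at h
  have e3 : w⁻¹ / w = (w ^ 2)⁻¹ := by field_simp
  have e4 : (-1 : ℂ) * w = -w ^ 1 := by ring
  have e5 : (-1 : ℂ) / w = -w⁻¹ ^ 1 := by field_simp
  rw [e3, ← sq, e4, e5, thetaProd_inv hQ (pow_ne_zero 2 hw0), thetaProd_inv hQ hw0] at h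
  have hA : ∑' n : ℤ, (-w ^ 1) ^ n * Q ^ triInt n / (1 - z * w * Q ^ n) = appell 1 Q z w := by
    simp [appell]
  have hB : ∑' n : ℤ, (-w⁻¹ ^ 1) ^ n * Q ^ triInt n / (1 - z / w * Q ^ n) = appell 1 Q z w⁻¹ := by
    simp [appell, div_eq_mul_inv]
  rw [hA, hB] at h
  have hθ1 := thetaProd_ne_zero hQ0 hQ hw
  have hθ2 := thetaProd_ne_zero hQ0 hQ hw2
  have hθ3 := thetaProd_ne_zero hQ0 hQ h1
  have hθ4 := thetaProd_ne_zero hQ0 hQ h2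
  rw [div_eq_iff (mul_ne_zero hθ3 hθ4)] at h
  rw [eq_div_iff (by positivity), h]
  field_simp

theorem appell_three_relation (hQ0 : Q ≠ 0) (hQ : ‖Q‖ < 1) {z w : ℂ} (hz0 : z ≠ 0) (hw0 : w ≠ 0)
    (hz : ∀ n : ℤ, z * Q ^ n ≠ 1)
    (hw : ∀ n : ℤ, w * Q ^ n ≠ 1) (hw2 : ∀ n : ℤ, w ^ 2 * Q ^ n ≠ 1)
    (h1 : ∀ n : ℤ, z * w * Q ^ n ≠ 1) (h2 : ∀ n : ℤ, z / w * Q ^ n ≠ 1) :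
    w ^ 3 * appell 3 Q z w + appell 3 Q z w⁻¹
        - w * thetaProd Q (w ^ 2) / thetaProd Q w * appell 3 Q z 1 =
      qPochInf Q Q ^ 2 * thetaProd Q w * thetaProd Q (w ^ 2) /
      (thetaProd Q z * thetaProd Q (z * w) * thetaProd Q (z / w)) := by
  have hQQ := qPochInf_ne_zero hQ (one_sub_mul_pow_ne_zero hQ)
  have hw2' : ∀ n : ℤ, w⁻¹ ^ 2 * Q ^ n ≠ 1 := fun n hn => hw2 (-n) (by
    rw [← inv_inj, mul_inv, zpow_neg, inv_inv, inv_one, ← inv_pow, hn])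
  have hw' : ∀ n : ℤ, w⁻¹ * Q ^ n ≠ 1 := fun n hn => hw (-n) (by
    rw [← inv_inj, mul_inv, zpow_neg, inv_inv, inv_one, hn])
  have h := prod_thetaProd_div_eq (ι := Fin 3) (κ := Fin 0) hQ0 hQ ![w⁻¹, 1, w] (fun _ => 1) 3
    (by norm_num) (by simp) (by simp [Fin.forall_fin_succ, hw0]) (by simp)
    (by
      have e1 : w⁻¹ / w = w⁻¹ ^ 2 := by ring
      have e2 : w / w⁻¹ = w ^ 2 := by field_simp
      have e3 : (1 : ℂ) / w = w⁻¹ := by field_simp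
      simp only [Fin.forall_fin_succ, Fin.isValue]
      simp [e1, e2, e3]
      refine ⟨⟨hw', by simpa using hw2'⟩, ⟨hw, hw'⟩, hw2, hw⟩) hz0
    (by
      simp only [Fin.forall_fin_succ]
      simp
      exact ⟨h1, hz, h2⟩)
  have e1 : (Finset.univ : Finset (Fin 3)).erase 0 = {1, 2} := by decide
  have e2 : (Finset.univ : Finset (Fin 3)).erase 1 = {0, 2} := by decide
  have e2' : (Finset.univ : Finset (Fin 3)).erase 2 = {0, 1} := by decide
  simp only [Fin.prod_univ_three, Fin.prod_univ_zero, Fin.sum_univ_three, e1, e2, e2',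
    Finset.prod_pair (show (1 : Fin 3) ≠ 2 by decide),
        Finset.prod_pair (show (0 : Fin 3) ≠ 2 by decide),
    Finset.prod_pair (show (0 : Fin 3) ≠ 1 by decide),
    Matrix.cons_val_zero, Matrix.cons_val_one, Matrix.cons_val, inv_mul_cancel₀ hw0, div_one,
    mul_one, div_inv_eq_mul] at h
  have e3 : w⁻¹ / w = (w ^ 2)⁻¹ := by field_simp
  have e4 : ((-1 : ℂ) ^ 3 * 1) / w⁻¹ ^ 3 = -w ^ 3 := by field_simp
  have e5 : ((-1 : ℂ) ^ 3 * 1) / w ^ 3 = -w⁻¹ ^ 3 := by field_simp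
  have e6 : ((-1 : ℂ) ^ 3 * 1) / 1 ^ 3 = -1 ^ 3 := by norm_num
  rw [mul_one] at e4 e5 e6
  rw [e3, ← sq, e4, e5, e6, one_mul, one_div w, thetaProd_inv hQ (pow_ne_zero 2 hw0),
    thetaProd_inv hQ hw0] at h
  have hA : ∑' n : ℤ, (-w ^ 3) ^ n * (Q ^ triInt n) ^ 3 / (1 - z * w * Q ^ n) =
      appell 3 Q z w := rfl
  have hB : ∑' n : ℤ, (-w⁻¹ ^ 3) ^ n * (Q ^ triInt n) ^ 3 / (1 - z / w * Q ^ n) =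
    appell 3 Q z w⁻¹ := by simp [appell, div_eq_mul_inv]
  have hC : ∑' n : ℤ, (-1 ^ 3) ^ n * (Q ^ triInt n) ^ 3 / (1 - z * Q ^ n) =
    appell 3 Q z 1 := by simp [appell]
  rw [hA, hB, hC] at h
  have hθ1 := thetaProd_ne_zero hQ0 hQ hw
  have hθ2 := thetaProd_ne_zero hQ0 hQ hw2
  have hθ3 := thetaProd_ne_zero hQ0 hQ h1
  have hθ4 := thetaProd_ne_zero hQ0 hQ h2
  have hθ5 := thetaProd_ne_zero hQ0 hQ hz
  generalize appell 3 Q z w = A at *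
  generalize appell 3 Q z w⁻¹ = B at *
  generalize appell 3 Q z 1 = C at *
  generalize thetaProd Q (z * w) = T3 at *
  generalize thetaProd Q (z / w) = T4 at *
  rw [div_eq_iff (by positivity)] at h
  rw [eq_div_iff (by positivity)]
  field_simp at h ⊢
  linear_combination -h

end appell

section pole

variable {Q : ℂ}

theorem thetaProd_zpow (hQ0 : Q ≠ 0) (hQ : ‖Q‖ < 1) (n : ℤ) : thetaProd Q (Q ^ n) = 0 := by
  induction n using Int.induction_on with
  | zero => rw [zpow_zero, thetaProd_eq_thetaCore hQ]; simp
  | succ n ih => rw [zpow_add_one₀ hQ0, thetaProd_mul_self hQ0 hQ (zpow_ne_zero _ hQ0), ih,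
      mul_zero]
  | pred n ih =>
    have hx : Q ^ (-(n : ℤ) - 1) ≠ 0 := zpow_ne_zero _ hQ0
    have := thetaProd_mul_self hQ0 hQ hx
    rw [← zpow_add_one₀ hQ0, sub_add_cancel, ih] at this
    exact (mul_eq_zero.1 this.symm).resolve_left (neg_ne_zero.2 (inv_ne_zero hx))

theorem mul_zpow_ne_one (hQ0 : Q ≠ 0) (hQ : ‖Q‖ < 1) {x : ℂ} (hx : thetaProd Q x ≠ 0) (n : ℤ) :
    x * Q ^ n ≠ 1 := fun h => hx (by
  rw [eq_inv_of_mul_eq_one_left h, ← zpow_neg]; exact thetaProd_zpow hQ0 hQ _)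

theorem eventually_thetaProd_mul_ne_zero (hQ : ‖Q‖ < 1) {k : ℂ} (hk : k ≠ 0)
    (hθ : thetaProd Q k ≠ 0) : ∀ᶠ u in 𝓝[≠] (1 : ℂ), thetaProd Q (k * u) ≠ 0 := by
  refine Filter.Eventually.filter_mono nhdsWithin_le_nhds ?_
  exact (hasDerivAt_thetaProd_mul hQ hk hθ).continuousAt.eventually_ne (by simpa using hθ)

theorem eventually_thetaCore_ne_zero (hQ : ‖Q‖ < 1) : ∀ᶠ u in 𝓝[≠] (1 : ℂ), thetaCore Q u ≠ 0 := by
  refine Filter.Eventually.filter_mono nhdsWithin_le_nhds ?_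
  refine (hasDerivAt_thetaCore_one hQ).continuousAt.eventually_ne ?_
  rw [thetaCore_one]
  exact pow_ne_zero 2 (qPochInf_ne_zero hQ (one_sub_mul_pow_ne_zero hQ))

theorem tendsto_sub_one_div {Φ : ℂ → ℂ} {D : ℂ} (h : HasDerivAt Φ D 1) (h1 : Φ 1 = 1) :
    Tendsto (fun u => (Φ u - 1) / (1 - u)) (𝓝[≠] 1) (𝓝 (-D)) := by
  refine (hasDerivAt_iff_tendsto_slope.1 h).neg.congr fun u => ?_
  rw [slope_def_field, h1, ← div_neg, neg_sub]

theorem tendsto_mul_nhdsNE {w : ℂ} (hw : w ≠ 0) :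
    Tendsto (fun u => w * u) (𝓝[≠] 1) (𝓝[≠] w) := by
  refine tendsto_nhdsWithin_iff.2 ⟨?_, ?_⟩
  · have : Tendsto (fun u => w * u) (𝓝 1) (𝓝 (w * 1)) := (continuous_const_mul w).tendsto 1
    rw [mul_one] at this
    exact this.mono_left nhdsWithin_le_nhds
  · filter_upwards [self_mem_nhdsWithin] with u hu h
    exact hu (mul_left_cancel₀ hw (by rw [Set.mem_singleton_iff] at h; rw [h, mul_one]))

theorem appell_three_pole (hQ0 : Q ≠ 0) (hQ : ‖Q‖ < 1) {w : ℂ} (hw0 : w ≠ 0)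
    (hθ : thetaProd Q w ≠ 0) (hθ2 : thetaProd Q (w ^ 2) ≠ 0) :
    w ^ 3 * appell 3 Q w w + appell 3 Q w w⁻¹
        - w * thetaProd Q (w ^ 2) / thetaProd Q w * appell 3 Q w 1 =
      thetaLog Q w + thetaLog Q (w ^ 2) := by
  have hQQ := qPochInf_ne_zero hQ (one_sub_mul_pow_ne_zero hQ)
  have hw20 := pow_ne_zero 2 hw0
  have hn := mul_zpow_ne_one hQ0 hQ hθ
  have hn2 := mul_zpow_ne_one hQ0 hQ hθ2
  have hT := tendsto_mul_nhdsNE hw0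
  have hT' := hT.mono_right nhdsWithin_le_nhds
  have t1 := (continuousAt_appell hQ0 hQ (e := 3) (by norm_num) hw0 hw0
    (fun n => by rw [← sq]; exact hn2 n)).tendsto.comp hT'
  have t2 := (tendsto_appell_sub_pole hQ0 hQ (e := 3) (by norm_num) hw0).comp hT
  have t3 := (continuousAt_appell hQ0 hQ (e := 3) (by norm_num) one_ne_zero hw0
    (fun n => by rw [mul_one]; exact hn n)).tendsto.comp hT'
  have hL := ((t1.const_mul (w ^ 3)).add t2).sub
    (t3.const_mul (w * thetaProd Q (w ^ 2) / thetaProd Q w))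
  have hD := (((hasDerivAt_thetaProd_mul hQ hw0 hθ).mul
    (hasDerivAt_thetaProd_mul hQ hw20 hθ2)).mul (hasDerivAt_thetaCore_one hQ)).inv
    (by simp only [Pi.mul_apply, mul_one, thetaCore_one]; positivity)
  have hΦ := hD.const_mul (qPochInf Q Q ^ 2 * thetaProd Q w * thetaProd Q (w ^ 2))
  simp only [Pi.mul_apply, Pi.inv_apply, mul_one, mul_zero, add_zero, thetaCore_one] at hΦ
  have hR := tendsto_sub_one_div hΦ (by
    simp only [mul_one, thetaCore_one]
    field_simp)
  refine (tendsto_nhds_unique_of_eventuallyEq hL hR ?_).trans ?_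
  · filter_upwards [eventually_thetaProd_mul_ne_zero hQ hw0 hθ,
      eventually_thetaProd_mul_ne_zero hQ hw20 hθ2, eventually_thetaCore_ne_zero hQ,
      self_mem_nhdsWithin, mem_nhdsWithin_of_mem_nhds (isOpen_ne.mem_nhds (one_ne_zero (α := ℂ)))]
      with u h1 h2 h3 h4 h5
    have h4' : (1 : ℂ) - u ≠ 0 := sub_ne_zero.2 (Ne.symm h4)
    have hu : thetaProd Q u ≠ 0 := by rw [thetaProd_eq_thetaCore hQ]; exact mul_ne_zero h4' h3
    have e1 : w * u * w = w ^ 2 * u := by ring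
    have e2 : w * u / w = u := by field_simp
    have e3 : w * u * w⁻¹ = u := by field_simp
    have h := appell_three_relation hQ0 hQ (mul_ne_zero hw0 h5) hw0 (mul_zpow_ne_one hQ0 hQ h1) hn hn2
      (by rw [e1]; exact mul_zpow_ne_one hQ0 hQ h2) (by rw [e2]; exact mul_zpow_ne_one hQ0 hQ hu)
    rw [e1, e2, thetaProd_eq_thetaCore hQ u] at h
    simp only [Function.comp_def, e3]
    rw [add_sub, sub_right_comm, h]
    field_simp
  · field_simp

theorem appell_one_pole (hQ0 : Q ≠ 0) (hQ : ‖Q‖ < 1) {w : ℂ} (hw0 : w ≠ 0)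
    (hθ : thetaProd Q w ≠ 0) (hθ2 : thetaProd Q (w ^ 2) ≠ 0) :
    w * appell 1 Q w w + appell 1 Q w w⁻¹ = thetaLog Q (w ^ 2) - thetaLog Q w := by
  have hQQ := qPochInf_ne_zero hQ (one_sub_mul_pow_ne_zero hQ)
  have hw20 := pow_ne_zero 2 hw0
  have hn := mul_zpow_ne_one hQ0 hQ hθ
  have hn2 := mul_zpow_ne_one hQ0 hQ hθ2
  have hT := tendsto_mul_nhdsNE hw0
  have hT' := hT.mono_right nhdsWithin_le_nhds
  have t1 := (continuousAt_appell hQ0 hQ (e := 1) le_rfl hw0 hw0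
    (fun n => by rw [← sq]; exact hn2 n)).tendsto.comp hT'
  have t2 := (tendsto_appell_sub_pole hQ0 hQ (e := 1) le_rfl hw0).comp hT
  have hL := (t1.const_mul w).add t2
  have hD := ((hasDerivAt_thetaProd_mul hQ hw20 hθ2).mul (hasDerivAt_thetaCore_one hQ)).inv
    (by simp only [Pi.mul_apply, mul_one, thetaCore_one]; positivity)
  have hΦ := ((hasDerivAt_thetaProd_mul hQ hw0 hθ).mul hD).const_mul
    (qPochInf Q Q ^ 2 * thetaProd Q (w ^ 2) / thetaProd Q w)
  simp only [Pi.mul_apply, Pi.inv_apply, mul_one, mul_zero, add_zero, thetaCore_one] at hΦ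
  have hR := tendsto_sub_one_div hΦ (by
    simp only [mul_one, thetaCore_one]
    field_simp)
  refine (tendsto_nhds_unique_of_eventuallyEq hL hR ?_).trans ?_
  · filter_upwards [eventually_thetaProd_mul_ne_zero hQ hw0 hθ,
      eventually_thetaProd_mul_ne_zero hQ hw20 hθ2, eventually_thetaCore_ne_zero hQ,
      self_mem_nhdsWithin, mem_nhdsWithin_of_mem_nhds (isOpen_ne.mem_nhds (one_ne_zero (α := ℂ)))]
      with u h1 h2 h3 h4 h5
    have h4' : (1 : ℂ) - u ≠ 0 := sub_ne_zero.2 (Ne.symm h4)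
    have hu : thetaProd Q u ≠ 0 := by rw [thetaProd_eq_thetaCore hQ]; exact mul_ne_zero h4' h3
    have e1 : w * u * w = w ^ 2 * u := by ring
    have e2 : w * u / w = u := by field_simp
    have e3 : w * u * w⁻¹ = u := by field_simp
    have h := appell_one_relation hQ0 hQ (mul_ne_zero hw0 h5) hw0 hn hn2
      (by rw [e1]; exact mul_zpow_ne_one hQ0 hQ h2) (by rw [e2]; exact mul_zpow_ne_one hQ0 hQ hu)
    rw [e1, e2, thetaProd_eq_thetaCore hQ u] at h
    simp only [Function.comp_def, e3]
    rw [add_sub, h]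
    field_simp
  · field_simp
    ring

end pole

/-- The series whose residue classes give the rank (`e = 3`) and the crank (`e = 1`). -/
noncomputable def baseSeries (e : ℕ) (q : ℂ) (s : ℤ) : ℂ :=
  ∑' n : ℤ, (-1) ^ n * q ^ ((e : ℤ) * (triInt n + 5 * n - s * n)) / (1 - (q ^ 11) ^ n)

theorem bijective_residue {s : ℤ} (hs : ¬ 11 ∣ s) :
    Function.Bijective fun p : Fin 11 × ℤ => 11 * p.2 + s * (1 + ((p.1 : ℤ) - 5)) := by
  have hp : Prime (11 : ℤ) := Int.prime_iff_natAbs_prime.2 (by norm_num)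
  constructor
  · rintro ⟨i, m⟩ ⟨j, n⟩ h
    simp only at h
    have hd : (11 : ℤ) ∣ s * ((i : ℤ) - j) := ⟨n - m, by linarith⟩
    have hd' := (hp.dvd_or_dvd hd).resolve_left hs
    have hij : i = j := by
      have := i.2; have := j.2
      apply Fin.ext
      omega
    subst hij
    simp only [Prod.mk.injEq, true_and]
    linarith
  · intro n
    obtain ⟨a, b, hab⟩ := (Int.isCoprime_iff_gcd_eq_one.2 (by
      have := (hp.coprime_iff_not_dvd).2 hs
      rwa [Int.isCoprime_iff_gcd_eq_one] at this) : IsCoprime (11 : ℤ) s)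
    have h0 : 0 ≤ (b * n + 4) % 11 := Int.emod_nonneg _ (by norm_num)
    have h1 : (b * n + 4) % 11 < 11 := Int.emod_lt_of_pos _ (by norm_num)
    have h2 := Int.mul_ediv_add_emod (b * n + 4) 11
    refine ⟨(⟨((b * n + 4) % 11).toNat, by omega⟩,
      a * n + s * ((b * n + 4) / 11)), ?_⟩
    simp only [Int.toNat_of_nonneg h0]
    linear_combination n * hab + s * h2

theorem triInt_eleven_mul (m : ℤ) : triInt (11 * m) = 121 * triInt m - 55 * m := by
  have := two_mul_triInt m; have := two_mul_triInt (11 * m); linarith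

theorem triInt_mul (m : ℤ) : triInt m = m * m - triInt m + m := by
  have := two_mul_triInt m; linarith

section

variable {q : ℂ}

theorem neg_one_zpow_eleven_mul (m : ℤ) : (-1 : ℂ) ^ (11 * m) = (-1) ^ m := by
  rw [zpow_mul]; norm_num

theorem baseSeries_term (hq0 : q ≠ 0) {e : ℕ} (s k m : ℤ) :
    (-1) ^ (11 * m + s * (1 + k)) * q ^ ((e : ℤ) * (triInt (11 * m + s * (1 + k)) +
        5 * (11 * m + s * (1 + k)) - s * (11 * m + s * (1 + k)))) /
        (1 - (q ^ 11) ^ (11 * m + s * (1 + k))) =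
      ((-1) ^ (s * (1 + k)) * q ^ ((e : ℤ) * (6 * s - triInt s + (triInt (s * k) + 5 * (s * k))))) *
      ((-((q ^ 11) ^ (s * k)) ^ e) ^ m * ((q ^ 121) ^ triInt m) ^ e /
        (1 - (q ^ 11) ^ s * (q ^ 11) ^ (s * k) * (q ^ 121) ^ m)) := by
  have hy0 : q ^ 11 ≠ 0 := pow_ne_zero _ hq0
  have e1 : (q ^ 11) ^ (11 * m + s * (1 + k)) =
      (q ^ 11) ^ s * (q ^ 11) ^ (s * k) * (q ^ 121) ^ m := by
    rw [← zpow_natCast, ← zpow_natCast, ← zpow_mul, ← zpow_mul, ← zpow_mul, ← zpow_mul,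
      ← zpow_add₀ hq0, ← zpow_add₀ hq0]
    congr 1; push_cast; ring
  have e2 : (-((q ^ 11) ^ (s * k)) ^ e) ^ m * ((q ^ 121) ^ triInt m) ^ e =
      (-1) ^ m * q ^ ((e : ℤ) * (11 * (s * k) * m + 121 * triInt m)) := by
    rw [neg_eq_neg_one_mul, mul_zpow, mul_assoc]
    congr 1
    simp only [← zpow_natCast, ← zpow_mul, ← zpow_add₀ hq0]
    congr 1; push_cast; ring
  rw [e1, e2, zpow_add₀ (by norm_num), neg_one_zpow_eleven_mul, ← mul_div_assoc, mul_mul_mul_comm,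
    ← zpow_add₀ hq0, mul_comm ((-1 : ℂ) ^ m)]
  congr 4
  rw [triInt_add, triInt_eleven_mul, mul_add s, mul_one, triInt_add]
  linear_combination (2 * (e : ℤ)) * triInt_mul s - e * (two_mul_triInt s)

theorem baseSeries_eq_sum (hq0 : q ≠ 0) (hq : ‖q‖ < 1) {e : ℕ} (he : 1 ≤ e) {s : ℤ}
    (hs : ¬ 11 ∣ s) :
    baseSeries e q s = ∑ i : Fin 11, ((-1) ^ (s * (1 + ((i : ℤ) - 5))) *
      q ^ ((e : ℤ) * (6 * s - triInt s + (triInt (s * ((i : ℤ) - 5)) + 5 * (s * ((i : ℤ) - 5)))))) *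
        appell e (q ^ 121) ((q ^ 11) ^ s) ((q ^ 11) ^ (s * ((i : ℤ) - 5))) := by
  have hQ0 : q ^ 121 ≠ 0 := pow_ne_zero _ hq0
  have hQ : ‖q ^ 121‖ < 1 := by
    rw [norm_pow]; exact pow_lt_one₀ (norm_nonneg _) hq (by norm_num)
  have hy0 : q ^ 11 ≠ 0 := pow_ne_zero _ hq0
  set E := Equiv.ofBijective _ (bijective_residue hs) with hE
  have hfib : ∀ i : Fin 11, Summable fun m : ℤ =>
      ‖(-((q ^ 11) ^ (s * ((i : ℤ) - 5))) ^ e) ^ m * ((q ^ 121) ^ triInt m) ^ e /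
        (1 - (q ^ 11) ^ s * (q ^ 11) ^ (s * ((i : ℤ) - 5)) * (q ^ 121) ^ m)‖ := fun i =>
    summable_theta_div hQ0 hQ (neg_ne_zero.2 (pow_ne_zero e (zpow_ne_zero _ hy0)))
      (mul_ne_zero (zpow_ne_zero _ hy0) (zpow_ne_zero _ hy0)) he
  have hsum : Summable fun p : Fin 11 × ℤ => (-1 : ℂ) ^ (E p) *
      q ^ ((e : ℤ) * (triInt (E p) + 5 * (E p) - s * (E p))) / (1 - (q ^ 11) ^ (E p)) := by
    refine Summable.of_norm ?_
    rw [summable_prod_of_nonneg fun _ => norm_nonneg _]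
    refine ⟨fun i => ?_, Summable.of_finite⟩
    simp only [hE, Equiv.ofBijective_apply, baseSeries_term hq0, norm_mul _ (_ / _)]
    exact (hfib i).mul_left _
  rw [baseSeries, ← E.tsum_eq, hsum.tsum_prod, tsum_fintype]
  refine Finset.sum_congr rfl fun i _ => ?_
  simp only [hE, Equiv.ofBijective_apply, baseSeries_term hq0]
  rw [tsum_mul_left, appell]

/-- Pairing opposite residues. -/
theorem baseSeries_eq_pairs (hq0 : q ≠ 0) (hq : ‖q‖ < 1) {e : ℕ} (he : 1 ≤ e) {s : ℤ}
    (hs : ¬ 11 ∣ s) (hs' : Odd s) :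
    baseSeries e q s = -q ^ ((e : ℤ) * (6 * s - triInt s)) *
      (appell e (q ^ 121) ((q ^ 11) ^ s) 1 + ∑ k ∈ Finset.Icc (1 : ℕ) 5, (-1) ^ k *
        q ^ ((e : ℤ) * (triInt (s * k) - 6 * (s * k))) *
        (((q ^ 11) ^ (s * k)) ^ e * appell e (q ^ 121) ((q ^ 11) ^ s) ((q ^ 11) ^ (s * k)) +
          appell e (q ^ 121) ((q ^ 11) ^ s) ((q ^ 11) ^ (s * k))⁻¹)) := by
  have hsgn : ∀ k : ℤ, (-1 : ℂ) ^ (s * k) = (-1) ^ k := fun k => by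
    rw [zpow_mul, hs'.neg_one_zpow]
  have hneg : ∀ j : ℤ, q ^ ((e : ℤ) * (triInt (-j) + 5 * (-j))) =
      q ^ ((e : ℤ) * (triInt j - 6 * j)) := fun j => by
    rw [triInt_neg]; ring_nf
  have hpos : ∀ j : ℤ, q ^ ((e : ℤ) * (triInt j + 5 * j)) =
      q ^ ((e : ℤ) * (triInt j - 6 * j)) * ((q ^ 11) ^ j) ^ e := fun j => by
    simp only [← zpow_natCast, ← zpow_mul, ← zpow_add₀ hq0]
    congr 1; push_cast; ring
  have h0 : triInt 0 = 0 := rfl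
  have hI : Finset.Icc 1 5 = {1, 2, 3, 4, 5} := by decide
  rw [baseSeries_eq_sum hq0 hq he hs, hI]
  have n1 : ∀ j : ℤ, s * -j = -(s * j) := fun j => by ring
  simp only [Fin.sum_univ_succ, hsgn, mul_add (e : ℤ) (6 * s - triInt s), zpow_add₀ hq0 (e * _)]
  simp [-mul_neg, Fin.val_succ]
  norm_num [-mul_neg]
  simp only [n1, hneg, hpos, zpow_neg]
  simp [h0]
  ring

end

section

variable {q : ℂ}

theorem norm_pow_lt_one (hq : ‖q‖ < 1) {n : ℕ} (hn : n ≠ 0) : ‖q ^ n‖ < 1 := by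
  rw [norm_pow]
  exact pow_lt_one₀ (norm_nonneg _) hq hn

theorem thetaProd_pow_zpow_ne_zero (hq0 : q ≠ 0) (hq : ‖q‖ < 1) {k : ℤ} (hk : ¬ 11 ∣ k) :
    thetaProd (q ^ 121) ((q ^ 11) ^ k) ≠ 0 :=
  thetaProd_ne_zero (pow_ne_zero _ hq0) (norm_pow_lt_one hq (by norm_num))
    (pow_zpow_ne_one hq0 hq hk)

theorem appell_three_thetaVal (hq0 : q ≠ 0) (hq : ‖q‖ < 1) {s j : ℤ} (hs : ¬ 11 ∣ s)
    (hj : ¬ 11 ∣ j) (hj2 : ¬ 11 ∣ 2 * j) (h1 : ¬ 11 ∣ s + j) (h2 : ¬ 11 ∣ s - j) :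
    q ^ (3 * (6 * s - triInt s)) * (q ^ (3 * (triInt j - 6 * j)) *
      (((q ^ 11) ^ j) ^ 3 * appell 3 (q ^ 121) ((q ^ 11) ^ s) ((q ^ 11) ^ j) +
        appell 3 (q ^ 121) ((q ^ 11) ^ s) ((q ^ 11) ^ j)⁻¹)) =
    q ^ (3 * (6 * s - triInt s)) * (thetaVal q (2 * j) / thetaVal q j) *
        appell 3 (q ^ 121) ((q ^ 11) ^ s) 1 +
      qPochInf (q ^ 121) (q ^ 121) ^ 2 * (thetaVal q j * thetaVal q (2 * j) /
        (thetaVal q s * thetaVal q (s + j) * thetaVal q (s - j))) := by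
  have hQ0 : q ^ 121 ≠ 0 := pow_ne_zero _ hq0
  have hQ : ‖q ^ 121‖ < 1 := norm_pow_lt_one hq (by norm_num)
  have hy0 : q ^ 11 ≠ 0 := pow_ne_zero _ hq0
  have e2 : ((q ^ 11) ^ j) ^ 2 = (q ^ 11) ^ (2 * j) := by
    rw [← zpow_natCast, ← zpow_mul]; congr 1; push_cast; ring
  have e3 : (q ^ 11) ^ s * (q ^ 11) ^ j = (q ^ 11) ^ (s + j) := (zpow_add₀ hy0 _ _).symm
  have e4 : (q ^ 11) ^ s / (q ^ 11) ^ j = (q ^ 11) ^ (s - j) := (zpow_sub₀ hy0 _ _).symm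
  have key := appell_three_relation (w := (q ^ 11) ^ j) (z := (q ^ 11) ^ s) hQ0 hQ
    (zpow_ne_zero _ hy0) (zpow_ne_zero _ hy0)
    (pow_zpow_ne_one hq0 hq hs) (pow_zpow_ne_one hq0 hq hj)
    (by rw [e2]; exact pow_zpow_ne_one hq0 hq hj2) (by rw [e3]; exact pow_zpow_ne_one hq0 hq h1)
    (by rw [e4]; exact pow_zpow_ne_one hq0 hq h2)
  have key' := eq_add_of_sub_eq key
  rw [key', e2, e3, e4]
  simp only [thetaVal]
  have n1 := thetaProd_pow_zpow_ne_zero hq0 hq hs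
  have n2 := thetaProd_pow_zpow_ne_zero hq0 hq hj
  have n3 := thetaProd_pow_zpow_ne_zero hq0 hq h1
  have n4 := thetaProd_pow_zpow_ne_zero hq0 hq h2
  have t1 := two_mul_triInt j
  have t2 := two_mul_triInt (2 * j)
  have t3 := two_mul_triInt s
  have t4 := two_mul_triInt (s + j)
  have t5 := two_mul_triInt (s - j)
  have x1 : q ^ (3 * (triInt j - 6 * j)) * (q ^ 11) ^ j =
      q ^ (triInt (2 * j) - 6 * (2 * j)) / q ^ (triInt j - 6 * j) := by
    rw [← zpow_sub₀ hq0, ← zpow_natCast, ← zpow_mul, ← zpow_add₀ hq0]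
    congr 1; push_cast; linarith
  have x2 : q ^ (3 * (6 * s - triInt s)) * q ^ (3 * (triInt j - 6 * j)) =
      q ^ (triInt j - 6 * j) * q ^ (triInt (2 * j) - 6 * (2 * j)) / (q ^ (triInt s - 6 * s) *
        q ^ (triInt (s + j) - 6 * (s + j)) * q ^ (triInt (s - j) - 6 * (s - j))) := by
    rw [← zpow_add₀ hq0, ← zpow_add₀ hq0, ← zpow_add₀ hq0, ← zpow_add₀ hq0, ← zpow_sub₀ hq0]
    congr 1; linarith
  have y1 : thetaProd (q ^ 121) ((q ^ 11) ^ (2 * j)) * q ^ (triInt (2 * j) - 6 * (2 * j)) /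
      (q ^ (triInt j - 6 * j) * thetaProd (q ^ 121) ((q ^ 11) ^ j)) =
      q ^ (3 * (triInt j - 6 * j)) * (q ^ 11) ^ j * (thetaProd (q ^ 121) ((q ^ 11) ^ (2 * j)) /
        thetaProd (q ^ 121) ((q ^ 11) ^ j)) := by
    rw [x1]; ring
  rw [mul_comm (q ^ (triInt (2 * j) - 6 * (2 * j))) (thetaProd (q ^ 121) ((q ^ 11) ^ (2 * j))), y1]
  linear_combination qPochInf (q ^ 121) (q ^ 121) ^ 2 * thetaProd (q ^ 121) ((q ^ 11) ^ j) *
    thetaProd (q ^ 121) ((q ^ 11) ^ (2 * j)) / (thetaProd (q ^ 121) ((q ^ 11) ^ s) *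
      thetaProd (q ^ 121) ((q ^ 11) ^ (s + j)) * thetaProd (q ^ 121) ((q ^ 11) ^ (s - j))) * x2

theorem appell_one_thetaVal (hq0 : q ≠ 0) (hq : ‖q‖ < 1) {s j : ℤ}
    (hj : ¬ 11 ∣ j) (hj2 : ¬ 11 ∣ 2 * j) (h1 : ¬ 11 ∣ s + j) (h2 : ¬ 11 ∣ s - j) :
    q ^ (6 * s - triInt s) * (q ^ (triInt j - 6 * j) *
      ((q ^ 11) ^ j * appell 1 (q ^ 121) ((q ^ 11) ^ s) ((q ^ 11) ^ j) +
        appell 1 (q ^ 121) ((q ^ 11) ^ s) ((q ^ 11) ^ j)⁻¹)) =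
      qPochInf (q ^ 121) (q ^ 121) ^ 2 * (thetaVal q s * thetaVal q (2 * j) /
        (thetaVal q j * thetaVal q (s + j) * thetaVal q (s - j))) := by
  have hQ0 : q ^ 121 ≠ 0 := pow_ne_zero _ hq0
  have hQ : ‖q ^ 121‖ < 1 := norm_pow_lt_one hq (by norm_num)
  have hy0 : q ^ 11 ≠ 0 := pow_ne_zero _ hq0
  have e2 : ((q ^ 11) ^ j) ^ 2 = (q ^ 11) ^ (2 * j) := by
    rw [← zpow_natCast, ← zpow_mul]; congr 1; push_cast; ring
  have e3 : (q ^ 11) ^ s * (q ^ 11) ^ j = (q ^ 11) ^ (s + j) := (zpow_add₀ hy0 _ _).symm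
  have e4 : (q ^ 11) ^ s / (q ^ 11) ^ j = (q ^ 11) ^ (s - j) := (zpow_sub₀ hy0 _ _).symm
  have key := appell_one_relation (w := (q ^ 11) ^ j) (z := (q ^ 11) ^ s) hQ0 hQ
    (zpow_ne_zero _ hy0) (zpow_ne_zero _ hy0) (pow_zpow_ne_one hq0 hq hj)
    (by rw [e2]; exact pow_zpow_ne_one hq0 hq hj2) (by rw [e3]; exact pow_zpow_ne_one hq0 hq h1)
    (by rw [e4]; exact pow_zpow_ne_one hq0 hq h2)
  rw [key, e2, e3, e4]
  simp only [thetaVal]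
  have t1 := two_mul_triInt j
  have t2 := two_mul_triInt (2 * j)
  have t3 := two_mul_triInt s
  have t4 := two_mul_triInt (s + j)
  have t5 := two_mul_triInt (s - j)
  have x2 : q ^ (6 * s - triInt s) * q ^ (triInt j - 6 * j) =
      q ^ (triInt s - 6 * s) * q ^ (triInt (2 * j) - 6 * (2 * j)) / (q ^ (triInt j - 6 * j) *
        q ^ (triInt (s + j) - 6 * (s + j)) * q ^ (triInt (s - j) - 6 * (s - j))) := by
    rw [← zpow_add₀ hq0, ← zpow_add₀ hq0, ← zpow_add₀ hq0, ← zpow_add₀ hq0, ← zpow_sub₀ hq0]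
    congr 1; linarith
  linear_combination qPochInf (q ^ 121) (q ^ 121) ^ 2 * thetaProd (q ^ 121) ((q ^ 11) ^ s) *
    thetaProd (q ^ 121) ((q ^ 11) ^ (2 * j)) / (thetaProd (q ^ 121) ((q ^ 11) ^ j) *
      thetaProd (q ^ 121) ((q ^ 11) ^ (s + j)) * thetaProd (q ^ 121) ((q ^ 11) ^ (s - j))) * x2

theorem appell_three_thetaVal_self (hq0 : q ≠ 0) (hq : ‖q‖ < 1) {s : ℤ} (hs : ¬ 11 ∣ s)
    (hs2 : ¬ 11 ∣ 2 * s) :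
    q ^ (3 * (6 * s - triInt s)) * (q ^ (3 * (triInt s - 6 * s)) *
      (((q ^ 11) ^ s) ^ 3 * appell 3 (q ^ 121) ((q ^ 11) ^ s) ((q ^ 11) ^ s) +
        appell 3 (q ^ 121) ((q ^ 11) ^ s) ((q ^ 11) ^ s)⁻¹)) =
    q ^ (3 * (6 * s - triInt s)) * (thetaVal q (2 * s) / thetaVal q s) *
        appell 3 (q ^ 121) ((q ^ 11) ^ s) 1 +
      (thetaLog (q ^ 121) ((q ^ 11) ^ s) + thetaLog (q ^ 121) ((q ^ 11) ^ (2 * s))) := by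
  have hQ0 : q ^ 121 ≠ 0 := pow_ne_zero _ hq0
  have hQ : ‖q ^ 121‖ < 1 := norm_pow_lt_one hq (by norm_num)
  have hy0 : q ^ 11 ≠ 0 := pow_ne_zero _ hq0
  have e2 : ((q ^ 11) ^ s) ^ 2 = (q ^ 11) ^ (2 * s) := by
    rw [← zpow_natCast, ← zpow_mul]; congr 1; push_cast; ring
  have key := appell_three_pole (w := (q ^ 11) ^ s) hQ0 hQ
    (zpow_ne_zero _ hy0) (thetaProd_pow_zpow_ne_zero hq0 hq hs)
    (by rw [e2]; exact thetaProd_pow_zpow_ne_zero hq0 hq hs2)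
  rw [eq_add_of_sub_eq key, e2]
  simp only [thetaVal]
  have t1 := two_mul_triInt s
  have t2 := two_mul_triInt (2 * s)
  have x1 : q ^ (3 * (triInt s - 6 * s)) * (q ^ 11) ^ s =
      q ^ (triInt (2 * s) - 6 * (2 * s)) / q ^ (triInt s - 6 * s) := by
    rw [← zpow_sub₀ hq0, ← zpow_natCast, ← zpow_mul, ← zpow_add₀ hq0]
    congr 1; push_cast; linarith
  have x2 : q ^ (3 * (6 * s - triInt s)) * q ^ (3 * (triInt s - 6 * s)) = 1 := by
    rw [← zpow_add₀ hq0, show 3 * (6 * s - triInt s) + 3 * (triInt s - 6 * s) = 0 by ring,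
        zpow_zero]
  linear_combination (thetaLog (q ^ 121) ((q ^ 11) ^ s) + thetaLog (q ^ 121) ((q ^ 11) ^ (2 * s))) *
    x2 + q ^ (3 * (6 * s - triInt s)) * thetaProd (q ^ 121) ((q ^ 11) ^ (2 * s)) /
      thetaProd (q ^ 121) ((q ^ 11) ^ s) * appell 3 (q ^ 121) ((q ^ 11) ^ s) 1 * x1

theorem not_dvd_mul_of_prime {s k : ℤ} (hs : ¬ 11 ∣ s) (hk : ¬ 11 ∣ k) : ¬ 11 ∣ s * k := by
  have hp : Prime (11 : ℤ) := Int.prime_iff_natAbs_prime.2 (by norm_num)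
  exact fun h => (hp.dvd_or_dvd h).elim hs hk

/-- The weight-zero combination of theta quotients proportional to Euler's product. -/
noncomputable def eulerSum (T : ℤ → ℂ) : ℂ :=
  1 + ∑ k ∈ Finset.Icc (1 : ℕ) 5, (-1) ^ k * (T (2 * k) / T k)

theorem baseSeries_three_eq (hq0 : q ≠ 0) (hq : ‖q‖ < 1) {s : ℤ} (hs : ¬ 11 ∣ s) (hs' : Odd s)
    {T : ℤ → ℂ} (hT : T = fun k => thetaVal q (s * k)) :
    baseSeries 3 q s = -q ^ (3 * (6 * s - triInt s)) * appell 3 (q ^ 121) ((q ^ 11) ^ s) 1 *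
        eulerSum T - qPochInf (q ^ 121) (q ^ 121) ^ 2 * (∑ k ∈ Finset.Icc (2 : ℕ) 5,
          (-1) ^ k * (T k * T (2 * k) / (T 1 * T (1 + k) * T (1 - k)))) +
      (thetaLog (q ^ 121) ((q ^ 11) ^ s) + thetaLog (q ^ 121) ((q ^ 11) ^ (2 * s))) := by
  have hj : ∀ {k : ℤ}, ¬ 11 ∣ k → ¬ 11 ∣ s * k := fun hk => not_dvd_mul_of_prime hs hk
  have hI : Finset.Icc 1 5 = {1, 2, 3, 4, 5} := by decide
  have hI' : Finset.Icc 2 5 = {2, 3, 4, 5} := by decide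
  have key : ∀ k : ℤ, ¬ 11 ∣ k → ¬ 11 ∣ 2 * k → ¬ 11 ∣ 1 + k → ¬ 11 ∣ 1 - k →
      q ^ (3 * (6 * s - triInt s)) * (q ^ (3 * (triInt (s * k) - 6 * (s * k))) *
      (((q ^ 11) ^ (s * k)) ^ 3 * appell 3 (q ^ 121) ((q ^ 11) ^ s) ((q ^ 11) ^ (s * k)) +
        appell 3 (q ^ 121) ((q ^ 11) ^ s) ((q ^ 11) ^ (s * k))⁻¹)) =
    q ^ (3 * (6 * s - triInt s)) * (T (2 * k) / T k) * appell 3 (q ^ 121) ((q ^ 11) ^ s) 1 +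
      qPochInf (q ^ 121) (q ^ 121) ^ 2 * (T k * T (2 * k) / (T 1 * T (1 + k) * T (1 - k))) := by
    intro k h1 h2 h3 h4
    have e1 : s + s * k = s * (1 + k) := by ring
    have e2 : s - s * k = s * (1 - k) := by ring
    have e3 : 2 * (s * k) = s * (2 * k) := by ring
    rw [appell_three_thetaVal hq0 hq hs (hj h1) (by rw [e3]; exact hj h2) (by rw [e1]; exact hj h3)
      (by rw [e2]; exact hj h4), e1, e2, e3, hT]
    simp only [mul_one]
  have key1 := appell_three_thetaVal_self hq0 hq hs (by rw [mul_comm]; exact hj (by norm_num))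
  have k2 := key 2 (by norm_num) (by norm_num) (by norm_num) (by norm_num)
  have k3 := key 3 (by norm_num) (by norm_num) (by norm_num) (by norm_num)
  have k4 := key 4 (by norm_num) (by norm_num) (by norm_num) (by norm_num)
  have k5 := key 5 (by norm_num) (by norm_num) (by norm_num) (by norm_num)
  have t1 : T 1 = thetaVal q s := by rw [hT]; simp
  have t2 : T 2 = thetaVal q (2 * s) := by rw [hT, mul_comm]
  rw [← t1, ← t2] at key1
  rw [baseSeries_eq_pairs hq0 hq (by norm_num) hs hs', eulerSum, hI, hI']
  norm_num at k2 k3 k4 k5 key1 ⊢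
  linear_combination key1 - k2 + k3 - k4 + k5

theorem baseSeries_one_eq (hq0 : q ≠ 0) (hq : ‖q‖ < 1) {s : ℤ} (hs : ¬ 11 ∣ s) (hs' : Odd s)
    {T : ℤ → ℂ} (hT : T = fun k => thetaVal q (s * k)) :
    baseSeries 1 q s = -(qPochInf (q ^ 121) (q ^ 121) ^ 2 / T 1) -
        qPochInf (q ^ 121) (q ^ 121) ^ 2 * (∑ k ∈ Finset.Icc (2 : ℕ) 5,
          (-1) ^ k * (T 1 * T (2 * k) / (T k * T (1 + k) * T (1 - k)))) +
      (thetaLog (q ^ 121) ((q ^ 11) ^ (2 * s)) - thetaLog (q ^ 121) ((q ^ 11) ^ s)) := by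
  have hQ0 : q ^ 121 ≠ 0 := pow_ne_zero _ hq0
  have hQ : ‖q ^ 121‖ < 1 := norm_pow_lt_one hq (by norm_num)
  have hy0 : q ^ 11 ≠ 0 := pow_ne_zero _ hq0
  have hj : ∀ {k : ℤ}, ¬ 11 ∣ k → ¬ 11 ∣ s * k := fun hk => not_dvd_mul_of_prime hs hk
  have hI : Finset.Icc 1 5 = {1, 2, 3, 4, 5} := by decide
  have hI' : Finset.Icc 2 5 = {2, 3, 4, 5} := by decide
  have key : ∀ k : ℤ, ¬ 11 ∣ k → ¬ 11 ∣ 2 * k → ¬ 11 ∣ 1 + k → ¬ 11 ∣ 1 - k →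
      q ^ (6 * s - triInt s) * (q ^ (triInt (s * k) - 6 * (s * k)) *
      ((q ^ 11) ^ (s * k) * appell 1 (q ^ 121) ((q ^ 11) ^ s) ((q ^ 11) ^ (s * k)) +
        appell 1 (q ^ 121) ((q ^ 11) ^ s) ((q ^ 11) ^ (s * k))⁻¹)) =
      qPochInf (q ^ 121) (q ^ 121) ^ 2 * (T 1 * T (2 * k) / (T k * T (1 + k) * T (1 - k))) := by
    intro k h1 h2 h3 h4
    have e1 : s + s * k = s * (1 + k) := by ring
    have e2 : s - s * k = s * (1 - k) := by ring
    have e3 : 2 * (s * k) = s * (2 * k) := by ring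
    rw [appell_one_thetaVal hq0 hq (hj h1) (by rw [e3]; exact hj h2) (by rw [e1]; exact hj h3)
      (by rw [e2]; exact hj h4), e1, e2, e3, hT]
    simp only [mul_one]
  have e2 : ((q ^ 11) ^ s) ^ 2 = (q ^ 11) ^ (2 * s) := by
    rw [← zpow_natCast, ← zpow_mul]; congr 1; push_cast; ring
  have key1 := appell_one_pole (w := (q ^ 11) ^ s) hQ0 hQ
    (zpow_ne_zero _ hy0) (thetaProd_pow_zpow_ne_zero hq0 hq hs)
    (by rw [e2, mul_comm]; exact thetaProd_pow_zpow_ne_zero hq0 hq (hj (by norm_num)))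
  rw [e2] at key1
  have key0 := appell_one_one (z := (q ^ 11) ^ s) hQ0 hQ (zpow_ne_zero _ hy0)
    (pow_zpow_ne_one hq0 hq hs)
  have x2 : q ^ (6 * s - triInt s) * q ^ (triInt s - 6 * s) = 1 := by
    rw [← zpow_add₀ hq0, show 6 * s - triInt s + (triInt s - 6 * s) = 0 by ring, zpow_zero]
  have k2 := key 2 (by norm_num) (by norm_num) (by norm_num) (by norm_num)
  have k3 := key 3 (by norm_num) (by norm_num) (by norm_num) (by norm_num)
  have k4 := key 4 (by norm_num) (by norm_num) (by norm_num) (by norm_num)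
  have k5 := key 5 (by norm_num) (by norm_num) (by norm_num) (by norm_num)
  have k0 : q ^ (6 * s - triInt s) * appell 1 (q ^ 121) ((q ^ 11) ^ s) 1 =
      qPochInf (q ^ 121) (q ^ 121) ^ 2 / T 1 := by
    have n1 := thetaProd_pow_zpow_ne_zero hq0 hq hs
    have n2 : q ^ (triInt s - 6 * s) ≠ 0 := zpow_ne_zero _ hq0
    have t1 : T 1 = thetaVal q s := by rw [hT]; simp
    rw [key0, t1, thetaVal]
    field_simp
    linear_combination qPochInf (q ^ 121) (q ^ 121) ^ 2 * x2
  rw [baseSeries_eq_pairs hq0 hq (by norm_num) hs hs', hI, hI']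
  norm_num at k0 k2 k3 k4 k5 key1 ⊢
  linear_combination q ^ (6 * s - triInt s) * q ^ (triInt s - 6 * s) * key1 +
    (thetaLog (q ^ 121) ((q ^ 11) ^ (2 * s)) - thetaLog (q ^ 121) ((q ^ 11) ^ s)) * x2 - k0 - k2 +
        k3 - k4 + k5

end

namespace IsThetaSeq

variable {t : ℤ → ℂ}

theorem eleven_sub (h : IsThetaSeq t) (k : ℤ) : t (11 - k) = t k := by
  have := h.add_eleven (-k)
  rw [h.neg, neg_neg] at this
  rw [← this]; ring_nf

theorem thetaUnits (h : IsThetaSeq t) :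
    ThetaUnits (t 1) (t 2) (t 3) (t 4) (t 5) (t 3 * t 4 * t 5 / (t 1 ^ 2 * t 2))
      (t 4 * t 5 ^ 2 / (t 1 ^ 2 * t 3)) (t 3 * t 5 ^ 3 / (t 1 ^ 3 * t 2))
      (t 4 ^ 3 * t 5 / (t 1 ^ 3 * t 2)) (t 4 ^ 2 * t 5 ^ 3 / (t 1 ^ 2 * t 2 ^ 2 * t 3))
      (t 2 * t 4 * t 5 ^ 2 / t 1 ^ 4) := by
  have n₁ := h.ne_zero 1 (by decide)
  have n₂ := h.ne_zero 2 (by decide)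
  have n₃ := h.ne_zero 3 (by decide)
  have n₄ := h.ne_zero 4 (by decide)
  have n₅ := h.ne_zero 5 (by decide)
  have e6 : t 6 = t 5 := h.eleven_sub 5
  have e7 : t 7 = t 4 := h.eleven_sub 4
  have e8 : t 8 = t 3 := h.eleven_sub 3
  have e9 : t 9 = t 2 := h.eleven_sub 2
  have w1 := h.three_term 5 3 1 0
  have w2 := h.three_term 5 4 1 0
  have w3 := h.three_term 5 4 3 0
  have w4 := h.three_term 5 2 1 0
  norm_num [e6, e7, e8, e9] at w1 w2 w3 w4
  refine ⟨n₁, n₂, n₃, n₄, n₅, rfl, rfl, rfl, rfl, rfl, rfl, ?_, ?_, ?_, ?_, ?_⟩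
  · field_simp
    linear_combination w1
  · field_simp
    linear_combination -w2
  · field_simp
    linear_combination t 4 * t 5 * w3 - t 2 * t 3 * w2
  · field_simp
    linear_combination -w4
  · field_simp
    linear_combination t 3 * t 5 ^ 2 * (t 5 * t 2 * w2 + t 4 ^ 2 * w1)

end IsThetaSeq

section

variable {q : ℂ}

/-- The logarithmic derivative of the theta function at a power of `q`, normalized to be odd and
periodic. -/
noncomputable def zetaVal (q : ℂ) (k : ℤ) : ℂ :=
  thetaLog (q ^ 121) ((q ^ 11) ^ k) + (2 * k - 11) / 22

theorem zetaVal_neg (hq0 : q ≠ 0) (hq : ‖q‖ < 1) {k : ℤ} (hk : ¬ 11 ∣ k) :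
    zetaVal q (-k) = -zetaVal q k := by
  rw [zetaVal, zetaVal, zpow_neg, thetaLog_inv (norm_pow_lt_one hq (by norm_num))
    (zpow_ne_zero _ (pow_ne_zero _ hq0)) (thetaProd_pow_zpow_ne_zero hq0 hq hk)]
  push_cast
  ring

theorem zetaVal_add_eleven (hq0 : q ≠ 0) (hq : ‖q‖ < 1) {k : ℤ} (hk : ¬ 11 ∣ k) :
    zetaVal q (k + 11) = zetaVal q k := by
  have e : (q ^ 11) ^ (k + 11) = (q ^ 11) ^ k * q ^ 121 := by
    rw [zpow_add₀ (pow_ne_zero _ hq0)]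
    congr 1
    norm_cast
    rw [← pow_mul]
  rw [zetaVal, zetaVal, e, thetaLog_mul_self (pow_ne_zero _ hq0) (norm_pow_lt_one hq (by norm_num))
    (zpow_ne_zero _ (pow_ne_zero _ hq0)) (thetaProd_pow_zpow_ne_zero hq0 hq hk)]
  push_cast
  ring

theorem zetaVal_add_eleven_mul (hq0 : q ≠ 0) (hq : ‖q‖ < 1) {k : ℤ} (hk : ¬ 11 ∣ k) (s : ℤ) :
    zetaVal q (k + 11 * s) = zetaVal q k := by
  induction s using Int.induction_on with
  | zero => simp
  | succ i ih =>
    rw [← ih, ← zetaVal_add_eleven hq0 hq (k := k + 11 * i) (by omega)]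
    congr 1; ring
  | pred i ih =>
    rw [← ih, ← zetaVal_add_eleven hq0 hq (k := k + 11 * (-i - 1)) (by omega)]
    congr 1; ring

theorem zetaVal_eleven_sub (hq0 : q ≠ 0) (hq : ‖q‖ < 1) {s k : ℤ} (hs : ¬ 11 ∣ s) (hk : ¬ 11 ∣ k) :
    zetaVal q (s * (11 - k)) = -zetaVal q (s * k) := by
  have h : ¬ 11 ∣ s * k := not_dvd_mul_of_prime hs hk
  rw [← zetaVal_neg hq0 hq h, ← zetaVal_add_eleven_mul hq0 hq (by omega : ¬ 11 ∣ -(s * k)) s]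
  congr 1; ring

theorem zetaVal_add (hq0 : q ≠ 0) (hq : ‖q‖ < 1) {a b : ℤ} (ha : ¬ 11 ∣ a) (h1 : ¬ 11 ∣ a + b)
    (h2 : ¬ 11 ∣ a - b) :
    zetaVal q (a + b) + zetaVal q (a - b) - 2 * zetaVal q a =
      -(qPochInf (q ^ 121) (q ^ 121) ^ 2 * (thetaVal q (2 * a) * thetaVal q b ^ 2 /
        (thetaVal q a ^ 2 * thetaVal q (a + b) * thetaVal q (a - b)))) := by
  have hQ0 : q ^ 121 ≠ 0 := pow_ne_zero _ hq0
  have hQ : ‖q ^ 121‖ < 1 := norm_pow_lt_one hq (by norm_num)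
  have hy0 : q ^ 11 ≠ 0 := pow_ne_zero _ hq0
  have e2 : ((q ^ 11) ^ a) ^ 2 = (q ^ 11) ^ (2 * a) := by
    rw [← zpow_natCast, ← zpow_mul]; congr 1; push_cast; ring
  have e3 : (q ^ 11) ^ a * (q ^ 11) ^ b = (q ^ 11) ^ (a + b) := (zpow_add₀ hy0 _ _).symm
  have e4 : (q ^ 11) ^ a / (q ^ 11) ^ b = (q ^ 11) ^ (a - b) := (zpow_sub₀ hy0 _ _).symm
  have key := thetaLog_add (b := (q ^ 11) ^ b) (c := (q ^ 11) ^ a) hQ0 hQ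
    (zpow_ne_zero _ hy0) (zpow_ne_zero _ hy0)
    (thetaProd_pow_zpow_ne_zero hq0 hq ha) (by rw [e3]; exact thetaProd_pow_zpow_ne_zero hq0 hq h1)
    (by rw [e4]; exact thetaProd_pow_zpow_ne_zero hq0 hq h2)
  rw [e2, e3, e4] at key
  have t1 := two_mul_triInt a
  have t2 := two_mul_triInt (2 * a)
  have t3 := two_mul_triInt b
  have t4 := two_mul_triInt (a + b)
  have t5 := two_mul_triInt (a - b)
  have x2 : (q ^ 11) ^ (a - b) = q ^ (triInt (2 * a) - 6 * (2 * a)) * (q ^ (triInt b - 6 * b)) ^ 2 /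
      ((q ^ (triInt a - 6 * a)) ^ 2 * q ^ (triInt (a + b) - 6 * (a + b)) *
        q ^ (triInt (a - b) - 6 * (a - b))) := by
    rw [← zpow_natCast, ← zpow_natCast, ← zpow_natCast, ← zpow_mul, ← zpow_mul, ← zpow_mul,
      ← zpow_add₀ hq0, ← zpow_add₀ hq0, ← zpow_add₀ hq0, ← zpow_sub₀ hq0]
    congr 1; push_cast; linarith
  simp only [zetaVal, thetaVal]
  push_cast
  linear_combination key - qPochInf (q ^ 121) (q ^ 121) ^ 2 *
    thetaProd (q ^ 121) ((q ^ 11) ^ (2 * a)) * thetaProd (q ^ 121) ((q ^ 11) ^ b) ^ 2 /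
      (thetaProd (q ^ 121) ((q ^ 11) ^ a) ^ 2 * thetaProd (q ^ 121) ((q ^ 11) ^ (a + b)) *
        thetaProd (q ^ 121) ((q ^ 11) ^ (a - b))) * x2

/-- The five instances of `zetaVal_add` needed below. -/
theorem zetaVal_relations (hq0 : q ≠ 0) (hq : ‖q‖ < 1) {s : ℤ} (hs : ¬ 11 ∣ s)
    (hs' : Odd s) {T : ℤ → ℂ} (hT : T = fun k => thetaVal q (s * k)) {d : ℂ}
    (hd : d = qPochInf (q ^ 121) (q ^ 121) ^ 2) :
    11 * zetaVal q s = d * (-(T 3 ^ 2 / (T 1 ^ 2 * T 4)) - T 2 * T 4 ^ 2 / (T 1 ^ 2 * T 3 * T 5) -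
      T 2 * T 5 / (T 1 ^ 2 * T 4) - 3 / 2 * (T 2 ^ 3 / (T 1 ^ 3 * T 3)) -
        1 / 2 * (T 1 * T 4 / (T 2 ^ 2 * T 3))) ∧
    11 * zetaVal q (s * 2) = d * (-2 * (T 3 ^ 2 / (T 1 ^ 2 * T 4)) -
      2 * (T 2 * T 4 ^ 2 / (T 1 ^ 2 * T 3 * T 5)) -
      2 * (T 2 * T 5 / (T 1 ^ 2 * T 4)) + 5 / 2 * (T 2 ^ 3 / (T 1 ^ 3 * T 3)) +
        9 / 2 * (T 1 * T 4 / (T 2 ^ 2 * T 3))) := by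
  have hts : IsThetaSeq T := by rw [hT]; exact (isThetaSeq_thetaVal hq0 hq).comp_mul hs' hs
  have e6 : T 6 = T 5 := hts.eleven_sub 5
  have m1 := hts.neg 1
  have m2 := hts.neg 2
  have m3 := hts.neg 3
  have m4 := hts.neg 4
  have z4 := zetaVal_eleven_sub hq0 hq (k := 5) hs (by norm_num)
  have z1 := zetaVal_neg hq0 hq (k := s * 1) (not_dvd_mul_of_prime hs (by norm_num))
  have z2 := zetaVal_neg hq0 hq (k := s * 2) (not_dvd_mul_of_prime hs (by norm_num))
  have z3 := zetaVal_neg hq0 hq (k := s * 3) (not_dvd_mul_of_prime hs (by norm_num))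
  have z5 := zetaVal_neg hq0 hq (k := s * 4) (not_dvd_mul_of_prime hs (by norm_num))
  have key : ∀ a b : ℤ, ¬ 11 ∣ a → ¬ 11 ∣ a + b → ¬ 11 ∣ a - b →
      zetaVal q (s * (a + b)) + zetaVal q (s * (a - b)) - 2 * zetaVal q (s * a) =
      -(d * (T (2 * a) * T b ^ 2 / (T a ^ 2 * T (a + b) * T (a - b)))) := by
    intro a b h1 h2 h3
    have := zetaVal_add hq0 hq (a := s * a) (b := s * b) (not_dvd_mul_of_prime hs h1)
      (by rw [← mul_add]; exact not_dvd_mul_of_prime hs h2)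
      (by rw [← mul_sub]; exact not_dvd_mul_of_prime hs h3)
    rw [hd, hT, mul_add, mul_sub, this]
    simp only
    rw [mul_add, mul_sub, mul_left_comm 2 s a]
  have k13 := key 1 3 (by norm_num) (by norm_num) (by norm_num)
  have k14 := key 1 4 (by norm_num) (by norm_num) (by norm_num)
  have k15 := key 1 5 (by norm_num) (by norm_num) (by norm_num)
  have k12 := key 1 2 (by norm_num) (by norm_num) (by norm_num)
  have k21 := key 2 1 (by norm_num) (by norm_num) (by norm_num)
  clear key
  have n₁ := hts.ne_zero 1 (by decide)
  have n₂ := hts.ne_zero 2 (by decide)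
  have n₃ := hts.ne_zero 3 (by decide)
  have n₄ := hts.ne_zero 4 (by decide)
  have n₅ := hts.ne_zero 5 (by decide)
  norm_num at k13 k14 k15 k12 k21 z4 z1 z2 z3 z5 m1 m2 m3 m4
  norm_num [z1, z2, z3, z4, z5, m1, m2, m3, m4, e6] at k13 k14 k15 k12 k21
  have r15 : T 2 * T 5 ^ 2 / (T 1 ^ 2 * T 5 * T 4) = T 2 * T 5 / (T 1 ^ 2 * T 4) := by
    field_simp
  have r14 : T 2 * T 4 ^ 2 / (T 1 ^ 2 * T 5 * T 3) = T 2 * T 4 ^ 2 / (T 1 ^ 2 * T 3 * T 5) := by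
    ring
  have r13 : T 2 * T 3 ^ 2 / (T 1 ^ 2 * T 4 * T 2) = T 3 ^ 2 / (T 1 ^ 2 * T 4) := by
    field_simp
  have r12 : T 2 * T 2 ^ 2 / (T 1 ^ 2 * T 3 * T 1) = T 2 ^ 3 / (T 1 ^ 3 * T 3) := by
    field_simp
  have r21 : T 4 * T 1 ^ 2 / (T 2 ^ 2 * T 3 * T 1) = T 1 * T 4 / (T 2 ^ 2 * T 3) := by
    field_simp
  simp only [div_neg, mul_neg, neg_neg] at k13 k14 k15 k12 k21
  rw [r13] at k13
  rw [r14] at k14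
  rw [r15] at k15
  rw [r12] at k12
  rw [r21] at k21
  constructor
  · linear_combination -k13 - k14 - k15 - 3 / 2 * k12 + 1 / 2 * k21
  · linear_combination -2 * k13 - 2 * k14 - 2 * k15 + 5 / 2 * k12 - 9 / 2 * k21

theorem eleven_mul_baseSeries_three (hq0 : q ≠ 0) (hq : ‖q‖ < 1) {s : ℤ} (hs : ¬ 11 ∣ s)
    (hs' : Odd s) {T : ℤ → ℂ} (hT : T = fun k => thetaVal q (s * k)) :
    11 * baseSeries 3 q s + (3 * s - 11) = -11 * (q ^ (3 * (6 * s - triInt s)) *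
      appell 3 (q ^ 121) ((q ^ 11) ^ s) 1 * eulerSum T) + qPochInf (q ^ 121) (q ^ 121) ^ 2 *
      (11 * (T 2 * T 4 / (T 1 ^ 2 * T 3)) - 11 * (T 3 * T 5 / (T 1 * T 2 * T 4)) +
        11 * (T 4 / (T 1 * T 5)) - 11 * (1 / T 4) - 3 * (T 3 ^ 2 / (T 1 ^ 2 * T 4)) -
        3 * (T 2 * T 4 ^ 2 / (T 1 ^ 2 * T 3 * T 5)) - 3 * (T 2 * T 5 / (T 1 ^ 2 * T 4)) +
        T 2 ^ 3 / (T 1 ^ 3 * T 3) + 4 * (T 1 * T 4 / (T 2 ^ 2 * T 3))) := by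
  have hts : IsThetaSeq T := by rw [hT]; exact (isThetaSeq_thetaVal hq0 hq).comp_mul hs' hs
  obtain ⟨z1, z2⟩ := zetaVal_relations hq0 hq hs hs' hT rfl
  rw [baseSeries_three_eq hq0 hq hs hs' hT, show Finset.Icc 2 5 = {2, 3, 4, 5} by decide]
  have e6 : T 6 = T 5 := hts.eleven_sub 5
  have e8 : T 8 = T 3 := hts.eleven_sub 3
  have e10 : T 10 = T 1 := hts.eleven_sub 1
  have m1 := hts.neg 1
  have m2 := hts.neg 2
  have m3 := hts.neg 3
  have m4 := hts.neg 4
  have n₁ := hts.ne_zero 1 (by decide)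
  have n₂ := hts.ne_zero 2 (by decide)
  have n₃ := hts.ne_zero 3 (by decide)
  have n₄ := hts.ne_zero 4 (by decide)
  have n₅ := hts.ne_zero 5 (by decide)
  rw [zetaVal] at z1 z2
  have r2 : T 2 * T 4 / (T 1 * T 3 * T 1) = T 2 * T 4 / (T 1 ^ 2 * T 3) := by ring
  have r3 : T 3 * T 5 / (T 1 * T 4 * T 2) = T 3 * T 5 / (T 1 * T 2 * T 4) := by ring
  have r4 : T 4 * T 3 / (T 1 * T 5 * T 3) = T 4 / (T 1 * T 5) := by field_simp
  have r5 : T 5 * T 1 / (T 1 * T 5 * T 4) = 1 / T 4 := by field_simp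
  rw [mul_comm s 2] at z2
  push_cast at z2
  norm_num [m1, m2, m3, m4, e6, e8, e10]
  simp only [div_neg, neg_neg, r2, r3, r4, r5]
  norm_num
  linear_combination z1 + z2

theorem eleven_mul_baseSeries_one (hq0 : q ≠ 0) (hq : ‖q‖ < 1) {s : ℤ} (hs : ¬ 11 ∣ s)
    (hs' : Odd s) {T : ℤ → ℂ} (hT : T = fun k => thetaVal q (s * k)) :
    11 * baseSeries 1 q s + s = qPochInf (q ^ 121) (q ^ 121) ^ 2 *
      (11 * (T 4 / (T 2 * T 3)) - 11 * (T 1 * T 5 / (T 2 * T 3 * T 4)) +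
        11 * (T 1 / (T 4 * T 5)) - 11 * (T 1 ^ 2 / (T 4 * T 5 ^ 2)) - 11 / T 1 -
        T 3 ^ 2 / (T 1 ^ 2 * T 4) -
        T 2 * T 4 ^ 2 / (T 1 ^ 2 * T 3 * T 5) - T 2 * T 5 / (T 1 ^ 2 * T 4) +
        4 * (T 2 ^ 3 / (T 1 ^ 3 * T 3)) + 5 * (T 1 * T 4 / (T 2 ^ 2 * T 3))) := by
  have hts : IsThetaSeq T := by rw [hT]; exact (isThetaSeq_thetaVal hq0 hq).comp_mul hs' hs
  obtain ⟨z1, z2⟩ := zetaVal_relations hq0 hq hs hs' hT rfl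
  rw [baseSeries_one_eq hq0 hq hs hs' hT, show Finset.Icc 2 5 = {2, 3, 4, 5} by decide]
  have e6 : T 6 = T 5 := hts.eleven_sub 5
  have e8 : T 8 = T 3 := hts.eleven_sub 3
  have e10 : T 10 = T 1 := hts.eleven_sub 1
  have m1 := hts.neg 1
  have m2 := hts.neg 2
  have m3 := hts.neg 3
  have m4 := hts.neg 4
  have n₁ := hts.ne_zero 1 (by decide)
  have n₂ := hts.ne_zero 2 (by decide)
  have n₃ := hts.ne_zero 3 (by decide)
  have n₄ := hts.ne_zero 4 (by decide)
  have n₅ := hts.ne_zero 5 (by decide)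
  rw [zetaVal] at z1 z2
  have r2 : T 1 * T 4 / (T 2 * T 3 * T 1) = T 4 / (T 2 * T 3) := by field_simp
  have r3 : T 1 * T 5 / (T 3 * T 4 * T 2) = T 1 * T 5 / (T 2 * T 3 * T 4) := by ring
  have r4 : T 1 * T 3 / (T 4 * T 5 * T 3) = T 1 / (T 4 * T 5) := by field_simp
  have r5 : T 1 * T 1 / (T 5 * T 5 * T 4) = T 1 ^ 2 / (T 4 * T 5 ^ 2) := by ring
  rw [mul_comm s 2] at z2
  push_cast at z2
  norm_num [m1, m2, m3, m4, e6, e8, e10]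
  simp only [div_neg, neg_neg, r2, r3, r4, r5]
  linear_combination z2 - z1

end

section

variable {Q : ℂ}

theorem qPoch_three_mul (x : ℂ) (N : ℕ) : qPoch Q x (3 * N) =
    qPoch (Q ^ 3) x N * qPoch (Q ^ 3) (x * Q) N * qPoch (Q ^ 3) (x * Q ^ 2) N := by
  induction N with
  | zero => simp [qPoch]
  | succ N ih =>
    rw [show 3 * (N + 1) = 3 * N + 1 + 1 + 1 by ring]
    simp only [qPoch_succ, ih]
    ring

theorem qPochInf_eq_three (hQ : ‖Q‖ < 1) (x : ℂ) : qPochInf Q x =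
    qPochInf (Q ^ 3) x * qPochInf (Q ^ 3) (x * Q) * qPochInf (Q ^ 3) (x * Q ^ 2) := by
  have h3 : ‖Q ^ 3‖ < 1 := norm_pow_lt_one hQ (by norm_num)
  refine tendsto_nhds_unique ((tendsto_qPoch hQ x).comp
    (tendsto_id.const_mul_atTop' (r := 3) (by norm_num))) ?_
  refine (((tendsto_qPoch h3 x).mul (tendsto_qPoch h3 (x * Q))).mul
    (tendsto_qPoch h3 (x * Q ^ 2))).congr fun N => ?_
  simp [qPoch_three_mul]

/-- A cubic theta series. -/
noncomputable def cubeSum (Q w : ℂ) (j : ℤ) : ℂ :=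
  ∑' m : ℤ, (-w ^ 3) ^ m * (Q ^ triInt m) ^ 3 * (Q ^ m) ^ j

theorem cubeSum_term (w : ℂ) (j m : ℤ) :
    (-w ^ 3) ^ m * (Q ^ triInt m) ^ 3 * (Q ^ m) ^ j =
    (-(w ^ 3 * Q ^ j)) ^ m * (Q ^ 3) ^ triInt m := by
  rw [← neg_mul, mul_zpow, pow_triInt, ← zpow_mul, ← zpow_mul, mul_comm m j]
  ring

theorem summable_cubeSum (hQ0 : Q ≠ 0) (hQ : ‖Q‖ < 1) {w : ℂ} (hw : w ≠ 0) (j : ℤ) :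
    Summable fun m : ℤ => ‖(-w ^ 3) ^ m * (Q ^ triInt m) ^ 3 * (Q ^ m) ^ j‖ := by
  simp only [cubeSum_term]
  exact summable_zpow_mul_triInt (neg_ne_zero.2 (mul_ne_zero (pow_ne_zero _ hw)
    (zpow_ne_zero _ hQ0))) (pow_ne_zero _ hQ0) (norm_pow_lt_one hQ (by norm_num))

theorem cubeSum_one (hQ0 : Q ≠ 0) (hQ : ‖Q‖ < 1) : cubeSum Q 1 (-2) = qPochInf Q Q := by
  rw [qPochInf_eq_three hQ, cubeSum]
  have key := qPochInf_mul_thetaProd (Q := Q ^ 3) (x := Q) (pow_ne_zero _ hQ0)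
    (norm_pow_lt_one hQ (by norm_num)) hQ0
  rw [thetaProd, show Q ^ 3 / Q = Q * Q by field_simp] at key
  rw [show Q * Q ^ 2 = Q ^ 3 by ring]
  simp only [cubeSum_term]
  have e : -Q / Q ^ 3 = -(1 ^ 3 * Q ^ (-2 : ℤ)) := by
    rw [one_pow, one_mul, zpow_neg, show (2 : ℤ) = (2 : ℕ) from rfl, zpow_natCast]
    field_simp
  rw [e] at key
  rw [← key]
  ring

theorem appell_three_shift (hQ0 : Q ≠ 0) (hQ : ‖Q‖ < 1) {z w : ℂ} (hz : z ≠ 0) (hw : w ≠ 0)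
    (h : ∀ n : ℤ, z * w * Q ^ n ≠ 1) :
    appell 3 Q (z * Q) w + z ^ 3 * appell 3 Q z w =
      -((w ^ 3)⁻¹ * cubeSum Q w (-3) + z * (w ^ 2)⁻¹ * cubeSum Q w (-2) +
        z ^ 2 * w⁻¹ * cubeSum Q w (-1)) := by
  have s1 := (summable_appell hQ0 hQ (e := 3) (by norm_num) (mul_ne_zero hz hQ0) hw)
  have s2 := (summable_appell hQ0 hQ (e := 3) (by norm_num) hz hw)
  rw [appell, ← (Equiv.subRight (1 : ℤ)).tsum_eq]
  rw [← (Equiv.subRight (1 : ℤ)).summable_iff] at s1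
  rw [appell, cubeSum, cubeSum, cubeSum, ← tsum_mul_left, ← tsum_mul_left, ← tsum_mul_left,
    ← tsum_mul_left]
  have c1 := (summable_cubeSum hQ0 hQ hw (-3)).of_norm.mul_left (w ^ 3)⁻¹
  have c2 := (summable_cubeSum hQ0 hQ hw (-2)).of_norm.mul_left (z * (w ^ 2)⁻¹)
  have c3 := (summable_cubeSum hQ0 hQ hw (-1)).of_norm.mul_left (z ^ 2 * w⁻¹)
  have s1' : Summable fun n : ℤ => (-w ^ 3) ^ (Equiv.subRight (1 : ℤ) n) *
      ((Q ^ triInt (Equiv.subRight (1 : ℤ) n)) ^ 3) /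
        (1 - z * Q * w * Q ^ (Equiv.subRight (1 : ℤ) n)) := s1
  rw [← (Summable.tsum_add s1' (s2.mul_left (z ^ 3))), ← c1.tsum_add c2, ← (c1.add c2).tsum_add c3,
    ← tsum_neg]
  refine tsum_congr fun n => ?_
  have hd : 1 - z * w * Q ^ n ≠ 0 := by rw [Ne, sub_eq_zero]; exact fun hh => h n hh.symm
  have e1 : triInt (n - 1) = triInt n - n := by
    have := two_mul_triInt n; have := two_mul_triInt (n - 1); linarith
  have hQn : Q ^ n ≠ 0 := zpow_ne_zero _ hQ0
  have e2 : Q ^ (n - 1) * Q = Q ^ n := by rw [← zpow_add_one₀ hQ0]; congr 1; ring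
  have hd' : 1 - z * Q * w * Q ^ (n - 1) = 1 - z * w * Q ^ n := by
    rw [← e2]; ring
  simp only [Equiv.subRight_apply]
  rw [hd', e1, zpow_sub₀ hQ0, zpow_sub₀ (neg_ne_zero.2 (pow_ne_zero 3 hw)), zpow_one, zpow_neg,
    zpow_neg, zpow_neg]
  norm_cast
  generalize Q ^ triInt n = a
  generalize (-w ^ 3) ^ n = b
  generalize Q ^ n = c at hd hQn ⊢
  generalize hD : 1 - z * w * c = d at hd ⊢
  field_simp
  rw [← hD]
  ring

/-- The quintuple product identity. -/
theorem cubeSum_add {q : ℂ} (hq0 : q ≠ 0) (hq : ‖q‖ < 1) {j : ℤ} (hj : ¬ 11 ∣ j)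
    (hj2 : ¬ 11 ∣ 2 * j) :
    (q ^ 11) ^ j * cubeSum (q ^ 121) ((q ^ 11) ^ j) (-2) +
      ((q ^ 11) ^ j) ^ 2 * cubeSum (q ^ 121) ((q ^ 11) ^ j)⁻¹ (-2) =
    (q ^ 11) ^ j * thetaProd (q ^ 121) ((q ^ 11) ^ (2 * j)) / thetaProd (q ^ 121) ((q ^ 11) ^ j) *
      qPochInf (q ^ 121) (q ^ 121) := by
  have hQ0 : q ^ 121 ≠ 0 := pow_ne_zero _ hq0
  have hQ : ‖q ^ 121‖ < 1 := norm_pow_lt_one hq (by norm_num)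
  have hy0 : q ^ 11 ≠ 0 := pow_ne_zero _ hq0
  have hnq : ‖q‖ ≠ 0 := norm_ne_zero_iff.2 hq0
  set w := (q ^ 11) ^ j with hw
  have hw0 : w ≠ 0 := zpow_ne_zero _ hy0
  have e2 : w ^ 2 = (q ^ 11) ^ (2 * j) := by
    rw [hw, ← zpow_natCast, ← zpow_mul]; congr 1; push_cast; ring
  rw [← e2]
  have hθ2 : thetaProd (q ^ 121) (w ^ 2) ≠ 0 := by
    rw [e2]; exact thetaProd_pow_zpow_ne_zero hq0 hq hj2
  have hθ : thetaProd (q ^ 121) w ≠ 0 := thetaProd_pow_zpow_ne_zero hq0 hq hj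
  have hnode : ∀ u : ℂ, ‖u‖ = 1 → ∀ a n : ℤ, q * u * (q ^ 11) ^ a * (q ^ 121) ^ n ≠ 1 := by
    intro u hu a n h
    have h1 : ‖q‖ ^ (1 + 11 * a + 121 * n) = 1 := by
      have := congrArg norm h
      rw [norm_mul, norm_mul, norm_mul, hu, norm_zpow, norm_zpow, norm_pow, norm_pow, norm_one,
        mul_one] at this
      rw [zpow_add₀ hnq, zpow_add₀ hnq, zpow_mul, zpow_mul, zpow_one]
      exact_mod_cast this
    rw [zpow_eq_one_iff_right₀ (norm_nonneg _) hq.ne] at h1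
    omega
  have hz : ∀ u : ℂ, ‖u‖ = 1 → ∀ a : ℤ, thetaProd (q ^ 121) (q * u * (q ^ 11) ^ a) ≠ 0 :=
    fun u hu a => thetaProd_ne_zero hQ0 hQ (hnode u hu a)
  set κ := w * thetaProd (q ^ 121) (w ^ 2) / thetaProd (q ^ 121) w with hκ
  have main : ∀ u : ℂ, ‖u‖ = 1 →
      (cubeSum (q ^ 121) w (-3) + w ^ 3 * cubeSum (q ^ 121) w⁻¹ (-3) -
        κ * cubeSum (q ^ 121) 1 (-3)) +
      q * u * (w * cubeSum (q ^ 121) w (-2) + w ^ 2 * cubeSum (q ^ 121) w⁻¹ (-2) -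
        κ * cubeSum (q ^ 121) 1 (-2)) +
      (q * u) ^ 2 * (w ^ 2 * cubeSum (q ^ 121) w (-1) + w * cubeSum (q ^ 121) w⁻¹ (-1) -
        κ * cubeSum (q ^ 121) 1 (-1)) = 0 := by
    intro u hu
    have hu0 : u ≠ 0 := norm_ne_zero_iff.1 (by rw [hu]; exact one_ne_zero)
    set z := q * u with hzu
    have hz0 : z ≠ 0 := mul_ne_zero hq0 hu0
    have hn0 : ∀ n : ℤ, z * (q ^ 121) ^ n ≠ 1 := fun n => by simpa using hnode u hu 0 n
    have hn1 : ∀ n : ℤ, z * w * (q ^ 121) ^ n ≠ 1 := hnode u hu j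
    have hn2 : ∀ n : ℤ, z * w⁻¹ * (q ^ 121) ^ n ≠ 1 := fun n => by
      have := hnode u hu (-j) n
      rwa [zpow_neg, ← hw] at this
    have hshift : ∀ x : ℂ, (∀ n : ℤ, x * (q ^ 121) ^ n ≠ 1) →
        ∀ n : ℤ, x * q ^ 121 * (q ^ 121) ^ n ≠ 1 := fun x hx n hxn => hx (1 + n) (by
      rw [zpow_add₀ hQ0, zpow_one, ← mul_assoc]; exact hxn)
    have r1 := appell_three_relation (w := w) (z := z) hQ0 hQ hz0 hw0 hn0
      (pow_zpow_ne_one hq0 hq hj) (by rw [e2]; exact pow_zpow_ne_one hq0 hq hj2) hn1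
      (by simpa [div_eq_mul_inv] using hn2)
    have r2 := appell_three_relation (w := w) (z := z * q ^ 121) hQ0 hQ (mul_ne_zero hz0 hQ0) hw0
      (hshift z hn0) (pow_zpow_ne_one hq0 hq hj) (by rw [e2]; exact pow_zpow_ne_one hq0 hq hj2)
      (by rw [mul_right_comm]; exact hshift _ hn1)
      (by rw [mul_div_right_comm, div_eq_mul_inv]; exact hshift _ hn2)
    rw [show z * q ^ 121 * w = z * w * q ^ 121 by ring,
      show z * q ^ 121 / w = z / w * q ^ 121 by ring,
      thetaProd_mul_self hQ0 hQ hz0, thetaProd_mul_self hQ0 hQ (mul_ne_zero hz0 hw0),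
      thetaProd_mul_self hQ0 hQ (div_ne_zero hz0 hw0)] at r2
    have a1 := appell_three_shift hQ0 hQ hz0 hw0 hn1
    have a2 := appell_three_shift hQ0 hQ hz0 (inv_ne_zero hw0) hn2
    have a3 := appell_three_shift hQ0 hQ hz0 one_ne_zero (by simpa using hn0)
    rw [← hκ] at r1 r2
    have f0 : thetaProd (q ^ 121) z ≠ 0 := thetaProd_ne_zero hQ0 hQ hn0
    have f1 : thetaProd (q ^ 121) (z * w) ≠ 0 := thetaProd_ne_zero hQ0 hQ hn1
    have f2 : thetaProd (q ^ 121) (z / w) ≠ 0 :=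
      thetaProd_ne_zero hQ0 hQ (by simpa [div_eq_mul_inv] using hn2)
    have hR : qPochInf (q ^ 121) (q ^ 121) ^ 2 * thetaProd (q ^ 121) w *
        thetaProd (q ^ 121) (w ^ 2) /
        (-z⁻¹ * thetaProd (q ^ 121) z * (-(z * w)⁻¹ * thetaProd (q ^ 121) (z * w)) *
          (-(z / w)⁻¹ * thetaProd (q ^ 121) (z / w))) =
      -z ^ 3 * (qPochInf (q ^ 121) (q ^ 121) ^ 2 * thetaProd (q ^ 121) w *
        thetaProd (q ^ 121) (w ^ 2) / (thetaProd (q ^ 121) z * thetaProd (q ^ 121) (z * w) *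
          thetaProd (q ^ 121) (z / w))) := by
      field_simp
    rw [hR, ← r1] at r2
    clear hR r1
    have i1 : w ^ 3 * (w ^ 3)⁻¹ = 1 := mul_inv_cancel₀ (pow_ne_zero _ hw0)
    have i2 : w ^ 3 * (w ^ 2)⁻¹ = w := by field_simp
    have i3 : w ^ 3 * w⁻¹ = w ^ 2 := by field_simp
    simp only [inv_pow, inv_inv, one_pow, inv_one, one_mul, mul_one] at a1 a2 a3
    linear_combination -(r2 - w ^ 3 * a1 - a2 + κ * a3) - cubeSum (q ^ 121) w (-3) * i1 -
      z * cubeSum (q ^ 121) w (-2) * i2 - z ^ 2 * cubeSum (q ^ 121) w (-1) * i3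
  have m1 := main 1 (by simp)
  have m2 := main (-1) (by simp)
  have h : q * (w * cubeSum (q ^ 121) w (-2) + w ^ 2 * cubeSum (q ^ 121) w⁻¹ (-2) -
      κ * cubeSum (q ^ 121) 1 (-2)) = 0 := by
    linear_combination (m1 - m2) / 2
  rw [cubeSum_one hQ0 hQ] at h
  exact sub_eq_zero.1 ((mul_eq_zero.1 h).resolve_left hq0)

end

section

variable {q : ℂ}

theorem eulerSum_eq {t : ℤ → ℂ} (h : IsThetaSeq t) : eulerSum t =
    1 + (-(t 2 / t 1)) + t 4 / t 2 + (-(t 5 / t 3)) + t 3 / t 4 + (-(t 1 / t 5)) := by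
  have e6 : t 6 = t 5 := h.eleven_sub 5
  have e8 : t 8 = t 3 := h.eleven_sub 3
  have e10 : t 10 = t 1 := h.eleven_sub 1
  rw [eulerSum, show Finset.Icc 1 5 = {1, 2, 3, 4, 5} by decide]
  norm_num [e6, e8, e10]
  ring

theorem cubeSum_fiber (hq0 : q ≠ 0) (k m : ℤ) :
    (-1 : ℂ) ^ (2 - k - 11 * m) * q ^ (3 * triInt (2 - k - 11 * m) - 2 * (2 - k - 11 * m)) =
      (-1) ^ k * q ^ (5 + (3 * triInt k - 7 * k)) *
        ((-((q ^ 11) ^ k) ^ 3) ^ m * ((q ^ 121) ^ triInt m) ^ 3 * ((q ^ 121) ^ m) ^ (-2 : ℤ)) := by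
  have hs : (-1 : ℂ) ^ (2 - k - 11 * m) = (-1) ^ k * (-1) ^ m := by
    rw [show 2 - k - 11 * m = k + m + 2 * (1 - k - 6 * m) by ring, zpow_add₀ (by norm_num),
      zpow_add₀ (by norm_num), zpow_mul (-1 : ℂ) 2]
    norm_num
  rw [hs, ← neg_one_mul (((q ^ 11) ^ k) ^ 3), mul_zpow (-1 : ℂ)]
  simp only [← zpow_natCast, ← zpow_mul]
  rw [show (-1 : ℂ) ^ k * (-1) ^ m * q ^ (3 * triInt (2 - k - 11 * m) - 2 * (2 - k - 11 * m)) =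
    (-1) ^ k * (-1) ^ m * (q ^ (5 + (3 * triInt k - 7 * k)) * q ^ (((11 : ℕ) : ℤ) * k * (3 : ℕ) *
        m) *
      q ^ (((121 : ℕ) : ℤ) * triInt m * (3 : ℕ)) * q ^ (((121 : ℕ) : ℤ) * m * -2)) by
    rw [← zpow_add₀ hq0, ← zpow_add₀ hq0, ← zpow_add₀ hq0]
    congr 2
    have h1 := two_mul_triInt (2 - k - 11 * m)
    have h2 := two_mul_triInt k
    have h3 := two_mul_triInt m
    refine mul_left_cancel₀ (two_ne_zero) ?_
    push_cast
    linear_combination 3 * h1 - 3 * h2 - 363 * h3]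
  ring

/-- The dissection of Euler's product. -/
theorem qPochInf_eq_eulerSum (hq0 : q ≠ 0) (hq : ‖q‖ < 1) :
    qPochInf q q = q ^ 5 * (qPochInf (q ^ 121) (q ^ 121) * eulerSum (thetaVal q)) := by
  have hQ0 : q ^ 121 ≠ 0 := pow_ne_zero _ hq0
  have hQ : ‖q ^ 121‖ < 1 := norm_pow_lt_one hq (by norm_num)
  have hy0 : q ^ 11 ≠ 0 := pow_ne_zero _ hq0
  have hterm : ∀ n : ℤ, (-(1 : ℂ) ^ 3) ^ n * (q ^ triInt n) ^ 3 * (q ^ n) ^ (-2 : ℤ) =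
      (-1) ^ n * q ^ (3 * triInt n - 2 * n) := fun n => by
    rw [one_pow, zpow_sub₀ hq0, mul_comm 3, mul_comm 2 n, zpow_mul, zpow_mul, zpow_neg,
      div_eq_mul_inv, mul_assoc]
    norm_cast
  set E := (Equiv.ofBijective _ (bijective_residue (s := 1) (by decide))).trans
    (Equiv.subLeft (3 : ℤ)) with hE
  have hEp : ∀ p : Fin 11 × ℤ, E p = 2 - ((p.1 : ℤ) - 5) - 11 * p.2 := fun p => by
    simp only [hE, Equiv.trans_apply, Equiv.ofBijective_apply, Equiv.subLeft_apply]; ring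
  have hsum := (summable_cubeSum hq0 hq one_ne_zero (-2)).of_norm
  simp only [hterm] at hsum
  have hsum' := (E.summable_iff).2 hsum
  have hfac : qPochInf q q = ∑ i : Fin 11, (-1) ^ ((i : ℤ) - 5) *
      q ^ (5 + (3 * triInt ((i : ℤ) - 5) - 7 * ((i : ℤ) - 5))) *
        cubeSum (q ^ 121) ((q ^ 11) ^ ((i : ℤ) - 5)) (-2) := by
    rw [← cubeSum_one hq0 hq, cubeSum]
    simp only [hterm]
    rw [← E.tsum_eq]
    change ∑' p, ((fun n : ℤ => (-1 : ℂ) ^ n * q ^ (3 * triInt n - 2 * n)) ∘ E) p = _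
    rw [hsum'.tsum_prod, tsum_fintype]
    refine Finset.sum_congr rfl fun i _ => ?_
    simp only [Function.comp, hEp, cubeSum_fiber hq0]
    rw [tsum_mul_left, cubeSum]
  have hpair : ∀ k : ℤ, ¬ 11 ∣ k → ¬ 11 ∣ 2 * k →
      q ^ (3 * triInt k - 7 * k) * cubeSum (q ^ 121) ((q ^ 11) ^ k) (-2) +
        q ^ (3 * triInt (-k) - 7 * -k) * cubeSum (q ^ 121) ((q ^ 11) ^ (-k)) (-2) =
      thetaVal q (2 * k) / thetaVal q k * qPochInf (q ^ 121) (q ^ 121) := by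
    intro k hk hk2
    have hw0 : (q ^ 11) ^ k ≠ 0 := zpow_ne_zero _ hy0
    have key := cubeSum_add hq0 hq hk hk2
    have hθ := thetaProd_pow_zpow_ne_zero hq0 hq hk
    have e1 : q ^ (3 * triInt (-k) - 7 * -k) = q ^ (3 * triInt k - 7 * k) * (q ^ 11) ^ k := by
      rw [← zpow_natCast, ← zpow_mul, ← zpow_add₀ hq0, triInt_neg]
      congr 1; push_cast; ring
    have e2 : q ^ (triInt (2 * k) - 6 * (2 * k)) =
        q ^ (3 * triInt k - 7 * k) * q ^ (triInt k - 6 * k) := by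
      rw [← zpow_add₀ hq0]
      congr 1
      have h1 := two_mul_triInt (2 * k)
      have h2 := two_mul_triInt k
      linarith
    have hc : q ^ (triInt k - 6 * k) ≠ 0 := zpow_ne_zero _ hq0
    rw [thetaVal, thetaVal, e1, e2, zpow_neg]
    generalize q ^ (3 * triInt k - 7 * k) = a at *
    refine mul_left_cancel₀ hw0 ?_
    have : q ^ (triInt k - 6 * k) * thetaProd (q ^ 121) ((q ^ 11) ^ k) ≠ 0 := mul_ne_zero hc hθ
    field_simp
    field_simp at key
    linear_combination a * key
  have p1 := hpair 1 (by decide) (by decide)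
  have p2 := hpair 2 (by decide) (by decide)
  have p3 := hpair 3 (by decide) (by decide)
  have p4 := hpair 4 (by decide) (by decide)
  have p5 := hpair 5 (by decide) (by decide)
  have p0 := cubeSum_one hQ0 hQ
  have h5 : ∀ j : ℤ, q ^ (5 + j) = q ^ 5 * q ^ j := fun j => by
    rw [zpow_add₀ hq0]; norm_cast
  rw [hfac, eulerSum, show Finset.Icc 1 5 = {1, 2, 3, 4, 5} by decide]
  simp only [Fin.sum_univ_succ, h5]
  simp [Fin.val_succ]
  norm_num
  norm_num at p1 p2 p3 p4 p5
  rw [p0, show triInt 0 = 0 from rfl, mul_zero, zpow_zero, mul_one]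
  linear_combination q ^ 5 * (-p1 + p2 - p3 + p4 - p5)

/-- The values of a theta sequence in terms of the first five. -/
theorem IsThetaSeq.values {t : ℤ → ℂ} (h : IsThetaSeq t) :
    (t 9 = t 2 ∧ t 18 = -t 4 ∧ t 27 = t 5 ∧ t 36 = -t 3 ∧ t 45 = t 1) ∧
    (t 6 = t 5 ∧ t 12 = -t 1 ∧ t 15 = -t 4) ∧
    (t 7 = t 4 ∧ t 14 = -t 3 ∧ t 21 = -t 1 ∧ t 28 = t 5 ∧ t 35 = -t 2) ∧
    (t 10 = t 1 ∧ t 20 = -t 2 ∧ t 25 = t 3) := by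
  have a := h.add_eleven
  have e := h.eleven_sub
  have e1 := e 1; have e2 := e 2; have e3 := e 3; have e4 := e 4; have e5 := e 5
  have a1 := a 1; have a3 := a 3; have a4 := a 4; have a7 := a 7; have a9 := a 9
  have a10 := a 10; have a14 := a 14; have a16 := a 16; have a5 := a 5; have a17 := a 17
  have a25 := a 25; have a24 := a 24; have a34 := a 34; have a23 := a 23; have a12 := a 12
  have a6 := a 6; have a2 := a 2; have a13 := a 13
  norm_num at *
  simp [*]

theorem IsThetaSeq.eulerSum_comp {t : ℤ → ℂ} (h : IsThetaSeq t) :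
    eulerSum (fun k => t (9 * k)) = eulerSum t ∧ eulerSum (fun k => t (3 * k)) = eulerSum t ∧
    eulerSum (fun k => t (7 * k)) = eulerSum t ∧ eulerSum (fun k => t (5 * k)) = eulerSum t := by
  obtain ⟨⟨h9, h18, h27, h36, h45⟩, ⟨h6, h12, h15⟩, ⟨h7, h14, h21, h28, h35⟩, h10, h20, h25⟩ :=
    h.values
  have n₁ := h.ne_zero 1 (by decide)
  refine ⟨?_, ?_, ?_, ?_⟩ <;>
    rw [eulerSum_eq (h.comp_mul (by decide) (by decide)), eulerSum_eq h] <;>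
    norm_num [h9, h18, h27, h36, h45, h6, h12, h15, h7, h14, h21, h28, h35, h10, h20, h25] <;> ring

end

section

theorem cubic_disc {a b c d x y z : ℂ} (hxy : x ≠ y) (hxz : x ≠ z) (hyz : y ≠ z)
    (hx : a * x ^ 3 + b * x ^ 2 + c * x + d = 0) (hy : a * y ^ 3 + b * y ^ 2 + c * y + d = 0)
    (hz : a * z ^ 3 + b * z ^ 2 + c * z + d = 0) :
    18 * a * b * c * d - 4 * b ^ 3 * d + b ^ 2 * c ^ 2 - 4 * a * c ^ 3 - 27 * a ^ 2 * d ^ 2 =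
      a ^ 4 * ((x - y) * (x - z) * (y - z)) ^ 2 := by
  have h1 : a * (x ^ 2 + x * y + y ^ 2) + b * (x + y) + c = 0 :=
    (mul_eq_zero.1 (by linear_combination hx - hy :
      (x - y) * (a * (x ^ 2 + x * y + y ^ 2) + b * (x + y) + c) =
          0)).resolve_left (sub_ne_zero.2 hxy)
  have h2 : a * (x ^ 2 + x * z + z ^ 2) + b * (x + z) + c = 0 :=
    (mul_eq_zero.1 (by linear_combination hx - hz :
      (x - z) * (a * (x ^ 2 + x * z + z ^ 2) + b * (x + z) + c) =
          0)).resolve_left (sub_ne_zero.2 hxz)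
  have hb : b = -a * (x + y + z) := by
    have := (mul_eq_zero.1 (by linear_combination h1 - h2 :
      (y - z) * (a * (x + y + z) + b) = 0)).resolve_left (sub_ne_zero.2 hyz)
    linear_combination this
  have hc : c = a * (x * y + x * z + y * z) := by subst hb; linear_combination h1
  have hd : d = -a * (x * y * z) := by subst hb hc; linear_combination hx
  subst hb hc hd
  ring

/-- The abscissa of a point of order two, in terms of a theta sequence. -/
theorem IsThetaSeq.cubic {t f : ℤ → ℂ} {d : ℂ} (h : IsThetaSeq t) (h0 : f 0 ≠ 0)
    (hneg : ∀ k, f (-k) = d ^ k * f k)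
    (hf : ∀ i j k l, f (i + j) * f (i - j) * (t (k + l) * t (k - l)) -
      f (i + k) * f (i - k) * (t (j + l) * t (j - l)) +
      f (i + l) * f (i - l) * (t (j + k) * t (j - k)) = 0) :
    -(4 * t 2 ^ 6 * t 3 ^ 2 * t 1 ^ 4) * (f 1 * f (-1) / f 0 ^ 2) ^ 3 +
      ((t 2 ^ 6 + t 1 ^ 4 * t 2 * t 4) ^ 2 + 4 * t 1 ^ 5 * t 3 ^ 3 * t 2 ^ 4) *
        (f 1 * f (-1) / f 0 ^ 2) ^ 2 +
      -(2 * t 1 * t 3 * t 2 ^ 4 * (t 2 ^ 6 + t 1 ^ 4 * t 2 * t 4)) * (f 1 * f (-1) / f 0 ^ 2) +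
      t 1 ^ 2 * t 3 ^ 2 * t 2 ^ 8 = 0 := by
  have n₁ := h.ne_zero 1 (by decide)
  have hA := hf 0 2 1 0
  have hB := hf 0 3 1 0
  have hC := hf 1 1 2 0
  have t1 := h.neg 1
  norm_num [hneg, t1] at hA hB hC
  rw [hneg 1, zpow_one]
  set X := f 1 * (d * f 1) / f 0 ^ 2 with hX
  set X₂ := d ^ 2 * f 2 ^ 2 / f 0 ^ 2 with hX₂
  set X₃ := d ^ 3 * f 3 ^ 2 / f 0 ^ 2 with hX₃
  have eA : X₂ * t 1 ^ 2 = X * t 2 ^ 2 - t 3 * t 1 := by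
    rw [hX, hX₂]; field_simp; linear_combination hA
  have eB : X₃ * t 1 ^ 2 = X * t 3 ^ 2 - t 4 * t 2 := by
    rw [hX, hX₃]; field_simp; linear_combination hB
  have eC : (X₃ * X * t 1 ^ 4 - X₂ * t 2 ^ 4 - X ^ 2 * t 3 ^ 2 * t 1 ^ 2) ^ 2 =
      4 * X₂ * X ^ 2 * t 2 ^ 4 * t 3 ^ 2 * t 1 ^ 2 := by
    have e1 : X₃ * X * t 1 ^ 4 = (d ^ 2 * f 3 * f 1 * t 1 ^ 2 / f 0 ^ 2) ^ 2 := by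
      rw [hX, hX₃]; ring
    have e2 : X₂ * t 2 ^ 4 = (d * f 2 * t 2 ^ 2 / f 0) ^ 2 := by
      rw [hX₂]; ring
    have e3 : d ^ 2 * f 3 * f 1 * t 1 ^ 2 / f 0 ^ 2 = d * f 2 * t 2 ^ 2 / f 0 - X * t 3 * t 1 := by
      rw [hX]; field_simp; linear_combination -d * hC
    have e4 : 4 * X₂ * X ^ 2 * t 2 ^ 4 * t 3 ^ 2 * t 1 ^ 2 =
        4 * (X₂ * t 2 ^ 4) * (X * t 3 * t 1) ^ 2 := by ring
    rw [e4, e1, e2, e3]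
    ring
  have eP : t 1 ^ 2 * (X₃ * X * t 1 ^ 4 - X₂ * t 2 ^ 4 - X ^ 2 * t 3 ^ 2 * t 1 ^ 2) =
      -(X * (t 2 ^ 6 + t 1 ^ 4 * t 2 * t 4) - t 1 * t 3 * t 2 ^ 4) := by
    linear_combination X * t 1 ^ 4 * eB - t 2 ^ 4 * eA
  have eS := congrArg (· ^ 2) eP
  simp only [mul_pow, eC] at eS
  linear_combination -eS + 4 * X ^ 2 * t 2 ^ 4 * t 3 ^ 2 * t 1 ^ 4 * eA

variable {Q q : ℂ}

theorem qPochInf_mul_neg (hQ : ‖Q‖ < 1) (x : ℂ) :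
    qPochInf Q x * qPochInf Q (-x) = qPochInf (Q ^ 2) (x ^ 2) := by
  refine tendsto_nhds_unique ((tendsto_qPoch hQ x).mul (tendsto_qPoch hQ (-x))) ?_
  refine (tendsto_qPoch (norm_pow_lt_one hQ two_ne_zero) (x ^ 2)).congr fun N => ?_
  simp only [qPoch, ← Finset.prod_mul_distrib]
  exact Finset.prod_congr rfl fun i _ => by ring

theorem qPoch_two_mul (x : ℂ) (N : ℕ) : qPoch Q x (2 * N) =
    qPoch (Q ^ 2) x N * qPoch (Q ^ 2) (x * Q) N := by
  induction N with
  | zero => simp [qPoch]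
  | succ N ih =>
    rw [show 2 * (N + 1) = 2 * N + 1 + 1 by ring]
    simp only [qPoch_succ, ih]
    ring

theorem qPochInf_eq_two (hQ : ‖Q‖ < 1) (x : ℂ) : qPochInf Q x =
    qPochInf (Q ^ 2) x * qPochInf (Q ^ 2) (x * Q) := by
  have h2 : ‖Q ^ 2‖ < 1 := norm_pow_lt_one hQ (by norm_num)
  refine tendsto_nhds_unique ((tendsto_qPoch hQ x).comp
    (tendsto_id.const_mul_atTop' (r := 2) (by norm_num))) ?_
  refine ((tendsto_qPoch h2 x).mul (tendsto_qPoch h2 (x * Q))).congr fun N => ?_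
  simp [qPoch_two_mul]

/-- The product of the theta function over the nontrivial points of order two. -/
theorem thetaProd_two_torsion {r : ℂ} (hr0 : r ≠ 0) (hr : ‖r‖ < 1) :
    thetaProd (r ^ 2) (-1) * thetaProd (r ^ 2) r * thetaProd (r ^ 2) (-r) = 2 := by
  have hQ : ‖r ^ 2‖ < 1 := norm_pow_lt_one hr (by norm_num)
  have hQQ : qPochInf (r ^ 2) (r ^ 2) ≠ 0 := qPochInf_ne_zero hQ (one_sub_mul_pow_ne_zero hQ)
  have e1 := qPochInf_mul_neg hQ r
  have e2 := qPochInf_mul_neg hQ (r ^ 2)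
  have e3 := qPochInf_eq_two hQ (r ^ 2)
  have e4 := qPochInf_eq hQ (-1)
  have d1 : r ^ 2 / r = r := by field_simp
  have d2 : r ^ 2 / -r = -r := by field_simp
  have key : qPochInf (r ^ 2) (-r ^ 2) * qPochInf ((r ^ 2) ^ 2) (r ^ 2) = 1 := by
    refine mul_left_cancel₀ hQQ ?_
    rw [← mul_assoc, e2, mul_one, e3]
    ring_nf
  rw [neg_one_mul] at e4
  rw [thetaProd, thetaProd, thetaProd, d1, d2, div_neg, div_one, e4]
  linear_combination (2 * qPochInf (r ^ 2) (-r ^ 2) ^ 2 * (qPochInf (r ^ 2) r *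
    qPochInf (r ^ 2) (-r) + qPochInf ((r ^ 2) ^ 2) (r ^ 2))) * e1 +
      2 * (qPochInf (r ^ 2) (-r ^ 2) * qPochInf ((r ^ 2) ^ 2) (r ^ 2) + 1) * key

/-- The shifted theta values. -/
noncomputable def thetaShift (q v : ℂ) (k : ℤ) : ℂ :=
  q ^ (triInt k - 6 * k) * thetaProd (q ^ 121) (v * (q ^ 11) ^ k)

theorem zpow_theta_pair (hq0 : q ≠ 0) (a b : ℤ) :
    q ^ (triInt (a + b) - 6 * (a + b)) * q ^ (triInt (a - b) - 6 * (a - b)) =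
      q ^ (a * a + b * b) / (q ^ 11) ^ a := by
  rw [← zpow_natCast, ← zpow_mul, ← zpow_add₀ hq0, ← zpow_sub₀ hq0]
  congr 1
  have := two_mul_triInt (a + b); have := two_mul_triInt (a - b)
  push_cast; linarith

theorem thetaShift_three_term (hq0 : q ≠ 0) (hq : ‖q‖ < 1) {v : ℂ} (hv : v ≠ 0) (i j k l : ℤ) :
    thetaShift q v (i + j) * thetaShift q v (i - j) * (thetaVal q (k + l) * thetaVal q (k - l)) -
      thetaShift q v (i + k) * thetaShift q v (i - k) *
        (thetaVal q (j + l) * thetaVal q (j - l)) +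
      thetaShift q v (i + l) * thetaShift q v (i - l) *
        (thetaVal q (j + k) * thetaVal q (j - k)) = 0 := by
  have hQ0 : q ^ 121 ≠ 0 := pow_ne_zero _ hq0
  have hQ : ‖q ^ 121‖ < 1 := norm_pow_lt_one hq (by norm_num)
  have hy0 : q ^ 11 ≠ 0 := pow_ne_zero _ hq0
  have hyk : ∀ k : ℤ, (q ^ 11) ^ k ≠ 0 := fun k => zpow_ne_zero k hy0
  have h := thetaProd_three_term hQ0 hQ (mul_ne_zero hv (hyk i)) (hyk j) (hyk k) (hyk l)
  simp only [mul_assoc v, mul_div_assoc v, ← zpow_add₀ hy0, ← zpow_sub₀ hy0] at h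
  have hp : ∀ a b : ℤ, thetaVal q (a + b) * thetaVal q (a - b) = q ^ (a * a + b * b) *
      (thetaProd (q ^ 121) ((q ^ 11) ^ (a + b)) * thetaProd (q ^ 121) ((q ^ 11) ^ (a - b)) /
        (q ^ 11) ^ a) := by
    intro a b
    rw [thetaVal, thetaVal, mul_mul_mul_comm, zpow_theta_pair hq0]; ring
  have hs : ∀ a b : ℤ, thetaShift q v (a + b) * thetaShift q v (a - b) = q ^ (a * a + b * b) * (v *
      (thetaProd (q ^ 121) (v * (q ^ 11) ^ (a + b)) *
        thetaProd (q ^ 121) (v * (q ^ 11) ^ (a - b)) / (v * (q ^ 11) ^ a))) := by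
    intro a b
    rw [thetaShift, thetaShift, mul_mul_mul_comm, zpow_theta_pair hq0]; field_simp
  rw [hp, hp, hp, hs, hs, hs]
  have e1 : q ^ (i * i + k * k) * q ^ (j * j + l * l) =
      q ^ (i * i + j * j) * q ^ (k * k + l * l) := by
    rw [← zpow_add₀ hq0, ← zpow_add₀ hq0]; ring_nf
  have e2 : q ^ (i * i + l * l) * q ^ (j * j + k * k) =
      q ^ (i * i + j * j) * q ^ (k * k + l * l) := by
    rw [← zpow_add₀ hq0, ← zpow_add₀ hq0]; ring_nf
  rw [mul_mul_mul_comm, mul_mul_mul_comm (q ^ (i * i + k * k)),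
    mul_mul_mul_comm (q ^ (i * i + l * l)), e1, e2, ← mul_sub, ← mul_add]
  simp only [mul_assoc v, ← mul_sub, ← mul_add]
  rw [h, mul_zero, mul_zero]

theorem thetaShift_mul_neg (hq0 : q ≠ 0) (v : ℂ) (s : ℤ) :
    thetaShift q v s * thetaShift q v (-s) = q ^ (s * s) *
      (thetaProd (q ^ 121) (v * (q ^ 11) ^ s) * thetaProd (q ^ 121) (v / (q ^ 11) ^ s)) := by
  have e : triInt s - 6 * s + (triInt (-s) - 6 * -s) = s * s := by
    have := two_mul_triInt s; have := two_mul_triInt (-s)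
    linarith
  rw [thetaShift, thetaShift, mul_mul_mul_comm, ← zpow_add₀ hq0, e, zpow_neg, div_eq_mul_inv]

theorem thetaShift_zero (v : ℂ) : thetaShift q v 0 = thetaProd (q ^ 121) v := by
  simp [thetaShift, show triInt 0 = 0 from rfl]

theorem thetaVal_sq (hq0 : q ≠ 0) (s : ℤ) : thetaVal q s ^ 2 =
    q ^ (s * s) * (thetaProd (q ^ 121) ((q ^ 11) ^ s) ^ 2 / (q ^ 11) ^ s) := by
  have e : (q ^ (triInt s - 6 * s)) ^ 2 = q ^ (s * s) / (q ^ 11) ^ s := by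
    rw [← zpow_natCast, ← zpow_natCast, ← zpow_mul, ← zpow_mul, ← zpow_sub₀ hq0]
    congr 1
    have := two_mul_triInt s
    push_cast; linarith
  rw [thetaVal, mul_pow, e]
  ring

/-- The difference of the values of the Weierstrass function at two points. -/
theorem thetaShift_sub (hq0 : q ≠ 0) (hq : ‖q‖ < 1) (s : ℤ) {v v' : ℂ} (hv : v ≠ 0) (hv' : v' ≠ 0)
    (h : thetaProd (q ^ 121) v ≠ 0) (h' : thetaProd (q ^ 121) v' ≠ 0) :
    thetaShift q v s * thetaShift q v (-s) / thetaShift q v 0 ^ 2 -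
      thetaShift q v' s * thetaShift q v' (-s) / thetaShift q v' 0 ^ 2 =
    v' * thetaVal q s ^ 2 * thetaProd (q ^ 121) (v * v') * thetaProd (q ^ 121) (v / v') /
      (thetaProd (q ^ 121) v ^ 2 * thetaProd (q ^ 121) v' ^ 2) := by
  have hQ0 : q ^ 121 ≠ 0 := pow_ne_zero _ hq0
  have hQ : ‖q ^ 121‖ < 1 := norm_pow_lt_one hq (by norm_num)
  have hy : (q ^ 11) ^ s ≠ 0 := zpow_ne_zero _ (pow_ne_zero 11 hq0)
  have key := thetaProd_three_term hQ0 hQ hv hv' hy one_ne_zero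
  rw [thetaShift_mul_neg hq0, thetaShift_mul_neg hq0, thetaShift_zero, thetaShift_zero,
    thetaVal_sq hq0]
  generalize (q ^ 11) ^ s = y at *
  generalize q ^ (s * s) = z at *
  simp only [mul_one, div_one] at key
  field_simp at key ⊢
  linear_combination -z * key

end

section

variable {q : ℂ}

/-- The discriminant relation for a theta sequence, in Tate normal form. -/
theorem thetaVal_disc (hq0 : q ≠ 0) (hq : ‖q‖ < 1) {s : ℤ} (hs : Odd s) (hs' : ¬ 11 ∣ s)
    {t : ℤ → ℂ} (hts : t = fun k => thetaVal q (s * k)) :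
    q ^ 121 * t 1 ^ 28 * t 2 ^ 24 * t 3 ^ 8 =
      t 1 ^ 7 * t 3 ^ 5 * t 2 ^ 12 *
        (-((t 2 ^ 5 + t 1 ^ 4 * t 4) ^ 2 * t 2 ^ 2 +
            4 * t 1 ^ 5 * t 3 ^ 3 * t 2 ^ 4) ^ 2 +
          9 * ((t 2 ^ 5 + t 1 ^ 4 * t 4) ^ 2 * t 2 ^ 2 +
            4 * t 1 ^ 5 * t 3 ^ 3 * t 2 ^ 4) *
            (t 2 ^ 5 + t 1 ^ 4 * t 4) * t 2 ^ 7 -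
          8 * (t 2 ^ 5 + t 1 ^ 4 * t 4) ^ 3 * t 2 ^ 9 -
          27 * t 1 ^ 5 * t 3 ^ 3 * t 2 ^ 16) := by
  obtain ⟨r, hr⟩ := IsAlgClosed.exists_pow_nat_eq (q ^ 121) (n := 2) two_pos
  have hQ0 : q ^ 121 ≠ 0 := pow_ne_zero _ hq0
  have hQ : ‖q ^ 121‖ < 1 := norm_pow_lt_one hq (by norm_num)
  have hr0 : r ≠ 0 := by rintro rfl; exact hQ0 (by rw [← hr]; norm_num)
  have hr1 : ‖r‖ < 1 := by
    rw [← hr, norm_pow] at hQ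
    exact lt_of_not_ge fun h => hQ.not_ge (one_le_pow₀ h)
  have hθ := thetaProd_two_torsion hr0 hr1
  rw [hr] at hθ
  have ht : IsThetaSeq t := hts ▸ (isThetaSeq_thetaVal hq0 hq).comp_mul hs hs'
  have n₁ := ht.ne_zero 1 (by decide)
  have ha : thetaProd (q ^ 121) (-1) ≠ 0 := fun h => by norm_num [h] at hθ
  have hb : thetaProd (q ^ 121) r ≠ 0 := fun h => by norm_num [h] at hθ
  have hc : thetaProd (q ^ 121) (-r) ≠ 0 := fun h => by norm_num [h] at hθ
  have hy0 : q ^ 11 ≠ 0 := pow_ne_zero _ hq0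
  have hm1 : (-1 : ℂ) ≠ 0 := by norm_num
  have hexp : ∀ k : ℤ, q ^ (triInt (-k) - 6 * -k) = (q ^ 11) ^ k * q ^ (triInt k - 6 * k) := by
    intro k
    rw [← zpow_natCast, ← zpow_mul, ← zpow_add₀ hq0, triInt_neg]
    congr 1; push_cast; ring
  have three : ∀ {v : ℂ}, v ≠ 0 → ∀ i j k l : ℤ,
      thetaShift q v (s * (i + j)) * thetaShift q v (s * (i - j)) * (t (k + l) * t (k - l)) -
        thetaShift q v (s * (i + k)) * thetaShift q v (s * (i - k)) *
          (t (j + l) * t (j - l)) +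
        thetaShift q v (s * (i + l)) * thetaShift q v (s * (i - l)) *
          (t (j + k) * t (j - k)) = 0 := by
    intro v hv i j k l
    simpa only [hts, mul_add, mul_sub] using
      thetaShift_three_term hq0 hq hv (s * i) (s * j) (s * k) (s * l)
  have zero : ∀ {v : ℂ}, thetaProd (q ^ 121) v ≠ 0 → thetaShift q v (s * 0) ≠ 0 := by
    intro v hv
    rwa [mul_zero, thetaShift_zero]
  have ca := ht.cubic (f := fun k => thetaShift q (-1) (s * k)) (d := 1) (zero ha) (fun j => by
    have hj : s * -j = -(s * j) := by ring
    rw [hj]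
    generalize s * j = k
    have hyk : (q ^ 11) ^ k ≠ 0 := zpow_ne_zero _ hy0
    rw [thetaShift, thetaShift, hexp, one_zpow, one_mul, neg_one_mul, neg_one_mul, zpow_neg,
      ← inv_neg, thetaProd_inv hQ (neg_ne_zero.2 hyk)]
    field_simp) (three hm1)
  have shift : ∀ v : ℂ, v ^ 2 = q ^ 121 → v ≠ 0 → ∀ k : ℤ,
      thetaShift q v (-k) = (q ^ 11) ^ k * thetaShift q v k := by
    intro v hv hv0 k
    have hyk : (q ^ 11) ^ k ≠ 0 := zpow_ne_zero _ hy0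
    have e : thetaProd (q ^ 121) (v * (q ^ 11) ^ (-k)) = thetaProd (q ^ 121) (v * (q ^ 11) ^ k) :=
        by
      rw [thetaProd, thetaProd, mul_comm]
      congr 2
      · rw [zpow_neg, ← hv]; field_simp
      · rw [zpow_neg, ← hv]; field_simp
    rw [thetaShift, thetaShift, hexp, e, mul_assoc]
  have hr' : (-r) ^ 2 = q ^ 121 := by rw [neg_sq, hr]
  have hr0' : -r ≠ 0 := neg_ne_zero.2 hr0
  have shift' : ∀ v : ℂ, v ^ 2 = q ^ 121 → v ≠ 0 → ∀ k : ℤ,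
      thetaShift q v (s * -k) = ((q ^ 11) ^ s) ^ k * thetaShift q v (s * k) := by
    intro v hv hv0 k
    rw [mul_neg, shift v hv hv0, zpow_mul]
  have cb := ht.cubic (f := fun k => thetaShift q r (s * k)) (zero hb) (shift' r hr hr0) (three hr0)
  have cc := ht.cubic (f := fun k => thetaShift q (-r) (s * k)) (zero hc) (shift' (-r) hr' hr0')
    (three hr0')
  have dab := thetaShift_sub hq0 hq s hm1 hr0 ha hb
  have dac := thetaShift_sub hq0 hq s hm1 hr0' ha hc
  have dbc := thetaShift_sub hq0 hq s hr0 hr0' hb hc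
  have i1 : (-1 : ℂ) / r = (-r)⁻¹ := by rw [inv_neg]; ring
  have i2 : (-1 : ℂ) / -r = r⁻¹ := by rw [neg_div_neg_eq, one_div]
  have i3 : r / -r = -1 := by field_simp
  have i4 : r * -r = -1 * q ^ 121 := by rw [← hr]; ring
  rw [i1, thetaProd_inv hQ hr0', neg_one_mul] at dab
  rw [i2, thetaProd_inv hQ hr0, neg_one_mul, neg_neg] at dac
  rw [i3, i4, thetaProd_mul_self hQ0 hQ hm1] at dbc
  simp only [mul_neg, mul_one, mul_zero] at ca cb cc
  have hts1 : thetaVal q s = t 1 := by simp [hts]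
  rw [hts1] at dab dac dbc
  generalize thetaShift q (-1) s * thetaShift q (-1) (-s) / thetaShift q (-1) 0 ^ 2 = A at *
  generalize thetaShift q r s * thetaShift q r (-s) / thetaShift q r 0 ^ 2 = B at *
  generalize thetaShift q (-r) s * thetaShift q (-r) (-s) / thetaShift q (-r) 0 ^ 2 = C at *
  have hAB : A ≠ B := by
    rw [← sub_ne_zero, dab]
    simp [n₁, ha, hb, hc, hr0]
  have hAC : A ≠ C := by
    rw [← sub_ne_zero, dac]
    simp [n₁, ha, hb, hc, hr0]
  have hBC : B ≠ C := by
    rw [← sub_ne_zero, dbc]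
    simp [n₁, ha, hb, hc, hr0]
  have key := cubic_disc hAB hAC hBC ca cb cc
  have hprod : ((A - B) * (A - C) * (B - C)) ^ 2 = q ^ 121 * t 1 ^ 12 / 16 := by
    have h4 : (thetaProd (q ^ 121) (-1) * thetaProd (q ^ 121) r * thetaProd (q ^ 121) (-r)) ^ 4 =
        16 := by
      rw [hθ]; norm_num
    rw [dab, dac, dbc, ← h4, ← hr]
    field_simp
    try ring
  rw [hprod] at key
  linear_combination -key / 16

theorem ThetaUnits.disc {t₁ t₂ t₃ t₄ t₅ x x₁ Y Y₁ U V Q : ℂ}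
    (h : ThetaUnits t₁ t₂ t₃ t₄ t₅ x x₁ Y Y₁ U V)
    (hd : Q * t₁ ^ 28 * t₂ ^ 24 * t₃ ^ 8 = t₁ ^ 7 * t₃ ^ 5 * t₂ ^ 12 *
      (-((t₂ ^ 5 + t₁ ^ 4 * t₄) ^ 2 * t₂ ^ 2 + 4 * t₁ ^ 5 * t₃ ^ 3 * t₂ ^ 4) ^ 2 +
        9 * ((t₂ ^ 5 + t₁ ^ 4 * t₄) ^ 2 * t₂ ^ 2 + 4 * t₁ ^ 5 * t₃ ^ 3 * t₂ ^ 4) *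
          (t₂ ^ 5 + t₁ ^ 4 * t₄) * t₂ ^ 7 -
        8 * (t₂ ^ 5 + t₁ ^ 4 * t₄) ^ 3 * t₂ ^ 9 - 27 * t₁ ^ 5 * t₃ ^ 3 * t₂ ^ 16)) :
    Q * (t₂ ^ 2 * t₃ ^ 2 * t₄ ^ 5 * t₅ ^ 6 / t₁ ^ 3) =
      1 + 2 * Y + 2 * x - 3 * x * Y - 5 * x ^ 2 + x ^ 3 := by
  obtain ⟨h₁, h₂, h₃, h₄, h₅, hx, hx₁, hY, hY₁, hU, hV, rx₁, rY₁, rU, rV, hc⟩ := h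
  have hx0 : x ≠ 0 := by rw [hx]; positivity
  have hY0 : Y ≠ 0 := by rw [hY]; positivity
  have hU0 : U ≠ 0 := by rw [hU]; positivity
  have hV0 : V ≠ 0 := by rw [hV]; positivity
  have eα : t₁ ^ 4 * t₄ = t₂ ^ 5 * (x * U / V ^ 2) := by
    rw [hx, hU, hV]; field_simp
  have eβ : t₁ ^ 5 * t₃ ^ 3 = t₂ ^ 8 * (x * Y ^ 2 * Y₁ / V ^ 4) := by
    rw [hx, hY, hY₁, hV]; field_simp
  have eM : t₂ ^ 14 * t₄ ^ 5 * t₅ ^ 6 / (t₁ ^ 24 * t₃) = x₁ * V ^ 8 / (Y ^ 2 * U ^ 2) := by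
    rw [hx₁, hY, hU, hV]; field_simp
  have e1 : Q * (t₂ ^ 2 * t₃ ^ 2 * t₄ ^ 5 * t₅ ^ 6 / t₁ ^ 3) =
      Q * t₁ ^ 28 * t₂ ^ 24 * t₃ ^ 8 / (t₁ ^ 7 * t₃ ^ 5 * t₂ ^ 36) *
        (t₂ ^ 14 * t₄ ^ 5 * t₅ ^ 6 / (t₁ ^ 24 * t₃)) := by
    field_simp
  have e2 : (4 * t₁ ^ 5 * t₃ ^ 3 * t₂ ^ 4 : ℂ) = 4 * (t₁ ^ 5 * t₃ ^ 3) * t₂ ^ 4 := by ring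
  have e3 : (27 * t₁ ^ 5 * t₃ ^ 3 * t₂ ^ 16 : ℂ) = 27 * (t₁ ^ 5 * t₃ ^ 3) * t₂ ^ 16 := by ring
  rw [e1, hd, eM, e2, e3, eα, eβ]
  clear e1 hd eM e2 e3 eα eβ hx hx₁ hY hY₁ hU hV
  field_simp
  rw [rU, rY₁, rx₁, rV]
  linear_combination (-Y - 3 * Y ^ 2 - 2 * Y ^ 3 + 5 * x * Y ^ 2 + 3 * x * Y ^ 3 + x ^ 2 +
      10 * x ^ 2 * Y -
    2 * x ^ 2 * Y ^ 2 - x ^ 3 - 9 * x ^ 3 * Y) * hc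

end

/-- The first coordinate of the modular curve attached to a theta sequence. -/
noncomputable def unitX (T : ℤ → ℂ) : ℂ := T 3 * T 4 * T 5 / (T 1 ^ 2 * T 2)

/-- The second coordinate of the modular curve attached to a theta sequence. -/
noncomputable def unitY (T : ℤ → ℂ) : ℂ := T 3 * T 5 ^ 3 / (T 1 ^ 3 * T 2)

/-- The part of the rank dissection lying in a given residue class. -/
noncomputable def rankTerm : ℕ → (ℤ → ℂ) → ℂ
  | 0, T => T 1 / (T 2 ^ 3 * T 3 ^ 2 * T 4 ^ 5 * T 5 ^ 4) *
      (22 + 11 * unitY T - 22 * unitX T + 11 * unitX T ^ 2)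
  | 1, T => T 1 ^ 3 / (T 2 ^ 2 * T 3 ^ 3 * T 4 ^ 5 * T 5 ^ 6) *
      (1 - 9 * unitY T - 9 * unitX T + 8 * unitX T * unitY T - 5 * unitX T ^ 2 + 12 * unitX T ^ 3)
  | 2, T => T 1 ^ 4 / (T 2 ^ 2 * T 3 ^ 2 * T 4 ^ 6 * T 5 ^ 7) *
      (7 + 3 * unitY T - 8 * unitX T - 10 * unitX T * unitY T - 13 * unitX T ^ 2 +
          11 * unitX T ^ 2 * unitY T + 18 * unitX T ^ 3)
  | 3, T => T 1 ^ 3 / (T 2 ^ 2 * T 3 ^ 2 * T 4 ^ 6 * T 5 ^ 6) *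
      (-9 - 7 * unitY T + 15 * unitX T + 16 * unitX T * unitY T - 10 * unitX T ^ 2 +
          13 * unitX T ^ 3)
  | 4, T => T 1 ^ 3 / (T 2 ^ 2 * T 3 ^ 2 * T 4 ^ 5 * T 5 ^ 7) *
      (5 + 21 * unitY T - 12 * unitX T - 37 * unitX T * unitY T + 19 * unitX T ^ 2 +
          11 * unitX T ^ 2 * unitY T - 17 * unitX T ^ 3)
  | 5, T => T 1 ^ 2 / (T 2 ^ 2 * T 3 ^ 2 * T 4 ^ 5 * T 5 ^ 6) *
      (-8 - 16 * unitY T + 17 * unitX T + 13 * unitX T * unitY T - 15 * unitX T ^ 2 +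
          3 * unitX T ^ 3)
  | 6, T => T 1 ^ 3 / (T 2 ^ 3 * T 3 ^ 3 * T 4 ^ 5 * T 5 ^ 5) *
      (3 + 6 * unitY T - 5 * unitX T + 13 * unitX T * unitY T + 18 * unitX T ^ 2 + 3 * unitX T ^ 3)
  | 7, T => T 1 ^ 3 / (T 2 * T 3 ^ 3 * T 4 ^ 5 * T 5 ^ 7) *
      (6 * unitY T - 11 * unitX T - 13 * unitX T * unitY T + 12 * unitX T ^ 2 +
          6 * unitX T ^ 2 * unitY T + 4 * unitX T ^ 3)
  | 8, T => T 1 ^ 2 / (T 2 * T 3 ^ 3 * T 4 ^ 5 * T 5 ^ 6) *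
      (-2 - 4 * unitY T + 7 * unitX T - 5 * unitX T * unitY T - 12 * unitX T ^ 2 + 9 * unitX T ^ 3)
  | 9, T => T 1 ^ 3 / (T 2 ^ 3 * T 3 ^ 2 * T 4 ^ 5 * T 5 ^ 6) *
      (4 - 14 * unitY T - 14 * unitX T + 21 * unitX T * unitY T + 13 * unitX T ^ 2 +
          4 * unitX T ^ 3)
  | 10, T => T 1 ^ 3 / (T 2 * T 3 ^ 2 * T 4 ^ 5 * T 5 ^ 8) *
      (1 - 10 * unitY T - 9 * unitX T + unitX T * unitY T + 15 * unitX T ^ 2 +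
          10 * unitX T ^ 2 * unitY T - 7 * unitX T ^ 3)
  | _, _ => 0

/-- The part of the crank dissection lying in a given residue class. -/
noncomputable def crankTerm : ℕ → (ℤ → ℂ) → ℂ
  | 1, T => 1 / T 3 * (4)
  | 2, T => T 1 / (T 4 * T 5) * (6)
  | 3, T => 1 / T 4 * (-3)
  | 4, T => 1 / T 5 * (-2)
  | 5, T => 1 / T 1 * (1)
  | 6, T => T 5 / (T 2 * T 3) * (1)
  | 7, T => T 3 / (T 1 * T 4) * (2)
  | 8, T => T 2 / (T 1 * T 3) * (3)
  | 9, T => 1 / T 2 * (5)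
  | 10, T => T 4 / (T 2 * T 5) * (-4)
  | _, _ => 0

/-- `F` is homogeneous of weight `w` for the action of the eleventh roots of unity. -/
def HasWeight (F : (ℤ → ℂ) → ℂ) (w : ℤ) : Prop :=
  ∀ μ : ℂ, μ ^ 11 = 1 → ∀ T, F (fun k => μ ^ (k * k) * T k) = μ ^ w * F T

namespace HasWeight

variable {F G : (ℤ → ℂ) → ℂ} {a b : ℤ}

theorem ne_zero_of_pow {μ : ℂ} (h : μ ^ 11 = 1) : μ ≠ 0 := by rintro rfl; norm_num at h

theorem zpow_congr {μ : ℂ} (h : μ ^ 11 = 1) (hab : (11 : ℤ) ∣ a - b) : μ ^ a = μ ^ b := by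
  obtain ⟨c, hc⟩ := hab
  rw [show a = b + 11 * c by linarith, zpow_add₀ (ne_zero_of_pow h), zpow_mul,
    show μ ^ (11 : ℤ) = 1 from mod_cast h, one_zpow, mul_one]

theorem congr (h : HasWeight F a) (hab : (11 : ℤ) ∣ a - b) : HasWeight F b := fun μ hμ T => by
  rw [h μ hμ, zpow_congr hμ hab]

theorem eval (k : ℤ) : HasWeight (fun T => T k) (k * k) := fun _ _ _ => rfl

theorem const (c : ℂ) : HasWeight (fun _ => c) 0 := fun _ _ _ => by simp

theorem mul (h : HasWeight F a) (h' : HasWeight G b) : HasWeight (fun T => F T * G T) (a + b) :=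
  fun μ hμ T => by
    beta_reduce
    rw [h μ hμ, h' μ hμ, zpow_add₀ (ne_zero_of_pow hμ)]; ring

theorem div (h : HasWeight F a) (h' : HasWeight G b) : HasWeight (fun T => F T / G T) (a - b) :=
  fun μ hμ T => by
    beta_reduce
    rw [h μ hμ, h' μ hμ, zpow_sub₀ (ne_zero_of_pow hμ)]; field_simp

theorem pow (h : HasWeight F a) (n : ℕ) : HasWeight (fun T => F T ^ n) (a * n) :=
  fun μ hμ T => by
    beta_reduce
    rw [h μ hμ, mul_pow, zpow_mul, zpow_natCast]

end HasWeight

theorem hasWeight_unitX : HasWeight unitX 0 :=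
  ((((HasWeight.eval 3).mul (.eval 4)).mul (.eval 5)).div (((HasWeight.eval 1).pow 2).mul
    (.eval 2))).congr (by decide)

theorem hasWeight_unitY : HasWeight unitY 0 :=
  (((HasWeight.eval 3).mul ((HasWeight.eval 5).pow 3)).div (((HasWeight.eval 1).pow 3).mul
    (.eval 2))).congr (by decide)

/-- A polynomial of weight zero. -/
theorem hasWeight_poly (P : ℂ → ℂ → ℂ) : HasWeight (fun T => P (unitX T) (unitY T)) 0 :=
  fun μ hμ T => by
    beta_reduce
    rw [hasWeight_unitX μ hμ, hasWeight_unitY μ hμ]; simp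

open HasWeight in
theorem hasWeight_rankTerm {c : ℕ} (hc : c < 11) : HasWeight (rankTerm c) (2 * c) := by
  interval_cases c
  · exact (((eval 1).div (((((eval 2).pow 3).mul ((eval 3).pow 2)).mul ((eval 4).pow 5)).mul ((eval 5).pow 4))).mul
      (hasWeight_poly fun x Y => 22 + 11 * Y - 22 * x + 11 * x ^ 2)).congr (by decide)
  · exact ((((eval 1).pow 3).div (((((eval 2).pow 2).mul ((eval 3).pow 3)).mul ((eval 4).pow 5)).mul ((eval 5).pow 6))).mul
      (hasWeight_poly fun x Y => 1 - 9 * Y - 9 * x + 8 * x * Y - 5 * x ^ 2 +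
          12 * x ^ 3)).congr (by decide)
  · exact ((((eval 1).pow 4).div (((((eval 2).pow 2).mul ((eval 3).pow 2)).mul ((eval 4).pow 6)).mul ((eval 5).pow 7))).mul
      (hasWeight_poly fun x Y => 7 + 3 * Y - 8 * x - 10 * x * Y - 13 * x ^ 2 + 11 * x ^ 2 * Y +
          18 * x ^ 3)).congr (by decide)
  · exact ((((eval 1).pow 3).div (((((eval 2).pow 2).mul ((eval 3).pow 2)).mul ((eval 4).pow 6)).mul ((eval 5).pow 6))).mul
      (hasWeight_poly fun x Y => -9 - 7 * Y + 15 * x + 16 * x * Y - 10 * x ^ 2 +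
          13 * x ^ 3)).congr (by decide)
  · exact ((((eval 1).pow 3).div (((((eval 2).pow 2).mul ((eval 3).pow 2)).mul ((eval 4).pow 5)).mul ((eval 5).pow 7))).mul
      (hasWeight_poly fun x Y => 5 + 21 * Y - 12 * x - 37 * x * Y + 19 * x ^ 2 + 11 * x ^ 2 * Y -
          17 * x ^ 3)).congr (by decide)
  · exact ((((eval 1).pow 2).div (((((eval 2).pow 2).mul ((eval 3).pow 2)).mul ((eval 4).pow 5)).mul ((eval 5).pow 6))).mul
      (hasWeight_poly fun x Y => -8 - 16 * Y + 17 * x + 13 * x * Y - 15 * x ^ 2 +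
          3 * x ^ 3)).congr (by decide)
  · exact ((((eval 1).pow 3).div (((((eval 2).pow 3).mul ((eval 3).pow 3)).mul ((eval 4).pow 5)).mul ((eval 5).pow 5))).mul
      (hasWeight_poly fun x Y => 3 + 6 * Y - 5 * x + 13 * x * Y + 18 * x ^ 2 +
          3 * x ^ 3)).congr (by decide)
  · exact ((((eval 1).pow 3).div ((((eval 2).mul ((eval 3).pow 3)).mul ((eval 4).pow 5)).mul ((eval 5).pow 7))).mul
      (hasWeight_poly fun x Y => 6 * Y - 11 * x - 13 * x * Y + 12 * x ^ 2 + 6 * x ^ 2 * Y +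
          4 * x ^ 3)).congr (by decide)
  · exact ((((eval 1).pow 2).div ((((eval 2).mul ((eval 3).pow 3)).mul ((eval 4).pow 5)).mul ((eval 5).pow 6))).mul
      (hasWeight_poly fun x Y => -2 - 4 * Y + 7 * x - 5 * x * Y - 12 * x ^ 2 +
          9 * x ^ 3)).congr (by decide)
  · exact ((((eval 1).pow 3).div (((((eval 2).pow 3).mul ((eval 3).pow 2)).mul ((eval 4).pow 5)).mul ((eval 5).pow 6))).mul
      (hasWeight_poly fun x Y => 4 - 14 * Y - 14 * x + 21 * x * Y + 13 * x ^ 2 +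
          4 * x ^ 3)).congr (by decide)
  · exact ((((eval 1).pow 3).div ((((eval 2).mul ((eval 3).pow 2)).mul ((eval 4).pow 5)).mul ((eval 5).pow 8))).mul
      (hasWeight_poly fun x Y => 1 - 10 * Y - 9 * x + x * Y + 15 * x ^ 2 + 10 * x ^ 2 * Y -
          7 * x ^ 3)).congr (by decide)

open HasWeight in
theorem hasWeight_crankTerm {c : ℕ} (hc : c < 11) : HasWeight (crankTerm c) (2 * c) := by
  interval_cases c
  · exact const 0
  · exact (((const 1).div (eval 3)).mul (.const 4)).congr (by decide)
  · exact (((eval 1).div ((eval 4).mul (eval 5))).mul (.const 6)).congr (by decide)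
  · exact (((const 1).div (eval 4)).mul (.const (-3))).congr (by decide)
  · exact (((const 1).div (eval 5)).mul (.const (-2))).congr (by decide)
  · exact (((const 1).div (eval 1)).mul (.const 1)).congr (by decide)
  · exact (((eval 5).div ((eval 2).mul (eval 3))).mul (.const 1)).congr (by decide)
  · exact (((eval 3).div ((eval 1).mul (eval 4))).mul (.const 2)).congr (by decide)
  · exact (((eval 2).div ((eval 1).mul (eval 3))).mul (.const 3)).congr (by decide)
  · exact (((const 1).div (eval 2)).mul (.const 5)).congr (by decide)
  · exact (((eval 4).div ((eval 2).mul (eval 5))).mul (.const (-4))).congr (by decide)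

theorem IsThetaSeq.rank_dissection {T : ℤ → ℂ} (h : IsThetaSeq T) :
    eulerSum T * ∑ c ∈ Finset.range 11, rankTerm c T =
      T 1 ^ 3 / (T 2 ^ 2 * T 3 ^ 2 * T 4 ^ 5 * T 5 ^ 6) * (1 + 2 * unitY T + 2 * unitX T -
        3 * unitX T * unitY T - 5 * unitX T ^ 2 + unitX T ^ 3) *
      (11 * (T 2 * T 4 / (T 1 ^ 2 * T 3)) - 11 * (T 3 * T 5 / (T 1 * T 2 * T 4)) +
        11 * (T 4 / (T 1 * T 5)) - 11 * (1 / T 4) - 3 * (T 3 ^ 2 / (T 1 ^ 2 * T 4)) -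
        3 * (T 2 * T 4 ^ 2 / (T 1 ^ 2 * T 3 * T 5)) - 3 * (T 2 * T 5 / (T 1 ^ 2 * T 4)) +
        T 2 ^ 3 / (T 1 ^ 3 * T 3) + 4 * (T 1 * T 4 / (T 2 ^ 2 * T 3))) := by
  have k := _root_.rank_dissection h.thetaUnits
  rw [eulerSum_eq h]
  simp only [Finset.sum_range_succ, Finset.sum_range_zero, rankTerm, unitX, unitY]
  linear_combination k

theorem IsThetaSeq.crank_dissection {T : ℤ → ℂ} (h : IsThetaSeq T) :
    eulerSum T * ∑ c ∈ Finset.range 11, crankTerm c T =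
      11 * (T 4 / (T 2 * T 3)) - 11 * (T 1 * T 5 / (T 2 * T 3 * T 4)) +
        11 * (T 1 / (T 4 * T 5)) - 11 * (T 1 ^ 2 / (T 4 * T 5 ^ 2)) - 11 / T 1 -
        T 3 ^ 2 / (T 1 ^ 2 * T 4) -
        T 2 * T 4 ^ 2 / (T 1 ^ 2 * T 3 * T 5) - T 2 * T 5 / (T 1 ^ 2 * T 4) +
        4 * (T 2 ^ 3 / (T 1 ^ 3 * T 3)) + 5 * (T 1 * T 4 / (T 2 ^ 2 * T 3)) := by
  have k := _root_.crank_dissection h.thetaUnits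
  rw [eulerSum_eq h]
  simp only [Finset.sum_range_succ, Finset.sum_range_zero, crankTerm]
  linear_combination k

section

variable {q ζ : ℂ}

theorem thetaVal_root_mul {η : ℂ} (hη : η ^ 11 = 1) (s k : ℤ) :
    thetaVal (η * q) (s * k) = (η ^ (6 * (s * s))) ^ (k * k) * thetaVal q (s * k) := by
  have hη0 := HasWeight.ne_zero_of_pow hη
  have e : η ^ 121 = 1 := by rw [show 121 = 11 * 11 by rfl, pow_mul, hη, one_pow]
  have e' : η ^ (triInt (s * k) - 6 * (s * k)) = (η ^ (6 * (s * s))) ^ (k * k) := by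
    rw [← zpow_mul]
    refine HasWeight.zpow_congr hη ⟨-triInt (s * k), ?_⟩
    have := two_mul_triInt (s * k)
    linear_combination 6 * this
  rw [thetaVal, thetaVal, mul_pow, mul_pow, e, hη, one_mul, one_mul, mul_zpow, e', mul_assoc]

theorem sum_root_zpow (hζ : IsPrimitiveRoot ζ 11) (j : ℤ) :
    ∑ k ∈ Finset.range 11, (ζ ^ k) ^ j = if (11 : ℤ) ∣ j then 11 else 0 := by
  have h11 : ζ ^ (11 : ℤ) = 1 := mod_cast hζ.pow_eq_one
  have e : ∀ k : ℕ, (ζ ^ k) ^ j = (ζ ^ j) ^ k := fun k => by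
    rw [← zpow_natCast, ← zpow_natCast, ← zpow_mul, ← zpow_mul, mul_comm]
  simp only [e]
  split_ifs with h
  · rw [(hζ.zpow_eq_one_iff_dvd j).2 (mod_cast h)]
    simp
  · have h1 : ζ ^ j ≠ 1 := fun h1 => h (mod_cast (hζ.zpow_eq_one_iff_dvd j).1 h1)
    rw [geom_sum_eq h1, ← zpow_natCast, ← zpow_mul, mul_comm, zpow_mul]
    simp [h11]

/-- The quotient of the base series of the ranks by the Euler product. -/
noncomputable def rankLambert (q : ℂ) (s : ℤ) : ℂ :=
  (11 * baseSeries 3 q s + (3 * s - 11)) / qPochInf q q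

/-- The quotient of the base series of the cranks by the Euler product. -/
noncomputable def crankLambert (q : ℂ) (s : ℤ) : ℂ :=
  (11 * baseSeries 1 q s + s) / qPochInf q q

theorem rankLambert_eq (hq0 : q ≠ 0) (hq : ‖q‖ < 1) {s : ℤ} (hs : ¬ 11 ∣ s) (hs' : Odd s)
    (hE : ∀ t, IsThetaSeq t → eulerSum (fun k => t (s * k)) = eulerSum t)
    {T : ℤ → ℂ} (hT : T = fun k => thetaVal q (s * k)) :
    rankLambert q s = -11 * (q ^ (3 * (6 * s - triInt s)) *
      appell 3 (q ^ 121) ((q ^ 11) ^ s) 1) / (q ^ 5 * qPochInf (q ^ 121) (q ^ 121)) +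
      qPochInf (q ^ 121) (q ^ 121) / (q ^ 5 * q ^ 121) *
        ∑ c ∈ Finset.range 11, rankTerm c T := by
  have hv := isThetaSeq_thetaVal hq0 hq
  have ht : IsThetaSeq T := hT ▸ hv.comp_mul hs' hs
  have hQ : ‖q ^ 121‖ < 1 := norm_pow_lt_one hq (by norm_num)
  have hQQ : qPochInf (q ^ 121) (q ^ 121) ≠ 0 := qPochInf_ne_zero hQ (one_sub_mul_pow_ne_zero hQ)
  have hqq : qPochInf q q ≠ 0 := qPochInf_ne_zero hq (one_sub_mul_pow_ne_zero hq)
  have hP := qPochInf_eq_eulerSum hq0 hq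
  rw [← hE _ hv, ← hT] at hP
  have hE0 : eulerSum T ≠ 0 := fun h => hqq (by rw [hP, h]; ring)
  have hd := ht.thetaUnits.disc (thetaVal_disc hq0 hq hs' hs hT)
  have key := ht.rank_dissection
  rw [unitX, unitY, ← hd] at key
  rw [rankLambert, eleven_mul_baseSeries_three hq0 hq hs hs' hT, hP]
  have n₁ := ht.ne_zero 1 (by decide)
  have n₂ := ht.ne_zero 2 (by decide)
  have n₃ := ht.ne_zero 3 (by decide)
  have n₄ := ht.ne_zero 4 (by decide)
  have n₅ := ht.ne_zero 5 (by decide)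
  rw [show ∀ w, T 1 ^ 3 / (T 2 ^ 2 * T 3 ^ 2 * T 4 ^ 5 * T 5 ^ 6) *
    (q ^ 121 * (T 2 ^ 2 * T 3 ^ 2 * T 4 ^ 5 * T 5 ^ 6 / T 1 ^ 3)) * w = q ^ 121 * w from
      fun w => by field_simp] at key
  generalize 11 * (T 2 * T 4 / (T 1 ^ 2 * T 3)) - 11 * (T 3 * T 5 / (T 1 * T 2 * T 4)) +
        11 * (T 4 / (T 1 * T 5)) - 11 * (1 / T 4) - 3 * (T 3 ^ 2 / (T 1 ^ 2 * T 4)) -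
        3 * (T 2 * T 4 ^ 2 / (T 1 ^ 2 * T 3 * T 5)) - 3 * (T 2 * T 5 / (T 1 ^ 2 * T 4)) +
        T 2 ^ 3 / (T 1 ^ 3 * T 3) + 4 * (T 1 * T 4 / (T 2 ^ 2 * T 3)) = w at *
  generalize ∑ c ∈ Finset.range 11, rankTerm c T = S at *
  generalize qPochInf (q ^ 121) (q ^ 121) = Z at *
  generalize eulerSum T = E at *
  field_simp
  linear_combination -Z ^ 2 * key

theorem crankLambert_eq (hq0 : q ≠ 0) (hq : ‖q‖ < 1) {s : ℤ} (hs : ¬ 11 ∣ s) (hs' : Odd s)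
    (hE : ∀ t, IsThetaSeq t → eulerSum (fun k => t (s * k)) = eulerSum t)
    {T : ℤ → ℂ} (hT : T = fun k => thetaVal q (s * k)) :
    crankLambert q s = qPochInf (q ^ 121) (q ^ 121) / q ^ 5 *
        ∑ c ∈ Finset.range 11, crankTerm c T := by
  have hv := isThetaSeq_thetaVal hq0 hq
  have ht : IsThetaSeq T := hT ▸ hv.comp_mul hs' hs
  have hQ : ‖q ^ 121‖ < 1 := norm_pow_lt_one hq (by norm_num)
  have hQQ : qPochInf (q ^ 121) (q ^ 121) ≠ 0 := qPochInf_ne_zero hQ (one_sub_mul_pow_ne_zero hQ)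
  have hqq : qPochInf q q ≠ 0 := qPochInf_ne_zero hq (one_sub_mul_pow_ne_zero hq)
  have hP := qPochInf_eq_eulerSum hq0 hq
  rw [← hE _ hv, ← hT] at hP
  have hE0 : eulerSum T ≠ 0 := fun h => hqq (by rw [hP, h]; ring)
  rw [crankLambert, eleven_mul_baseSeries_one hq0 hq hs hs' hT, hP, ← ht.crank_dissection]
  field_simp

theorem sum_root_weight (hζ : IsPrimitiveRoot ζ 11) {s : ℤ} {F : ℕ → (ℤ → ℂ) → ℂ}
    (hF : ∀ c < 11, HasWeight (F c) (2 * c)) {c : ℕ} (hc : c < 11) (h : (11 : ℤ) ∣ 1 + s * s * c)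
    {T : ℤ → ℂ} (hT : T = fun k => thetaVal q (s * k)) :
    ∑ k ∈ Finset.range 11, ζ ^ k *
      ∑ c ∈ Finset.range 11, F c (fun j => thetaVal (ζ ^ k * q) (s * j)) = 11 * F c T := by
  have hη : ∀ k : ℕ, (ζ ^ k) ^ 11 = 1 := fun k => by
    rw [← pow_mul, mul_comm, pow_mul, hζ.pow_eq_one, one_pow]
  have step : ∀ k ∈ Finset.range 11, ζ ^ k *
      ∑ c ∈ Finset.range 11, F c (fun j => thetaVal (ζ ^ k * q) (s * j)) =
      ∑ c ∈ Finset.range 11, (ζ ^ k) ^ (1 + s * s * c) * F c T := by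
    intro k _
    rw [Finset.mul_sum]
    refine Finset.sum_congr rfl fun c hc => ?_
    have hμ : ((ζ ^ k) ^ (6 * (s * s))) ^ 11 = 1 := by
      rw [← zpow_natCast, ← zpow_mul, mul_comm, zpow_mul, zpow_natCast, hη, one_zpow]
    simp only [thetaVal_root_mul (hη k)]
    have := hF c (Finset.mem_range.1 hc) _ hμ T
    rw [hT] at this ⊢
    rw [this, ← mul_assoc, zpow_add₀ (HasWeight.ne_zero_of_pow (hη k)), zpow_one, ← zpow_mul,
      HasWeight.zpow_congr (hη k) (a := 6 * (s * s) * (2 * c)) (b := s * s * c) ⟨s * s * c,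
          by ring⟩]
  rw [Finset.sum_congr rfl step, Finset.sum_comm]
  simp only [← Finset.sum_mul, sum_root_zpow hζ]
  rw [Finset.sum_eq_single_of_mem c (Finset.mem_range.2 hc), if_pos h]
  intro b hb hbc
  rw [if_neg, zero_mul]
  intro h'
  have h0 : (11 : ℤ) ∣ s * s * ((b : ℤ) - c) := by
    have := dvd_sub h' h
    rwa [show 1 + s * s * b - (1 + s * s * c) = s * s * ((b : ℤ) - c) by ring] at this
  have hp : Prime (11 : ℤ) := by norm_num
  have hs0 : ¬ (11 : ℤ) ∣ s * s := fun hs0 => by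
    have := (Int.dvd_add_left (hs0.mul_right c)).1 h
    omega
  have := (hp.dvd_or_dvd h0).resolve_left hs0
  have := Finset.mem_range.1 hb
  omega

theorem qPochInf_root_mul {η : ℂ} (hη : η ^ 11 = 1) : (η * q) ^ 121 = q ^ 121 ∧
    (η * q) ^ 11 = q ^ 11 := by
  have e : η ^ 121 = 1 := by rw [show 121 = 11 * 11 by rfl, pow_mul, hη, one_pow]
  rw [mul_pow, mul_pow, e, hη, one_mul, one_mul]
  exact ⟨rfl, rfl⟩

theorem sieve_rankLambert (hq0 : q ≠ 0) (hq : ‖q‖ < 1) (hζ : IsPrimitiveRoot ζ 11) {s : ℤ}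
    (hs : ¬ 11 ∣ s) (hs' : Odd s)
    (hE : ∀ t, IsThetaSeq t → eulerSum (fun k => t (s * k)) = eulerSum t) {c : ℕ} (hc : c < 11)
    (h : (11 : ℤ) ∣ 1 + s * s * c) (hm : ¬ (11 : ℤ) ∣ 3 * (6 * s - triInt s) + 1)
    {T : ℤ → ℂ} (hT : T = fun k => thetaVal q (s * k)) :
    ∑ k ∈ Finset.range 11, (ζ ^ k) ^ 6 * rankLambert (ζ ^ k * q) s =
      11 * (qPochInf (q ^ 121) (q ^ 121) / (q ^ 5 * q ^ 121) * rankTerm c T) := by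
  have hη : ∀ k : ℕ, (ζ ^ k) ^ 11 = 1 := fun k => by
    rw [← pow_mul, mul_comm, pow_mul, hζ.pow_eq_one, one_pow]
  have hη1 : ∀ k : ℕ, ‖ζ ^ k‖ = 1 := fun k => Complex.norm_eq_one_of_pow_eq_one (hη k) (by norm_num)
  have step : ∀ k ∈ Finset.range 11, (ζ ^ k) ^ 6 * rankLambert (ζ ^ k * q) s =
      (ζ ^ k) ^ (3 * (6 * s - triInt s) + 1) * (-11 * (q ^ (3 * (6 * s - triInt s)) *
        appell 3 (q ^ 121) ((q ^ 11) ^ s) 1) / (q ^ 5 * qPochInf (q ^ 121) (q ^ 121))) +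
      qPochInf (q ^ 121) (q ^ 121) / (q ^ 5 * q ^ 121) * (ζ ^ k * ∑ c ∈ Finset.range 11,
        rankTerm c (fun j => thetaVal (ζ ^ k * q) (s * j))) := by
    intro k _
    have h0 := HasWeight.ne_zero_of_pow (hη k)
    have hηq : ‖ζ ^ k * q‖ < 1 := by rw [norm_mul, hη1, one_mul]; exact hq
    rw [rankLambert_eq (mul_ne_zero h0 hq0) hηq hs hs' hE rfl,
      (qPochInf_root_mul (hη k)).1, (qPochInf_root_mul (hη k)).2, mul_zpow, zpow_add₀ h0, zpow_one]
    field_simp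
  rw [Finset.sum_congr rfl step, Finset.sum_add_distrib, ← Finset.sum_mul, sum_root_zpow hζ,
    if_neg hm, ← Finset.mul_sum,
    sum_root_weight hζ (fun c hc => hasWeight_rankTerm hc) hc h hT]
  ring

theorem sieve_crankLambert (hq0 : q ≠ 0) (hq : ‖q‖ < 1) (hζ : IsPrimitiveRoot ζ 11) {s : ℤ}
    (hs : ¬ 11 ∣ s) (hs' : Odd s)
    (hE : ∀ t, IsThetaSeq t → eulerSum (fun k => t (s * k)) = eulerSum t) {c : ℕ} (hc : c < 11)
    (h : (11 : ℤ) ∣ 1 + s * s * c) {T : ℤ → ℂ} (hT : T = fun k => thetaVal q (s * k)) :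
    ∑ k ∈ Finset.range 11, (ζ ^ k) ^ 6 * crankLambert (ζ ^ k * q) s =
      11 * (qPochInf (q ^ 121) (q ^ 121) / q ^ 5 * crankTerm c T) := by
  have hη : ∀ k : ℕ, (ζ ^ k) ^ 11 = 1 := fun k => by
    rw [← pow_mul, mul_comm, pow_mul, hζ.pow_eq_one, one_pow]
  have hη1 : ∀ k : ℕ, ‖ζ ^ k‖ = 1 := fun k => Complex.norm_eq_one_of_pow_eq_one (hη k) (by norm_num)
  have step : ∀ k ∈ Finset.range 11, (ζ ^ k) ^ 6 * crankLambert (ζ ^ k * q) s =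
      qPochInf (q ^ 121) (q ^ 121) / q ^ 5 * (ζ ^ k * ∑ c ∈ Finset.range 11,
        crankTerm c (fun j => thetaVal (ζ ^ k * q) (s * j))) := by
    intro k _
    have h0 := HasWeight.ne_zero_of_pow (hη k)
    have hηq : ‖ζ ^ k * q‖ < 1 := by rw [norm_mul, hη1, one_mul]; exact hq
    rw [crankLambert_eq (mul_ne_zero h0 hq0) hηq hs hs' hE rfl,
      (qPochInf_root_mul (hη k)).1]
    field_simp
  rw [Finset.sum_congr rfl step, ← Finset.mul_sum,
    sum_root_weight hζ (fun c hc => hasWeight_crankTerm hc) hc h hT]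
  ring

end

namespace IsThetaSeq

variable {t : ℤ → ℂ}

theorem rankTerm_values (h : IsThetaSeq t) {R x Y : ℂ}
    (hR : R = t 1 ^ 3 / (t 2 ^ 3 * t 3 ^ 2 * t 4 ^ 4 * t 5 ^ 7)) (hx : x = unitX t)
    (hY : Y = unitY t) :
    rankTerm 10 (fun k => t (1 * k)) =
      R * (-11 * (Y / x) - 1 + 9 * Y - 2 * x + 3 * Y * x - 6 * x ^ 2 + 10 * x ^ 3) ∧
    rankTerm 8 (fun k => t (9 * k)) =
      R * (11 * (Y / x) + 2 - 18 * Y - 7 * x + 5 * Y * x + x ^ 2 + 2 * x ^ 3) ∧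
    rankTerm 6 (fun k => t (3 * k)) =
      R * (-3 + 16 * Y + 16 * x - 24 * Y * x - 18 * x ^ 2 - 3 * x ^ 3) ∧
    rankTerm 2 (fun k => t (7 * k)) =
      R * (-11 * (Y / x) + 4 + 8 * Y - 25 * x - Y * x + 24 * x ^ 2 - 7 * x ^ 3) ∧
    rankTerm 7 (fun k => t (5 * k)) =
      R * (11 * (Y / x) - 5 - 32 * Y + 12 * x + 15 * Y * x - 19 * x ^ 2 + 6 * x ^ 3) := by
  obtain ⟨⟨h9, h18, h27, h36, h45⟩, ⟨h6, h12, h15⟩, ⟨h7, h14, h21, h28, h35⟩, h10, h20, h25⟩ :=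
    h.values
  have hu := h.thetaUnits
  subst hR hx hY
  refine ⟨?_, ?_, ?_, ?_, ?_⟩
  · have e := rank_piece_one hu
    norm_num [rankTerm, unitX, unitY] at e ⊢
    rw [e]; ring
  · have e := rank_piece_two hu rfl rfl
    norm_num [rankTerm, unitX, unitY, h9, h18, h27, h36, h45] at e ⊢
    rw [e]; ring
  · have e := rank_piece_three hu rfl rfl
    norm_num [rankTerm, unitX, unitY, h9, h6, h12, h15] at e ⊢
    rw [e]
  · have e := rank_piece_four hu rfl rfl
    norm_num [rankTerm, unitX, unitY, h7, h14, h21, h28, h35] at e ⊢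
    rw [e]; ring
  · have e := rank_piece_five hu rfl rfl
    norm_num [rankTerm, unitX, unitY, h10, h20, h25, h15] at e ⊢
    rw [e]; ring

theorem crankTerm_values (h : IsThetaSeq t) :
    crankTerm 6 (fun k => t (3 * k)) = -(t 4 / (t 2 * t 5)) ∧
    crankTerm 2 (fun k => t (7 * k)) = -6 * (t 4 / (t 2 * t 5)) ∧
    crankTerm 7 (fun k => t (5 * k)) = 2 * (t 4 / (t 2 * t 5)) := by
  obtain ⟨⟨h9, h18, h27, h36, h45⟩, ⟨h6, h12, h15⟩, ⟨h7, h14, h21, h28, h35⟩, h10, h20, h25⟩ :=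
    h.values
  refine ⟨?_, ?_, ?_⟩ <;>
  · norm_num [crankTerm, h6, h9, h12, h15, h7, h28, h35, h10, h20]
    ring

/-- The five combinations of the rank and crank dissections that collapse to theta quotients. -/
theorem combinations (h : IsThetaSeq t) {R₁ R₉ R₃ R₇ R₅ B Q : ℂ}
    (h₁ : R₁ = rankTerm 10 (fun k => t (1 * k))) (h₉ : R₉ = rankTerm 8 (fun k => t (9 * k)))
    (h₃ : R₃ = rankTerm 6 (fun k => t (3 * k))) (h₇ : R₇ = rankTerm 2 (fun k => t (7 * k)))
    (h₅ : R₅ = rankTerm 7 (fun k => t (5 * k))) (hB : B = t 4 / (t 2 * t 5))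
    (hd : Q * (t 2 ^ 2 * t 3 ^ 2 * t 4 ^ 5 * t 5 ^ 6 / t 1 ^ 3) =
      1 + 2 * unitY t + 2 * unitX t - 3 * unitX t * unitY t - 5 * unitX t ^ 2 + unitX t ^ 3) :
    4 * R₁ + 8 * R₉ + 3 * R₃ + R₇ - 3 * R₅ - 22 * (Q * B) =
      121 / (t 1 * t 2 ^ 4 * t 3 ^ 2 * t 4 ^ 2 * t 5 ^ 4) ∧
    -R₁ - 13 * R₉ + 2 * R₃ - 3 * R₇ + 9 * R₅ - 33 * (Q * B) =
      121 / (t 1 * t 2 ^ 5 * t 3 ^ 4 * t 4 * t 5 ^ 2) ∧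
    -2 * R₁ + 7 * R₉ - 7 * R₃ + 5 * R₇ - 4 * R₅ + 44 * (Q * B) =
      121 / (t 1 * t 2 ^ 3 * t 3 ^ 4 * t 4 ^ 2 * t 5 ^ 3) ∧
    -3 * R₁ - 6 * R₉ - 5 * R₃ - 9 * R₇ - 6 * R₅ =
      121 / (t 1 * t 2 ^ 2 * t 3 ^ 2 * t 4 ^ 3 * t 5 ^ 5) ∧
    7 * R₁ - 8 * R₉ + 8 * R₃ - R₇ + 3 * R₅ - 55 * (Q * B) =
      121 / (t 1 * t 2 * t 3 ^ 4 * t 4 ^ 3 * t 5 ^ 4) := by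
  obtain ⟨r₁, r₉, r₃, r₇, r₅⟩ := h.rankTerm_values rfl rfl rfl
  obtain ⟨n₁, n₂, n₃, n₄, n₅, -, hx₁, -, -, hU, hV, rx₁, -, rU, rV, -⟩ :=
    h.thetaUnits
  rw [← h₁] at r₁; rw [← h₉] at r₉; rw [← h₃] at r₃; rw [← h₇] at r₇; rw [← h₅] at r₅
  have hQB : Q * B = t 1 ^ 3 / (t 2 ^ 3 * t 3 ^ 2 * t 4 ^ 4 * t 5 ^ 7) *
      (1 + 2 * unitY t + 2 * unitX t - 3 * unitX t * unitY t - 5 * unitX t ^ 2 + unitX t ^ 3) := by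
    rw [← hd, hB]; field_simp
  have hx : unitX t = t 3 * t 4 * t 5 / (t 1 ^ 2 * t 2) := rfl
  have hY : unitY t = t 3 * t 5 ^ 3 / (t 1 ^ 3 * t 2) := rfl
  have hx0 : unitX t ≠ 0 := by rw [hx]; positivity
  rw [← hx] at rx₁ rU rV
  rw [← hY] at rU rV
  have hw : unitY t / unitX t = unitY t * (unitX t)⁻¹ := div_eq_mul_inv _ _
  have hi := mul_inv_cancel₀ hx0
  have e1 : 121 / (t 1 * t 2 ^ 4 * t 3 ^ 2 * t 4 ^ 2 * t 5 ^ 4) =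
      t 1 ^ 3 / (t 2 ^ 3 * t 3 ^ 2 * t 4 ^ 4 * t 5 ^ 7) *
        (121 * (unitX t * (t 4 * t 5 ^ 2 / (t 1 ^ 2 * t 3)))) := by
    rw [hx]; field_simp
  have e2 : 121 / (t 1 * t 2 ^ 5 * t 3 ^ 4 * t 4 * t 5 ^ 2) =
      t 1 ^ 3 / (t 2 ^ 3 * t 3 ^ 2 * t 4 ^ 4 * t 5 ^ 7) *
        (121 * (t 4 * t 5 ^ 2 / (t 1 ^ 2 * t 3) *
          (t 4 ^ 2 * t 5 ^ 3 / (t 1 ^ 2 * t 2 ^ 2 * t 3)))) := by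
    field_simp
  have e3 : 121 / (t 1 * t 2 ^ 3 * t 3 ^ 4 * t 4 ^ 2 * t 5 ^ 3) =
      t 1 ^ 3 / (t 2 ^ 3 * t 3 ^ 2 * t 4 ^ 4 * t 5 ^ 7) *
        (121 * (t 4 * t 5 ^ 2 / (t 1 ^ 2 * t 3)) ^ 2) := by
    field_simp
  have e4 : 121 / (t 1 * t 2 ^ 2 * t 3 ^ 2 * t 4 ^ 3 * t 5 ^ 5) =
      t 1 ^ 3 / (t 2 ^ 3 * t 3 ^ 2 * t 4 ^ 4 * t 5 ^ 7) *
        (121 * (t 2 * t 4 * t 5 ^ 2 / t 1 ^ 4)) := by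
    field_simp
  have e5 : 121 / (t 1 * t 2 * t 3 ^ 4 * t 4 ^ 3 * t 5 ^ 4) =
      t 1 ^ 3 / (t 2 ^ 3 * t 3 ^ 2 * t 4 ^ 4 * t 5 ^ 7) *
        (121 * (t 4 * t 5 ^ 2 / (t 1 ^ 2 * t 3) * (t 2 * t 4 * t 5 ^ 2 / t 1 ^ 4) *
          (unitX t)⁻¹)) := by
    rw [hx]; field_simp
  rw [rx₁] at e1 e2 e3 e5
  rw [rU] at e2
  rw [rV] at e4 e5
  rw [e1, e2, e3, e4, e5, r₁, r₉, r₃, r₇, r₅, hQB, hw]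
  generalize t 1 ^ 3 / (t 2 ^ 3 * t 3 ^ 2 * t 4 ^ 4 * t 5 ^ 7) = R
  generalize unitY t = Y at *
  generalize unitX t = x at *
  refine ⟨by ring, by ring, by ring, by ring, ?_⟩
  linear_combination -121 * R * (Y + x - 1) * hi

end IsThetaSeq

/-- The Cauchy product of two sequences. -/
def cauchyProd (c d : ℕ → ℝ) (n : ℕ) : ℝ := ∑ p ∈ Finset.HasAntidiagonal.antidiagonal n,
    c p.1 * d p.2

/-- `c` is a nonnegative sequence with generating function `f` on the unit interval. -/
structure IsPosCoeff (c : ℕ → ℝ) (f : ℝ → ℂ) : Prop where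
  nonneg : ∀ n, 0 ≤ c n
  one_le : 1 ≤ c 0
  hasSum : ∀ y, 0 < y → y < 1 → ∃ r : ℝ, f y = r ∧ HasSum (fun n => c n * y ^ n) r

/-- Functions on the unit interval with nonnegative Taylor coefficients. -/
def PosSeries (f : ℝ → ℂ) : Prop := ∃ c, IsPosCoeff c f

theorem IsPosCoeff.mul {c d : ℕ → ℝ} {f g : ℝ → ℂ} (h : IsPosCoeff c f) (h' : IsPosCoeff d g) :
    IsPosCoeff (cauchyProd c d) (fun y => f y * g y) := by
  refine ⟨fun n => Finset.sum_nonneg fun p _ => mul_nonneg (h.nonneg _) (h'.nonneg _), ?_, ?_⟩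
  · simpa [cauchyProd] using one_le_mul_of_one_le_of_one_le h.one_le h'.one_le
  · intro y h0 h1
    obtain ⟨r, hr, hs⟩ := h.hasSum y h0 h1
    obtain ⟨r', hr', hs'⟩ := h'.hasSum y h0 h1
    refine ⟨r * r', by simp [hr, hr'], ?_⟩
    have e : (fun n => cauchyProd c d n * y ^ n) =
        fun n => ∑ p ∈ Finset.HasAntidiagonal.antidiagonal n,
            c p.1 * y ^ p.1 * (d p.2 * y ^ p.2) := by
      ext n
      rw [cauchyProd, Finset.sum_mul]
      refine Finset.sum_congr rfl fun p hp => ?_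
      rw [← Finset.HasAntidiagonal.mem_antidiagonal.1 hp, pow_add]; ring
    rw [e, ← hs.tsum_eq, ← hs'.tsum_eq]
    have n1 := hs.summable.norm
    have n2 := hs'.summable.norm
    rw [tsum_mul_tsum_eq_tsum_sum_antidiagonal_of_summable_norm n1 n2]
    exact (summable_norm_sum_mul_antidiagonal_of_summable_norm n1 n2).of_norm.hasSum

theorem IsPosCoeff.le_cauchyProd {c d : ℕ → ℝ} {f g : ℝ → ℂ} (h : IsPosCoeff c f)
    (h' : IsPosCoeff d g) (n : ℕ) : c n ≤ cauchyProd c d n := by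
  have hn : (n, 0) ∈ Finset.HasAntidiagonal.antidiagonal n := by simp
  refine le_trans ?_ (Finset.single_le_sum (f := fun p : ℕ × ℕ => c p.1 * d p.2)
    (fun p _ => mul_nonneg (h.nonneg _) (h'.nonneg _)) hn)
  exact le_mul_of_one_le_right (h.nonneg n) h'.one_le

namespace PosSeries

variable {f g : ℝ → ℂ}

theorem mul (h : PosSeries f) (h' : PosSeries g) : PosSeries fun y => f y * g y :=
  h.elim fun _ hc => h'.elim fun _ hd => ⟨_, hc.mul hd⟩

theorem congr (h : PosSeries f) (hfg : ∀ y, 0 < y → y < 1 → g y = f y) : PosSeries g :=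
  h.elim fun c hc => ⟨c, hc.nonneg, hc.one_le, fun y h0 h1 => by
    rw [hfg y h0 h1]; exact hc.hasSum y h0 h1⟩

theorem isPosCoeff_one : IsPosCoeff (fun n => if n = 0 then 1 else 0) (fun _ => 1) := by
  refine ⟨fun n => by positivity, by simp, fun y h0 h1 => ⟨1, by simp, ?_⟩⟩
  have := hasSum_ite_eq (0 : ℕ) (1 : ℝ)
  refine this.congr_fun ?_ |> id
  intro n
  split_ifs with h <;> simp [h]

theorem one : PosSeries fun _ => 1 := ⟨_, isPosCoeff_one⟩

theorem pow (h : PosSeries f) (n : ℕ) : PosSeries fun y => f y ^ n := by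
  induction n with
  | zero => simpa using one
  | succ n ih => simpa only [pow_succ] using ih.mul h

theorem hasSum_dvd {m : ℕ} (hm : 0 < m) {y : ℝ} (h0 : 0 < y) (h1 : y < 1) :
    HasSum (fun n => (if m ∣ n then 1 else 0) * y ^ n) (1 - y ^ m)⁻¹ := by
  have hinj : Function.Injective fun j : ℕ => m * j := fun i j h => Nat.eq_of_mul_eq_mul_left hm h
  refine (hinj.hasSum_iff fun n hn => ?_).1 ?_
  · rw [if_neg, zero_mul]
    rintro ⟨j, rfl⟩
    exact hn ⟨j, rfl⟩
  · have := hasSum_geometric_of_lt_one (pow_nonneg h0.le m) (pow_lt_one₀ h0.le h1 hm.ne')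
    refine this.congr_fun ?_ |> id
    intro j
    simp [pow_mul]

theorem inv_one_sub {m : ℕ} (hm : 0 < m) : PosSeries fun y => (1 - (y : ℂ) ^ m)⁻¹ :=
  ⟨fun n => if m ∣ n then 1 else 0, fun n => by positivity, by simp,
    fun _ h0 h1 => ⟨_, by push_cast; rfl, hasSum_dvd hm h0 h1⟩⟩

theorem one_sub_ne_zero {m : ℕ} (hm : 0 < m) {y : ℝ} (h0 : 0 < y) (h1 : y < 1) :
    1 - (y : ℂ) ^ m ≠ 0 := by
  have := pow_lt_one₀ h0.le h1 hm.ne'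
  exact_mod_cast (sub_pos.2 this).ne'

theorem one_sub_div {a b : ℕ} (ha : 0 < a) (hb : 0 < b) :
    PosSeries fun y => (1 - (y : ℂ) ^ (a + b)) / ((1 - (y : ℂ) ^ a) * (1 - (y : ℂ) ^ b)) := by
  refine ⟨fun n => (if b ∣ n then 1 else 0) + if n = 0 then 0 else if a ∣ n then 1 else 0,
    fun n => by positivity, by simp, fun y h0 h1 =>
      ⟨(1 - y ^ b)⁻¹ + ((1 - y ^ a)⁻¹ - 1), ?_, ?_⟩⟩
  · have := one_sub_ne_zero ha h0 h1
    have := one_sub_ne_zero hb h0 h1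
    push_cast
    field_simp
    ring
  · have := (hasSum_dvd hb h0 h1).add ((hasSum_dvd ha h0 h1).sub (hasSum_ite_eq (0 : ℕ) (1 : ℝ)))
    refine this.congr_fun ?_ |> id
    intro n
    by_cases hn : n = 0
    · simp [hn]
    · simp [hn, add_mul]

theorem of_tendsto {f : ℕ → ℝ → ℂ} {u : ℕ → ℝ → ℂ} (h0 : ∀ y, f 0 y = 1)
    (hu : ∀ N, PosSeries (u N)) (hf : ∀ N y, f (N + 1) y = f N y * u N y)
    (hg : ∀ y : ℝ, 0 < y → y < 1 → Tendsto (fun N => f N y) atTop (𝓝 (g y))) : PosSeries g := by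
  choose d hd using hu
  let c : ℕ → ℕ → ℝ := fun N => Nat.rec (fun n => if n = 0 then 1 else 0)
    (fun N cN => cauchyProd cN (d N)) N
  have hc : ∀ N, IsPosCoeff (c N) (f N) := by
    intro N
    induction N with
    | zero => rw [show f 0 = fun _ => 1 from funext h0]; exact isPosCoeff_one
    | succ N ih => rw [show f (N + 1) = _ from funext (hf N)]; exact ih.mul (hd N)
  have hmono : ∀ n, Monotone fun N => c N n := fun n =>
    monotone_nat_of_le_succ fun N => (hc N).le_cauchyProd (hd N) n
  have hre : ∀ y : ℝ, 0 < y → y < 1 → Tendsto (fun N => ∑' n, c N n * y ^ n) atTop (𝓝 (g y).re) ∧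
      g y = (g y).re := by
    intro y h0 h1
    have e : ∀ N, f N y = ((∑' n, c N n * y ^ n : ℝ) : ℂ) := fun N => by
      obtain ⟨r, hr, hs⟩ := (hc N).hasSum y h0 h1
      rw [hr, hs.tsum_eq]
    have t := hg y h0 h1
    simp only [e] at t
    have t1 := (Complex.continuous_re.tendsto _).comp t
    have t2 := (Complex.continuous_im.tendsto _).comp t
    refine ⟨t1, ?_⟩
    have him : (g y).im = 0 := tendsto_nhds_unique t2 (by
      refine tendsto_const_nhds.congr fun N => ?_
      simp)
    exact Complex.ext rfl him
  have hsum : ∀ N y, 0 < y → y < 1 → Summable fun n => c N n * y ^ n := fun N y h0 h1 => by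
    obtain ⟨r, -, hs⟩ := (hc N).hasSum y h0 h1
    exact hs.summable
  have hle : ∀ (y : ℝ), 0 < y → y < 1 → ∀ N (s : Finset ℕ),
      ∑ n ∈ s, c N n * y ^ n ≤ (g y).re := by
    intro y h0 h1 N s
    refine ge_of_tendsto (hre y h0 h1).1 ((eventually_ge_atTop N).mono fun M hM => ?_)
    refine le_trans (Finset.sum_le_sum fun n _ =>
      mul_le_mul_of_nonneg_right (hmono n hM) (pow_nonneg h0.le n)) ?_
    exact (hsum M y h0 h1).sum_le_tsum s fun n _ => mul_nonneg ((hc M).nonneg n) (pow_nonneg h0.le n)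
  have hbdd : ∀ n, BddAbove (Set.range fun N => c N n) := by
    intro n
    refine ⟨(g (1 / 2 : ℝ)).re / (1 / 2) ^ n, ?_⟩
    rintro _ ⟨N, rfl⟩
    rw [le_div_iff₀ (by positivity)]
    simpa using hle (1 / 2) (by norm_num) (by norm_num) N {n}
  have hL : ∀ n, Tendsto (fun N => c N n) atTop (𝓝 (⨆ N, c N n)) := fun n =>
    tendsto_atTop_ciSup (hmono n) (hbdd n)
  refine ⟨fun n => ⨆ N, c N n, fun n => ge_of_tendsto' (hL n) fun N => (hc N).nonneg n,
    ge_of_tendsto' (hL 0) fun N => (hc N).one_le, fun y h0 h1 =>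
      ⟨(g y).re, (hre y h0 h1).2, ?_⟩⟩
  have hS : Summable fun n => (⨆ N, c N n) * y ^ n := by
    refine summable_of_sum_le (fun n => mul_nonneg
      (ge_of_tendsto' (hL n) fun N => (hc N).nonneg n) (pow_nonneg h0.le n)) (c := (g y).re)
      fun s => ?_
    exact le_of_tendsto' (tendsto_finsetSum s fun n _ => (hL n).mul_const (y ^ n))
      fun N => hle y h0 h1 N s
  have key := tendsto_tsum_of_dominated_convergence (f := fun N n => c N n * y ^ n) hS
    (fun n => (hL n).mul_const (y ^ n)) (Eventually.of_forall fun N n => by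
      rw [Real.norm_of_nonneg (mul_nonneg ((hc N).nonneg n) (pow_nonneg h0.le n))]
      exact mul_le_mul_of_nonneg_right (le_ciSup (hbdd n) N) (pow_nonneg h0.le n))
  rw [← tendsto_nhds_unique key (hre y h0 h1).1]
  exact hS.hasSum

end PosSeries

namespace PosSeries

theorem norm_ofReal_lt_one {y : ℝ} (h0 : 0 < y) (h1 : y < 1) : ‖(y : ℂ)‖ < 1 := by
  simpa [abs_of_pos h0] using h1

theorem norm_ofReal_pow_lt_one {y : ℝ} (h0 : 0 < y) (h1 : y < 1) : ‖(y : ℂ) ^ 11‖ < 1 :=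
  norm_pow_lt_one (norm_ofReal_lt_one h0 h1) (by norm_num)

theorem one_sub_ofReal_pow_ne_zero {k : ℕ} (hk : 0 < k) {y : ℝ} (h0 : 0 < y) (h1 : y < 1) (i : ℕ) :
    1 - (y : ℂ) ^ k * ((y : ℂ) ^ 11) ^ i ≠ 0 := by
  rw [← pow_mul, ← pow_add]
  exact one_sub_ne_zero (by omega) h0 h1

theorem qPochInf_ofReal_ne_zero {k : ℕ} (hk : 0 < k) {y : ℝ} (h0 : 0 < y) (h1 : y < 1) :
    qPochInf ((y : ℂ) ^ 11) ((y : ℂ) ^ k) ≠ 0 :=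
  qPochInf_ne_zero (norm_ofReal_pow_lt_one h0 h1) (one_sub_ofReal_pow_ne_zero hk h0 h1)

theorem inv_qPochInf {k : ℕ} (hk : 0 < k) :
    PosSeries fun y => (qPochInf ((y : ℂ) ^ 11) ((y : ℂ) ^ k))⁻¹ := by
  refine of_tendsto (f := fun N y => (qPoch ((y : ℂ) ^ 11) ((y : ℂ) ^ k) N)⁻¹)
    (u := fun N y => (1 - (y : ℂ) ^ (k + 11 * N))⁻¹) (fun y => by simp [qPoch])
    (fun N => inv_one_sub (by omega)) (fun N y => ?_) (fun y h0 h1 => ?_)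
  · simp only [qPoch_succ, mul_inv, pow_add, pow_mul]
  · exact (tendsto_qPoch (norm_ofReal_pow_lt_one h0 h1) _).inv₀ (qPochInf_ofReal_ne_zero hk h0 h1)

theorem qPochInf_div {a b c : ℕ} (ha : 0 < a) (hb : 0 < b) (h : a + b = c) :
    PosSeries fun y => qPochInf (((y : ℂ) ^ 11) ^ 2) ((y : ℂ) ^ c) /
      (qPochInf ((y : ℂ) ^ 11) ((y : ℂ) ^ a) * qPochInf ((y : ℂ) ^ 11) ((y : ℂ) ^ b)) := by
  refine of_tendsto (f := fun N y => qPoch (((y : ℂ) ^ 11) ^ 2) ((y : ℂ) ^ c) N /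
      (qPoch ((y : ℂ) ^ 11) ((y : ℂ) ^ a) N * qPoch ((y : ℂ) ^ 11) ((y : ℂ) ^ b) N))
    (u := fun N y => (1 - (y : ℂ) ^ ((a + 11 * N) + (b + 11 * N))) /
      ((1 - (y : ℂ) ^ (a + 11 * N)) * (1 - (y : ℂ) ^ (b + 11 * N)))) (fun y => by simp [qPoch])
    (fun N => one_sub_div (by omega) (by omega)) (fun N y => ?_) (fun y h0 h1 => ?_)
  · simp only [qPoch_succ]
    rw [div_mul_div_comm]
    congr 1
    · rw [← h]; ring
    · ring
  · have hQ := norm_ofReal_pow_lt_one h0 h1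
    exact (tendsto_qPoch (norm_pow_lt_one hQ (by norm_num)) _).div
      ((tendsto_qPoch hQ _).mul (tendsto_qPoch hQ _))
      (mul_ne_zero (qPochInf_ofReal_ne_zero ha h0 h1) (qPochInf_ofReal_ne_zero hb h0 h1))

theorem thetaProd_ofReal {k : ℕ} (hk : k ≤ 11) {y : ℝ} (h0 : 0 < y) :
    thetaProd ((y : ℂ) ^ 11) ((y : ℂ) ^ k) = qPochInf ((y : ℂ) ^ 11) ((y : ℂ) ^ k) *
      qPochInf ((y : ℂ) ^ 11) ((y : ℂ) ^ (11 - k)) := by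
  rw [thetaProd]
  congr 2
  have : (y : ℂ) ≠ 0 := by exact_mod_cast h0.ne'
  rw [div_eq_iff (pow_ne_zero _ this), ← pow_add]
  congr 1; omega

theorem inv_thetaProd {k : ℕ} (hk : 0 < k) (hk' : k < 11) :
    PosSeries fun y => (thetaProd ((y : ℂ) ^ 11) ((y : ℂ) ^ k))⁻¹ :=
  ((inv_qPochInf hk).mul (inv_qPochInf (Nat.sub_pos_of_lt hk'))).congr fun y h0 _ => by
    rw [thetaProd_ofReal hk'.le h0, mul_inv]

theorem qPochInf_div_thetaProd_mul :
    PosSeries fun y => qPochInf ((y : ℂ) ^ 11) ((y : ℂ) ^ 11) /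
      (thetaProd ((y : ℂ) ^ 11) ((y : ℂ) ^ 1) * thetaProd ((y : ℂ) ^ 11) ((y : ℂ) ^ 2)) := by
  refine (((qPochInf_div (a := 1) (b := 10) (by norm_num) (by norm_num) rfl).mul
    (qPochInf_div (a := 2) (b := 20) (by norm_num) (by norm_num) rfl)).mul
    (inv_one_sub (m := 9) (by norm_num))).congr fun y h0 h1 => ?_
  have hQ := norm_ofReal_pow_lt_one h0 h1
  rw [thetaProd_ofReal (by norm_num) h0, thetaProd_ofReal (by norm_num) h0,
    qPochInf_eq_two hQ, qPochInf_eq hQ ((y : ℂ) ^ (11 - 2))]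
  simp only [← pow_add]
  norm_num only
  simp only [div_eq_mul_inv, mul_inv]
  ring

/-- Positivity of the quotients of theta products in the residue class five. -/
theorem theta_quotient (e₁ e₂ e₃ e₄ e₅ : ℕ) :
    PosSeries fun y => qPochInf ((y : ℂ) ^ 11) ((y : ℂ) ^ 11) /
      (thetaProd ((y : ℂ) ^ 11) ((y : ℂ) ^ 1) ^ (e₁ + 1) *
        thetaProd ((y : ℂ) ^ 11) ((y : ℂ) ^ 2) ^ (e₂ + 1) *
        thetaProd ((y : ℂ) ^ 11) ((y : ℂ) ^ 3) ^ e₃ * thetaProd ((y : ℂ) ^ 11) ((y : ℂ) ^ 4) ^ e₄ *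
        thetaProd ((y : ℂ) ^ 11) ((y : ℂ) ^ 5) ^ e₅) := by
  refine (qPochInf_div_thetaProd_mul.mul (((inv_thetaProd (k := 1) (by norm_num)
    (by norm_num)).pow e₁).mul (((inv_thetaProd (k := 2) (by norm_num) (by norm_num)).pow e₂).mul
    (((inv_thetaProd (k := 3) (by norm_num) (by norm_num)).pow e₃).mul
    (((inv_thetaProd (k := 4) (by norm_num) (by norm_num)).pow e₄).mul
    ((inv_thetaProd (k := 5) (by norm_num) (by norm_num)).pow e₅)))))).congr fun y h0 h1 => ?_
  simp only [div_eq_mul_inv, mul_inv, pow_succ, inv_pow]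
  ring

end PosSeries

/-- If two real power series agree on `(0, 1)`, their coefficients agree. -/
theorem eq_of_hasSum_eq {c d : ℕ → ℝ} {ε : ℝ} (hε : 0 < ε)
    (h : ∀ y : ℝ, 0 < y → y < ε → ∃ r, HasSum (fun n => c n * y ^ n) r ∧
      HasSum (fun n => d n * y ^ n) r) : c = d := by
  have key : ∀ e : ℕ → ℝ, (∀ y : ℝ, 0 < y → y < ε → HasSum (fun n => e n * y ^ n) 0) →
      ∀ n, e n = 0 := by
    intro e he n
    induction n using Nat.strong_induction_on with
    | _ n ih =>
    have hs : Summable fun m => |e (m + n)| * (ε / 2) ^ m := by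
      have h1 := (he (ε / 2) (by linarith) (by linarith)).summable.abs
      have h2 := ((summable_nat_add_iff n).2 h1).mul_right ((ε / 2) ^ n)⁻¹
      refine h2.congr fun m => ?_
      rw [abs_mul, abs_of_pos (by positivity : (0 : ℝ) < (ε / 2) ^ (m + n)), pow_add]
      field_simp
    have hz : ∀ y : ℝ, 0 < y → y < ε → ∑' m, e (m + n) * y ^ m = 0 := by
      intro y h0 h1
      have h2 := (hasSum_nat_add_iff' n).2 (he y h0 h1)
      rw [Finset.sum_eq_zero fun i hi => by rw [ih i (Finset.mem_range.1 hi), zero_mul]] at h2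
      have h3 := h2.mul_right (y ^ n)⁻¹
      have h4 : (fun m => e (m + n) * y ^ (m + n) * (y ^ n)⁻¹) = fun m => e (m + n) * y ^ m := by
        ext m; rw [pow_add]; field_simp
      rw [h4] at h3
      simpa using h3.tsum_eq
    have ht : Tendsto (fun y : ℝ => ∑' m, e (m + n) * y ^ m) (𝓝[Set.Ioo 0 (ε / 2)] 0)
        (𝓝 (∑' m, e (m + n) * (0 : ℝ) ^ m)) := by
      refine tendsto_tsum_of_dominated_convergence hs
        (fun m => ((continuous_pow m).tendsto 0).mono_left nhdsWithin_le_nhds |>.const_mul _)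
        (eventually_mem_nhdsWithin.mono fun y hy m => ?_)
      rw [Real.norm_eq_abs, abs_mul, abs_of_pos (pow_pos hy.1 m)]
      exact mul_le_mul_of_nonneg_left (pow_le_pow_left₀ hy.1.le hy.2.le m) (abs_nonneg _)
    have ht' : Tendsto (fun y : ℝ => ∑' m, e (m + n) * y ^ m) (𝓝[Set.Ioo 0 (ε / 2)] 0)
        (𝓝 0) := by
      refine tendsto_const_nhds.congr' (eventually_mem_nhdsWithin.mono fun y hy => ?_)
      exact (hz y hy.1 (hy.2.trans (by linarith))).symm
    have hne : (𝓝[Set.Ioo (0 : ℝ) (ε / 2)] 0).NeBot := by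
      rw [← mem_closure_iff_nhdsWithin_neBot, closure_Ioo (by linarith)]
      exact ⟨le_rfl, by linarith⟩
    have h0 := tendsto_nhds_unique ht ht'
    rw [tsum_eq_single 0 fun m hm => by rw [zero_pow hm, mul_zero]] at h0
    simpa using h0
  funext n
  refine sub_eq_zero.1 (key (fun n => c n - d n) (fun y h0 h1 => ?_) n)
  obtain ⟨r, h2, h3⟩ := h y h0 h1
  simpa [sub_mul] using h2.sub h3

/-- The finset of partitions of the integer `n`, as multisets of positive integers. -/
noncomputable def partitionFinset (n : ℤ) : Finset (Multiset ℕ) :=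
  if 0 ≤ n then Finset.univ.image fun π : Nat.Partition n.toNat => π.parts else ∅

theorem mem_partitionFinset {n : ℤ} {s : Multiset ℕ} :
    s ∈ partitionFinset n ↔ 0 ∉ s ∧ (s.sum : ℤ) = n := by
  unfold partitionFinset
  split_ifs with h
  · simp only [Finset.mem_image, Finset.mem_univ, true_and]
    constructor
    · rintro ⟨π, rfl⟩
      exact ⟨fun h0 => (π.parts_pos h0).ne' rfl, by rw [π.parts_sum]; omega⟩
    · rintro ⟨h0, h1⟩
      exact ⟨⟨s, fun {i} hi => Nat.pos_of_ne_zero fun h => h0 (h ▸ hi), by omega⟩, rfl⟩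
  · simp only [Finset.notMem_empty, false_iff, not_and]
    intro _ h1
    omega

open scoped Classical in
/-- The number of partitions of the integer `n` with a given property. -/
noncomputable def cnt (n : ℤ) (p : Multiset ℕ → Prop) : ℕ := ((partitionFinset n).filter p).card

theorem cnt_congr {n : ℤ} {p q : Multiset ℕ → Prop}
    (h : ∀ s, 0 ∉ s → (s.sum : ℤ) = n → (p s ↔ q s)) : cnt n p = cnt n q := by
  classical
  unfold cnt
  congr 1
  refine Finset.filter_congr fun s hs => ?_
  rw [mem_partitionFinset] at hs
  exact h s hs.1 hs.2

theorem cnt_le_cnt {n : ℤ} {p q : Multiset ℕ → Prop}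
    (h : ∀ s, 0 ∉ s → (s.sum : ℤ) = n → p s → q s) : cnt n p ≤ cnt n q := by
  classical
  refine Finset.card_le_card fun s hs => ?_
  rw [Finset.mem_filter] at hs ⊢
  have := mem_partitionFinset.1 hs.1
  exact ⟨hs.1, h s this.1 this.2 hs.2⟩

theorem cnt_split (n : ℤ) (p q : Multiset ℕ → Prop) :
    cnt n p = cnt n (fun s => p s ∧ q s) + cnt n fun s => p s ∧ ¬ q s := by
  classical
  unfold cnt
  rw [← Finset.card_filter_add_card_filter_not q, Finset.filter_filter, Finset.filter_filter]
  congr!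

theorem cnt_eq_zero {n : ℤ} {p : Multiset ℕ → Prop}
    (h : ∀ s, 0 ∉ s → (s.sum : ℤ) = n → ¬ p s) : cnt n p = 0 := by
  classical
  refine Finset.card_eq_zero.2 (Finset.filter_eq_empty_iff.2 fun s hs => ?_)
  rw [mem_partitionFinset] at hs
  exact h s hs.1 hs.2

theorem cnt_of_neg {n : ℤ} (hn : n < 0) (p : Multiset ℕ → Prop) : cnt n p = 0 :=
  cnt_eq_zero fun _ _ h => by omega

theorem cnt_bij {n m : ℤ} {p q : Multiset ℕ → Prop} (f g : Multiset ℕ → Multiset ℕ)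
    (hf : ∀ s, 0 ∉ s → (s.sum : ℤ) = n → p s →
      (0 ∉ f s ∧ ((f s).sum : ℤ) = m ∧ q (f s)) ∧ g (f s) = s)
    (hg : ∀ s, 0 ∉ s → (s.sum : ℤ) = m → q s →
      (0 ∉ g s ∧ ((g s).sum : ℤ) = n ∧ p (g s)) ∧ f (g s) = s) : cnt n p = cnt m q := by
  classical
  refine Finset.card_nbij' f g ?_ ?_ ?_ ?_
  · intro s hs
    simp only [Finset.coe_filter, Set.mem_ofPred_eq, mem_partitionFinset] at hs ⊢
    have := (hf s hs.1.1 hs.1.2 hs.2).1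
    tauto
  · intro s hs
    simp only [Finset.coe_filter, Set.mem_ofPred_eq, mem_partitionFinset] at hs ⊢
    have := (hg s hs.1.1 hs.1.2 hs.2).1
    tauto
  · intro s hs
    simp only [Finset.coe_filter, Set.mem_ofPred_eq, mem_partitionFinset] at hs
    exact (hf s hs.1.1 hs.1.2 hs.2).2
  · intro s hs
    simp only [Finset.coe_filter, Set.mem_ofPred_eq, mem_partitionFinset] at hs
    exact (hg s hs.1.1 hs.1.2 hs.2).2

theorem cnt_fiberwise {n : ℤ} {p : Multiset ℕ → Prop} (d : ℕ → Multiset ℕ → Prop) (K : Finset ℕ)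
    (hd : ∀ s, 0 ∉ s → (s.sum : ℤ) = n → p s → ∃ k ∈ K, d k s)
    (hu : ∀ s k k', d k s → d k' s → k = k') :
    cnt n p = ∑ k ∈ K, cnt n fun s => p s ∧ d k s := by
  classical
  unfold cnt
  rw [← Finset.card_biUnion]
  · congr 1
    ext s
    simp only [Finset.mem_filter, Finset.mem_biUnion, mem_partitionFinset]
    constructor
    · rintro ⟨h1, h2⟩
      obtain ⟨k, hk, hk'⟩ := hd s h1.1 h1.2 h2
      exact ⟨k, hk, h1, h2, hk'⟩
    · rintro ⟨k, hk, h1, h2, -⟩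
      exact ⟨h1, h2⟩
  · intro k _ k' _ hkk
    rw [Function.onFun, Finset.disjoint_left]
    intro s h1 h2
    simp only [Finset.mem_filter] at h1 h2
    exact hkk (hu s k k' h1.2.2 h2.2.2)

theorem cnt_natCast (n : ℕ) (p : Multiset ℕ → Prop) [DecidablePred p] :
    cnt n p = (Finset.univ.filter fun π : Nat.Partition n => p π.parts).card := by
  symm
  refine Finset.card_bij (fun π _ => π.parts) (fun π hπ => ?_)
    (fun π _ π' _ h => Nat.Partition.ext h) (fun s hs => ?_)
  · simp only [Finset.mem_filter] at hπ ⊢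
    exact ⟨mem_partitionFinset.2 ⟨fun h => (π.parts_pos h).ne' rfl, by rw [π.parts_sum]⟩, hπ.2⟩
  · simp only [Finset.mem_filter, mem_partitionFinset] at hs
    exact ⟨⟨s, fun {i} hi => Nat.pos_of_ne_zero fun h => hs.1.1 (h ▸ hi),
      by exact_mod_cast hs.1.2⟩, by simpa using hs.2, rfl⟩

/-- The number of partitions of an integer. -/
noncomputable def pCount (n : ℤ) : ℕ := cnt n fun _ => True

theorem pCount_le (n : ℕ) : pCount n ≤ 2 ^ n := by
  rw [pCount, cnt_natCast]
  calc _ ≤ Fintype.card (Nat.Partition n) := Finset.card_filter_le _ _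
    _ ≤ Fintype.card (Composition n) :=
      Fintype.card_le_of_surjective _ Nat.Partition.ofComposition_surj
    _ = 2 ^ (n - 1) := composition_card n
    _ ≤ 2 ^ n := Nat.pow_le_pow_right (by norm_num) (Nat.sub_le _ _)

theorem sum_map_pred (s : Multiset ℕ) (h : 0 ∉ s) :
    (s.map fun x => x - 1).sum + Multiset.card s = s.sum := by
  induction s using Multiset.induction_on with
  | empty => simp
  | cons a s ih =>
    simp only [Multiset.mem_cons, not_or] at h
    have := ih h.2
    simp only [Multiset.map_cons, Multiset.sum_cons, Multiset.card_cons]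
    omega

theorem sum_filter_pos (s : Multiset ℕ) : (s.filter (0 < ·)).sum = s.sum := by
  induction s using Multiset.induction_on with
  | empty => simp
  | cons a s ih =>
    by_cases h : 0 < a
    · simp [h, ih]
    · simp [ih, Nat.eq_zero_of_not_pos h]

theorem filter_pos_of_zero_notMem {s : Multiset ℕ} (h : 0 ∉ s) : s.filter (0 < ·) = s :=
  Multiset.filter_eq_self.2 fun _ ha => Nat.pos_of_ne_zero fun h0 => h (h0 ▸ ha)

theorem sup_le_of_forall {s : Multiset ℕ} {a : ℕ} (h : ∀ x ∈ s, x ≤ a) : s.sup ≤ a :=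
  Multiset.sup_le.2 h

theorem sup_mem {s : Multiset ℕ} (h : s ≠ 0) : s.sup ∈ s := by
  induction s using Multiset.induction_on with
  | empty => exact absurd rfl h
  | cons a s ih =>
    rw [Multiset.sup_cons]
    rcases le_total s.sup a with h1 | h1
    · rw [sup_eq_left.2 h1]; exact Multiset.mem_cons_self _ _
    · rw [sup_eq_right.2 h1]
      by_cases h2 : s = 0
      · subst h2
        simp at h1
        simp [h1]
      · exact Multiset.mem_cons_of_mem (ih h2)

/-- Splitting off the ones: shifting the parts down and up again. -/
theorem map_succ_filter_map_pred (s : Multiset ℕ) (h : 0 ∉ s) :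
    ((s.map fun x => x - 1).filter (0 < ·)).map (· + 1) +
      Multiset.replicate (Multiset.card s -
        Multiset.card ((s.map fun x => x - 1).filter (0 < ·))) 1 = s := by
  induction s using Multiset.induction_on with
  | empty => simp
  | cons a s ih =>
    simp only [Multiset.mem_cons, not_or] at h
    have ih := ih h.2
    have hle : Multiset.card ((s.map fun x => x - 1).filter (0 < ·)) ≤ Multiset.card s :=
      (Multiset.card_le_card (Multiset.filter_le _ _)).trans_eq (Multiset.card_map _ _)
    rw [Multiset.map_cons]
    by_cases ha : 0 < a - 1
    · rw [Multiset.filter_cons_of_pos _ ha, Multiset.map_cons, Multiset.card_cons,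
        Multiset.card_cons, Nat.add_sub_add_right, Multiset.cons_add, ih]
      congr 1; omega
    · rw [Multiset.filter_cons_of_neg _ ha, Multiset.card_cons, Nat.sub_add_comm hle,
        Multiset.replicate_succ, Multiset.add_cons, ih]
      congr 1; omega

/-- Dyson's map: decrease every part by one and add a new part `card s + k`. -/
def dysonMap (k : ℤ) (s : Multiset ℕ) : Multiset ℕ :=
  ((Multiset.card s + k).toNat ::ₘ s.map fun x => x - 1).filter (0 < ·)

/-- The inverse of Dyson's map: remove the largest part and increase all others by one. -/
def dysonInv (k : ℤ) (s : Multiset ℕ) : Multiset ℕ :=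
  (s.erase s.sup).map (· + 1) +
    Multiset.replicate ((s.sup : ℤ) - k - Multiset.card (s.erase s.sup)).toNat 1

theorem dysonInv_cons (k : ℤ) {a : ℕ} {s : Multiset ℕ} (h : ∀ x ∈ s, x ≤ a) :
    dysonInv k (a ::ₘ s) = s.map (· + 1) +
      Multiset.replicate ((a : ℤ) - k - Multiset.card s).toNat 1 := by
  have : (a ::ₘ s).sup = a := by
    rw [Multiset.sup_cons, sup_eq_left]; exact sup_le_of_forall h
  rw [dysonInv, this, Multiset.erase_cons_head]

/-- Dyson's bijection, with the condition that the partition on the nonzero side is nonempty. -/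
theorem cnt_dyson {k : ℤ} (hk0 : k ≠ 0) (m : ℤ) :
    cnt m (fun s => (0 < k ∨ s ≠ 0) ∧ (s.sup : ℤ) - Multiset.card s ≤ k + 1) =
      cnt (m + k) (fun s => (0 < k → s ≠ 0) ∧ k - 1 ≤ (s.sup : ℤ) - Multiset.card s) := by
  refine cnt_bij (dysonMap k) (dysonInv k) ?_ ?_
  · rintro s h0 hm ⟨hk, hr⟩
    have hle : ∀ x ∈ s, x ≤ s.sup := fun x hx => Multiset.le_sup hx
    have hcard : 0 ≤ (Multiset.card s : ℤ) + k := by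
      rcases hk with hk | hk
      · positivity
      · have := sup_mem hk
        have : s.sup ≠ 0 := fun h => h0 (h ▸ this)
        omega
    obtain ⟨a, ha⟩ := Int.eq_ofNat_of_zero_le hcard
    have hF : dysonMap k s = (a ::ₘ s.map fun x => x - 1).filter (0 < ·) := by
      rw [dysonMap, ha]; rfl
    have hsum := sum_map_pred s h0
    have hla : ∀ x ∈ (s.map fun x => x - 1).filter (0 < ·), x ≤ a := by
      intro x hx
      obtain ⟨y, hy, rfl⟩ := Multiset.mem_map.1 (Multiset.mem_filter.1 hx).1
      have := hle y hy
      omega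
    have hrec := map_succ_filter_map_pred s h0
    have hc : Multiset.card ((s.map fun x => x - 1).filter (0 < ·)) ≤ Multiset.card s :=
      (Multiset.card_le_card (Multiset.filter_le _ _)).trans_eq (Multiset.card_map _ _)
    refine ⟨⟨?_, ?_, ?_⟩, ?_⟩
    · rw [hF]; intro h; simpa using (Multiset.mem_filter.1 h).2
    · rw [hF, sum_filter_pos, Multiset.sum_cons]; omega
    · rcases Nat.eq_zero_or_pos a with ha0 | ha0
      · have hk' : ¬ 0 < k := by omega
        refine ⟨fun h => absurd h hk', ?_⟩
        have : dysonMap k s = 0 := by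
          rw [hF, ha0, Multiset.filter_cons_of_neg (p := (0 < ·)) _ (by simp)]
          refine Multiset.eq_zero_of_forall_notMem fun x hx => ?_
          have := hla x hx
          have := (Multiset.mem_filter.1 hx).2
          omega
        rw [this]
        simp
        omega
      · rw [hF, Multiset.filter_cons_of_pos (p := (0 < ·)) _ ha0]
        refine ⟨fun _ => Multiset.cons_ne_zero, ?_⟩
        rw [Multiset.sup_cons, sup_eq_left.2 (sup_le_of_forall hla), Multiset.card_cons]
        push_cast; omega
    · rcases Nat.eq_zero_or_pos a with ha0 | ha0
      · have hz : (s.map fun x => x - 1).filter (0 < ·) = 0 := by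
          refine Multiset.eq_zero_of_forall_notMem fun x hx => ?_
          have := hla x hx
          have := (Multiset.mem_filter.1 hx).2
          omega
        rw [hF, ha0, Multiset.filter_cons_of_neg (p := (0 < ·)) _ (by simp), hz]
        rw [hz] at hrec
        conv_rhs => rw [← hrec]
        simp only [dysonInv, Multiset.sup_zero, Multiset.erase_zero, Multiset.map_zero,
          Multiset.card_zero, zero_add]
        congr 1
        simp only [Nat.bot_eq_zero, Nat.cast_zero]
        omega
      · rw [hF, Multiset.filter_cons_of_pos (p := (0 < ·)) _ ha0, dysonInv_cons k hla]
        conv_rhs => rw [← hrec]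
        congr 2
        omega
  · rintro s h0 hm ⟨hk, hr⟩
    by_cases hs : s = 0
    · subst hs
      have hk' : k ≤ 0 := by
        by_contra h
        exact hk (by omega) rfl
      obtain ⟨j, hj⟩ := Int.eq_ofNat_of_zero_le (show 0 ≤ -k by omega)
      have hg : dysonInv k 0 = Multiset.replicate j 1 := by
        simp [dysonInv, hj]
      simp only [Multiset.sup_zero, Multiset.card_zero, Multiset.sum_zero] at hr hm
      have hj0 : j ≠ 0 := by rintro rfl; exact hk0 (by simpa using hj)
      rw [hg]
      refine ⟨⟨?_, ?_, ?_, ?_⟩, ?_⟩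
      · intro h; simpa using Multiset.eq_of_mem_replicate h
      · simp at hm ⊢; omega
      · right
        intro h
        simpa [hj0] using congrArg Multiset.card h
      · have : (Multiset.replicate j 1).sup ≤ 1 :=
          sup_le_of_forall fun x hx => (Multiset.eq_of_mem_replicate hx).le
        rw [Multiset.card_replicate]
        omega
      · rw [dysonMap, Multiset.card_replicate, Multiset.map_replicate,
          show ((j : ℤ) + k).toNat = 0 by omega, ← Multiset.replicate_succ]
        refine Multiset.filter_eq_nil.2 fun x hx => ?_
        rw [Multiset.eq_of_mem_replicate hx]; omega
    · obtain ⟨t, ht⟩ := Multiset.exists_cons_of_mem (sup_mem hs)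
      have hle : ∀ x ∈ t, x ≤ s.sup := fun x hx =>
        Multiset.le_sup (ht ▸ Multiset.mem_cons_of_mem hx)
      generalize s.sup = a at ht hr hle
      subst ht
      rw [dysonInv_cons k hle]
      rw [Multiset.card_cons] at hr
      push_cast at hr
      obtain ⟨j, hj⟩ := Int.eq_ofNat_of_zero_le (show 0 ≤ (a : ℤ) - k - Multiset.card t by omega)
      rw [hj, Int.toNat_natCast]
      simp only [Multiset.mem_cons, not_or] at h0
      have hcard : Multiset.card (t.map (· + 1) + Multiset.replicate j 1) =
          Multiset.card t + j := by simp
      rw [Multiset.sum_cons] at hm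
      push_cast at hm
      refine ⟨⟨?_, ?_, ?_, ?_⟩, ?_⟩
      · intro h
        rcases Multiset.mem_add.1 h with h | h
        · simp at h
        · simpa using Multiset.eq_of_mem_replicate h
      · simp [Multiset.sum_map_add]; omega
      · by_cases hk' : 0 < k
        · exact Or.inl hk'
        · right
          intro h
          rw [h] at hcard
          simp at hcard
          omega
      · have : (t.map (· + 1) + Multiset.replicate j 1).sup ≤ a + 1 := by
          refine sup_le_of_forall fun x hx => ?_
          rcases Multiset.mem_add.1 hx with h | h
          · obtain ⟨y, hy, rfl⟩ := Multiset.mem_map.1 h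
            have := hle y hy
            omega
          · rw [Multiset.eq_of_mem_replicate h]; omega
        rw [hcard]
        push_cast
        omega
      · rw [dysonMap, hcard, show (((Multiset.card t + j : ℕ) : ℤ) + k).toNat = a by
          simp at hj ⊢; omega]
        rw [Multiset.filter_cons_of_pos (p := (0 < ·)) _ (Nat.pos_of_ne_zero (Ne.symm h0.1)),
            Multiset.map_add,
          Multiset.filter_add, Multiset.map_map]
        simp only [Function.comp_def, Nat.add_sub_cancel, Multiset.map_id', Multiset.map_replicate,
          Nat.sub_self]
        rw [filter_pos_of_zero_notMem h0.2, Multiset.filter_eq_nil.2 (fun x hx => by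
          rw [Multiset.eq_of_mem_replicate hx]; omega), add_zero]

/-- The recursion satisfied by the tails of the rank (`e = 3`) and crank (`e = 1`) counts. -/
def IsTailCount (e : ℤ) (u : ℤ → ℤ → ℕ) : Prop :=
  ∀ r n, 1 ≤ r → u r n + u (r + e) (n - r) = pCount (n - r)

theorem IsTailCount.eq_zero {e : ℤ} {u : ℤ → ℤ → ℕ} (hu : IsTailCount e u) {r n : ℤ} (hr : 1 ≤ r)
    (hn : n < r) : u r n = 0 := by
  have := hu r n hr
  rw [show pCount (n - r) = 0 from cnt_of_neg (by omega) _] at this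
  omega

theorem IsTailCount.le {e : ℤ} {u : ℤ → ℤ → ℕ} (hu : IsTailCount e u) {r n : ℤ} (hr : 1 ≤ r) :
    u r n ≤ pCount (n - r) := by
  have := hu r n hr
  omega

theorem IsTailCount.unique {e : ℤ} (he : 0 ≤ e) {u v : ℤ → ℤ → ℕ} (hu : IsTailCount e u)
    (hv : IsTailCount e v) {r : ℤ} (hr : 1 ≤ r) (n : ℤ) : u r n = v r n := by
  by_cases hn : n < r
  · rw [hu.eq_zero hr hn, hv.eq_zero hr hn]
  · have h1 := hu r n hr
    have h2 := hv r n hr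
    have h3 := IsTailCount.unique he hu hv (r := r + e) (by omega) (n - r)
    omega
termination_by n.toNat

/-- The number of nonempty partitions of `n` with rank at least `r - 1`. -/
noncomputable def rankTail (r n : ℤ) : ℕ :=
  cnt n fun s => s ≠ 0 ∧ r - 1 ≤ (s.sup : ℤ) - Multiset.card s

theorem isTailCount_rankTail : IsTailCount 3 rankTail := by
  intro r n hr
  have h := cnt_dyson (k := r) (by omega) (n - r)
  rw [sub_add_cancel] at h
  have h1 : cnt (n - r) (fun s => (0 < r ∨ s ≠ 0) ∧ (s.sup : ℤ) - Multiset.card s ≤ r + 1) =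
      cnt (n - r) fun s => True ∧ ¬ (r + 2 ≤ (s.sup : ℤ) - Multiset.card s) :=
    cnt_congr fun s _ _ => by
      simp only [true_and]
      exact ⟨fun h => by omega, fun h => ⟨Or.inl (by omega), by omega⟩⟩
  have h2 : rankTail r n =
      cnt n fun s => (0 < r → s ≠ 0) ∧ r - 1 ≤ (s.sup : ℤ) - Multiset.card s :=
    cnt_congr fun s _ _ => by simp [show 0 < r by omega]
  have h3 : rankTail (r + 3) (n - r) =
      cnt (n - r) fun s => True ∧ (r + 2 ≤ (s.sup : ℤ) - Multiset.card s) :=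
    cnt_congr fun s _ _ => by
      simp only [true_and]
      refine ⟨fun h => by omega, fun h => ⟨?_, by omega⟩⟩
      rintro rfl
      simp at h
      omega
  rw [h2, ← h, h1, h3, pCount, cnt_split (n - r) (fun _ => True), add_comm]

/-- The number of nonempty partitions of `n` with rank at most `1 - r`. -/
noncomputable def rankTailNeg (r n : ℤ) : ℕ :=
  cnt n fun s => s ≠ 0 ∧ (s.sup : ℤ) - Multiset.card s ≤ 1 - r

theorem isTailCount_rankTailNeg : IsTailCount 3 rankTailNeg := by
  intro r n hr
  have h := cnt_dyson (k := -r) (by omega) n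
  rw [← sub_eq_add_neg] at h
  have h1 : rankTailNeg r n =
      cnt n fun s => (0 < -r ∨ s ≠ 0) ∧ (s.sup : ℤ) - Multiset.card s ≤ -r + 1 :=
    cnt_congr fun s _ _ => by
      have h0 : ¬ 0 < -r := by omega
      simp only [h0, false_or]
      exact and_congr_right fun _ => by omega
  have h2 : cnt (n - r) (fun s => (0 < -r → s ≠ 0) ∧ -r - 1 ≤ (s.sup : ℤ) - Multiset.card s) =
      cnt (n - r) fun s => True ∧ ¬ ((s.sup : ℤ) - Multiset.card s ≤ -r - 2) :=
    cnt_congr fun s _ _ => by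
      have h0 : ¬ 0 < -r := by omega
      simp only [h0, false_imp_iff, true_and]
      omega
  have h3 : rankTailNeg (r + 3) (n - r) =
      cnt (n - r) fun s => True ∧ ((s.sup : ℤ) - Multiset.card s ≤ -r - 2) :=
    cnt_congr fun s _ _ => by
      simp only [true_and]
      refine ⟨fun h => by omega, fun h => ⟨?_, by omega⟩⟩
      rintro rfl
      simp at h
      omega
  rw [h1, h, h2, h3, pCount, cnt_split (n - r) (fun _ => True), add_comm]

/-- The number of parts larger than `a`. -/
def numGt (s : Multiset ℕ) (a : ℕ) : ℕ := Multiset.card (s.filter (a < ·))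

theorem numGt_succ (s : Multiset ℕ) (a : ℕ) : numGt s a = numGt s (a + 1) + s.count (a + 1) := by
  unfold numGt
  induction s using Multiset.induction_on with
  | empty => simp
  | cons x s ih =>
    rw [Multiset.count_cons]
    rcases lt_trichotomy x (a + 1) with h | h | h
    · rw [Multiset.filter_cons_of_neg _ (by omega), Multiset.filter_cons_of_neg _ (by omega), ih,
        if_neg (by omega), add_zero]
    · rw [Multiset.filter_cons_of_pos _ (by omega), Multiset.filter_cons_of_neg _ (by omega),
        Multiset.card_cons, ih, if_pos h.symm, add_assoc]
    · rw [Multiset.filter_cons_of_pos _ (by omega), Multiset.filter_cons_of_pos _ h,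
        Multiset.card_cons, Multiset.card_cons, ih, if_neg (by omega)]
      ring

theorem numGt_cons_of_le {s : Multiset ℕ} {a x : ℕ} (h : x ≤ a) : numGt (x ::ₘ s) a =
    numGt s a := by
  rw [numGt, Multiset.filter_cons_of_neg _ (by omega), numGt]

theorem numGt_anti (s : Multiset ℕ) : Antitone (numGt s) :=
  antitone_nat_of_succ_le fun a => by rw [numGt_succ s a]; omega

theorem exists_decomp (s : Multiset ℕ) (a : ℕ) : ∃ A i B, (∀ x ∈ A, a < x) ∧ (∀ x ∈ B, x < a) ∧
    s = A + (Multiset.replicate i a + B) := by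
  induction s using Multiset.induction_on with
  | empty => exact ⟨0, 0, 0, by simp, by simp, by simp⟩
  | cons x s ih =>
    obtain ⟨A, i, B, hA, hB, rfl⟩ := ih
    rcases lt_trichotomy x a with h | rfl | h
    · refine ⟨A, i, x ::ₘ B, hA, by simpa [h] using hB, by simp⟩
    · exact ⟨A, i + 1, B, hA, hB, by simp [Multiset.replicate_succ]⟩
    · exact ⟨x ::ₘ A, i, B, by simpa [h] using hA, hB, by simp⟩

section Decomp

variable {a i : ℕ} {A B : Multiset ℕ}

theorem filter_gt_decomp (hA : ∀ x ∈ A, a < x) (hB : ∀ x ∈ B, x < a) :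
    (A + (Multiset.replicate i a + B)).filter (a < ·) = A := by
  rw [Multiset.filter_add, Multiset.filter_add, Multiset.filter_eq_self.2 hA,
    Multiset.filter_eq_nil.2 (fun x hx => (hB x hx).not_gt),
    Multiset.filter_eq_nil.2 (fun x hx => by rw [Multiset.eq_of_mem_replicate hx]; omega)]
  simp

theorem filter_lt_decomp (hA : ∀ x ∈ A, a < x) (hB : ∀ x ∈ B, x < a) :
    (A + (Multiset.replicate i a + B)).filter (· < a) = B := by
  rw [Multiset.filter_add, Multiset.filter_add, Multiset.filter_eq_self.2 hB,
    Multiset.filter_eq_nil.2 (fun x hx => (hA x hx).not_gt),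
    Multiset.filter_eq_nil.2 (fun x hx => by rw [Multiset.eq_of_mem_replicate hx]; omega)]
  simp

theorem count_decomp (hA : ∀ x ∈ A, a < x) (hB : ∀ x ∈ B, x < a) :
    (A + (Multiset.replicate i a + B)).count a = i := by
  rw [Multiset.count_add, Multiset.count_add, Multiset.count_replicate_self,
    Multiset.count_eq_zero.2 fun h => (hA a h).ne rfl,
    Multiset.count_eq_zero.2 fun h => (hB a h).ne rfl]
  simp

theorem numGt_decomp (hA : ∀ x ∈ A, a < x) (hB : ∀ x ∈ B, x < a) :
    numGt (A + (Multiset.replicate i a + B)) a = Multiset.card A := by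
  rw [numGt, filter_gt_decomp hA hB]

end Decomp

/-- Decrease all parts larger than `a` by one. -/
def lowerMap (a : ℕ) (s : Multiset ℕ) : Multiset ℕ :=
  ((s.filter (a < ·)).map (fun x => x - 1) +
    (Multiset.replicate (s.count a) a + s.filter (· < a))).filter (0 < ·)

/-- Increase the `b` largest parts by one. -/
def raiseMap (a b : ℕ) (s : Multiset ℕ) : Multiset ℕ :=
  ((s.filter (a < ·)).map (· + 1) + Multiset.replicate (b - numGt s a) (a + 1)) +
    (Multiset.replicate (s.count a - (b - numGt s a)) a + s.filter (· < a))

/-- The partition contains the rectangle with `b` rows of length `a` as its Durfee-type rectangle: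
the `b` largest parts are at least `a` and the others at most `a`. -/
def HasRect (a b : ℕ) (s : Multiset ℕ) : Prop :=
  numGt s a ≤ b ∧ (a = 0 ∨ b ≤ numGt s a + s.count a)

/-- The number of partitions with exactly `b` parts larger than `a`. -/
noncomputable def exactCount (a b : ℕ) (n : ℤ) : ℕ := cnt n fun s => numGt s a = b

/-- The number of partitions whose `b` largest parts are at least `a`, the others at most `a`. -/
noncomputable def rectCount (a b : ℕ) (n : ℤ) : ℕ := cnt n (HasRect a b)

theorem filter_pos_replicate_add {a i : ℕ} {A B : Multiset ℕ} (hA : ∀ x ∈ A, a < x)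
    (hB : 0 ∉ B) :
    (A + (Multiset.replicate i a + B)).filter (0 < ·) =
      A + (Multiset.replicate (if a = 0 then 0 else i) a + B) := by
  rw [Multiset.filter_add, Multiset.filter_add, filter_pos_of_zero_notMem hB,
    filter_pos_of_zero_notMem fun h => absurd (hA 0 h) (by omega)]
  split_ifs with h
  · rw [Multiset.filter_eq_nil.2 (fun x hx => by rw [Multiset.eq_of_mem_replicate hx]; omega)]
    simp
  · rw [filter_pos_of_zero_notMem]
    intro h0
    exact h (Multiset.eq_of_mem_replicate h0).symm

theorem sum_map_succ (s : Multiset ℕ) : (s.map (· + 1)).sum = s.sum + Multiset.card s := by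
  simp [Multiset.sum_map_add]

theorem exactCount_eq (a b : ℕ) (n : ℤ) : exactCount a b n = rectCount a b (n - b) := by
  have hlow : ∀ (A B : Multiset ℕ) (m i : ℕ), (∀ x ∈ A, a < x) → (∀ x ∈ B, x < a) → 0 ∉ B →
      lowerMap a ((A.map (· + 1) + Multiset.replicate m (a + 1)) +
        (Multiset.replicate i a + B)) =
      A + (Multiset.replicate (if a = 0 then 0 else m + i) a + B) := by
    intro A B m i hA hB h0
    have hA' : ∀ x ∈ A.map (· + 1) + Multiset.replicate m (a + 1), a < x := by
      intro x hx
      rcases Multiset.mem_add.1 hx with h | h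
      · obtain ⟨y, hy, rfl⟩ := Multiset.mem_map.1 h
        have := hA y hy
        omega
      · rw [Multiset.eq_of_mem_replicate h]; omega
    rw [lowerMap, filter_gt_decomp hA' hB, count_decomp hA' hB, filter_lt_decomp hA' hB,
      ← filter_pos_replicate_add hA h0]
    congr 1
    rw [Multiset.map_add, Multiset.map_map, Multiset.replicate_add]
    simp [add_assoc]
  have hraise : ∀ (A B : Multiset ℕ) (i : ℕ), (∀ x ∈ A, a < x) → (∀ x ∈ B, x < a) →
      raiseMap a b (A + (Multiset.replicate i a + B)) =
      (A.map (· + 1) + Multiset.replicate (b - Multiset.card A) (a + 1)) +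
        (Multiset.replicate (i - (b - Multiset.card A)) a + B) := by
    intro A B i hA hB
    rw [raiseMap, numGt_decomp hA hB, filter_gt_decomp hA hB, count_decomp hA hB,
      filter_lt_decomp hA hB]
  refine cnt_bij (lowerMap a) (raiseMap a b) ?_ ?_
  · intro s h0 hn hs
    obtain ⟨A, i, B, hA, hB, rfl⟩ := exists_decomp s a
    rw [numGt_decomp hA hB] at hs
    obtain ⟨A₁, m, B₁, hA₁, hB₁, h1⟩ := exists_decomp (A.map fun x => x - 1) a
    have hB₁' : B₁ = 0 := by
      refine Multiset.eq_zero_of_forall_notMem fun x hx => ?_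
      have h2 : x ∈ A.map fun x => x - 1 := by rw [h1]; simp [hx]
      obtain ⟨y, hy, rfl⟩ := Multiset.mem_map.1 h2
      have := hA y hy
      have := hB₁ _ hx
      omega
    have h2 : A = A₁.map (· + 1) + Multiset.replicate m (a + 1) := by
      have h3 := congrArg (Multiset.map (· + 1)) h1
      rw [Multiset.map_map, Multiset.map_congr rfl (g := id) fun x hx => by
        have := hA x hx
        simp only [Function.comp, id]
        omega, Multiset.map_id] at h3
      rw [h3, hB₁']
      simp
    subst h2
    have h0B : 0 ∉ B := fun h => h0 (by simp [h])
    have hi : a = 0 → i = 0 := by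
      intro ha
      by_contra hi
      refine h0 (Multiset.mem_add.2 (Or.inr (Multiset.mem_add.2 (Or.inl ?_))))
      rw [ha]; exact Multiset.mem_replicate.2 ⟨hi, rfl⟩
    rw [hlow A₁ B m i hA₁ hB h0B, hraise A₁ B _ hA₁ hB]
    simp only [Multiset.card_add, Multiset.card_map, Multiset.card_replicate] at hs
    rw [Multiset.sum_add, Multiset.sum_add, Multiset.sum_add, Multiset.sum_replicate,
      Multiset.sum_replicate, sum_map_succ] at hn
    refine ⟨⟨?_, ?_, ?_, ?_⟩, ?_⟩
    · intro h
      rcases Multiset.mem_add.1 h with h | h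
      · exact absurd (hA₁ 0 h) (by omega)
      · rcases Multiset.mem_add.1 h with h | h
        · split_ifs at h with ha
          · simp at h
          · exact ha (Multiset.eq_of_mem_replicate h).symm
        · exact h0B h
    · rw [Multiset.sum_add, Multiset.sum_add, Multiset.sum_replicate]
      split_ifs with ha
      · subst ha
        simp only [smul_eq_mul, mul_zero] at hn ⊢
        omega
      · simp only [smul_eq_mul, mul_add, add_mul] at hn ⊢
        omega
    · rw [numGt_decomp hA₁ hB]; omega
    · rw [numGt_decomp hA₁ hB, count_decomp hA₁ hB]
      split_ifs with ha
      · exact Or.inl ha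
      · right; omega
    · rw [show b - Multiset.card A₁ = m by omega]
      congr 3
      split_ifs with ha
      · rw [hi ha]; omega
      · omega
  · rintro s h0 hn ⟨hs, hs'⟩
    obtain ⟨A, i, B, hA, hB, rfl⟩ := exists_decomp s a
    rw [numGt_decomp hA hB] at hs hs'
    rw [count_decomp hA hB] at hs'
    have h0B : 0 ∉ B := fun h => h0 (by simp [h])
    have hi : a = 0 → i = 0 := by
      intro ha
      by_contra hi
      refine h0 (Multiset.mem_add.2 (Or.inr (Multiset.mem_add.2 (Or.inl ?_))))
      rw [ha]; exact Multiset.mem_replicate.2 ⟨hi, rfl⟩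
    obtain ⟨m, rfl⟩ := Nat.exists_eq_add_of_le hs
    rw [hraise A B _ hA hB, hlow A B _ _ hA hB h0B, Nat.add_sub_cancel_left]
    have hA' : ∀ x ∈ A.map (· + 1) + Multiset.replicate m (a + 1), a < x := by
      intro x hx
      rcases Multiset.mem_add.1 hx with h | h
      · obtain ⟨y, hy, rfl⟩ := Multiset.mem_map.1 h
        have := hA y hy
        omega
      · rw [Multiset.eq_of_mem_replicate h]; omega
    rw [Multiset.sum_add, Multiset.sum_add, Multiset.sum_replicate] at hn
    refine ⟨⟨?_, ?_, ?_⟩, ?_⟩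
    · intro h
      rcases Multiset.mem_add.1 h with h | h
      · exact absurd (hA' 0 h) (by omega)
      · rcases Multiset.mem_add.1 h with h | h
        · have h1 := Multiset.mem_replicate.1 h
          exact h1.1 (by rw [hi h1.2.symm]; omega)
        · exact h0B h
    · rw [Multiset.sum_add, Multiset.sum_add, Multiset.sum_add, Multiset.sum_replicate,
        Multiset.sum_replicate, sum_map_succ]
      rcases hs' with ha | ha
      · subst ha
        simp only [smul_eq_mul, mul_zero] at hn ⊢
        push_cast at hn ⊢
        omega
      · obtain ⟨j, rfl⟩ := Nat.exists_eq_add_of_le (show m ≤ i by omega)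
        rw [Nat.add_sub_cancel_left]
        simp only [smul_eq_mul, mul_add, add_mul] at hn ⊢
        push_cast at hn ⊢
        omega
    · rw [numGt_decomp hA' hB]
      simp
    · congr 3
      split_ifs with ha
      · rw [hi ha]
      · have := hs'.resolve_left ha
        omega

theorem rectCount_pred_right (a b : ℕ) (n : ℤ) :
    rectCount a (b + 1) n = rectCount a (b + 1) (n - (b + 1 : ℕ)) + rectCount a b (n - a) := by
  rw [← exactCount_eq, rectCount, cnt_split n _ fun s => numGt s a = b + 1]
  congr 1
  · refine cnt_congr fun s _ _ => ⟨fun h => h.2, fun h => ⟨⟨h.le, Or.inr (by omega)⟩, h⟩⟩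
  · rcases Nat.eq_zero_or_pos a with rfl | ha
    · rw [rectCount, Nat.cast_zero, sub_zero]
      refine cnt_congr fun s _ _ => ?_
      simp only [HasRect, true_or, and_true]
      omega
    · refine cnt_bij (fun s => s.erase a) (fun s => a ::ₘ s) ?_ ?_
      · rintro s h0 hn ⟨⟨h1, h2⟩, h3⟩
        have hm : a ∈ s := by
          by_contra h
          rw [Multiset.count_eq_zero.2 h] at h2
          omega
        obtain ⟨t, rfl⟩ := Multiset.exists_cons_of_mem hm
        simp only [Multiset.mem_cons, not_or, Multiset.sum_cons, numGt_cons_of_le le_rfl,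
          Multiset.count_cons_self, Multiset.erase_cons_head, HasRect] at *
        exact ⟨⟨h0.2, by omega, by omega, by omega⟩, trivial⟩
      · rintro s h0 hn ⟨h1, h2⟩
        simp only [Multiset.mem_cons, not_or, Multiset.sum_cons, numGt_cons_of_le le_rfl,
          Multiset.count_cons_self, Multiset.erase_cons_head, HasRect] at *
        exact ⟨⟨⟨by omega, h0⟩, by omega, by omega⟩, trivial⟩

theorem rectCount_pred_left (a b : ℕ) (n : ℤ) :
    rectCount (a + 1) b n = rectCount (a + 1) b (n - (a + 1 : ℕ)) + rectCount a b (n - b) := by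
  rw [← exactCount_eq, rectCount, cnt_split n _ fun s => numGt s a = b, add_comm]
  congr 1
  · refine cnt_bij (fun s => s.erase (a + 1)) (fun s => (a + 1) ::ₘ s) ?_ ?_
    · rintro s h0 hn ⟨⟨h1, h2⟩, h3⟩
      rw [numGt_succ _ a] at h3
      have hm : a + 1 ∈ s := by
        by_contra h
        rw [Multiset.count_eq_zero.2 h] at h2 h3
        omega
      obtain ⟨t, rfl⟩ := Multiset.exists_cons_of_mem hm
      simp only [Multiset.mem_cons, not_or, Multiset.sum_cons, numGt_cons_of_le le_rfl,
        Multiset.count_cons_self, Multiset.erase_cons_head, HasRect] at *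
      exact ⟨⟨h0.2, by omega, by omega, by omega⟩, trivial⟩
    · rintro s h0 hn ⟨h1, h2⟩
      rw [numGt_succ _ a]
      simp only [Multiset.mem_cons, not_or, Multiset.sum_cons, numGt_cons_of_le le_rfl,
        Multiset.count_cons_self, Multiset.erase_cons_head, HasRect] at *
      exact ⟨⟨⟨by omega, h0⟩, by omega, by omega⟩, trivial⟩
  · refine cnt_congr fun s _ _ => ⟨fun h => h.2, fun h => ⟨⟨?_, Or.inr ?_⟩, h⟩⟩
    · rw [numGt_succ _ a] at h; omega
    · rw [numGt_succ _ a] at h; omega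

theorem rectCount_comm (a b : ℕ) (n : ℤ) : rectCount a b n = rectCount b a n := by
  obtain ⟨N, hN⟩ : ∃ N, (n + 1).toNat + a + b ≤ N := ⟨_, le_rfl⟩
  induction N generalizing a b n with
  | zero =>
    have hn : n < 0 := by omega
    rw [rectCount, rectCount, cnt_of_neg hn, cnt_of_neg hn]
  | succ N ih =>
    by_cases hn : n < 0
    · rw [rectCount, rectCount, cnt_of_neg hn, cnt_of_neg hn]
    · rcases b with _ | b
      · rcases a with _ | a
        · rfl
        · rw [rectCount_pred_left, rectCount_pred_right, ih (a + 1) 0 _ (by omega),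
            ih a 0 _ (by omega)]
      · rw [rectCount_pred_right, rectCount_pred_left b a, ih a (b + 1) _ (by omega),
          ih a b _ (by omega)]

theorem cnt_strip_ones (j : ℕ) (n : ℤ) (p : Multiset ℕ → Prop) :
    cnt n (fun s => j ≤ s.count 1 ∧ p s) =
      cnt (n - j) fun s => p (s + Multiset.replicate j 1) := by
  refine cnt_bij (fun s => s - Multiset.replicate j 1) (fun s => s + Multiset.replicate j 1) ?_ ?_
  · rintro s h0 hn ⟨h1, h2⟩
    obtain ⟨t, rfl⟩ := Multiset.le_iff_exists_add.1 (Multiset.le_count_iff_replicate_le.1 h1)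
    rw [add_comm (Multiset.replicate j 1) t] at h2 hn h0 ⊢
    simp only [add_tsub_cancel_right]
    rw [Multiset.sum_add, Multiset.sum_replicate] at hn
    refine ⟨⟨fun h => h0 (Multiset.mem_add.2 (Or.inl h)), ?_, h2⟩, trivial⟩
    simp only [smul_eq_mul, mul_one] at hn
    omega
  · intro s h0 hn hp
    refine ⟨⟨?_, ?_, ?_, hp⟩, add_tsub_cancel_right _ _⟩
    · intro h
      rcases Multiset.mem_add.1 h with h | h
      · exact h0 h
      · simpa using Multiset.eq_of_mem_replicate h
    · rw [Multiset.sum_add, Multiset.sum_replicate]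
      simp only [smul_eq_mul, mul_one]; omega
    · simp

theorem numGt_add_ones (s : Multiset ℕ) (j : ℕ) {a : ℕ} (ha : 1 ≤ a) :
    numGt (s + Multiset.replicate j 1) a = numGt s a := by
  have h : (Multiset.replicate j 1).filter (a < ·) = 0 :=
    Multiset.filter_eq_nil.2 fun x hx => by rw [Multiset.eq_of_mem_replicate hx]; omega
  rw [numGt, Multiset.filter_add, h, add_zero, numGt]

theorem hasRect_add_ones (s : Multiset ℕ) (j : ℕ) {a b : ℕ} (ha : 2 ≤ a) :
    HasRect a b (s + Multiset.replicate j 1) ↔ HasRect a b s := by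
  rw [HasRect, HasRect, numGt_add_ones s j (by omega), Multiset.count_add,
    Multiset.count_replicate, if_neg (by omega), add_zero]

theorem numGt_le_card (s : Multiset ℕ) (a : ℕ) : numGt s a ≤ Multiset.card s :=
  Multiset.card_le_card (Multiset.filter_le _ _)

theorem card_le_sum {s : Multiset ℕ} (h : 0 ∉ s) : Multiset.card s ≤ s.sum := by
  have := sum_map_pred s h
  omega

theorem HasRect.numGt_le_iff {s : Multiset ℕ} {i j k : ℕ} (h : HasRect (k + i) (k + j) s) (l : ℕ) :
    numGt s (l + i) ≤ l + j ↔ k ≤ l := by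
  constructor
  · intro h1
    by_contra h2
    obtain ⟨d, rfl⟩ := Nat.exists_eq_add_of_lt (not_le.1 h2)
    have h3 := h.2.resolve_left (by omega)
    rw [show l + d + 1 + i = (l + i + d) + 1 by omega, ← numGt_succ] at h3
    have := numGt_anti s (show l + i ≤ l + i + d by omega)
    omega
  · intro h1
    have := numGt_anti s (show k + i ≤ l + i by omega)
    have := h.1
    omega

theorem exists_hasRect (s : Multiset ℕ) {i j : ℕ} (hij : i = 0 ∨ j = 0) :
    ∃ k ≤ Multiset.card s, HasRect (k + i) (k + j) s := by
  have hex : ∃ k, numGt s (k + i) ≤ k + j :=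
    ⟨Multiset.card s, (numGt_le_card _ _).trans (Nat.le_add_right _ _)⟩
  classical
  refine ⟨Nat.find hex, Nat.find_min' hex ((numGt_le_card _ _).trans (Nat.le_add_right _ _)),
    Nat.find_spec hex, ?_⟩
  rcases h : Nat.find hex with _ | k
  · rcases hij with rfl | rfl
    · exact Or.inl rfl
    · exact Or.inr (by omega)
  · have := Nat.find_min hex (m := k) (by omega)
    right
    rw [show k + 1 + i = (k + i) + 1 by omega, ← numGt_succ]
    omega

theorem cnt_eq_sum_hasRect {i j : ℕ} (hij : i = 0 ∨ j = 0) {n : ℤ} {K : ℕ} (hK : n < K)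
    (p : Multiset ℕ → Prop) :
    cnt n p = ∑ k ∈ Finset.range K, cnt n fun s => p s ∧ HasRect (k + i) (k + j) s := by
  refine cnt_fiberwise (fun k s => HasRect (k + i) (k + j) s) _ ?_ ?_
  · intro s h0 hn _
    obtain ⟨k, hk, h⟩ := exists_hasRect s hij
    have := card_le_sum h0
    exact ⟨k, Finset.mem_range.2 (by omega), h⟩
  · intro s k k' h h'
    exact le_antisymm ((h.numGt_le_iff k').1 h'.1) ((h'.numGt_le_iff k).1 h.1)

theorem pCount_eq_sum (m : ℕ) {n : ℤ} {K : ℕ} (hK : n < K) :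
    pCount n = ∑ k ∈ Finset.range K, rectCount (k + m) k n := by
  rw [pCount, cnt_eq_sum_hasRect (i := m) (j := 0) (Or.inr rfl) hK]
  simp only [true_and]
  rfl

theorem cnt_ones_hasRect {a b : ℕ} (j : ℕ) (n : ℤ) (h : 2 ≤ a) :
    cnt n (fun s => j ≤ s.count 1 ∧ HasRect a b s) = rectCount a b (n - j) := by
  rw [cnt_strip_ones]
  exact cnt_congr fun s _ _ => hasRect_add_ones s j h

/-- Partitions in which the number of parts larger than `ω + m` is at most the number `ω`
of ones. -/
noncomputable def crankAux (m : ℕ) (n : ℤ) : ℕ :=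
  cnt n fun s => numGt s (s.count 1 + m) ≤ s.count 1

theorem crankAux_eq_sum {m : ℕ} (hm : 1 ≤ m) {n : ℤ} {K : ℕ} (hK : n < K) :
    crankAux m n = ∑ k ∈ Finset.range K, rectCount (k + m) k (n - k) := by
  rw [crankAux, cnt_eq_sum_hasRect (i := m) (j := 0) (Or.inr rfl) hK]
  refine Finset.sum_congr rfl fun k _ => ?_
  have h1 : cnt n (fun s => numGt s (s.count 1 + m) ≤ s.count 1 ∧ HasRect (k + m) (k + 0) s) =
      cnt n fun s => k ≤ s.count 1 ∧ HasRect (k + m) k s :=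
    cnt_congr fun s _ _ => and_congr_left fun h => h.numGt_le_iff _
  rw [h1]
  rcases Nat.eq_zero_or_pos k with rfl | hk
  · simp [rectCount]
  · exact cnt_ones_hasRect k n (by omega)

theorem crankAux_add {m : ℕ} (hm : 1 ≤ m) (n : ℤ) :
    crankAux m n + crankAux (m + 1) (n - (m + 1 : ℕ)) = pCount n := by
  obtain ⟨K, hK⟩ : ∃ K : ℕ, n < K := ⟨n.toNat + 1, by omega⟩
  rw [pCount_eq_sum m (K := K + 1) (by push_cast; omega),
    crankAux_eq_sum hm (K := K + 1) (by push_cast; omega),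
    crankAux_eq_sum (by omega) (K := K) (by omega), Finset.sum_range_succ',
    Finset.sum_range_succ' (fun k => rectCount (k + m) k n), add_right_comm,
    ← Finset.sum_add_distrib]
  simp only [Nat.cast_zero, sub_zero]
  congr 1
  refine Finset.sum_congr rfl fun k _ => ?_
  rw [rectCount_pred_right (k + 1 + m) k n]
  congr 1
  rw [show k + (m + 1) = k + 1 + m by omega]
  congr 1
  push_cast
  ring

/-- The crank of a multiset of positive integers. -/
noncomputable def multisetCrank (s : Multiset ℕ) : ℤ :=
  if s.count 1 = 0 then (s.sup : ℤ) else (numGt s (s.count 1) : ℤ) - s.count 1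

/-- The number of partitions of `n` with crank at most `-r`. -/
noncomputable def crankTailNeg (r n : ℤ) : ℕ := cnt n fun s => multisetCrank s ≤ -r

/-- The number of partitions of `n` with crank at least `r`. -/
noncomputable def crankTail (r n : ℤ) : ℕ := cnt n fun s => r ≤ multisetCrank s

theorem crankTailNeg_eq {m : ℕ} (hm : 1 ≤ m) (n : ℤ) : crankTailNeg m n = crankAux m (n - m) := by
  have h : crankTailNeg m n =
      cnt n fun s => m ≤ s.count 1 ∧ numGt s (s.count 1) + m ≤ s.count 1 := by
    refine cnt_congr fun s _ _ => ?_
    unfold multisetCrank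
    split_ifs with h
    · rw [h]; omega
    · omega
  rw [h, cnt_strip_ones]
  refine cnt_congr fun s _ _ => ?_
  rw [Multiset.count_add, Multiset.count_replicate_self, numGt_add_ones s m (by omega)]
  omega

theorem isTailCount_crankTailNeg : IsTailCount 1 crankTailNeg := by
  intro r n hr
  obtain ⟨m, rfl⟩ := Int.eq_ofNat_of_zero_le (show 0 ≤ r by omega)
  have hm : 1 ≤ m := by omega
  rw [crankTailNeg_eq hm, ← crankAux_add hm (n - m),
    show (m : ℤ) + 1 = ((m + 1 : ℕ) : ℤ) by push_cast; ring, crankTailNeg_eq (by omega)]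

theorem lt_multisetSup_iff (s : Multiset ℕ) (a : ℕ) : a < s.sup ↔ 1 ≤ numGt s a := by
  rw [numGt, Nat.one_le_iff_ne_zero, Ne, Multiset.card_eq_zero, Multiset.filter_eq_nil, ← not_le,
    Multiset.sup_le]
  simp only [not_lt]

theorem cnt_lt_sup (μ : ℕ) {n : ℤ} {K : ℕ} (hK : n < K) :
    cnt n (fun s => μ < s.sup) =
      ∑ k ∈ Finset.range K, rectCount (k + 1) (k + 1 + μ) n := by
  rw [cnt_eq_sum_hasRect (i := μ) (j := 0) (K := K + 1) (Or.inr rfl) (by push_cast; omega),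
    Finset.sum_range_succ', cnt_eq_zero (n := n)
      (p := fun s => μ < s.sup ∧ HasRect (0 + μ) (0 + 0) s), add_zero]
  · refine Finset.sum_congr rfl fun k _ => ?_
    rw [rectCount_comm]
    refine cnt_congr fun s _ _ => ⟨fun h => h.2, fun h => ⟨?_, h⟩⟩
    have := h.numGt_le_iff (j := 0) 0
    rw [lt_multisetSup_iff]
    rw [zero_add] at this
    omega
  · rintro s _ _ ⟨h1, h2⟩
    rw [lt_multisetSup_iff] at h1
    have := h2.1
    simp only [zero_add] at this
    omega

theorem crankTail_eq {m : ℕ} (hm : 1 ≤ m) {n : ℤ} (hn : n ≠ 1) :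
    crankTail m n = crankAux m (n - m) := by
  obtain ⟨μ, rfl⟩ := Nat.exists_eq_add_of_le' hm
  obtain ⟨K, hK⟩ : ∃ K : ℕ, n < K := ⟨n.toNat + 1, by omega⟩
  have h1 : cnt n (fun s => μ < s.sup ∧ s.count 1 = 0) + cnt (n - 1) (fun s => μ < s.sup) =
      cnt n fun s => μ < s.sup := by
    rw [cnt_split n (fun s => μ < s.sup) fun s => s.count 1 = 0]
    congr 1
    have h := cnt_strip_ones 1 n fun s => μ < s.sup
    rw [Nat.cast_one] at h
    have h2 : cnt n (fun s => 1 ≤ s.count 1 ∧ μ < s.sup) =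
        cnt n fun s => μ < s.sup ∧ ¬ s.count 1 = 0 := cnt_congr fun s _ _ => by omega
    rw [← h2, h]
    refine cnt_congr fun s h0 hs => ?_
    rw [Multiset.sup_add, Multiset.replicate_one, Multiset.sup_singleton, lt_sup_iff]
    refine ⟨Or.inl, fun h => h.elim id fun h => ?_⟩
    by_contra h3
    have h4 : s = 0 := Multiset.eq_zero_of_forall_notMem fun x hx => by
      have := Multiset.le_sup hx
      exact h0 (by rwa [show x = 0 by omega] at hx)
    rw [h4] at hs
    simp only [Multiset.sum_zero] at hs
    omega
  have h2 : crankTail ((μ + 1 : ℕ) : ℤ) n =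
      cnt n (fun s => μ < s.sup ∧ s.count 1 = 0) +
        cnt (n - 1) fun s => s.count 1 + 1 + (μ + 1) ≤ numGt s (s.count 1 + 1) := by
    rw [crankTail, cnt_split n _ fun s => s.count 1 = 0]
    have h := cnt_strip_ones 1 n fun s => s.count 1 + (μ + 1) ≤ numGt s (s.count 1)
    rw [Nat.cast_one] at h
    congr 1
    · refine cnt_congr fun s _ _ => and_congr_left fun h => ?_
      rw [multisetCrank, if_pos h]
      push_cast; omega
    · have h3 : cnt n (fun s => 1 ≤ s.count 1 ∧ s.count 1 + (μ + 1) ≤ numGt s (s.count 1)) =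
          cnt n fun s => ((μ + 1 : ℕ) : ℤ) ≤ multisetCrank s ∧ ¬ s.count 1 = 0 := by
        refine cnt_congr fun s _ _ => ?_
        unfold multisetCrank
        split_ifs with h
        · omega
        · push_cast; omega
      rw [← h3, h]
      refine cnt_congr fun s _ _ => ?_
      rw [Multiset.count_add, Multiset.count_replicate_self, numGt_add_ones s 1 (by omega)]
  have h3 : cnt (n - 1) (fun s => s.count 1 + 1 + (μ + 1) ≤ numGt s (s.count 1 + 1)) +
      ∑ k ∈ Finset.range K, rectCount (k + 1) (k + 1 + μ) (n - (k + 1 : ℕ)) =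
      ∑ k ∈ Finset.range K, rectCount (k + 1) (k + 1 + μ) (n - 1) := by
    rw [cnt_eq_sum_hasRect (i := 0) (j := μ) (K := K + 1) (Or.inl rfl) (by push_cast; omega),
      Finset.sum_range_succ', cnt_eq_zero (n := n - 1) (p := fun s =>
        s.count 1 + 1 + (μ + 1) ≤ numGt s (s.count 1 + 1) ∧ HasRect (0 + 0) (0 + μ) s), add_zero,
      ← Finset.sum_add_distrib]
    · refine Finset.sum_congr rfl fun k _ => ?_
      conv_rhs => rw [rectCount, cnt_split (n - 1) _ fun s => s.count 1 + 1 + (μ +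
          1) ≤ numGt s (s.count 1 + 1)]
      congr 1
      · exact cnt_congr fun s _ _ => and_comm
      · rcases Nat.eq_zero_or_pos k with rfl | hk
        · rw [rectCount]
          norm_num only
          refine cnt_congr fun s _ _ => ⟨fun h => ⟨h, ?_⟩, fun h => h.1⟩
          have := h.numGt_le_iff (i := 0) (s.count 1 + 1)
          rw [add_zero] at this
          omega
        · rw [show n - ((k + 1 : ℕ) : ℤ) = n - 1 - (k : ℕ) by push_cast; ring,
            ← cnt_ones_hasRect _ _ (by omega)]
          refine cnt_congr fun s _ _ => ?_
          rw [and_comm]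
          refine and_congr_right fun h => ?_
          have := h.numGt_le_iff (i := 0) (s.count 1 + 1)
          rw [add_zero] at this
          omega
    · rintro s _ _ ⟨h1, h2⟩
      have := h2.numGt_le_iff (s.count 1 + 1)
      rw [add_zero] at this
      omega
  rw [cnt_lt_sup μ hK, cnt_lt_sup μ (show n - 1 < K by omega)] at h1
  have h4 : ∑ k ∈ Finset.range K, rectCount (k + 1) (k + 1 + μ) n =
      ∑ k ∈ Finset.range K, rectCount (k + 1) (k + 1 + μ) (n - (k + 1 : ℕ)) +
        crankAux (μ + 1) (n - (μ + 1 : ℕ)) := by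
    rw [crankAux_eq_sum (by omega) (K := K) (by omega), ← Finset.sum_add_distrib]
    refine Finset.sum_congr rfl fun k _ => ?_
    rw [rectCount_pred_left]
    congr 1
    rw [rectCount_comm]
    congr 1
    · omega
    · push_cast; ring
  omega

theorem cnt_dvd_add (n : ℤ) (p : Multiset ℕ → Prop) (ρ : Multiset ℕ → ℤ) (b : ℤ) :
    cnt n (fun s => p s ∧ b ≤ ρ s ∧ (11 : ℤ) ∣ ρ s - b) + cnt n (fun s => p s ∧ b + 1 ≤ ρ s) =
      cnt n (fun s => p s ∧ b ≤ ρ s) +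
        cnt n fun s => p s ∧ b + 11 ≤ ρ s ∧ (11 : ℤ) ∣ ρ s - (b + 11) := by
  rw [cnt_split n (fun s => p s ∧ b ≤ ρ s ∧ (11 : ℤ) ∣ ρ s - b) fun s => ρ s = b,
    cnt_split n (fun s => p s ∧ b ≤ ρ s) fun s => ρ s = b]
  have h1 : cnt n (fun s => (p s ∧ b ≤ ρ s ∧ (11 : ℤ) ∣ ρ s - b) ∧ ρ s = b) =
      cnt n fun s => (p s ∧ b ≤ ρ s) ∧ ρ s = b :=
    cnt_congr fun s _ _ => by
      constructor
      · exact fun h => ⟨⟨h.1.1, h.1.2.1⟩, h.2⟩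
      · exact fun h => ⟨⟨h.1.1, h.1.2, by rw [h.2, sub_self]; exact dvd_zero _⟩, h.2⟩
  have h2 : cnt n (fun s => (p s ∧ b ≤ ρ s ∧ (11 : ℤ) ∣ ρ s - b) ∧ ¬ ρ s = b) =
      cnt n fun s => p s ∧ b + 11 ≤ ρ s ∧ (11 : ℤ) ∣ ρ s - (b + 11) :=
    cnt_congr fun s _ _ => by
      constructor
      · exact fun h => ⟨h.1.1, by omega, by omega⟩
      · exact fun h => ⟨⟨h.1, by omega, by omega⟩, by omega⟩
  have h3 : cnt n (fun s => (p s ∧ b ≤ ρ s) ∧ ¬ ρ s = b) = cnt n fun s => p s ∧ b + 1 ≤ ρ s :=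
    cnt_congr fun s _ _ => by
      constructor
      · exact fun h => ⟨h.1.1, by omega⟩
      · exact fun h => ⟨⟨h.1, by omega⟩, by omega⟩
  rw [h1, h2, h3]
  omega

theorem cnt_dvd_eq_sum (n : ℤ) (p : Multiset ℕ → Prop) (ρ : Multiset ℕ → ℤ) (a : ℤ) (A : ℤ → ℕ)
    (hA : ∀ r, a ≤ r → cnt n (fun s => p s ∧ r ≤ ρ s) = A r) (K : ℕ) (hK : A (a + 11 * K) = 0) :
    (cnt n (fun s => p s ∧ a ≤ ρ s ∧ (11 : ℤ) ∣ ρ s - a) : ℤ) =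
      ∑ j ∈ Finset.range K, (A (a + 11 * j) : ℤ) -
        ∑ j ∈ Finset.range K, (A (a + 1 + 11 * j) : ℤ) := by
  have hind : ∀ K : ℕ, (cnt n (fun s => p s ∧ a ≤ ρ s ∧ (11 : ℤ) ∣ ρ s - a) : ℤ) =
      ∑ j ∈ Finset.range K, (A (a + 11 * j) : ℤ) -
        ∑ j ∈ Finset.range K, (A (a + 1 + 11 * j) : ℤ) +
        cnt n fun s => p s ∧ a + 11 * K ≤ ρ s ∧ (11 : ℤ) ∣ ρ s - (a + 11 * K) := by
    intro K
    induction K with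
    | zero => simp
    | succ K ih =>
      have h := cnt_dvd_add n p ρ (a + 11 * K)
      rw [hA _ (by omega), hA _ (by omega),
        show a + 11 * (K : ℤ) + 1 = a + 1 + 11 * K by ring,
        show a + 11 * (K : ℤ) + 11 = a + 11 * (K + 1 : ℕ) by push_cast; ring] at h
      rw [ih, Finset.sum_range_succ, Finset.sum_range_succ]
      omega
  have h0 : cnt n (fun s => p s ∧ a + 11 * K ≤ ρ s ∧ (11 : ℤ) ∣ ρ s - (a + 11 * K)) = 0 := by
    have h := cnt_le_cnt (n := n) (p := fun s => p s ∧ a + 11 * K ≤ ρ s ∧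
      (11 : ℤ) ∣ ρ s - (a + 11 * K)) (q := fun s => p s ∧ a + 11 * K ≤ ρ s)
      fun s _ _ h => ⟨h.1, h.2.1⟩
    rw [hA _ (by omega), hK] at h
    omega
  rw [hind K, h0]
  simp

/-- The sum of the tail counts `u r n` over `r = a, a + 11, a + 22, …`. -/
noncomputable def residueSum (u : ℤ → ℤ → ℕ) (a : ℤ) (n : ℕ) : ℤ :=
  ∑ j ∈ Finset.range (n + 1), (u (a + 11 * j) n : ℤ)

theorem IsTailCount.residueSum_sub {e : ℤ} {u : ℤ → ℤ → ℕ} (hu : IsTailCount e u) {a : ℤ}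
    (ha : 1 ≤ a) (n : ℕ) : residueSum u a n - residueSum u (a + 11) n = u a n := by
  have h : residueSum u a n = ∑ j ∈ Finset.range (n + 2), (u (a + 11 * j) n : ℤ) := by
    rw [Finset.sum_range_succ, hu.eq_zero (r := a + 11 * (n + 1 : ℕ)) (by omega)
      (by push_cast; omega)]
    simp [residueSum]
  rw [h, Finset.sum_range_succ', residueSum]
  have h2 : ∀ j : ℕ, a + 11 * ((j + 1 : ℕ) : ℤ) = a + 11 + 11 * j := fun j => by push_cast; ring
  simp only [h2, Nat.cast_zero, mul_zero, add_zero, add_sub_cancel_left]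

/-- Residue class counts modulo 11 of a statistic with symmetric tails. -/
theorem IsTailCount.cnt_emod {e d : ℤ} {u : ℤ → ℤ → ℕ} (hu : IsTailCount e u) (n : ℕ)
    (p : Multiset ℕ → Prop) (ρ : Multiset ℕ → ℤ) (hd : 0 ≤ d)
    (h₁ : ∀ r, 1 ≤ r + d → 0 ≤ r → cnt n (fun s => p s ∧ r ≤ ρ s) = u (r + d) n)
    (h₂ : ∀ r, 1 ≤ r → cnt n (fun s => p s ∧ ρ s ≤ -r) = u (r + d) n) {i : ℤ} (hi : 0 ≤ i)
    (hi' : i < 11) (hid : 1 ≤ i + d) :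
    (cnt n (fun s => p s ∧ ρ s % 11 = i % 11) : ℤ) =
      residueSum u (i + d) n - residueSum u (i + d + 1) n +
        residueSum u (11 - i + d) n - residueSum u (12 - i + d) n := by
  have hA := cnt_dvd_eq_sum n p ρ i (fun r => u (r + d) n) (fun r hr => h₁ r (by omega) (by omega))
    (n + 1) (hu.eq_zero (by push_cast; omega) (by push_cast; omega))
  have hB := cnt_dvd_eq_sum n p (fun s => -ρ s) (11 - i) (fun r => u (r + d) n)
    (fun r hr => by
      rw [← h₂ r (by omega)]
      exact cnt_congr fun s _ _ => and_congr_right fun _ => by omega)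
    (n + 1) (hu.eq_zero (by push_cast; omega) (by push_cast; omega))
  rw [cnt_split n _ fun s => i ≤ ρ s]
  have e1 : cnt n (fun s => (p s ∧ ρ s % 11 = i % 11) ∧ i ≤ ρ s) =
      cnt n fun s => p s ∧ i ≤ ρ s ∧ (11 : ℤ) ∣ ρ s - i :=
    cnt_congr fun s _ _ => by
      rw [and_assoc]
      exact and_congr_right fun _ => by omega
  have e2 : cnt n (fun s => (p s ∧ ρ s % 11 = i % 11) ∧ ¬ i ≤ ρ s) =
      cnt n fun s => p s ∧ 11 - i ≤ -ρ s ∧ (11 : ℤ) ∣ -ρ s - (11 - i) :=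
    cnt_congr fun s _ _ => by
      rw [and_assoc]
      exact and_congr_right fun _ => by omega
  rw [e1, e2, Nat.cast_add, hA, hB]
  have c1 : ∀ j : ℕ, i + 11 * (j : ℤ) + d = i + d + 11 * j := fun j => by ring
  have c2 : ∀ j : ℕ, i + 1 + 11 * (j : ℤ) + d = i + d + 1 + 11 * j := fun j => by ring
  have c3 : ∀ j : ℕ, 11 - i + 11 * (j : ℤ) + d = 11 - i + d + 11 * j := fun j => by ring
  have c4 : ∀ j : ℕ, 11 - i + 1 + 11 * (j : ℤ) + d = 12 - i + d + 11 * j := fun j => by ring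
  simp only [c1, c2, c3, c4, residueSum]
  ring

theorem ne_zero_of_sum {n : ℕ} (hn : 1 ≤ n) {s : Multiset ℕ} (h : (s.sum : ℤ) = n) : s ≠ 0 := by
  rintro rfl
  simp only [Multiset.sum_zero] at h
  omega

theorem rankCount_eq {n : ℕ} (hn : 1 ≤ n) {i : ℤ} (hi : 0 ≤ i) (hi' : i < 11) :
    (rankCount i 11 n : ℤ) =
      residueSum rankTail (i + 1) n - residueSum rankTail (i + 2) n +
        residueSum rankTail (12 - i) n - residueSum rankTail (13 - i) n := by
  have h := isTailCount_rankTail.cnt_emod n (d := 1) (fun s => s ≠ 0)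
    (fun s => (s.sup : ℤ) - Multiset.card s) (by norm_num)
    (fun r _ _ => by simp only [rankTail, add_sub_cancel_right])
    (fun r hr => by
      rw [isTailCount_rankTail.unique (by norm_num) isTailCount_rankTailNeg (by omega)]
      exact cnt_congr fun s _ _ => and_congr_right fun _ => by omega) hi hi' (by omega)
  have e : rankCount i 11 n =
      cnt n fun s => s ≠ 0 ∧ ((s.sup : ℤ) - Multiset.card s) % 11 = i % 11 := by
    have := cnt_natCast n fun s => ((s.sup : ℤ) - Multiset.card s) % 11 = i % 11
    rw [rankCount]
    refine this.symm.trans (cnt_congr fun s _ hs => ?_)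
    have := ne_zero_of_sum hn hs
    tauto
  rw [e, h, show i + 1 + 1 = i + 2 by ring, show 11 - i + 1 = 12 - i by ring,
    show 12 - i + 1 = 13 - i by ring]

theorem crankTail_eq_crankTailNeg {n : ℕ} (hn : n ≠ 1) {r : ℤ} (hr : 1 ≤ r) :
    crankTail r n = crankTailNeg r n := by
  obtain ⟨m, rfl⟩ := Int.eq_ofNat_of_zero_le (show 0 ≤ r by omega)
  rw [crankTail_eq (by omega) (by omega), crankTailNeg_eq (by omega)]

theorem crankCount_eq_cnt {n : ℕ} (hn : n ≠ 1) (i : ℤ) :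
    crankCount i n = cnt n fun s => True ∧ multisetCrank s % 11 = i % 11 := by
  classical
  have := cnt_natCast n fun s => True ∧ multisetCrank s % 11 = i % 11
  rw [crankCount, if_neg hn, this]
  congr 2
  ext π
  simp only [true_and]
  rfl

theorem crankCount_eq {n : ℕ} (hn : n ≠ 1) {i : ℤ} (hi : 1 ≤ i) (hi' : i < 11) :
    crankCount i n =
      residueSum crankTailNeg i n - residueSum crankTailNeg (i + 1) n +
        residueSum crankTailNeg (11 - i) n - residueSum crankTailNeg (12 - i) n := by
  have h := isTailCount_crankTailNeg.cnt_emod n (d := 0) (fun _ => True) multisetCrank le_rfl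
    (fun r hr _ => by
      rw [add_zero, ← crankTail_eq_crankTailNeg hn (by omega)]
      simp only [true_and, crankTail])
    (fun r hr => by simp only [true_and, crankTailNeg, add_zero]) (by omega) hi' (by omega)
  simpa only [crankCount_eq_cnt hn, add_zero] using h

theorem crankCount_zero_eq {n : ℕ} (hn : n ≠ 1) :
    crankCount 0 n = pCount n - 2 * residueSum crankTailNeg 1 n +
      2 * residueSum crankTailNeg 11 n := by
  have hup : ∀ r : ℤ, 1 ≤ r → cnt n (fun s => True ∧ r ≤ multisetCrank s) = crankTailNeg r n :=
    fun r hr => by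
      rw [← crankTail_eq_crankTailNeg hn hr]
      simp only [true_and, crankTail]
  have hdn : ∀ r : ℤ, cnt n (fun s => True ∧ r ≤ -multisetCrank s) = crankTailNeg r n :=
    fun r => cnt_congr fun s _ _ => by rw [true_and]; omega
  have hz := isTailCount_crankTailNeg.eq_zero (r := 11 + 11 * (n + 1 : ℕ)) (n := n)
    (by push_cast; omega) (by push_cast; omega)
  have hA := cnt_dvd_eq_sum n (fun _ => True) multisetCrank 11 (fun r => crankTailNeg r n)
    (fun r hr => hup r (by omega)) (n + 1) hz
  have hB := cnt_dvd_eq_sum n (fun _ => True) (fun s => -multisetCrank s) 11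
    (fun r => crankTailNeg r n) (fun r _ => hdn r) (n + 1) hz
  have hC := cnt_dvd_add n (fun _ => True) (fun s => -multisetCrank s) 0
  rw [hdn, hdn] at hC
  have h1 := isTailCount_crankTailNeg.residueSum_sub (a := 1) (by norm_num) n
  have hp : pCount n = crankTailNeg 0 n + crankTailNeg 1 n := by
    rw [← hup 1 le_rfl, ← hdn 0, pCount, cnt_split n _ fun s => multisetCrank s ≤ 0]
    refine congrArg₂ (· + ·) (cnt_congr fun s _ _ => ?_) (cnt_congr fun s _ _ => ?_)
    · rw [true_and, true_and]; omega
    · rw [true_and, true_and]; omega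
  rw [crankCount_eq_cnt hn, cnt_split n _ fun s => 11 ≤ multisetCrank s]
  have e1 : cnt n (fun s => (True ∧ multisetCrank s % 11 = 0 % 11) ∧ 11 ≤ multisetCrank s) =
      cnt n fun s => True ∧ 11 ≤ multisetCrank s ∧ (11 : ℤ) ∣ multisetCrank s - 11 :=
    cnt_congr fun s _ _ => by simp only [true_and]; omega
  have e2 : cnt n (fun s => (True ∧ multisetCrank s % 11 = 0 % 11) ∧ ¬ 11 ≤ multisetCrank s) =
      cnt n fun s => True ∧ 0 ≤ -multisetCrank s ∧ (11 : ℤ) ∣ -multisetCrank s - 0 :=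
    cnt_congr fun s _ _ => by simp only [true_and]; omega
  norm_num only at h1 hA hB hC
  rw [e1, e2]
  simp only [residueSum] at h1 ⊢
  omega

theorem pCount_eq_rankTail {n : ℕ} (hn : 1 ≤ n) : pCount n = rankTail 1 n + rankTail 2 n := by
  rw [isTailCount_rankTail.unique (by norm_num) isTailCount_rankTailNeg (r := 2) (by omega),
    pCount, cnt_split n _ fun s => 0 ≤ (s.sup : ℤ) - Multiset.card s]
  congr 1
  · refine cnt_congr fun s _ hs => ?_
    have := ne_zero_of_sum hn hs
    simp only [true_and, sub_self]
    tauto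
  · refine cnt_congr fun s _ hs => ?_
    have := ne_zero_of_sum hn hs
    simp only [true_and, this, ne_eq, not_false_eq_true]
    omega

/-- The combination of residue counts that the inequalities assert to be nonnegative. -/
noncomputable def combSeq (c₁ c₉ c₃ c₇ c₅ m k : ℤ) (n : ℕ) : ℤ :=
  c₁ * (residueSum rankTail 10 n - residueSum rankTail 4 n) +
  c₉ * (residueSum rankTail 12 n - residueSum rankTail 2 n) +
  c₃ * (residueSum rankTail 5 n - residueSum rankTail 9 n) +
  c₇ * (residueSum rankTail 6 n - residueSum rankTail 8 n) +
  c₅ * (residueSum rankTail 11 n - residueSum rankTail 3 n) + k * pCount n +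
  m * (residueSum crankTailNeg 2 n - residueSum crankTailNeg 3 n +
    residueSum crankTailNeg 9 n - residueSum crankTailNeg 10 n - pCount n +
    2 * residueSum crankTailNeg 1 n - 2 * residueSum crankTailNeg 11 n)

theorem counts_eq {n : ℕ} (hn : 2 ≤ n) :
    (rankCount 0 11 n : ℤ) = pCount n - 2 * residueSum rankTail 2 n +
        2 * residueSum rankTail 12 n ∧
    (rankCount 1 11 n : ℤ) = residueSum rankTail 2 n - residueSum rankTail 3 n +
        residueSum rankTail 11 n - residueSum rankTail 12 n ∧
    (rankCount 2 11 n : ℤ) = residueSum rankTail 3 n - residueSum rankTail 4 n +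
        residueSum rankTail 10 n - residueSum rankTail 11 n ∧
    (rankCount 3 11 n : ℤ) = residueSum rankTail 4 n - residueSum rankTail 5 n +
        residueSum rankTail 9 n - residueSum rankTail 10 n ∧
    (rankCount 4 11 n : ℤ) = residueSum rankTail 5 n - residueSum rankTail 6 n +
        residueSum rankTail 8 n - residueSum rankTail 9 n ∧
    (rankCount 5 11 n : ℤ) = residueSum rankTail 6 n - residueSum rankTail 8 n ∧
    crankCount 2 n = residueSum crankTailNeg 2 n - residueSum crankTailNeg 3 n +
      residueSum crankTailNeg 9 n - residueSum crankTailNeg 10 n := by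
  have h : ∀ i : ℤ, 0 ≤ i → i < 11 → _ := fun i hi hi' => rankCount_eq (n := n) (by omega) hi hi'
  have h0 := h 0 (by norm_num) (by norm_num)
  have h1 := isTailCount_rankTail.residueSum_sub (a := 1) (by norm_num) n
  have h2 := isTailCount_rankTail.residueSum_sub (a := 2) (by norm_num) n
  have hp := pCount_eq_rankTail (n := n) (by omega)
  norm_num only at h0 h1 h2
  refine ⟨by rw [h0]; omega, h 1 (by norm_num) (by norm_num), h 2 (by norm_num) (by norm_num),
    h 3 (by norm_num) (by norm_num), h 4 (by norm_num) (by norm_num), ?_,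
    crankCount_eq (by omega) (i := 2) (by norm_num) (by norm_num)⟩
  have h5 := h 5 (by norm_num) (by norm_num)
  norm_num only at h5
  omega

/-- The partial theta series `∑ (-1)^k q^(e k(k+1)/2 + r(k+1))`. -/
noncomputable def partialTheta (e : ℕ) (q : ℂ) (r : ℤ) : ℂ :=
  ∑' k : ℕ, (-1) ^ k * q ^ ((e : ℤ) * triInt k + r * (k + 1))

/-- The series `∑ (-1)^k q^(e k(k+1)/2 + r(k+1)) / (1 - q^(11(k+1)))`. -/
noncomputable def partialLambert (e : ℕ) (q : ℂ) (r : ℤ) : ℂ :=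
  ∑' k : ℕ, (-1) ^ k * q ^ ((e : ℤ) * triInt k + r * (k + 1)) / (1 - (q ^ 11) ^ (k + 1))

section PartialTheta

variable {e : ℕ} {q : ℂ}

theorem summable_partialTheta (he : 1 ≤ e) (hq0 : q ≠ 0) (hq : ‖q‖ < 1) (r : ℤ) :
    Summable fun k : ℕ => ‖(-1) ^ k * q ^ ((e : ℤ) * triInt k + r * (k + 1))‖ := by
  have h := (summable_zpow_mul_triInt (a := q ^ r) (zpow_ne_zero _ hq0) (pow_ne_zero e hq0)
    (norm_pow_lt_one hq (by omega))).comp_injective Nat.cast_injective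
  refine (h.mul_left ‖q ^ r‖).congr fun k => ?_
  simp only [Function.comp, ← norm_mul]
  rw [norm_mul ((-1) ^ k), norm_pow, norm_neg, norm_one, one_pow, one_mul,
    zpow_add₀ hq0, zpow_mul, zpow_natCast q e, mul_add, mul_one, zpow_add₀ hq0, zpow_mul]
  congr 1
  ring

theorem norm_one_sub_pow_ge (hq : ‖q‖ < 1) (k : ℕ) : 1 - ‖q‖ ≤ ‖1 - (q ^ 11) ^ (k + 1)‖ := by
  have h1 : ‖(q ^ 11) ^ (k + 1)‖ ≤ ‖q‖ := by
    rw [← pow_mul, norm_pow]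
    exact pow_le_of_le_one (norm_nonneg _) hq.le (by positivity)
  have h2 := norm_sub_norm_le (1 : ℂ) ((q ^ 11) ^ (k + 1))
  rw [norm_one] at h2
  linarith

theorem one_sub_pow_ne_zero (hq : ‖q‖ < 1) (k : ℕ) : 1 - (q ^ 11) ^ (k + 1) ≠ 0 := by
  rw [← norm_pos_iff]
  exact (sub_pos.2 hq).trans_le (norm_one_sub_pow_ge hq k)

theorem summable_partialLambert (he : 1 ≤ e) (hq0 : q ≠ 0) (hq : ‖q‖ < 1) (r : ℤ) :
    Summable fun k : ℕ =>
      (-1) ^ k * q ^ ((e : ℤ) * triInt k + r * (k + 1)) / (1 - (q ^ 11) ^ (k + 1)) := by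
  refine Summable.of_norm_bounded ((summable_partialTheta he hq0 hq r).mul_right (1 - ‖q‖)⁻¹)
    fun k => ?_
  rw [norm_div, div_eq_mul_inv]
  exact mul_le_mul_of_nonneg_left (inv_anti₀ (sub_pos.2 hq) (norm_one_sub_pow_ge hq k))
    (norm_nonneg _)

theorem partialTheta_eq (he : 1 ≤ e) (hq0 : q ≠ 0) (hq : ‖q‖ < 1) (r : ℤ) :
    partialTheta e q r = q ^ r * (1 - partialTheta e q (r + e)) := by
  rw [partialTheta, (summable_partialTheta he hq0 hq r).of_norm.tsum_eq_zero_add, mul_sub, mul_one,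
    partialTheta, ← tsum_mul_left, sub_eq_add_neg, ← tsum_neg]
  congr 1
  · simp [triInt]
  · refine tsum_congr fun k => ?_
    rw [Nat.cast_succ, triInt_succ, mul_left_comm, ← zpow_add₀ hq0, pow_succ]
    rw [show (e : ℤ) * (triInt k + (k + 1)) + r * (k + 1 + 1) =
      r + (e * triInt k + (r + e) * (k + 1)) by ring]
    ring

theorem partialLambert_sub (he : 1 ≤ e) (hq0 : q ≠ 0) (hq : ‖q‖ < 1) (r : ℤ) :
    partialLambert e q r - partialLambert e q (r + 11) = partialTheta e q r := by
  rw [partialLambert, partialLambert, ← (summable_partialLambert he hq0 hq r).tsum_sub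
    (summable_partialLambert he hq0 hq (r + 11)), partialTheta]
  refine tsum_congr fun k => ?_
  have h := one_sub_pow_ne_zero hq k
  have h2 : q ^ ((e : ℤ) * triInt k + (r + 11) * (k + 1)) =
      q ^ ((e : ℤ) * triInt k + r * (k + 1)) * (q ^ 11) ^ (k + 1) := by
    rw [← pow_mul, ← zpow_natCast q (11 * (k + 1)), ← zpow_add₀ hq0]
    congr 1
    push_cast
    ring
  rw [h2, ← sub_div, div_eq_iff h]
  ring

theorem norm_partialTheta_term_le (hq0 : q ≠ 0) (hq : ‖q‖ < 1) (r : ℕ) (k : ℕ) :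
    ‖(-1) ^ k * q ^ ((e : ℤ) * triInt k + (r : ℤ) * (k + 1))‖ ≤ ‖q‖ ^ r * (‖q‖ ^ r) ^ k := by
  rw [norm_mul, norm_pow, norm_neg, norm_one, one_pow, one_mul, norm_zpow, ← pow_succ', ← pow_mul,
    ← zpow_natCast]
  refine zpow_le_zpow_right_of_le_one₀ (norm_pos_iff.2 hq0) hq.le ?_
  have := two_mul_triInt k
  have : 0 ≤ triInt k := by nlinarith
  have : 0 ≤ (e : ℤ) * triInt k := by positivity
  push_cast
  linarith

theorem norm_partialTheta_le (hq0 : q ≠ 0) (hq : ‖q‖ < 1) {r : ℤ} (hr : 1 ≤ r) :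
    ‖partialTheta e q r‖ ≤ (1 - ‖q‖)⁻¹ := by
  obtain ⟨m, rfl⟩ := Int.eq_ofNat_of_zero_le (show 0 ≤ r by omega)
  refine tsum_of_norm_bounded (hasSum_geometric_of_lt_one (norm_nonneg q) hq) fun k => ?_
  refine (norm_partialTheta_term_le hq0 hq m k).trans ?_
  rw [← pow_succ', ← pow_mul]
  exact pow_le_pow_of_le_one (norm_nonneg _) hq.le (by nlinarith)

theorem tendsto_partialLambert (hq0 : q ≠ 0) (hq : ‖q‖ < 1) {r : ℤ} (hr : 1 ≤ r) :
    Tendsto (fun j : ℕ => partialLambert e q (r + 11 * j)) atTop (𝓝 0) := by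
  obtain ⟨m, rfl⟩ := Int.eq_ofNat_of_zero_le (show 0 ≤ r by omega)
  have hb : ∀ j : ℕ, ‖partialLambert e q (m + 11 * j)‖ ≤
      ‖q‖ ^ j * ((1 - ‖q‖)⁻¹ * (1 - ‖q‖)⁻¹) := fun j => by
    refine tsum_of_norm_bounded (((hasSum_geometric_of_lt_one (norm_nonneg q) hq).mul_right
      (1 - ‖q‖)⁻¹).mul_left (‖q‖ ^ j)) fun k => ?_
    rw [norm_div, div_eq_mul_inv, ← mul_assoc]
    refine mul_le_mul ?_ (inv_anti₀ (sub_pos.2 hq) (norm_one_sub_pow_ge hq k))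
      (inv_nonneg.2 (norm_nonneg _)) (by positivity)
    have h := norm_partialTheta_term_le (e := e) hq0 hq (m + 11 * j) k
    push_cast at h
    refine h.trans ?_
    rw [← pow_mul]
    exact mul_le_mul (pow_le_pow_of_le_one (norm_nonneg _) hq.le (by omega))
      (pow_le_pow_of_le_one (norm_nonneg _) hq.le (by nlinarith)) (by positivity) (by positivity)
  refine squeeze_zero_norm hb ?_
  simpa using (tendsto_pow_atTop_nhds_zero_of_lt_one (norm_nonneg q) hq).mul_const
    ((1 - ‖q‖)⁻¹ * (1 - ‖q‖)⁻¹)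

/-- The bilateral Lambert series as a difference of two one-sided series. -/
theorem baseSeries_eq (he : 1 ≤ e) (hq0 : q ≠ 0) (hq : ‖q‖ < 1) (s : ℤ) :
    baseSeries e q s =
      partialLambert e q (e + 11 - e * (6 - s)) - partialLambert e q (e * (6 - s)) := by
  have hterm : ∀ n : ℤ, (-1 : ℂ) ^ n * q ^ ((e : ℤ) * (triInt n + 5 * n - s * n)) /
      (1 - (q ^ 11) ^ n) = (-1) ^ n * q ^ ((e : ℤ) * (triInt n - n) + e * (6 - s) * n) /
      (1 - (q ^ 11) ^ n) := fun n => by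
    rw [show (e : ℤ) * (triInt n + 5 * n - s * n) =
      (e : ℤ) * (triInt n - n) + e * (6 - s) * n by ring]
  rw [baseSeries]
  simp only [hterm]
  generalize (e : ℤ) * (6 - s) = a
  have h1 : HasSum (fun n : ℕ => (-1 : ℂ) ^ (n : ℤ) * q ^ ((e : ℤ) * (triInt n - n) + a * n) /
      (1 - (q ^ 11) ^ (n : ℤ))) (-partialLambert e q a) := by
    have h := (summable_partialLambert he hq0 hq a).hasSum.neg
    rw [← hasSum_nat_add_iff' 1]
    simp only [Finset.range_one, Finset.sum_singleton, Nat.cast_zero, zpow_zero, sub_self, div_zero,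
      sub_zero]
    refine h.congr_fun fun k => ?_
    rw [zpow_natCast, zpow_natCast, Nat.cast_succ, triInt_succ, pow_succ (-1 : ℂ),
      add_sub_cancel_right]
    ring
  have h2 : HasSum (fun n : ℕ => (-1 : ℂ) ^ (-((n : ℤ) + 1)) *
      q ^ ((e : ℤ) * (triInt (-((n : ℤ) + 1)) - -((n : ℤ) + 1)) + a * -((n : ℤ) + 1)) /
      (1 - (q ^ 11) ^ (-((n : ℤ) + 1)))) (partialLambert e q (e + 11 - a)) := by
    refine (summable_partialLambert he hq0 hq (e + 11 - a)).hasSum.congr_fun fun k => ?_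
    have h := one_sub_pow_ne_zero hq k
    have hQ : (q ^ 11) ^ (k + 1) ≠ 0 := pow_ne_zero _ (pow_ne_zero _ hq0)
    have hz : q ^ ((e : ℤ) * triInt k + (e + 11 - a) * (k + 1)) =
        q ^ ((e : ℤ) * (triInt k + (k + 1)) + a * -(k + 1)) * (q ^ 11) ^ (k + 1) := by
      rw [← pow_mul, ← zpow_natCast q (11 * (k + 1)), ← zpow_add₀ hq0]
      congr 1
      push_cast
      ring
    rw [hz, triInt_neg, triInt_succ, sub_neg_eq_add, sub_add_cancel]
    generalize q ^ ((e : ℤ) * (triInt k + (k + 1)) + a * -(k + 1)) = E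
    rw [show (k : ℤ) + 1 = ((k + 1 : ℕ) : ℤ) by push_cast; rfl, zpow_neg, zpow_neg, zpow_natCast,
      zpow_natCast, ← inv_pow, inv_neg_one, pow_succ (-1 : ℂ)]
    generalize (q ^ 11) ^ (k + 1) = Q at h hQ
    have h' : 1 - Q⁻¹ ≠ 0 := fun h0 => h (by
      rw [sub_eq_zero] at h0 ⊢
      rw [← inv_inv Q, ← h0, inv_one])
    rw [div_eq_div_iff h' h]
    linear_combination ((-1) ^ k * E) * (mul_inv_cancel₀ hQ)
  have h3 := HasSum.of_nat_of_neg_add_one (f := fun n : ℤ => (-1 : ℂ) ^ n *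
    q ^ ((e : ℤ) * (triInt n - n) + a * n) / (1 - (q ^ 11) ^ n)) h1 h2
  rw [h3.tsum_eq]
  ring

end PartialTheta

section GeneratingSeries

variable {q : ℂ} {e : ℕ} {u : ℤ → ℤ → ℕ}

/-- The generating function of the partition numbers. -/
noncomputable def pSeries (q : ℂ) : ℂ := ∑' n : ℕ, (pCount n : ℂ) * q ^ n

/-- The generating function of the tail counts `u r`. -/
noncomputable def tailSeries (u : ℤ → ℤ → ℕ) (q : ℂ) (r : ℤ) : ℂ := ∑' n : ℕ, (u r n : ℂ) * q ^ n

/-- The generating function of `residueSum u a`. -/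
noncomputable def residueSeries (u : ℤ → ℤ → ℕ) (q : ℂ) (a : ℤ) : ℂ :=
  ∑' n : ℕ, (residueSum u a n : ℂ) * q ^ n

theorem pCount_int_le (n : ℕ) {m : ℤ} (hm : m ≤ n) : pCount m ≤ 2 ^ n := by
  rcases lt_or_ge m 0 with h | h
  · rw [pCount, cnt_of_neg h]
    exact Nat.zero_le _
  · obtain ⟨k, rfl⟩ := Int.eq_ofNat_of_zero_le h
    exact (pCount_le k).trans (Nat.pow_le_pow_right (by norm_num) (by omega))

theorem norm_natCast_mul_pow_le {c n : ℕ} (hc : c ≤ 2 ^ n) :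
    ‖(c : ℂ) * q ^ n‖ ≤ (2 * ‖q‖) ^ n := by
  rw [norm_mul, norm_pow, mul_pow, Complex.norm_natCast]
  exact mul_le_mul_of_nonneg_right (by exact_mod_cast hc) (by positivity)

theorem summable_two_mul_norm_pow (hq : ‖q‖ < 1 / 2) : Summable fun n : ℕ => (2 * ‖q‖) ^ n :=
  summable_geometric_of_lt_one (by positivity) (by linarith)

theorem summable_pSeries (hq : ‖q‖ < 1 / 2) : Summable fun n : ℕ => (pCount n : ℂ) * q ^ n :=
  .of_norm_bounded (summable_two_mul_norm_pow hq) fun n =>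
    norm_natCast_mul_pow_le (pCount_int_le n le_rfl)

theorem IsTailCount.le_two_pow (hu : IsTailCount e u) {r : ℤ} (hr : 1 ≤ r) (n : ℕ) :
    u r n ≤ 2 ^ n :=
  (hu.le hr).trans (pCount_int_le n (by omega))

theorem IsTailCount.summable_tailSeries (hu : IsTailCount e u) (hq : ‖q‖ < 1 / 2) {r : ℤ}
    (hr : 1 ≤ r) : Summable fun n : ℕ => (u r n : ℂ) * q ^ n :=
  .of_norm_bounded (summable_two_mul_norm_pow hq) fun n =>
    norm_natCast_mul_pow_le (hu.le_two_pow hr n)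

theorem hasSum_shift {f : ℤ → ℕ} (hf : ∀ n < 0, f n = 0) {x : ℂ}
    (h : HasSum (fun n : ℕ => (f n : ℂ) * q ^ n) x) (r : ℕ) :
    HasSum (fun n : ℕ => (f (n - r) : ℂ) * q ^ n) (q ^ r * x) := by
  rw [← hasSum_nat_add_iff' r, Finset.sum_eq_zero, sub_zero]
  · refine (h.mul_left (q ^ r)).congr_fun fun n => ?_
    rw [Nat.cast_add, add_sub_cancel_right, pow_add]
    ring
  · intro i hi
    rw [hf _ (by have := Finset.mem_range.1 hi; omega), Nat.cast_zero, zero_mul]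

theorem IsTailCount.tailSeries_add (hu : IsTailCount e u) (hq : ‖q‖ < 1 / 2) {r : ℤ} (hr : 1 ≤ r) :
    tailSeries u q r = q ^ r * (pSeries q - tailSeries u q (r + e)) := by
  obtain ⟨m, rfl⟩ := Int.eq_ofNat_of_zero_le (show 0 ≤ r by omega)
  have h1 := hasSum_shift (f := fun n => pCount n) (fun n hn => cnt_of_neg hn _)
    (summable_pSeries hq).hasSum m
  have h2 := hasSum_shift (f := u (m + e)) (fun n hn => hu.eq_zero (by omega) (by omega))
    (hu.summable_tailSeries hq (r := m + e) (by omega)).hasSum m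
  rw [mul_sub, zpow_natCast]
  refine HasSum.tsum_eq ((h1.sub h2).congr_fun fun n => ?_)
  rw [← hu m n hr]
  push_cast
  ring

theorem IsTailCount.tailSeries_eq (hu : IsTailCount e u) (he : 1 ≤ e) (hq0 : q ≠ 0)
    (hq : ‖q‖ < 1 / 2) {r : ℤ} (hr : 1 ≤ r) :
    tailSeries u q r = pSeries q * partialTheta e q r := by
  have hq1 : ‖q‖ < 1 := by linarith
  set C : ℝ := ∑' n : ℕ, (2 * ‖q‖) ^ n + ‖pSeries q‖ * (1 - ‖q‖)⁻¹ with hC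
  have hbound : ∀ r : ℤ, 1 ≤ r → ‖tailSeries u q r - pSeries q * partialTheta e q r‖ ≤ C :=
    fun r hr => (norm_sub_le _ _).trans (add_le_add
      (tsum_of_norm_bounded (summable_two_mul_norm_pow hq).hasSum fun n =>
        norm_natCast_mul_pow_le (hu.le_two_pow hr n))
      ((norm_mul _ _).le.trans (mul_le_mul_of_nonneg_left (norm_partialTheta_le hq0 hq1 hr)
        (norm_nonneg _))))
  have hstep : ∀ r : ℤ, 1 ≤ r → ‖tailSeries u q r - pSeries q * partialTheta e q r‖ ≤
      ‖q‖ * ‖tailSeries u q (r + e) - pSeries q * partialTheta e q (r + e)‖ := by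
    intro r hr
    have h : tailSeries u q r - pSeries q * partialTheta e q r =
        -q ^ r * (tailSeries u q (r + e) - pSeries q * partialTheta e q (r + e)) := by
      rw [hu.tailSeries_add hq hr, partialTheta_eq he hq0 hq1 r]
      ring
    rw [h, norm_mul, norm_neg, norm_zpow]
    refine mul_le_mul_of_nonneg_right ?_ (norm_nonneg _)
    calc ‖q‖ ^ r ≤ ‖q‖ ^ (1 : ℤ) :=
          zpow_le_zpow_right_of_le_one₀ (norm_pos_iff.2 hq0) hq1.le hr
      _ = ‖q‖ := zpow_one _
  have hiter : ∀ (k : ℕ) (r : ℤ), 1 ≤ r →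
      ‖tailSeries u q r - pSeries q * partialTheta e q r‖ ≤ ‖q‖ ^ k * C := by
    intro k
    induction k with
    | zero => intro r hr; rw [pow_zero, one_mul]; exact hbound r hr
    | succ k ih =>
      intro r hr
      refine (hstep r hr).trans ?_
      rw [pow_succ', mul_assoc]
      exact mul_le_mul_of_nonneg_left (ih _ (by omega)) (norm_nonneg _)
  have hlim : Tendsto (fun k : ℕ => ‖q‖ ^ k * C) atTop (𝓝 (0 * C)) :=
    (tendsto_pow_atTop_nhds_zero_of_lt_one (norm_nonneg q) hq1).mul_const C
  have h0 := ge_of_tendsto' hlim fun k => hiter k r hr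
  rw [zero_mul] at h0
  exact sub_eq_zero.1 (norm_eq_zero.1 (le_antisymm h0 (norm_nonneg _)))

theorem IsTailCount.norm_residueSum_le (hu : IsTailCount e u) {a : ℤ} (ha : 1 ≤ a) (n : ℕ) :
    ‖(residueSum u a n : ℂ) * q ^ n‖ ≤ (n + 1) * (2 * ‖q‖) ^ n := by
  have hj : ∀ j : ℕ, 1 ≤ a + 11 * (j : ℤ) := fun j => by omega
  rw [residueSum]
  push_cast
  rw [Finset.sum_mul]
  refine (norm_sum_le _ _).trans ((Finset.sum_le_sum fun j _ =>
    norm_natCast_mul_pow_le (hu.le_two_pow (hj j) n)).trans ?_)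
  rw [Finset.sum_const, Finset.card_range, nsmul_eq_mul]
  push_cast
  exact le_rfl

theorem summable_succ_mul_two_mul_norm_pow (hq : ‖q‖ < 1 / 2) :
    Summable fun n : ℕ => ((n : ℝ) + 1) * (2 * ‖q‖) ^ n := by
  have h : ‖2 * ‖q‖‖ < 1 := by
    rw [Real.norm_of_nonneg (by positivity)]
    linarith
  have h1 := summable_pow_mul_geometric_of_norm_lt_one 1 h
  simp only [pow_one] at h1
  simp only [add_mul, one_mul]
  exact h1.add (summable_two_mul_norm_pow hq)

theorem IsTailCount.hasSum_residueSeries (hu : IsTailCount e u) (hq : ‖q‖ < 1 / 2) {a : ℤ}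
    (ha : 1 ≤ a) :
    HasSum (fun n : ℕ => (residueSum u a n : ℂ) * q ^ n) (residueSeries u q a) :=
  (Summable.of_norm_bounded (summable_succ_mul_two_mul_norm_pow hq)
    (hu.norm_residueSum_le ha)).hasSum

theorem IsTailCount.tendsto_residueSeries (hu : IsTailCount e u) (hq : ‖q‖ < 1 / 2) {a : ℤ}
    (ha : 1 ≤ a) : Tendsto (fun j : ℕ => residueSeries u q (a + 11 * j)) atTop (𝓝 0) := by
  have h := tendsto_tsum_of_dominated_convergence (𝓕 := atTop)
    (f := fun (j : ℕ) (n : ℕ) => (residueSum u (a + 11 * j) n : ℂ) * q ^ n) (g := fun _ => 0)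
    (summable_succ_mul_two_mul_norm_pow hq) (fun n => ?_)
    (.of_forall fun j n => hu.norm_residueSum_le (by omega) n)
  · rwa [tsum_zero] at h
  · refine tendsto_const_nhds.congr' ((eventually_ge_atTop (n + 1)).mono fun j hj => ?_)
    have h0 : residueSum u (a + 11 * j) n = 0 := Finset.sum_eq_zero fun i _ => by
      rw [hu.eq_zero (by omega) (by omega), Nat.cast_zero]
    simp only [h0, Int.cast_zero, zero_mul]

theorem IsTailCount.residueSeries_eq (hu : IsTailCount e u) (he : 1 ≤ e) (hq0 : q ≠ 0)
    (hq : ‖q‖ < 1 / 2) {a : ℤ} (ha : 1 ≤ a) :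
    residueSeries u q a = pSeries q * partialLambert e q a := by
  have hq1 : ‖q‖ < 1 := by linarith
  have hstep : ∀ a : ℤ, 1 ≤ a → residueSeries u q a - pSeries q * partialLambert e q a =
      residueSeries u q (a + 11) - pSeries q * partialLambert e q (a + 11) := by
    intro a ha
    have h1 : residueSeries u q a - residueSeries u q (a + 11) = tailSeries u q a := by
      refine (HasSum.tsum_eq (((hu.hasSum_residueSeries hq ha).sub
        (hu.hasSum_residueSeries hq (a := a + 11) (by omega))).congr_fun fun n => ?_)).symm
      rw [← sub_mul, ← Int.cast_sub, hu.residueSum_sub ha, Int.cast_natCast]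
    rw [hu.tailSeries_eq he hq0 hq ha, ← partialLambert_sub he hq0 hq1] at h1
    linear_combination h1
  have hiter : ∀ j : ℕ, residueSeries u q a - pSeries q * partialLambert e q a =
      residueSeries u q (a + 11 * j) - pSeries q * partialLambert e q (a + 11 * j) := by
    intro j
    induction j with
    | zero => simp
    | succ j ih =>
      rw [ih, hstep _ (by omega), show a + 11 * (j : ℤ) + 11 = a + 11 * (j + 1 : ℕ) by
        push_cast; ring]
  have h := (hu.tendsto_residueSeries hq ha).sub
    ((tendsto_partialLambert (e := e) hq0 hq1 ha).const_mul (pSeries q))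
  have h2 := tendsto_nhds_unique h (tendsto_const_nhds.congr hiter)
  rw [mul_zero, sub_zero] at h2
  exact sub_eq_zero.1 h2.symm

/-- Euler's product for the generating function of the partition numbers. -/
theorem pSeries_mul_one_sub (hq0 : q ≠ 0) (hq : ‖q‖ < 1 / 2) :
    pSeries q * (1 - partialTheta 3 q 1 - partialTheta 3 q 2) = 1 := by
  have hu := isTailCount_rankTail
  have h := (summable_pSeries hq).tsum_eq_zero_add
  have h2 := (hu.summable_tailSeries (e := 3) hq (r := 1) le_rfl).tsum_eq_zero_add
  have h3 := (hu.summable_tailSeries (e := 3) hq (r := 2) (by norm_num)).tsum_eq_zero_add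
  rw [hu.eq_zero le_rfl (by norm_num)] at h2
  rw [hu.eq_zero (by norm_num) (by norm_num)] at h3
  have h4 : pCount ((0 : ℕ) : ℤ) = 1 := by
    rw [pCount, cnt_natCast]
    simp
  have h5 : ∑' n : ℕ, (pCount (n + 1 : ℕ) : ℂ) * q ^ (n + 1) =
      ∑' n : ℕ, (rankTail 1 (n + 1 : ℕ) : ℂ) * q ^ (n + 1) +
      ∑' n : ℕ, (rankTail 2 (n + 1 : ℕ) : ℂ) * q ^ (n + 1) := by
    rw [← Summable.tsum_add]
    · refine tsum_congr fun n => ?_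
      rw [pCount_eq_rankTail (by omega), Nat.cast_add, add_mul]
    · exact (hu.summable_tailSeries (e := 3) hq le_rfl).comp_injective (add_left_injective 1)
    · exact (hu.summable_tailSeries (e := 3) hq (by norm_num)).comp_injective
        (add_left_injective 1)
  rw [mul_sub, mul_sub, ← hu.tailSeries_eq (e := 3) (by norm_num) hq0 hq le_rfl,
    ← hu.tailSeries_eq (e := 3) (by norm_num) hq0 hq (by norm_num)]
  rw [pSeries, h, h4, h5, tailSeries, h2, tailSeries, h3, Nat.cast_zero, Nat.cast_one]
  ring

theorem pSeries_mul (hq0 : q ≠ 0) (hq : ‖q‖ < 1 / 2) : pSeries q * qPochInf q q = 1 := by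
  have hq1 : ‖q‖ < 1 := by linarith
  rw [← pSeries_mul_one_sub hq0 hq, ← cubeSum_one hq0 hq1, cubeSum]
  congr 1
  have hc := fun r : ℤ => (summable_partialTheta (e := 3) (by norm_num) hq0 hq1 r).of_norm.hasSum
  have hterm : ∀ m : ℤ, (-1 ^ 3 : ℂ) ^ m * (q ^ triInt m) ^ 3 * (q ^ m) ^ (-2 : ℤ) =
      (-1) ^ m * q ^ (3 * triInt m - 2 * m) := fun m => by
    rw [one_pow, ← zpow_natCast (q ^ triInt m), ← zpow_mul, ← zpow_mul, mul_assoc, ← zpow_add₀ hq0]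
    congr 2
    push_cast
    ring
  simp only [hterm]
  have e1 : HasSum (fun n : ℕ => (-1 : ℂ) ^ (n : ℤ) * q ^ (3 * triInt n - 2 * n))
      (1 - partialTheta 3 q 1) := by
    rw [← hasSum_nat_add_iff' 1]
    simp only [Finset.range_one, Finset.sum_singleton]
    have e0 : (-1 : ℂ) ^ ((0 : ℕ) : ℤ) * q ^ (3 * triInt ((0 : ℕ) : ℤ) - 2 * ((0 : ℕ) : ℤ)) =
        1 := by
      simp [triInt]
    rw [e0, sub_sub_cancel_left]
    refine (hc 1).neg.congr_fun fun k => ?_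
    rw [zpow_natCast, Nat.cast_succ, triInt_succ, pow_succ,
      show 3 * (triInt k + ((k : ℤ) + 1)) - 2 * (k + 1) = ((3 : ℕ) : ℤ) * triInt k + 1 * (k + 1) by
        push_cast; ring]
    ring
  have e2 : HasSum (fun n : ℕ => (-1 : ℂ) ^ (-((n : ℤ) + 1)) *
      q ^ (3 * triInt (-((n : ℤ) + 1)) - 2 * -((n : ℤ) + 1))) (-partialTheta 3 q 2) := by
    refine (hc 2).neg.congr_fun fun k => ?_
    rw [triInt_neg, triInt_succ, add_sub_cancel_right, zpow_neg,
      show (k : ℤ) + 1 = ((k + 1 : ℕ) : ℤ) by push_cast; rfl, zpow_natCast, ← inv_pow, inv_neg_one,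
      pow_succ, show 3 * triInt k - 2 * -((k + 1 : ℕ) : ℤ) =
        ((3 : ℕ) : ℤ) * triInt k + 2 * ((k + 1 : ℕ) : ℤ) by push_cast; ring]
    ring
  have h3 := HasSum.of_nat_of_neg_add_one (f := fun n : ℤ => (-1 : ℂ) ^ n *
    q ^ (3 * triInt n - 2 * n)) e1 e2
  rw [h3.tsum_eq]
  ring

end GeneratingSeries

section LambertDissection

variable {q : ℂ}

local notation "Rs" => residueSeries rankTail q
local notation "Cs" => residueSeries crankTailNeg q

theorem div_qPochInf (hq0 : q ≠ 0) (hq : ‖q‖ < 1 / 2) (x : ℂ) :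
    x / qPochInf q q = x * pSeries q := by
  rw [eq_inv_of_mul_eq_one_left (pSeries_mul hq0 hq), div_eq_mul_inv]

theorem rankLambert_values (hq0 : q ≠ 0) (hq : ‖q‖ < 1 / 2) :
    rankLambert q 1 = 11 * (Rs 10 - Rs 4) + 3 * pSeries q + 11 * q⁻¹ ∧
    rankLambert q 9 = 11 * (Rs 12 - Rs 2) + 5 * pSeries q ∧
    rankLambert q 3 = 11 * (Rs 5 - Rs 9) - 2 * pSeries q ∧
    rankLambert q 7 = 11 * (Rs 6 - Rs 8) - pSeries q ∧
    rankLambert q 5 = 11 * (Rs 11 - Rs 3) + 4 * pSeries q := by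
  have hq1 : ‖q‖ < 1 := by linarith
  have hR := fun {a : ℤ} (ha : 1 ≤ a) =>
    isTailCount_rankTail.residueSeries_eq (e := 3) (by norm_num) hq0 hq ha
  have hS := fun r : ℤ => partialTheta_eq (e := 3) (by norm_num) hq0 hq1 r
  have hL := fun r : ℤ => partialLambert_sub (e := 3) (by norm_num) hq0 hq1 r
  have hB := fun s : ℤ => baseSeries_eq (e := 3) (by norm_num) hq0 hq1 s
  have h0 := pSeries_mul_one_sub hq0 hq
  have p3 : q ^ (3 : ℤ) * q ^ (-3 : ℤ) = 1 := by rw [← zpow_add₀ hq0]; norm_num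
  have p6 : q ^ (6 : ℤ) * q ^ (-6 : ℤ) = 1 := by rw [← zpow_add₀ hq0]; norm_num
  have p9 : q ^ (9 : ℤ) * q ^ (-9 : ℤ) = 1 := by rw [← zpow_add₀ hq0]; norm_num
  have hS1 : partialTheta 3 q (-1) + partialTheta 3 q 4 =
      1 + q⁻¹ * (1 - partialTheta 3 q 1 - partialTheta 3 q 2) := by
    have a1 := hS (-1)
    have a2 := hS 1
    norm_num at a1 a2
    rw [a1, a2]
    linear_combination (1 - partialTheta 3 q 4) * inv_mul_cancel₀ hq0
  have hS7 : partialTheta 3 q (-3) + partialTheta 3 q 6 = 1 := by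
    have a1 := hS (-3)
    have a2 := hS 0
    have a3 := hS 3
    norm_num at a1 a2 a3 p3
    rw [a1, a2, a3]
    linear_combination (1 - partialTheta 3 q 6) * p3
  have hS9 : partialTheta 3 q (-9) + partialTheta 3 q 12 = 1 := by
    have a1 := hS (-9)
    have a2 := hS (-6)
    have a3 := hS 6
    have a4 := hS 9
    norm_num at a1 a2 a3 a4 p9 p6
    rw [eq_sub_of_add_eq hS7, sub_sub_cancel, a3] at a2
    rw [a1, a2, a4]
    linear_combination -(1 - q ^ 9 * (1 - partialTheta 3 q 12)) * (q ^ 9)⁻¹ * p6 +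
      (1 - partialTheta 3 q 12) * p9
  have b1 := hL (-1)
  have b2 := hL 4
  have b3 := hL (-3)
  have b4 := hL 6
  have b5 := hL (-9)
  have b6 := hL 12
  simp only [rankLambert, div_qPochInf hq0 hq, hB]
  rw [hR (a := 10) (by norm_num), hR (a := 4) (by norm_num), hR (a := 12) (by norm_num),
    hR (a := 2) (by norm_num), hR (a := 5) (by norm_num), hR (a := 9) (by norm_num),
    hR (a := 6) (by norm_num), hR (a := 8) (by norm_num), hR (a := 11) (by norm_num),
    hR (a := 3) (by norm_num)]
  norm_num at b1 b2 b3 b4 b5 b6 ⊢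
  refine ⟨?_, ?_, by ring, ?_, by ring⟩
  · linear_combination 11 * pSeries q * (b1 + b2 + hS1) + 11 * q⁻¹ * h0
  · linear_combination -11 * pSeries q * (hS9 + b5 + b6)
  · linear_combination -11 * pSeries q * (hS7 + b3 + b4)

theorem crankLambert_values (hq0 : q ≠ 0) (hq : ‖q‖ < 1 / 2) :
    crankLambert q 3 + crankLambert q 7 - 2 * crankLambert q 5 =
      11 * (Cs 2 - Cs 3 + Cs 9 - Cs 10 - pSeries q + 2 * Cs 1 - 2 * Cs 11) := by
  have hq1 : ‖q‖ < 1 := by linarith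
  have hC := fun {a : ℤ} (ha : 1 ≤ a) =>
    isTailCount_crankTailNeg.residueSeries_eq (e := 1) (by norm_num) hq0 hq ha
  have hB := fun s : ℤ => baseSeries_eq (e := 1) (by norm_num) hq0 hq1 s
  have hS : partialTheta 1 q (-1) + partialTheta 1 q 2 = 1 := by
    have a1 := partialTheta_eq (e := 1) (by norm_num) hq0 hq1 (-1)
    have a2 := partialTheta_eq (e := 1) (by norm_num) hq0 hq1 0
    have a3 := partialTheta_eq (e := 1) (by norm_num) hq0 hq1 1
    norm_num at a1 a2 a3
    rw [a1, a2, a3]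
    linear_combination (1 - partialTheta 1 q 2) * inv_mul_cancel₀ hq0
  have b1 := partialLambert_sub (e := 1) (by norm_num) hq0 hq1 (-1)
  have b2 := partialLambert_sub (e := 1) (by norm_num) hq0 hq1 2
  simp only [crankLambert, div_qPochInf hq0 hq, hB]
  rw [hC (a := 2) (by norm_num), hC (a := 3) (by norm_num), hC (a := 9) (by norm_num),
    hC (a := 10) (by norm_num), hC (a := 1) (by norm_num), hC (a := 11) (by norm_num)]
  norm_num at b1 b2 ⊢
  linear_combination -11 * pSeries q * (b1 + b2 + hS)

end LambertDissection

section CombinationSeries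

variable {q : ℂ} {c₁ c₉ c₃ c₇ c₅ m k : ℤ}

/-- The combination of Lambert series matching `combSeq`. -/
noncomputable def combLambert (c₁ c₉ c₃ c₇ c₅ m : ℤ) (q : ℂ) : ℂ :=
  c₁ * rankLambert q 1 + c₉ * rankLambert q 9 + c₃ * rankLambert q 3 + c₇ * rankLambert q 7 +
    c₅ * rankLambert q 5 + m * (crankLambert q 3 + crankLambert q 7 - 2 * crankLambert q 5)

theorem hasSum_combSeq (hq0 : q ≠ 0) (hq : ‖q‖ < 1 / 2)
    (hk : 11 * k = 3 * c₁ + 5 * c₉ - 2 * c₃ - c₇ + 4 * c₅) :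
    HasSum (fun n : ℕ => (combSeq c₁ c₉ c₃ c₇ c₅ m k n : ℂ) * q ^ n)
      (combLambert c₁ c₉ c₃ c₇ c₅ m q / 11 - c₁ * q⁻¹) := by
  have hR := fun {a : ℤ} (ha : 1 ≤ a) => isTailCount_rankTail.hasSum_residueSeries (e := 3) hq ha
  have hC := fun {a : ℤ} (ha : 1 ≤ a) =>
    isTailCount_crankTailNeg.hasSum_residueSeries (e := 1) hq ha
  have hP := (summable_pSeries hq).hasSum
  have h := (((((((hR (a := 10) (by norm_num)).sub (hR (a := 4) (by norm_num))).mul_left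
    (c₁ : ℂ)).add (((hR (a := 12) (by norm_num)).sub (hR (a := 2) (by norm_num))).mul_left
    (c₉ : ℂ))).add (((hR (a := 5) (by norm_num)).sub (hR (a := 9) (by norm_num))).mul_left
    (c₃ : ℂ))).add (((hR (a := 6) (by norm_num)).sub (hR (a := 8) (by norm_num))).mul_left
    (c₇ : ℂ))).add (((hR (a := 11) (by norm_num)).sub (hR (a := 3) (by norm_num))).mul_left
    (c₅ : ℂ))).add (hP.mul_left (k : ℂ)) |>.add
    (((((((hC (a := 2) (by norm_num)).sub (hC (a := 3) (by norm_num))).add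
    (hC (a := 9) (by norm_num))).sub (hC (a := 10) (by norm_num))).sub hP).add
    ((hC (a := 1) (by norm_num)).mul_left 2)).sub ((hC (a :=
        11) (by norm_num)).mul_left 2) |>.mul_left
    (m : ℂ))
  obtain ⟨h1, h9, h3, h7, h5⟩ := rankLambert_values hq0 hq
  have hkn : (11 * k : ℂ) = 3 * c₁ + 5 * c₉ - 2 * c₃ - c₇ + 4 * c₅ := by exact_mod_cast hk
  rw [show combLambert c₁ c₉ c₃ c₇ c₅ m q / 11 - c₁ * q⁻¹ = _ from ?_]
  · refine h.congr_fun fun n => ?_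
    rw [combSeq]
    push_cast
    ring
  · rw [combLambert, h1, h9, h3, h7, h5, crankLambert_values hq0 hq, ← pSeries]
    linear_combination -pSeries q / 11 * hkn

/-- Summing over the eleventh roots of unity extracts one residue class of exponents. -/
theorem hasSum_sieve {ζ : ℂ} (hζ : IsPrimitiveRoot ζ 11) {a : ℕ → ℂ} {F : ℂ → ℂ}
    (h : ∀ k, HasSum (fun n : ℕ => a n * (ζ ^ k * q) ^ n) (F (ζ ^ k * q))) :
    HasSum (fun n : ℕ => a (11 * n + 5) * q ^ (11 * n + 5))
      ((∑ k ∈ Finset.range 11, (ζ ^ k) ^ 6 * F (ζ ^ k * q)) / 11) := by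
  have hinj : Function.Injective fun n : ℕ => 11 * n + 5 := fun a b h => by
    simpa using h
  have h1 := (hasSum_sum (s := Finset.range 11) fun k _ => (h k).mul_left ((ζ ^ k) ^ 6)).div_const 11
  have hroot : ∀ n : ℕ, ∑ k ∈ Finset.range 11, (ζ ^ k) ^ 6 * (a n * (ζ ^ k * q) ^ n) =
      (if (11 : ℤ) ∣ (n + 6 : ℕ) then 11 else 0) * (a n * q ^ n) := fun n => by
    rw [← sum_root_zpow hζ, Finset.sum_mul]
    refine Finset.sum_congr rfl fun k _ => ?_
    rw [zpow_natCast, pow_add, mul_pow]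
    ring
  simp only [hroot] at h1
  rw [← hinj.hasSum_iff] at h1
  · refine h1.congr_fun fun n => ?_
    rw [Function.comp_apply, if_pos (by omega)]
    ring
  · intro n hn
    rw [if_neg, zero_mul, zero_div]
    rintro h
    exact hn ⟨n / 11, by simp only; omega⟩

end CombinationSeries

section Assembly

variable {q : ℂ} {c₁ c₉ c₃ c₇ c₅ m k : ℤ}

/-- The theta function expression for the residue class extracted from `combLambert`. -/
noncomputable def combDissection (c₁ c₉ c₃ c₇ c₅ m : ℤ) (q : ℂ) : ℂ :=
  c₁ * rankTerm 10 (fun k => thetaVal q (1 * k)) + c₉ * rankTerm 8 (fun k => thetaVal q (9 * k)) +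
    c₃ * rankTerm 6 (fun k => thetaVal q (3 * k)) + c₇ * rankTerm 2 (fun k => thetaVal q (7 * k)) +
    c₅ * rankTerm 7 (fun k => thetaVal q (5 * k)) -
    11 * m * (q ^ 121 * (thetaVal q 4 / (thetaVal q 2 * thetaVal q 5)))

theorem sieve_combLambert (hq0 : q ≠ 0) (hq : ‖q‖ < 1) {ζ : ℂ} (hζ : IsPrimitiveRoot ζ 11) :
    ∑ k ∈ Finset.range 11, (ζ ^ k) ^ 6 * combLambert c₁ c₉ c₃ c₇ c₅ m (ζ ^ k * q) =
      11 * (qPochInf (q ^ 121) (q ^ 121) / (q ^ 5 * q ^ 121) *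
        combDissection c₁ c₉ c₃ c₇ c₅ m q) := by
  have E := fun (t : ℤ → ℂ) (h : IsThetaSeq t) => h.eulerSum_comp
  have r1 := sieve_rankLambert hq0 hq hζ (s := 1) (c := 10) (by decide) (by decide)
    (fun t _ => by simp only [one_mul]) (by decide) (by decide) (by decide) rfl
  have r9 := sieve_rankLambert hq0 hq hζ (s := 9) (c := 8) (by decide) (by decide)
    (fun t h => (E t h).1) (by decide) (by decide) (by decide) rfl
  have r3 := sieve_rankLambert hq0 hq hζ (s := 3) (c := 6) (by decide) (by decide)
    (fun t h => (E t h).2.1) (by decide) (by decide) (by decide) rfl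
  have r7 := sieve_rankLambert hq0 hq hζ (s := 7) (c := 2) (by decide) (by decide)
    (fun t h => (E t h).2.2.1) (by decide) (by decide) (by decide) rfl
  have r5 := sieve_rankLambert hq0 hq hζ (s := 5) (c := 7) (by decide) (by decide)
    (fun t h => (E t h).2.2.2) (by decide) (by decide) (by decide) rfl
  have k3 := sieve_crankLambert hq0 hq hζ (s := 3) (c := 6) (by decide) (by decide)
    (fun t h => (E t h).2.1) (by decide) (by decide) rfl
  have k7 := sieve_crankLambert hq0 hq hζ (s := 7) (c := 2) (by decide) (by decide)
    (fun t h => (E t h).2.2.1) (by decide) (by decide) rfl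
  have k5 := sieve_crankLambert hq0 hq hζ (s := 5) (c := 7) (by decide) (by decide)
    (fun t h => (E t h).2.2.2) (by decide) (by decide) rfl
  obtain ⟨v3, v7, v5⟩ := (isThetaSeq_thetaVal hq0 hq).crankTerm_values
  rw [v3] at k3
  rw [v7] at k7
  rw [v5] at k5
  have hsum : ∑ k ∈ Finset.range 11, (ζ ^ k) ^ 6 * combLambert c₁ c₉ c₃ c₇ c₅ m (ζ ^ k * q) =
      c₁ * ∑ k ∈ Finset.range 11, (ζ ^ k) ^ 6 * rankLambert (ζ ^ k * q) 1 +
      c₉ * ∑ k ∈ Finset.range 11, (ζ ^ k) ^ 6 * rankLambert (ζ ^ k * q) 9 +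
      c₃ * ∑ k ∈ Finset.range 11, (ζ ^ k) ^ 6 * rankLambert (ζ ^ k * q) 3 +
      c₇ * ∑ k ∈ Finset.range 11, (ζ ^ k) ^ 6 * rankLambert (ζ ^ k * q) 7 +
      c₅ * ∑ k ∈ Finset.range 11, (ζ ^ k) ^ 6 * rankLambert (ζ ^ k * q) 5 +
      m * (∑ k ∈ Finset.range 11, (ζ ^ k) ^ 6 * crankLambert (ζ ^ k * q) 3 +
      ∑ k ∈ Finset.range 11, (ζ ^ k) ^ 6 * crankLambert (ζ ^ k * q) 7 -
      2 * ∑ k ∈ Finset.range 11, (ζ ^ k) ^ 6 * crankLambert (ζ ^ k * q) 5) := by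
    simp only [Finset.mul_sum, ← Finset.sum_add_distrib, ← Finset.sum_sub_distrib]
    refine Finset.sum_congr rfl fun k _ => ?_
    rw [combLambert]
    ring
  rw [hsum, r1, r9, r3, r7, r5, k3, k7, k5, combDissection]
  generalize rankTerm 10 _ = x1
  generalize rankTerm 8 _ = x9
  generalize rankTerm 6 _ = x3
  generalize rankTerm 2 _ = x7
  generalize rankTerm 7 _ = x5
  generalize thetaVal q 4 / _ = b
  field_simp
  ring

theorem hasSum_combSeq_five (hq0 : q ≠ 0) (hq : ‖q‖ < 1 / 2)
    (hk : 11 * k = 3 * c₁ + 5 * c₉ - 2 * c₃ - c₇ + 4 * c₅) :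
    HasSum (fun n : ℕ => (combSeq c₁ c₉ c₃ c₇ c₅ m k (11 * n + 5) : ℂ) * q ^ (11 * n + 5))
      (qPochInf (q ^ 121) (q ^ 121) / (q ^ 5 * q ^ 121) *
        combDissection c₁ c₉ c₃ c₇ c₅ m q / 11) := by
  have hζ := Complex.isPrimitiveRoot_exp 11 (by norm_num)
  set ζ := Complex.exp (2 * Real.pi * Complex.I / (11 : ℕ))
  have hζ0 : ζ ≠ 0 := hζ.ne_zero (by norm_num)
  have hn : ∀ k : ℕ, ‖ζ ^ k * q‖ = ‖q‖ := fun k => by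
    rw [norm_mul, norm_pow, hζ.norm'_eq_one (by norm_num), one_pow, one_mul]
  have h := hasSum_sieve (q := q) (a := fun n => (combSeq c₁ c₉ c₃ c₇ c₅ m k n : ℂ)) (F :=
      fun z => combLambert c₁ c₉ c₃ c₇ c₅ m z / 11 - c₁ * z⁻¹) hζ fun j => hasSum_combSeq (c₁ :=
      c₁) (c₉ := c₉) (c₃ := c₃) (c₇ := c₇)
    (c₅ := c₅) (m := m) (mul_ne_zero (pow_ne_zero j hζ0) hq0) ((hn j).trans_lt hq) hk
  rwa [show (∑ k ∈ Finset.range 11, (ζ ^ k) ^ 6 * (combLambert c₁ c₉ c₃ c₇ c₅ m (ζ ^ k * q) / 11 -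
    c₁ * (ζ ^ k * q)⁻¹)) / 11 = (∑ k ∈ Finset.range 11,
    (ζ ^ k) ^ 6 * combLambert c₁ c₉ c₃ c₇ c₅ m (ζ ^ k * q)) / 121 -
    c₁ * q⁻¹ / 11 * ∑ k ∈ Finset.range 11, (ζ ^ k) ^ (5 : ℤ) from ?_,
    sum_root_zpow hζ, sieve_combLambert hq0 (by linarith) hζ, if_neg (by decide), mul_zero,
    sub_zero, show ∀ x : ℂ, 11 * x / 121 = x / 11 from fun x => by ring] at h
  rw [Finset.sum_div, Finset.sum_div, Finset.mul_sum, ← Finset.sum_sub_distrib]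
  refine Finset.sum_congr rfl fun k _ => ?_
  have h0 : ζ ^ k ≠ 0 := pow_ne_zero k hζ0
  generalize combLambert _ _ _ _ _ _ _ = x
  field_simp
  ring

theorem thetaVal_natCast_eq {j i : ℕ} (h : triInt j - 6 * j = -i) :
    thetaVal q j = thetaProd ((q ^ 11) ^ 11) ((q ^ 11) ^ j) / q ^ i := by
  rw [thetaVal, h, zpow_natCast, zpow_neg, zpow_natCast, ← pow_mul q 11 11, inv_mul_eq_div]

theorem combSeq_nonneg (e₁ e₂ e₃ e₄ e₅ a : ℕ)
    (hk : 11 * k = 3 * c₁ + 5 * c₉ - 2 * c₃ - c₇ + 4 * c₅)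
    (ha : 5 * (e₁ + 1) + 9 * (e₂ + 1) + 12 * e₃ + 14 * e₄ + 15 * e₅ = 131 + 11 * a)
    (h : ∀ q : ℂ, q ≠ 0 → ‖q‖ < 1 → combDissection c₁ c₉ c₃ c₇ c₅ m q =
      121 / (thetaVal q 1 ^ (e₁ + 1) * thetaVal q 2 ^ (e₂ + 1) * thetaVal q 3 ^ e₃ *
        thetaVal q 4 ^ e₄ * thetaVal q 5 ^ e₅)) (n : ℕ) :
    0 ≤ combSeq c₁ c₉ c₃ c₇ c₅ m k (11 * n + 5) := by
  obtain ⟨d, hd⟩ := PosSeries.theta_quotient e₁ e₂ e₃ e₄ e₅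
  have key := eq_of_hasSum_eq (c := fun n => (combSeq c₁ c₉ c₃ c₇ c₅ m k (11 * n + 5) : ℝ))
    (d := fun n => if a ≤ n then 11 * d (n - a) else 0) (ε := (1 / 2) ^ 11) (by positivity) ?_
  · have h1 := congrFun key n
    have h2 : (0 : ℝ) ≤ combSeq c₁ c₉ c₃ c₇ c₅ m k (11 * n + 5) := by
      rw [h1]
      split_ifs
      · exact mul_nonneg (by norm_num) (hd.nonneg _)
      · exact le_rfl
    exact_mod_cast h2
  · intro y hy0 hy1
    obtain ⟨r, hr, hs⟩ := hd.hasSum y hy0 (hy1.trans (by norm_num))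
    refine ⟨11 * y ^ a * r, ?_, ?_⟩
    · obtain ⟨x, hx0, hxy⟩ : ∃ x : ℝ, 0 < x ∧ x ^ 11 = y :=
        ⟨y ^ ((11 : ℕ) : ℝ)⁻¹, Real.rpow_pos_of_pos hy0 _,
            Real.rpow_inv_natCast_pow hy0.le (by norm_num)⟩
      have hx : x < 1 / 2 := lt_of_pow_lt_pow_left₀ 11 (by norm_num) (hxy.trans_lt hy1)
      have hq0 : (x : ℂ) ≠ 0 := by exact_mod_cast hx0.ne'
      have hq : ‖(x : ℂ)‖ < 1 / 2 := by rwa [Complex.norm_real, Real.norm_of_nonneg hx0.le]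
      have h1 := hasSum_combSeq_five (m := m) hq0 hq hk
      rw [h x hq0 (by linarith)] at h1
      have hv : qPochInf ((x : ℂ) ^ 121) (x ^ 121) / (x ^ 5 * x ^ 121) * (121 /
          (thetaVal x 1 ^ (e₁ + 1) * thetaVal x 2 ^ (e₂ + 1) * thetaVal x 3 ^ e₃ *
        thetaVal x 4 ^ e₄ * thetaVal x 5 ^ e₅)) / 11 = ((11 * y ^ a * r : ℝ) : ℂ) * x ^ 5 := by
        have t1 := thetaVal_natCast_eq (q := x) (j := 1) (i := 5) rfl
        have t2 := thetaVal_natCast_eq (q := x) (j := 2) (i := 9) rfl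
        have t3 := thetaVal_natCast_eq (q := x) (j := 3) (i := 12) rfl
        have t4 := thetaVal_natCast_eq (q := x) (j := 4) (i := 14) rfl
        have t5 := thetaVal_natCast_eq (q := x) (j := 5) (i := 15) rfl
        push_cast at t1 t2 t3 t4 t5 ⊢
        rw [t1, t2, t3, t4, t5, ← hr, ← hxy, show (x : ℂ) ^ 121 = (x ^ 11) ^ 11 by ring]
        push_cast
        have hp : ((x : ℂ) ^ 5) ^ (e₁ + 1) * (x ^ 9) ^ (e₂ + 1) * (x ^ 12) ^ e₃ * (x ^ 14) ^ e₄ *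
            (x ^ 15) ^ e₅ / (x ^ 5 * (x ^ 11) ^ 11) = (x ^ 11) ^ a * x ^ 5 := by
          rw [div_eq_iff (by positivity)]
          simp only [← pow_mul, ← pow_add]
          congr 1
          omega
        have hgen : ∀ b a₁ a₂ a₃ a₄ a₅ p₁ p₂ p₃ p₄ p₅ s : ℂ,
            b / s * (121 / (a₁ / p₁ * (a₂ / p₂) * (a₃ / p₃) * (a₄ / p₄) * (a₅ / p₅))) / 11 =
            11 * (p₁ * p₂ * p₃ * p₄ * p₅ / s) * (b / (a₁ * a₂ * a₃ * a₄ * a₅)) := by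
          intros
          simp only [div_eq_mul_inv, mul_inv, inv_inv]
          ring
        simp only [div_pow]
        rw [hgen, hp]
        ring
      rw [hv] at h1
      have h2 := h1.mul_right ((x : ℂ) ^ 5)⁻¹
      rw [mul_assoc, mul_inv_cancel₀ (pow_ne_zero 5 hq0), mul_one] at h2
      refine Complex.hasSum_ofReal.1 (h2.congr_fun fun n => ?_)
      rw [← hxy]
      push_cast
      rw [pow_add, pow_mul]
      field_simp
    · rw [← hasSum_nat_add_iff' a, Finset.sum_eq_zero fun i hi => by
        rw [if_neg (by simpa using hi), zero_mul], sub_zero]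
      refine (hs.mul_left (11 * y ^ a)).congr_fun fun n => ?_
      rw [if_pos (Nat.le_add_left a n), Nat.add_sub_cancel, pow_add]
      ring

theorem combDissection_values (hq0 : q ≠ 0) (hq : ‖q‖ < 1) :
    combDissection 4 8 3 1 (-3) 2 q = 121 / (thetaVal q 1 * thetaVal q 2 ^ 4 *
      thetaVal q 3 ^ 2 * thetaVal q 4 ^ 2 * thetaVal q 5 ^ 4) ∧
    combDissection (-1) (-13) 2 (-3) 9 3 q = 121 / (thetaVal q 1 * thetaVal q 2 ^ 5 *
      thetaVal q 3 ^ 4 * thetaVal q 4 * thetaVal q 5 ^ 2) ∧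
    combDissection (-2) 7 (-7) 5 (-4) (-4) q = 121 / (thetaVal q 1 * thetaVal q 2 ^ 3 *
      thetaVal q 3 ^ 4 * thetaVal q 4 ^ 2 * thetaVal q 5 ^ 3) ∧
    combDissection (-3) (-6) (-5) (-9) (-6) 0 q = 121 / (thetaVal q 1 * thetaVal q 2 ^ 2 *
      thetaVal q 3 ^ 2 * thetaVal q 4 ^ 3 * thetaVal q 5 ^ 5) ∧
    combDissection 7 (-8) 8 (-1) 3 5 q = 121 / (thetaVal q 1 * thetaVal q 2 *
      thetaVal q 3 ^ 4 * thetaVal q 4 ^ 3 * thetaVal q 5 ^ 4) := by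
  have ht := isThetaSeq_thetaVal hq0 hq
  obtain ⟨h₁, h₂, h₃, h₄, h₅⟩ := ht.combinations rfl rfl rfl rfl rfl rfl
    (ht.thetaUnits.disc (thetaVal_disc hq0 hq (s := 1) (by decide) (by decide)
      (by simp only [one_mul])))
  rw [← h₁, ← h₂, ← h₃, ← h₄, ← h₅]
  simp only [combDissection]
  push_cast
  refine ⟨?_, ?_, ?_, ?_, ?_⟩ <;> ring

end Assembly

/-- Rank-crank inequalities for the residue 5 modulo 11. -/
theorem rank_crank_inequalities_residue_five (n : ℕ) :
    (3 * (rankCount 0 11 (11  *  n  +  5) : ℤ)  +  (rankCount 2 11 (11  *  n  +  5) : ℤ)  +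
         (rankCount 5 11 (11  *  n  +  5) : ℤ)  +  2 * crankCount 2 (11  *  n  +
         5) ≥ 2 * (rankCount 1 11 (11  *  n  +  5) : ℤ)  +  3 * (rankCount 3 11 (11  *  n  +
         5) : ℤ)  +  2 * crankCount 0 (11  *  n  +  5))
    ∧ (7 * (rankCount 1 11 (11  *  n  +  5) : ℤ)  +  (rankCount 4 11 (11  *  n  +  5) : ℤ)  +
         3 * crankCount 2 (11  *  n  +  5) ≥ 3 * (rankCount 0 11 (11  *  n  +  5) : ℤ)  +
         2 * (rankCount 2 11 (11  *  n  +  5) : ℤ)  +  (rankCount 3 11 (11  *  n  +  5) : ℤ)  +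
         2 * (rankCount 5 11 (11  *  n  +  5) : ℤ)  +  3 * crankCount 0 (11  *  n  +  5))
    ∧ (2 * (rankCount 0 11 (11  *  n  +  5) : ℤ)  +  (rankCount 2 11 (11  *  n  +  5) : ℤ)  +
         3 * (rankCount 3 11 (11  *  n  +  5) : ℤ)  +  (rankCount 5 11 (11  *  n  +  5) : ℤ)  +
         4 * crankCount 0 (11  *  n  +  5) ≥ 3 * (rankCount 1 11 (11  *  n  +  5) : ℤ)  +
         4 * (rankCount 4 11 (11  *  n  +  5) : ℤ)  +  4 * crankCount 2 (11  *  n  +  5))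
    ∧ (4 * (rankCount 2 11 (11  *  n  +  5) : ℤ)  +  7 * (rankCount 3 11 (11  *  n  +  5) : ℤ)  +
         2 * (rankCount 4 11 (11  *  n  +  5) : ℤ) ≥ 4 * (rankCount 0 11 (11  *  n  +  5) : ℤ)  +
         2 * (rankCount 1 11 (11  *  n  +  5) : ℤ)  +  7 * (rankCount 5 11 (11  *  n  +  5) : ℤ))
    ∧ (4 * (rankCount 1 11 (11  *  n  +  5) : ℤ)  +  (rankCount 2 11 (11  *  n  +  5) : ℤ)  +
         2 * (rankCount 4 11 (11  *  n  +  5) : ℤ)  +  (rankCount 5 11 (11  *  n  +  5) : ℤ)  +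
         5 * crankCount 2 (11  *  n  +  5) ≥ 2 * (rankCount 0 11 (11  *  n  +  5) : ℤ)  +
         6 * (rankCount 3 11 (11  *  n  +  5) : ℤ)  +  5 * crankCount 0 (11  *  n  +  5)) := by

  have hv := fun (q : ℂ) (hq0 : q ≠ 0) (hq : ‖q‖ < 1) => combDissection_values hq0 hq
  have i1 := combSeq_nonneg (c₁ := 4) (c₉ := 8) (c₃ := 3) (c₇ := 1) (c₅ := -3) (m := 2) (k := 3)
    0 3 2 2 4 2 (by norm_num) (by norm_num) (fun q hq0 hq => by rw [(hv q hq0 hq).1]; ring) n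
  have i2 := combSeq_nonneg (c₁ := -1) (c₉ := -13) (c₃ := 2) (c₇ := -3) (c₅ := 9) (m := 3)
    (k := -3) 0 4 4 1 2 1 (by norm_num) (by norm_num)
    (fun q hq0 hq => by rw [(hv q hq0 hq).2.1]; ring) n
  have i3 := combSeq_nonneg (c₁ := -2) (c₉ := 7) (c₃ := -7) (c₇ := 5) (c₅ := -4) (m := -4)
    (k := 2) 0 2 4 2 3 2 (by norm_num) (by norm_num)
    (fun q hq0 hq => by rw [(hv q hq0 hq).2.2.1]; ring) n
  have i4 := combSeq_nonneg (c₁ := -3) (c₉ := -6) (c₃ := -5) (c₇ := -9) (c₅ := -6) (m := 0)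
    (k := -4) 0 1 2 3 5 3 (by norm_num) (by norm_num)
    (fun q hq0 hq => by rw [(hv q hq0 hq).2.2.2.1]; ring) n
  have i5 := combSeq_nonneg (c₁ := 7) (c₉ := -8) (c₃ := 8) (c₇ := -1) (c₅ := 3) (m := 5)
    (k := -2) 0 0 4 3 4 3 (by norm_num) (by norm_num)
    (fun q hq0 hq => by rw [(hv q hq0 hq).2.2.2.2]; ring) n
  obtain ⟨h0, h1, h2, h3, h4, h5, k2⟩ := counts_eq (n := 11 * n + 5) (by omega)
  have k0 := crankCount_zero_eq (n := 11 * n + 5) (by omega)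
  simp only [combSeq] at i1 i2 i3 i4 i5
  rw [h0, h1, h2, h3, h4, h5, k2, k0]
  refine ⟨?_, ?_, ?_, ?_, ?_⟩ <;> linarith
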